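/- Let A be a positive square-free integer with A ≡ 1 or 25 (mod 36), and let k be a non-negative integer. Then liminf_{X→∞} (#{D ∈ T(X) : rank E_D(ℚ) ≤ 2k}) / (#T(X)) ≥ (δ_k/8) · ∏_{p | A, p prime} p/((p−1)(p+1)). -/

import Mathlib

open Filter

/-- The Mordell curve `y² = x³ + a` as a Weierstrass curve over `ℚ`. -/
noncomputable def MordellCurve (a : ℤ) : WeierstrassCurve ℚ :=
  { a₁ := 0, a₂ := 0, a₃ := 0, a₄ := 0, a₆ := (a : ℚ) }

/-- The Mordell–Weil rank of `y² = x³ + a` over `ℚ`, i.e. the rank of the finitely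
generated abelian group of rational points. -/
noncomputable def mordellRank (a : ℤ) : ℕ :=
  Module.finrank ℤ (MordellCurve a).toAffine.Point

/-- `T X` is the set of positive square-free integers less than `X`. -/
def T (X : ℝ) : Set ℤ := {D : ℤ | 0 < D ∧ (D : ℝ) < X ∧ Squarefree D}

section
set_option linter.unusedSimpArgs false
set_option linter.unusedVariables false

section EC1
variable {F : Type*} [Field F]

/-- The curve `y² = x³ + a` over a field. -/
abbrev MC (a : F) : WeierstrassCurve.Affine F :=
  { a₁ := 0, a₂ := 0, a₃ := 0, a₄ := 0, a₆ := a }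

theorem mc_equation {a x y : F} : (MC a).Equation x y ↔ y ^ 2 = x ^ 3 + a := by
  rw [WeierstrassCurve.Affine.equation_iff]; simp [MC]

theorem mc_ns {a x y : F} (h2 : (2 : F) ≠ 0) (h3 : (3 : F) ≠ 0) (ha : a ≠ 0) :
    (MC a).Nonsingular x y ↔ y ^ 2 = x ^ 3 + a := by
  rw [WeierstrassCurve.Affine.nonsingular_iff, mc_equation]
  constructor
  · exact fun h => h.1
  · intro h
    refine ⟨h, ?_⟩
    by_cases hy : y = 0
    · left
      intro h'
      have : 3 * x ^ 2 = 0 := by simpa [MC] using h'.symm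
      have hx : x = 0 := by simpa [h3] using this
      subst hx; subst hy
      apply ha; simpa using h.symm
    · right
      intro h'
      have : 2 * y = 0 := by
        have h'' : y = -y := by simpa [MC] using h'
        linear_combination h''
      exact hy (by simpa [h2] using this)

variable [DecidableEq F]

/-- `l` is a slope of the chord/tangent through the two points. -/
def IsSl (x₁ y₁ x₂ y₂ l : F) : Prop :=
  (x₁ ≠ x₂ ∧ l * (x₁ - x₂) = y₁ - y₂) ∨ (x₁ = x₂ ∧ y₁ = y₂ ∧ y₁ ≠ 0 ∧ 2 * y₁ * l = 3 * x₁ ^ 2)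

open WeierstrassCurve.Affine in
theorem mc_add_eq {a x₁ y₁ x₂ y₂ x₃ y₃ l : F} (h2 : (2 : F) ≠ 0)
    (h₁ : (MC a).Nonsingular x₁ y₁) (h₂ : (MC a).Nonsingular x₂ y₂)
    (h₃ : (MC a).Nonsingular x₃ y₃)
    (hl : IsSl x₁ y₁ x₂ y₂ l) (hx : x₃ = l ^ 2 - x₁ - x₂) (hy : y₃ = -(y₁ + l * (x₃ - x₁))) :
    Point.some x₁ y₁ h₁ + Point.some x₂ y₂ h₂ = Point.some x₃ y₃ h₃ := by
  have hn : ¬(x₁ = x₂ ∧ y₁ = (MC a).negY x₂ y₂) := by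
    rintro ⟨e1, e2⟩
    rcases hl with ⟨h, _⟩ | ⟨_, h, h', _⟩
    · exact h e1
    · simp [negY, MC] at e2
      have : 2 * y₁ = 0 := by linear_combination e2 + h
      exact h' (by simpa [h2] using this)
  rw [Point.add_some hn]
  have hs : (MC a).slope x₁ x₂ y₁ y₂ = l := by
    rcases hl with ⟨h, h'⟩ | ⟨h, h', h0, h''⟩
    · rw [slope_of_X_ne h, ← h']
      have := sub_ne_zero.2 h
      field_simp
    · rw [slope_of_Y_ne h (fun e => hn ⟨h, e⟩)]
      simp only [negY, MC]
      have : y₁ - (-y₁ - 0 * x₁ - 0) ≠ 0 := by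
        have : y₁ - (-y₁ - 0 * x₁ - 0) = 2 * y₁ := by ring
        rw [this]; exact mul_ne_zero h2 h0
      rw [div_eq_iff this]
      linear_combination -h''
  have e1 : (MC a).addX x₁ x₂ ((MC a).slope x₁ x₂ y₁ y₂) = x₃ := by
    rw [hs]; simp only [addX, MC]; rw [hx]; ring
  have e2 : (MC a).addY x₁ x₂ y₁ ((MC a).slope x₁ x₂ y₁ y₂) = y₃ := by
    simp only [addY, negAddY, negY]; rw [e1, hs, hy]; ring
  simp only [Point.some.injEq]
  exact ⟨e1, e2⟩

open WeierstrassCurve.Affine in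
theorem mc_add_cases {a : F} (h2 : (2 : F) ≠ 0) (h3 : (3 : F) ≠ 0) (ha : a ≠ 0)
    {x₁ y₁ x₂ y₂ : F}
    (h₁ : (MC a).Nonsingular x₁ y₁) (h₂ : (MC a).Nonsingular x₂ y₂) :
    (x₁ = x₂ ∧ y₁ = -y₂ ∧ Point.some x₁ y₁ h₁ + Point.some x₂ y₂ h₂ = 0) ∨
    ∃ l x₃ y₃, ∃ h₃ : (MC a).Nonsingular x₃ y₃, IsSl x₁ y₁ x₂ y₂ l ∧ x₃ = l ^ 2 - x₁ - x₂ ∧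
      y₃ = -(y₁ + l * (x₃ - x₁)) ∧
      Point.some x₁ y₁ h₁ + Point.some x₂ y₂ h₂ = Point.some x₃ y₃ h₃ := by
  have E1 := (mc_ns h2 h3 ha).1 h₁
  have E2 := (mc_ns h2 h3 ha).1 h₂
  by_cases hc : x₁ = x₂ ∧ y₁ = -y₂
  · left
    refine ⟨hc.1, hc.2, ?_⟩
    apply Point.add_of_Y_eq hc.1
    simp [negY, MC, hc.2]
  · right
    have hl : ∃ l, IsSl x₁ y₁ x₂ y₂ l := by
      by_cases h : x₁ = x₂
      · have hne : y₁ ≠ -y₂ := fun e => hc ⟨h, e⟩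
        have : (y₁ - y₂) * (y₁ + y₂) = 0 := by
          subst h; linear_combination E1 - E2
        have hy : y₁ = y₂ := by
          rcases mul_eq_zero.1 this with h' | h'
          · exact sub_eq_zero.1 h'
          · exact absurd (eq_neg_of_add_eq_zero_left h') hne
        have h0 : y₁ ≠ 0 := by rintro h0; apply hne; rw [← hy, h0, neg_zero]
        refine ⟨3 * x₁ ^ 2 / (2 * y₁), Or.inr ⟨h, hy, h0, ?_⟩⟩
        field_simp
      · refine ⟨(y₁ - y₂) / (x₁ - x₂), Or.inl ⟨h, ?_⟩⟩
        have := sub_ne_zero.2 h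
        field_simp
    obtain ⟨l, hl⟩ := hl
    have h₃ : (MC a).Nonsingular (l ^ 2 - x₁ - x₂) (-(y₁ + l * (l ^ 2 - x₁ - x₂ - x₁))) := by
      rw [mc_ns h2 h3 ha]
      rcases hl with ⟨h, h'⟩ | ⟨h, h', h0, h''⟩
      · have hd := sub_ne_zero.2 h
        apply mul_left_cancel₀ hd
        have hy2 : y₂ = y₁ - l * (x₁ - x₂) := by linear_combination h'
        subst hy2
        linear_combination (l ^ 2 - x₁ - x₂ - x₂) * E1 - (l ^ 2 - x₁ - x₂ - x₁) * E2
      · subst h; subst h'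
        linear_combination E1 + (l^2 - 3 * x₁) * h''
    exact ⟨l, _, _, h₃, hl, rfl, rfl, mc_add_eq h2 h₁ h₂ h₃ hl rfl rfl⟩

end EC1
end

section
set_option linter.unusedSimpArgs false
set_option linter.unusedVariables false
set_option linter.unusedSectionVars false

section EC2
open WeierstrassCurve.Affine

variable {F G H : Type*} [Field F] [Field G] [Field H] [CharZero F] [CharZero G] [CharZero H]

theorem sc_ns (i : F →+* G) {u : G} (hu : u ≠ 0) {a : F} {b : G} (ha : a ≠ 0)
    (hb : b = u ^ 6 * i a) {x y : F} (h : (MC a).Nonsingular x y) :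
    (MC b).Nonsingular (u ^ 2 * i x) (u ^ 3 * i y) := by
  rw [mc_ns two_ne_zero three_ne_zero ha] at h
  rw [mc_ns two_ne_zero three_ne_zero
    (by rw [hb]; exact mul_ne_zero (pow_ne_zero _ hu) (by simpa using ha))]
  have := congrArg i h
  simp only [map_pow, map_add] at this
  rw [hb]; linear_combination u ^ 6 * this

/-- scaling a point, after applying a field embedding -/
def scFun (i : F →+* G) {u : G} (hu : u ≠ 0) {a : F} {b : G} (ha : a ≠ 0)
    (hb : b = u ^ 6 * i a) : (MC a).Point → (MC b).Point
  | .zero => .zero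
  | .some x y h => .some (u ^ 2 * i x) (u ^ 3 * i y) (sc_ns i hu ha hb h)

variable [DecidableEq F] [DecidableEq G] [DecidableEq H]

/-- scaling a point, as a group homomorphism -/
def sc (i : F →+* G) {u : G} (hu : u ≠ 0) {a : F} {b : G} (ha : a ≠ 0)
    (hb : b = u ^ 6 * i a) : (MC a).Point →+ (MC b).Point where
  toFun := scFun i hu ha hb
  map_zero' := rfl
  map_add' := by
    rintro (_ | ⟨x₁, y₁, h₁⟩) (_ | ⟨x₂, y₂, h₂⟩)
    · rfl
    · change scFun i hu ha hb (0 + _) = 0 + _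
      rw [zero_add, zero_add]
    · change scFun i hu ha hb (_ + 0) = _ + 0
      rw [add_zero, add_zero]
    · rcases mc_add_cases two_ne_zero three_ne_zero ha h₁ h₂ with
        ⟨e1, e2, e3⟩ | ⟨l, x₃, y₃, h₃, hl, hx, hy, e⟩
      · rw [e3]
        symm
        apply Point.add_of_Y_eq
        · rw [e1]
        · simp [negY, e2]
      · rw [e]
        symm
        apply mc_add_eq (l := u * i l) two_ne_zero
        · rcases hl with ⟨h, h'⟩ | ⟨h, h', h0, h''⟩
          · left
            refine ⟨fun e => h ?_, ?_⟩
            · exact i.injective (mul_left_cancel₀ (pow_ne_zero 2 hu) e)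
            · have := congrArg i h'
              simp only [map_mul, map_sub] at this
              linear_combination u ^ 3 * this
          · right
            refine ⟨by rw [h], by rw [h'], mul_ne_zero (pow_ne_zero _ hu) (by simpa using h0), ?_⟩
            have := congrArg i h''
            simp only [map_mul, map_pow, map_ofNat] at this
            linear_combination u ^ 4 * this
        · rw [hx]; simp only [map_sub, map_pow]; ring
        · rw [hy]; simp only [map_sub, map_add, map_mul, map_neg]; ring

@[simp] theorem sc_some (i : F →+* G) {u : G} (hu : u ≠ 0) {a : F} {b : G} (ha : a ≠ 0)
    (hb : b = u ^ 6 * i a) {x y : F} (h : (MC a).Nonsingular x y) :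
    sc i hu ha hb (.some x y h) = .some (u ^ 2 * i x) (u ^ 3 * i y) (sc_ns i hu ha hb h) := rfl

theorem sc_injective (i : F →+* G) {u : G} (hu : u ≠ 0) {a : F} {b : G} (ha : a ≠ 0)
    (hb : b = u ^ 6 * i a) : Function.Injective (sc i hu ha hb) := by
  rw [injective_iff_map_eq_zero]
  rintro (_ | ⟨x, y, h⟩) e
  · rfl
  · exact absurd e (Point.some_ne_zero _)

theorem some_congr {a x x' y y' : F} {h : (MC a).Nonsingular x y} {h' : (MC a).Nonsingular x' y'}
    (hx : x = x') (hy : y = y') : (Point.some x y h : (MC a).Point) = .some x' y' h' := by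
  subst hx; subst hy; rfl

end EC2

section EC3
open WeierstrassCurve.Affine
variable {G : Type*} [Field G] [CharZero G] [DecidableEq G]

theorem om_ne {w : G} (hw : w ^ 2 + w + 1 = 0) : w ≠ 0 := by
  rintro rfl; simp at hw

theorem om3 {w : G} (hw : w ^ 2 + w + 1 = 0) : w ^ 3 = 1 := by
  linear_combination (w - 1) * hw

/-- action of a cube root of unity -/
def act {w : G} (hw : w ^ 2 + w + 1 = 0) {a : G} (ha : a ≠ 0) : (MC a).Point →+ (MC a).Point :=
  sc (RingHom.id G) (u := w ^ 2) (pow_ne_zero 2 (om_ne hw)) ha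
    (by have := om3 hw; simp only [RingHom.id_apply]
        linear_combination (-(a * (w^9 + w^6 + w^3 + 1))) * this)

theorem om_sq {w : G} (hw : w ^ 2 + w + 1 = 0) : (w ^ 2) ^ 2 + w ^ 2 + 1 = 0 := by
  linear_combination (w ^ 2 - w + 1) * hw

/-- the endomorphism `√-3` -/
def theta {w : G} (hw : w ^ 2 + w + 1 = 0) {a : G} (ha : a ≠ 0) : (MC a).Point →+ (MC a).Point :=
  act hw ha - act (om_sq hw) ha

theorem act_some {w : G} (hw : w ^ 2 + w + 1 = 0) {a : G} (ha : a ≠ 0) {x y : G}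
    (h : (MC a).Nonsingular x y) (h' : (MC a).Nonsingular (w * x) y) :
    act hw ha (.some x y h) = .some (w * x) y h' := by
  have h3 := om3 hw
  refine some_congr ?_ ?_
  · simp only [RingHom.id_apply]; linear_combination w * x * h3
  · simp only [RingHom.id_apply]; linear_combination y * (w ^ 3 + 1) * h3

theorem act_ns {w : G} (hw : w ^ 2 + w + 1 = 0) {a : G} (ha : a ≠ 0) {x y : G}
    (h : (MC a).Nonsingular x y) : (MC a).Nonsingular (w * x) y := by
  rw [mc_ns two_ne_zero three_ne_zero ha] at h ⊢
  linear_combination h - x ^ 3 * om3 hw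

theorem theta_some {w : G} (hw : w ^ 2 + w + 1 = 0) {a : G} (ha : a ≠ 0) {x y x' y' : G}
    (hx : x ≠ 0)
    (h : (MC a).Nonsingular x y) (h' : (MC a).Nonsingular x' y')
    (hx' : 3 * x ^ 2 * x' = -(x ^ 3 + 4 * a))
    (hy' : 9 * x ^ 3 * y' = (w - w ^ 2) * y * (x ^ 3 - 8 * a)) :
    theta hw ha (.some x y h) = .some x' y' h' := by
  have h3 := om3 hw
  have hE := (mc_ns two_ne_zero three_ne_zero ha).1 h
  simp only [theta, AddMonoidHom.sub_apply]
  rw [act_some hw ha h (act_ns hw ha h), act_some (om_sq hw) ha h (act_ns (om_sq hw) ha h),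
    sub_eq_add_neg, Point.neg_some]
  have ht : (w - w ^ 2) ^ 2 = -3 := by linear_combination (w ^ 2 - 3 * w + 3) * hw
  have ht0 : w - w ^ 2 ≠ 0 := by
    intro h0; rw [h0] at ht; norm_num at ht
  have ht0' : w * x - w ^ 2 * x ≠ 0 := by
    rw [← sub_mul]; exact mul_ne_zero ht0 hx
  have hneg : (MC a).negY (w ^ 2 * x) y = -y := by simp [negY]
  have hL : ∃ l, l * (w - w ^ 2) * x = 2 * y := by
    refine ⟨2 * y / ((w - w ^ 2) * x), ?_⟩
    rw [mul_assoc, div_mul_cancel₀ _ (mul_ne_zero ht0 hx)]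
  obtain ⟨l, hl⟩ := hL
  have hl2 : 3 * x ^ 2 * l ^ 2 = -4 * y ^ 2 := by
    have := congrArg (· ^ 2) hl
    simp only [mul_pow, ht] at this
    linear_combination -this
  have hxx : x' = l ^ 2 - w * x - w ^ 2 * x := by
    have h3x : 3 * x ^ 2 ≠ 0 := mul_ne_zero three_ne_zero (pow_ne_zero 2 hx)
    apply mul_left_cancel₀ h3x
    rw [hx']
    linear_combination -hl2 + 4 * hE + 3 * x ^ 3 * hw
  apply mc_add_eq (l := l) two_ne_zero
  · left
    refine ⟨sub_ne_zero.1 ht0', ?_⟩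
    rw [hneg]; linear_combination hl
  · exact hxx
  · rw [hxx]
    have h9 : (9 : G) * x ^ 3 ≠ 0 := mul_ne_zero (by norm_num) (pow_ne_zero 3 hx)
    apply mul_left_cancel₀ h9
    rw [hy']
    have e1 : l * x = -(w - w ^ 2) * (2 * y) / 3 := by
      field_simp
      linear_combination (-(w - w ^ 2)) * hl + l * x * ht
    have e2 : x ^ 3 * l ^ 3 = (-(w - w ^ 2) * (2 * y) / 3) ^ 3 := by
      rw [← e1]; ring
    have e3 : a = y ^ 2 - x ^ 3 := by linear_combination -hE
    have hl' : l * x * x ^ 3 = -(w - w ^ 2) * (2 * y) / 3 * x ^ 3 := by rw [e1]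
    have hw2 : w ^ 2 = -w - 1 := by linear_combination hw
    have e4 : -(9 * x ^ 3 * (y + l * (l ^ 2 - w * x - w ^ 2 * x - w * x)))
      = -(9 * x ^ 3 * y + 9 * (x ^ 3 * l ^ 3) - 9 * (2 * w + w ^ 2) * (l * x * x ^ 3)) := by ring
    rw [mul_neg, e4, e2, hl', e3, hw2]
    ring_nf
    have hw3 : w ^ 3 = 1 := h3
    rw [hw3, hw2]; ring

theorem theta_theta {w : G} (hw : w ^ 2 + w + 1 = 0) {a : G} (ha : a ≠ 0) (P : (MC a).Point) :
    theta hw ha (theta hw ha P) = -((3 : ℕ) • P) := by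
  have h3 := om3 hw
  rcases P with _ | ⟨x, y, h⟩
  · change theta hw ha (theta hw ha 0) = -((3 : ℕ) • 0)
    simp
  have e0 : ∀ P, act hw ha (act hw ha P) = act (om_sq hw) ha P := by
    rintro (_ | ⟨x, y, h⟩)
    · rfl
    · rw [act_some hw ha h (act_ns hw ha h), act_some (om_sq hw) ha h (act_ns (om_sq hw) ha h),
        act_some hw ha _ (act_ns hw ha (act_ns hw ha h))]
      exact some_congr (by ring) rfl
  have e1 : ∀ P, act hw ha (act (om_sq hw) ha P) = P := by
    rintro (_ | ⟨x, y, h⟩)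
    · rfl
    · rw [act_some (om_sq hw) ha h (act_ns (om_sq hw) ha h),
        act_some hw ha _ (act_ns hw ha (act_ns (om_sq hw) ha h))]
      exact some_congr (by linear_combination x * h3) rfl
  have e2 : ∀ P, P + act hw ha P + act (om_sq hw) ha P = 0 := by
    rintro (_ | ⟨x, y, h⟩)
    · change (0 : (MC a).Point) + act hw ha 0 + act (om_sq hw) ha 0 = 0
      simp
    · have hE := (mc_ns two_ne_zero three_ne_zero ha).1 h
      rw [act_some hw ha h (act_ns hw ha h), act_some (om_sq hw) ha h (act_ns (om_sq hw) ha h)]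
      have hn : (MC a).Nonsingular (w ^ 2 * x) (-y) := by
        have := act_ns (om_sq hw) ha h
        rw [mc_ns two_ne_zero three_ne_zero ha] at this ⊢
        linear_combination this
      rw [mc_add_eq (l := 0) (x₃ := w ^ 2 * x) (y₃ := -y) two_ne_zero h _ hn]
      · apply Point.add_of_Y_eq rfl
        simp [negY]
      · by_cases hx : x = 0
        · right
          subst hx
          refine ⟨by simp, rfl, ?_, by simp⟩
          rintro rfl; apply ha; simpa using hE.symm
        · left
          refine ⟨?_, by simp⟩
          intro hh
          have : (w - 1) * x = 0 := by linear_combination -hh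
          rcases mul_eq_zero.1 this with h1 | h1
          · have : w = 1 := by linear_combination h1
            subst this; norm_num at hw
          · exact hx h1
      · linear_combination x * hw
      · ring
  have e3 : ∀ P, act (om_sq hw) ha (act hw ha P) = P := by
    intro P
    rw [← e0, e0 P, e1]
  have e4 : ∀ P, act (om_sq hw) ha (act (om_sq hw) ha P) = act hw ha P := by
    intro P
    rw [← e0, e1]
  simp only [theta, AddMonoidHom.sub_apply, map_sub]
  rw [e0, e1, e3, e4]
  have := e2 (.some x y h)
  set P : (MC a).Point := .some x y h
  have e5 : act (om_sq hw) ha P = -P - act hw ha P := by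
    rw [eq_sub_iff_add_eq, eq_neg_iff_add_eq_zero, ← this]; abel
  rw [e5]; abel

end EC3
end

section
set_option linter.unusedSimpArgs false
set_option linter.unusedVariables false
set_option linter.unusedSectionVars false

section EC4
open WeierstrassCurve.Affine

/-- `y + √a` is a cube -/
def CubeK (a : ℚ) : (MC a).Point → Prop
  | .zero => True
  | .some _ y _ => ∃ p q : ℚ, y = p ^ 3 + 3 * p * q ^ 2 * a ∧ 1 = 3 * p ^ 2 * q + q ^ 3 * a

theorem exists_om : ∃ w : ℂ, w ^ 2 + w + 1 = 0 := by
  obtain ⟨s, hs⟩ := IsAlgClosed.exists_pow_nat_eq (-3 : ℂ) (n := 2) two_pos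
  exact ⟨(-1 + s) / 2, by linear_combination hs / 4⟩

theorem om_sub_ne {G : Type*} [Field G] [CharZero G] {w : G} (hw : w ^ 2 + w + 1 = 0) :
    w - w ^ 2 ≠ 0 := by
  have ht : (w - w ^ 2) ^ 2 = -3 := by linear_combination (w ^ 2 - 3 * w + 3) * hw
  intro h0; rw [h0] at ht; norm_num at ht

theorem om_sub_sq {G : Type*} [Field G] [CharZero G] {w : G} (hw : w ^ 2 + w + 1 = 0) :
    (w - w ^ 2) ^ 2 = -3 := by linear_combination (w ^ 2 - 3 * w + 3) * hw

variable {G : Type*} [Field G] [CharZero G] [DecidableEq G]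

/-- embedding of the rational points -/
noncomputable def jp (G : Type*) [Field G] [CharZero G] [DecidableEq G] {a : ℚ} (ha : a ≠ 0) :
    (MC a).Point →+ (MC (a : G)).Point :=
  sc (algebraMap ℚ G) one_ne_zero ha (by simp)

/-- embedding of the rational points of the dual curve -/
noncomputable def jm {w : G} (hw : w ^ 2 + w + 1 = 0) {a a' : ℚ} (ha' : a' ≠ 0)
    (e : a' = -27 * a) :
    (MC a').Point →+ (MC (a : G)).Point :=
  sc (algebraMap ℚ G) (u := (w - w ^ 2)⁻¹) (inv_ne_zero (om_sub_ne hw)) ha' (by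
    have h := om_sub_sq hw
    have : ((w - w ^ 2)⁻¹) ^ 6 = -(1 / 27) := by
      rw [inv_pow, show (w - w ^ 2) ^ 6 = ((w - w ^ 2) ^ 2) ^ 3 by ring, h]; norm_num
    rw [this, e]; simp)

theorem isog_of_cube {w : G} (hw : w ^ 2 + w + 1 = 0) {a a' : ℚ} (ha : a ≠ 0) (ha' : a' ≠ 0)
    (e : a' = -27 * a) (P : (MC a).Point) (hP : CubeK a P) :
    ∃ R : (MC a').Point, theta hw (Rat.cast_ne_zero.2 ha) (jm hw ha' e R) = jp G ha P := by
  rcases P with _ | ⟨x, y, h⟩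
  · refine ⟨0, ?_⟩
    change _ = jp G ha 0
    simp
  obtain ⟨p, q, h1, h2⟩ := hP
  have hq : q ≠ 0 := by rintro rfl; norm_num at h2
  have hE := (mc_ns two_ne_zero three_ne_zero ha).1 h
  have hx : x = p ^ 2 - a * q ^ 2 := by
    have : x ^ 3 = (p ^ 2 - a * q ^ 2) ^ 3 := by
      subst h1
      linear_combination -hE - (a * (1 + 3 * p ^ 2 * q + q ^ 3 * a)) * h2
    exact (Odd.strictMono_pow (by decide : Odd 3)).injective this
  have hR : (MC a').Nonsingular (3 / q) (-9 * p / q) := by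
    rw [mc_ns two_ne_zero three_ne_zero ha', e]
    field_simp
    linear_combination (-27) * h2
  refine ⟨.some _ _ hR, ?_⟩
  have ht := om_sub_sq hw
  have ht0 := om_sub_ne hw
  have hi2 : ((w - w ^ 2)⁻¹) ^ 2 = -(1 / 3) := by rw [inv_pow, ht]; norm_num
  have hi3 : ((w - w ^ 2)⁻¹) ^ 3 = (w - w ^ 2) / 9 := by
    rw [eq_div_iff (by norm_num), pow_succ, hi2]
    apply mul_left_cancel₀ ht0
    rw [← mul_assoc, mul_comm (w - w ^ 2) (-(1/3) * _), mul_assoc (-(1/3) : G), inv_mul_cancel₀ ht0]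
    linear_combination -ht
  have hq' : (q : G) ≠ 0 := Rat.cast_ne_zero.2 hq
  have h2' : (1 : G) = 3 * p ^ 2 * q + q ^ 3 * a := by exact_mod_cast congrArg (Rat.cast : ℚ → G) h2
  simp only [jm, jp, sc_some]
  apply theta_some
  · simp only [hi2]
    simp [hq']
  · simp only [hi2, eq_ratCast]
    rw [hx]; push_cast
    field_simp
    linear_combination (-1) * h2'
  · simp only [hi2, hi3, eq_ratCast]
    rw [h1]; push_cast
    generalize w - w ^ 2 = t at *
    field_simp
    linear_combination (3 * p) * h2' + (-8 * (q:G)^3*p*a - p) * ht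

end EC4
end

section
set_option linter.unusedSimpArgs false
set_option linter.unusedVariables false
set_option linter.unusedSectionVars false

section EC4b
open WeierstrassCurve.Affine

theorem sc_theta {G : Type*} [Field G] [CharZero G] [DecidableEq G] {w : G}
    (hw : w ^ 2 + w + 1 = 0) {u a b : G} (hu : u ≠ 0) (ha : a ≠ 0) (hb0 : b ≠ 0)
    (hb : b = u ^ 6 * RingHom.id G a) (P : (MC a).Point) :
    sc (RingHom.id G) hu ha hb (theta hw ha P) = theta hw hb0 (sc (RingHom.id G) hu ha hb P) := by
  have key : ∀ {v : G} (hv : v ^ 2 + v + 1 = 0), sc (RingHom.id G) hu ha hb (act hv ha P) =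
      act hv hb0 (sc (RingHom.id G) hu ha hb P) := by
    intro v hv
    rcases P with _ | ⟨x, y, h⟩
    · rfl
    · simp only [act, sc_some]
      refine some_congr ?_ ?_ <;> simp <;> ring
  simp only [theta, AddMonoidHom.sub_apply, map_sub, key]

theorem isog_dual {G : Type*} [Field G] [CharZero G] [DecidableEq G]
    {w : G} (hw : w ^ 2 + w + 1 = 0) {a a' : ℚ} (ha : a ≠ 0) (ha' : a' ≠ 0)
    (e : a' = -27 * a) (P : (MC a').Point) (hP : CubeK a' P) :
    ∃ U : (MC a).Point, theta hw (Rat.cast_ne_zero.2 ha) (jp G ha U) = jm hw ha' e P := by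
  have ha'' : -27 * a' ≠ 0 := by simp [ha']
  obtain ⟨R, hR⟩ := isog_of_cube (G := G) hw ha' ha'' rfl P hP
  have ht0 := om_sub_ne hw
  have ht := om_sub_sq hw
  have hb : (a : G) = ((w - w ^ 2)⁻¹) ^ 6 * RingHom.id G (a' : G) := by
    have : ((w - w ^ 2)⁻¹) ^ 6 = -(1 / 27) := by
      rw [inv_pow, show (w - w ^ 2) ^ 6 = ((w - w ^ 2) ^ 2) ^ 3 by ring, ht]; norm_num
    rw [this, e]; simp
  have hR2 := congrArg (sc (RingHom.id G) (inv_ne_zero ht0) (Rat.cast_ne_zero.2 ha') hb) hR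
  rw [sc_theta hw _ _ (Rat.cast_ne_zero.2 ha)] at hR2
  have hq : a = (-(1/3) : ℚ) ^ 6 * RingHom.id ℚ (-27 * a') := by
    rw [e]; simp; ring
  refine ⟨sc (RingHom.id ℚ) (by norm_num) ha'' hq R, ?_⟩
  have hi2 : ((w - w ^ 2)⁻¹) ^ 2 = -(1 / 3) := by rw [inv_pow, ht]; norm_num
  have e1 : jp G ha (sc (RingHom.id ℚ) (by norm_num) ha'' hq R) =
      sc (RingHom.id G) (inv_ne_zero ht0) (Rat.cast_ne_zero.2 ha') hb (jm hw ha'' rfl R) := by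
    rcases R with _ | ⟨x, y, h⟩
    · rfl
    · simp only [jp, jm, sc_some]
      refine some_congr ?_ ?_
      · simp only [hi2, RingHom.id_apply, eq_ratCast]
        push_cast; ring
      · simp only [RingHom.id_apply, eq_ratCast]
        rw [← mul_assoc, ← mul_pow, ← sq, hi2]
        push_cast; ring
  have e2 : sc (RingHom.id G) (inv_ne_zero ht0) (Rat.cast_ne_zero.2 ha') hb (jp G ha' P) =
      jm hw ha' e P := by
    rcases P with _ | ⟨x, y, h⟩
    · rfl
    · simp only [jp, jm, sc_some]
      refine some_congr ?_ ?_ <;> simp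
  rw [e1, hR2, e2]

theorem index_lemma {a a' : ℚ} (ha : a ≠ 0) (ha' : a' ≠ 0) (e : a' = -27 * a)
    {C₁ C₂ : Type*} (f₁ : (MC a).Point → C₁) (f₂ : (MC a').Point → C₂)
    (h₁ : ∀ P Q, f₁ P = f₁ Q → CubeK a (P - Q)) (h₂ : ∀ P Q, f₂ P = f₂ Q → CubeK a' (P - Q)) :
    ∃ g : (MC a).Point → C₁ × C₂, ∀ P Q, g P = g Q → ∃ R, P - Q = (3 : ℕ) • R := by
  classical
  obtain ⟨w, hw⟩ := exists_om
  have H1 : ∀ P : (MC a).Point, ∃ Q : (MC a').Point, theta hw (Rat.cast_ne_zero.2 ha) (jm hw ha' e Q) =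
      jp ℂ ha (P - Function.invFun f₁ (f₁ P)) := by
    intro P
    refine isog_of_cube hw ha ha' e _ (h₁ _ _ ?_)
    exact (Function.invFun_eq (f := f₁) ⟨P, rfl⟩).symm
  choose R hR using H1
  refine ⟨fun P => (f₁ P, f₂ (R P)), fun P Q h => ?_⟩
  rw [Prod.mk.injEq] at h
  obtain ⟨U, hU⟩ := isog_dual hw ha ha' e _ (h₂ _ _ h.2)
  refine ⟨-U, ?_⟩
  have hinj : Function.Injective (jp ℂ ha) := sc_injective _ _ _ _
  apply hinj
  have : jp ℂ ha (P - Q) = theta hw (Rat.cast_ne_zero.2 ha) (jm hw ha' e (R P - R Q)) := by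
    rw [map_sub (jm hw ha' e), map_sub (theta hw _), hR, hR, h.1, ← map_sub]; simp
  rw [this, ← hU, theta_theta, map_nsmul, map_neg, smul_neg]

end EC4b
end

section
set_option linter.unusedSimpArgs false
set_option linter.unusedVariables false
set_option linter.unusedSectionVars false

section EC5
open WeierstrassCurve.Affine

variable {a : ℚ} [Hab : Fact (∀ r : ℚ, r ^ 2 ≠ a + 0 * r)]

/-- the Kummer value `y + √a` -/
def kap (a : ℚ) : (MC a).Point → QuadraticAlgebra ℚ a 0
  | .zero => ⟨1, 0⟩
  | .some _ y _ => ⟨y, 1⟩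

theorem kap_ne (P : (MC a).Point) : kap a P ≠ 0 := by
  rcases P with _ | ⟨x, y, h⟩
  · intro h; have := congrArg QuadraticAlgebra.re h; simp [kap] at this
  · intro h; have := congrArg QuadraticAlgebra.im h; simp [kap] at this

theorem kap_neg (ha : a ≠ 0) (P : (MC a).Point) :
    ∃ c : QuadraticAlgebra ℚ a 0, c ≠ 0 ∧ kap a P * kap a (-P) = c ^ 3 := by
  rcases P with _ | ⟨x, y, h⟩
  · exact ⟨1, one_ne_zero, by
      change (⟨1, 0⟩ * ⟨1, 0⟩ : QuadraticAlgebra ℚ a 0) = _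
      ext <;> simp <;> rfl⟩
  · have hE := (mc_ns two_ne_zero three_ne_zero ha).1 h
    rw [Point.neg_some]
    have e : (⟨y, 1⟩ * ⟨-y, 1⟩ : QuadraticAlgebra ℚ a 0) = (⟨-x, 0⟩) ^ 3 := by
      ext
      · simp [pow_succ]; linear_combination -hE
      · simp [pow_succ]
    refine ⟨⟨-x, 0⟩, ?_, ?_⟩
    · intro h0
      have : x = 0 := by simpa using congrArg QuadraticAlgebra.re h0
      have := Hab.out y
      apply this; rw [hE]; simp [*]
    · rw [← e]; simp [kap, WeierstrassCurve.Affine.negY, MC]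

theorem kap_add (ha : a ≠ 0) (P Q : (MC a).Point) :
    ∃ c : QuadraticAlgebra ℚ a 0, c ≠ 0 ∧ kap a P * kap a Q = c ^ 3 * kap a (P + Q) := by
  rcases P with _ | ⟨x₁, y₁, h₁⟩
  · refine ⟨1, one_ne_zero, ?_⟩
    change kap a 0 * _ = _ * kap a (0 + Q)
    rw [zero_add, one_pow]; congr 1
  rcases Q with _ | ⟨x₂, y₂, h₂⟩
  · refine ⟨1, one_ne_zero, ?_⟩
    change _ * kap a 0 = _ * kap a (_ + 0)
    rw [add_zero, one_pow, mul_comm]; congr 1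
  rcases mc_add_cases two_ne_zero three_ne_zero ha h₁ h₂ with ⟨e1, e2, e3⟩ | ⟨l, x₃, y₃, h₃, hl, hx, hy, e⟩
  · have : Point.some x₂ y₂ h₂ = - Point.some x₁ y₁ h₁ := (neg_eq_of_add_eq_zero_right e3).symm
    obtain ⟨c, hc, hc2⟩ := kap_neg ha (Point.some x₁ y₁ h₁)
    refine ⟨c, hc, ?_⟩
    rw [e3, this, hc2]
    ext <;> simp [kap]
  · rw [e]
    have E1 := (mc_ns two_ne_zero three_ne_zero ha).1 h₁
    have E2 := (mc_ns two_ne_zero three_ne_zero ha).1 h₂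
    have E3 := (mc_ns two_ne_zero three_ne_zero ha).1 h₃
    have hx3 : x₃ ≠ 0 := by
      intro h0; apply Hab.out y₃; rw [E3, h0]; ring
    set ν := y₁ - l * x₁ with hν
    have hy1 : y₁ = l * x₁ + ν := by rw [hν]; ring
    have hy2 : y₂ = l * x₂ + ν := by
      rcases hl with ⟨_, h⟩ | ⟨h, h', _, _⟩
      · rw [hν]; linear_combination h
      · rw [hν, ← h', ← h]; ring
    have hy3 : y₃ = -(l * x₃ + ν) := by rw [hy, hν]; ring
    clear_value ν
    -- Vieta relations
    have V1 : x₁ + x₂ + x₃ = l ^ 2 := by rw [hx]; ring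
    have V2 : x₁ * x₂ + x₁ * x₃ + x₂ * x₃ = -2 * l * ν := by
      subst hy1
      rcases hl with ⟨hne, h⟩ | ⟨h, h', hy0, h4⟩
      · have hne' : x₁ - x₂ ≠ 0 := sub_ne_zero.2 hne
        apply mul_left_cancel₀ hne'
        subst hy2
        rw [hx]
        linear_combination E1 - E2
      · subst h; rw [hx]; linear_combination h4
    have V3 : x₁ * x₂ * x₃ = ν ^ 2 - a := by
      subst hy1
      have : x₁ * x₂ * x₃ = x₁ ^ 3 - (x₁ + x₂ + x₃) * x₁ ^ 2 + (x₁ * x₂ + x₁ * x₃ + x₂ * x₃) * x₁ := by ring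
      rw [this, V1, V2]; linear_combination -E1
    have key : (⟨y₁, 1⟩ * ⟨y₂, 1⟩ * ⟨-y₃, 1⟩ : QuadraticAlgebra ℚ a 0) = ⟨ν, 1⟩ ^ 3 := by
      rw [hy1, hy2, hy3]
      ext
      · simp [pow_succ]
        linear_combination (a * l + l*ν^2) * V1 + (l^2*ν) * V2 + (l^3) * V3
      · simp [pow_succ]
        linear_combination (2 * l * ν) * V1 + l^2 * V2
    have key2 : (⟨y₃, 1⟩ * ⟨-y₃, 1⟩ : QuadraticAlgebra ℚ a 0) = (⟨-x₃, 0⟩) ^ 3 := by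
      ext
      · simp [pow_succ]; linear_combination -E3
      · simp [pow_succ]
    have hn : (⟨-x₃, 0⟩ : QuadraticAlgebra ℚ a 0) ≠ 0 := by
      intro h0
      apply hx3; simpa using congrArg QuadraticAlgebra.re h0
    refine ⟨⟨ν, 1⟩ / ⟨-x₃, 0⟩, div_ne_zero ?_ hn, ?_⟩
    · intro h; simpa using congrArg QuadraticAlgebra.im h
    · simp only [kap]
      rw [div_pow, ← key2, ← key]
      have h3 : (⟨y₃, 1⟩ : QuadraticAlgebra ℚ a 0) ≠ 0 := by
        intro h; simpa using congrArg QuadraticAlgebra.im h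
      have h4 : (⟨-y₃, 1⟩ : QuadraticAlgebra ℚ a 0) ≠ 0 := by
        intro h; simpa using congrArg QuadraticAlgebra.im h
      field_simp

theorem cubeK_of_kap (ha : a ≠ 0) (P : (MC a).Point) (r : ℚ) (z : QuadraticAlgebra ℚ a 0)
    (h : kap a P = ⟨r, 0⟩ * z ^ 3) : CubeK a P := by
  rcases P with _ | ⟨x, y, hP⟩
  · trivial
  have hE := (mc_ns two_ne_zero three_ne_zero ha).1 hP
  have hr : r ≠ 0 := by
    rintro rfl
    apply kap_ne (.some x y hP : (MC a).Point)
    rw [h, show (⟨0, 0⟩ : QuadraticAlgebra ℚ a 0) = 0 from rfl, zero_mul]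
  have hn := congrArg QuadraticAlgebra.norm h
  simp only [kap, map_mul, map_pow] at hn
  simp only [QuadraticAlgebra.norm_def] at hn
  set M := z.re * z.re + 0 * z.re * z.im - a * z.im * z.im
  have hM : r ^ 2 * M ^ 3 = x ^ 3 := by linear_combination hE - hn
  have hM0 : M ≠ 0 := by
    intro h0; rw [h0] at hM
    have hx : x = 0 := by
      have : x ^ 3 = 0 := by rw [← hM]; ring
      exact pow_eq_zero_iff (by norm_num) |>.1 this
    apply Hab.out y; rw [hE, hx]; ring
  -- r = (r * M / x)^3 ... r is a cube
  have hx0 : x ≠ 0 := by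
    rintro rfl
    apply Hab.out y; rw [hE]; ring
  have hcube : r = (r * M / x) ^ 3 := by
    field_simp
    linear_combination -hM
  have e : kap a (.some x y hP) = (⟨r * M / x, 0⟩ * z) ^ 3 := by
    rw [h, mul_pow]; congr 1
    ext
    · simp [pow_succ]; linear_combination hcube
    · simp [pow_succ]
  set w := (⟨r * M / x, 0⟩ * z : QuadraticAlgebra ℚ a 0)
  refine ⟨w.re, w.im, ?_, ?_⟩
  · have := congrArg QuadraticAlgebra.re e
    simp [kap, pow_succ] at this
    linear_combination this
  · have := congrArg QuadraticAlgebra.im e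
    simp [kap, pow_succ] at this
    linear_combination this

theorem cubeK_sub (ha : a ≠ 0) (P Q : (MC a).Point) (r : ℚ) (z : QuadraticAlgebra ℚ a 0)
    (h : kap a P = ⟨r, 0⟩ * z ^ 3 * kap a Q) : CubeK a (P - Q) := by
  obtain ⟨c, hc, h1⟩ := kap_add ha (P - Q) Q
  rw [sub_add_cancel, h] at h1
  have : kap a (P - Q) = c ^ 3 * (⟨r, 0⟩ * z ^ 3) := by
    apply mul_right_cancel₀ (kap_ne Q); rw [h1]; ring
  exact cubeK_of_kap ha _ r (c * z) (by rw [this]; ring)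

end EC5
end

section
set_option linter.unusedSimpArgs false
set_option linter.unusedVariables false
set_option linter.unusedSectionVars false

section EC6
open WeierstrassCurve.Affine Height

theorem addSub_eq {a : ℚ} (ha : a ≠ 0) (P Q : (MC a).Point) :
    ∃ c : ℚ, c ≠ 0 ∧ (fun i => (WeierstrassCurve.addSubMap (MC a) i).eval (P.sym2x Q)) =
      c • ((P + Q).sym2x (P - Q)) := by
  have ev : ∀ s t u : ℚ, (fun i => (WeierstrassCurve.addSubMap (MC a) i).eval ![s, t, u]) =
      ![s ^ 2 - 4 * a * t * u, 2 * t * s + 4 * a * u ^ 2, t ^ 2 - 4 * s * u] := by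
    intro s t u
    ext i
    fin_cases i <;> simp [WeierstrassCurve.addSubMap, WeierstrassCurve.b₂, WeierstrassCurve.b₄,
      WeierstrassCurve.b₆, WeierstrassCurve.b₈, MC]
  have same : ∀ P : (MC a).Point,
      ∃ c : ℚ, c ≠ 0 ∧ (fun i => (WeierstrassCurve.addSubMap (MC a) i).eval (P.sym2x P)) =
      c • ((P + P).sym2x 0) := by
    intro P
    rcases P with _ | ⟨x, y, h⟩
    · refine ⟨1, one_ne_zero, ?_⟩
      change (fun i => (WeierstrassCurve.addSubMap (MC a) i).eval ((0 : (MC a).Point).sym2x 0)) =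
        (1 : ℚ) • ((0 + 0 : (MC a).Point).sym2x 0)
      rw [add_zero, Point.sym2x_zero_zero, ev]; simp
    · have E := (mc_ns two_ne_zero three_ne_zero ha).1 h
      rcases mc_add_cases two_ne_zero three_ne_zero ha h h with
        ⟨_, e2, e3⟩ | ⟨l, x₃, y₃, h₃, hl, hx, hy, e⟩
      · have y0 : y = 0 := by linarith
        subst y0
        have hx0 : x ≠ 0 := by
          rintro rfl; apply ha; linear_combination -E
        refine ⟨9 * x ^ 4, by positivity, ?_⟩
        rw [e3, Point.sym2x_zero_zero, Point.sym2x_some_some, ev]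
        ext i
        fin_cases i
        · simp; linear_combination (8 * x) * E
        · simp; linear_combination (-4) * E
        · simp; ring
      · rcases hl with ⟨hh, _⟩ | ⟨_, _, hy0, hl⟩
        · exact absurd rfl hh
        refine ⟨4 * y ^ 2, by positivity, ?_⟩
        rw [e, Point.sym2x_some_zero, Point.sym2x_some_some, ev]
        ext i
        fin_cases i
        · simp; rw [hx]
          linear_combination (8 * x) * E - (2 * y * l + 3 * x ^ 2) * hl
        · simp; linear_combination (-4) * E
        · simp; ring
  rcases P with _ | ⟨x₁, y₁, h₁⟩
  · change ∃ c : ℚ, c ≠ 0 ∧ (fun i => (WeierstrassCurve.addSubMap (MC a) i).eval ((0 : (MC a).Point).sym2x Q)) =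
      c • ((0 + Q).sym2x (0 - Q))
    rw [zero_add, zero_sub, Point.sym2x_neg_right]
    rcases Q with _ | ⟨x₂, y₂, h₂⟩
    · obtain ⟨c, hc, h⟩ := same 0
      rw [add_zero] at h
      exact ⟨c, hc, h⟩
    · refine ⟨1, one_ne_zero, ?_⟩
      rw [Point.sym2x_zero_some, Point.sym2x_some_some, ev]
      ext i
      fin_cases i <;> simp <;> ring
  rcases Q with _ | ⟨x₂, y₂, h₂⟩
  · change ∃ c : ℚ, c ≠ 0 ∧ (fun i => (WeierstrassCurve.addSubMap (MC a) i).eval (Point.sym2x _ (0 : (MC a).Point))) =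
      c • (((_ : (MC a).Point) + 0).sym2x ((_ : (MC a).Point) - 0))
    rw [add_zero, sub_zero]
    refine ⟨1, one_ne_zero, ?_⟩
    rw [Point.sym2x_some_zero, Point.sym2x_some_some, ev]
    ext i
    fin_cases i <;> simp <;> ring
  by_cases hx : x₁ = x₂
  · subst hx
    have : Point.some x₁ y₁ h₁ = Point.some x₁ y₂ h₂ ∨ Point.some x₁ y₁ h₁ = - Point.some x₁ y₂ h₂ :=
      Point.eq_or_eq_neg_of_xRep_eq_xRep (by simp)
    rcases this with e | e
    · rw [← e, sub_self]; exact same _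
    · have e' : Point.some x₁ y₂ h₂ = - Point.some x₁ y₁ h₁ := by rw [e, neg_neg]
      rw [e', sub_neg_eq_add, Point.sym2x_neg_right, add_neg_cancel, Point.sym2x_comm 0]
      exact same _
  · have hne : x₁ - x₂ ≠ 0 := sub_ne_zero.2 hx
    have E1 := (mc_ns two_ne_zero three_ne_zero ha).1 h₁
    have E2 := (mc_ns two_ne_zero three_ne_zero ha).1 h₂
    have h₂' : (MC a).Nonsingular x₂ (-y₂) := by
      rw [mc_ns two_ne_zero three_ne_zero ha]; linear_combination E2
    have en : - Point.some x₂ y₂ h₂ = Point.some x₂ (-y₂) h₂' := by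
      rw [Point.neg_some]; exact some_congr rfl (by simp [MC, WeierstrassCurve.Affine.negY])
    rw [sub_eq_add_neg, en]
    rcases mc_add_cases two_ne_zero three_ne_zero ha h₁ h₂ with
        ⟨e1, _, _⟩ | ⟨l, x₃, y₃, h₃, hl, hx3, _, e⟩
    · exact absurd e1 hx
    rcases mc_add_cases two_ne_zero three_ne_zero ha h₁ h₂' with
        ⟨e1, _, _⟩ | ⟨l', x₄, y₄, h₄, hl', hx4, _, e'⟩
    · exact absurd e1 hx
    rw [e, e', Point.sym2x_some_some, Point.sym2x_some_some, ev]
    rcases hl with ⟨_, hl⟩ | ⟨h, _⟩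
    swap
    · exact absurd h hx
    rcases hl' with ⟨_, hl'⟩ | ⟨h, _⟩
    swap
    · exact absurd h hx
    refine ⟨(x₁ - x₂) ^ 2, by positivity, ?_⟩
    have k3 : (x₁ - x₂) ^ 2 * x₃ = (y₁ - y₂) ^ 2 - (x₁ + x₂) * (x₁ - x₂) ^ 2 := by
      rw [← hl, hx3]; ring
    have k4 : (x₁ - x₂) ^ 2 * x₄ = (y₁ + y₂) ^ 2 - (x₁ + x₂) * (x₁ - x₂) ^ 2 := by
      rw [show y₁ + y₂ = y₁ - -y₂ by ring, ← hl', hx4]; ring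
    ext i
    fin_cases i
    · simp
      apply mul_left_cancel₀ (pow_ne_zero 2 hne)
      have : (x₁ - x₂) ^ 2 * ((x₁ - x₂) ^ 2 * (x₃ * x₄)) =
        ((x₁ - x₂) ^ 2 * x₃) * ((x₁ - x₂) ^ 2 * x₄) := by ring
      rw [this, k3, k4]
      have e5 : (y₁ - y₂) ^ 2 - (x₁ + x₂) * (x₁ - x₂) ^ 2 =
        (x₁ * x₂ * (x₁ + x₂) + 2 * a) - 2 * y₁ * y₂ := by linear_combination E1 + E2
      have e6 : (y₁ + y₂) ^ 2 - (x₁ + x₂) * (x₁ - x₂) ^ 2 =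
        (x₁ * x₂ * (x₁ + x₂) + 2 * a) + 2 * y₁ * y₂ := by linear_combination E1 + E2
      rw [e5, e6]
      linear_combination (4 * y₂ ^ 2) * E1 + 4 * (x₁ ^ 3 + a) * E2
    · simp
      linear_combination -2 * E1 - 2 * E2 - k3 - k4
    · simp; ring

/-- naive height -/
noncomputable def nh {a : ℚ} (P : (MC a).Point) : ℝ := logHeight P.xRep

theorem nh_par {a : ℚ} (ha : a ≠ 0) :
    ∃ C, ∀ P Q : (MC a).Point, |nh (P + Q) + nh (P - Q) - 2 * (nh P + nh Q)| ≤ C := by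
  have : (MC a).IsElliptic := by
    refine ⟨?_⟩
    rw [isUnit_iff_ne_zero]
    simp [WeierstrassCurve.Δ, WeierstrassCurve.b₂, WeierstrassCurve.b₄,
      WeierstrassCurve.b₆, WeierstrassCurve.b₈, MC, ha]
  obtain ⟨C₁, h₁⟩ := WeierstrassCurve.abs_logHeight_addSubMap_sub_two_mul_logHeight_le (MC a)
  obtain ⟨C₂, h₂⟩ := abs_logHeight_sym2_sub_le ℚ
  have h2 : ∀ P Q : (MC a).Point, |logHeight (P.sym2x Q) - (nh P + nh Q)| ≤ C₂ := by
    intro P Q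
    have hr : ∀ P : (MC a).Point, P.xRep = ![P.xRep 0, P.xRep 1] := by
      intro P; ext i; fin_cases i <;> rfl
    have := @h₂ (P.xRep 0) (P.xRep 1) (Q.xRep 0) (Q.xRep 1)
      (by rw [← hr]; exact Point.xRep_ne_zero P) (by rw [← hr]; exact Point.xRep_ne_zero Q)
    rw [← hr, ← hr] at this
    exact this
  refine ⟨C₁ + C₂ + 2 * C₂, fun P Q => ?_⟩
  obtain ⟨c, hc, he⟩ := addSub_eq ha P Q
  have e1 := h₁ (P.sym2x Q)
  rw [he, logHeight_smul_eq_logHeight _ hc] at e1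
  have e2 := h2 P Q
  have e3 := h2 (P + Q) (P - Q)
  rw [abs_le] at *
  constructor <;> linarith [e1.1, e1.2, e2.1, e2.2, e3.1, e3.2]

instance nh_northcott {a : ℚ} : Northcott (nh (a := a)) := by
  refine ⟨fun B => ?_⟩
  have hf : {x : ℚ | logHeight₁ x ≤ B}.Finite := Northcott.finite_le B
  have hf2 : ((fun x : ℚ => (![x, 1] : Fin 2 → ℚ)) '' {x : ℚ | logHeight₁ x ≤ B} ∪ {![1, 0]}).Finite :=
    (hf.image _).union (Set.finite_singleton _)
  have key : {P : (MC a).Point | nh P ≤ B} ⊆ (fun P : (MC a).Point => P.xRep) ⁻¹'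
      ((fun x : ℚ => (![x, 1] : Fin 2 → ℚ)) '' {x : ℚ | logHeight₁ x ≤ B} ∪ {![1, 0]}) := by
    rintro (_ | ⟨x, y, h⟩) hP
    · right; rfl
    · left
      refine ⟨x, ?_, rfl⟩
      change logHeight₁ x ≤ B
      rw [logHeight₁_eq_logHeight]; exact hP
  refine Set.Finite.subset (Set.Finite.preimage' hf2 ?_) key
  intro v _
  by_cases hv : ∃ P : (MC a).Point, P.xRep = v
  · obtain ⟨P, rfl⟩ := hv
    refine ((Set.finite_singleton P).union (Set.finite_singleton (-P))).subset ?_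
    intro Q hQ
    exact Point.eq_or_eq_neg_of_xRep_eq_xRep hQ
  · convert Set.finite_empty
    ext Q
    simp only [Set.mem_preimage, Set.mem_singleton_iff, Set.mem_empty_iff_false, iff_false]
    exact fun h => hv ⟨Q, h⟩

theorem mc_fg {a : ℚ} (ha : a ≠ 0) {C : Type*} [Finite C] (g : (MC a).Point → C)
    (hg : ∀ P Q, g P = g Q → ∃ R, P - Q = (3 : ℕ) • R) : AddGroup.FG (MC a).Point := by
  obtain ⟨K, hK⟩ := nh_par ha
  have h0 : ∀ P : (MC a).Point, 0 ≤ nh P := fun P => logHeight_nonneg _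
  refine AddCommGroup.fg_of_descent (n := 3) (h := nh) (a := 2) (b := 9)
    (c₀ := 3 * K + 2 * nh (0 : (MC a).Point) + 10) (c := fun g => 2 * nh (-g) + K) (by norm_num) (by norm_num) ?_ ?_ ?_
  · have : Finite ((MC a).Point ⧸ (nsmulAddMonoidHom (α := (MC a).Point) 3).range) := by
      refine Finite.of_injective (fun q => g (Quotient.out q)) ?_
      intro p q h
      obtain ⟨R, hR⟩ := hg _ _ h
      rw [← QuotientAddGroup.out_eq' p, ← QuotientAddGroup.out_eq' q]
      rw [eq_comm, QuotientAddGroup.eq]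
      refine ⟨R, ?_⟩
      simp only [nsmulAddMonoidHom_apply]
      rw [← hR, sub_eq_neg_add]
    exact AddSubgroup.finiteIndex_of_finite_quotient
  · intro P Q
    have := hK (P + Q) (-P)
    rw [abs_le] at this
    have e1 : P + Q + -P = Q := by abel
    rw [e1] at this
    have := this.2
    linarith [h0 (P + Q - -P)]
  · intro P
    have a1 := hK P P
    have a2 := hK ((2 : ℕ) • P) P
    rw [abs_le] at a1 a2
    have e1 : P + P = (2 : ℕ) • P := (two_nsmul P).symm
    have e2 : (2 : ℕ) • P + P = (3 : ℕ) • P := (succ_nsmul P 2).symm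
    have e3 : (2 : ℕ) • P - P = P := by rw [two_nsmul]; abel
    rw [e1, sub_self] at a1
    rw [e2, e3] at a2
    linarith [a1.1, a1.2, a2.1, a2.2]

theorem three_pow_rank_le {M : Type*} [AddCommGroup M] [Module.Finite ℤ M] {C : Type*} [Finite C]
    (g : M → C) (hg : ∀ P Q, g P = g Q → ∃ R, P - Q = (3 : ℕ) • R) :
    3 ^ Module.finrank ℤ M ≤ Nat.card C := by
  let tors := Submodule.torsion ℤ M
  have hr : Module.finrank ℤ (M ⧸ tors) = Module.finrank ℤ M := by
    simp only [Module.finrank]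
    rw [rank_quotient_eq_of_le_torsion le_rfl]
  have : Module.Free ℤ (M ⧸ tors) := Module.free_of_finite_type_torsion_free'
  let b := Module.finBasis ℤ (M ⧸ tors)
  rw [hr] at b
  let φ : M → (Fin (Module.finrank ℤ M) → ZMod 3) := fun m i => ((b.repr (tors.mkQ m) i : ℤ) : ZMod 3)
  have hs : Function.Surjective φ := by
    intro v
    obtain ⟨m, hm⟩ := tors.mkQ_surjective (b.repr.symm (Finsupp.equivFunOnFinite.symm (fun i => ((v i).val : ℤ))))
    refine ⟨m, ?_⟩
    ext i
    simp only [φ, hm]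
    simp
  have hinj : Function.Injective (fun v => g (Function.surjInv hs v)) := by
    intro v w h
    obtain ⟨R, hR⟩ := hg _ _ h
    rw [← Function.surjInv_eq hs v, ← Function.surjInv_eq hs w]
    have e : Function.surjInv hs v = (3 : ℕ) • R + Function.surjInv hs w := by
      rw [← hR]; abel
    rw [e]
    ext i
    simp only [φ, map_add, map_nsmul]
    simp
    left; rfl
  have := Nat.card_le_card_of_injective _ hinj
  simpa using this

theorem mc_rank_le {a : ℚ} (ha : a ≠ 0) {C : Type*} [Finite C] (g : (MC a).Point → C)
    (hg : ∀ P Q, g P = g Q → ∃ R, P - Q = (3 : ℕ) • R) :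
    3 ^ Module.finrank ℤ (MC a).Point ≤ Nat.card C := by
  have hfg := mc_fg ha g hg
  have : Module.Finite ℤ (MC a).Point := Module.Finite.iff_addGroup_fg.2 hfg
  exact three_pow_rank_le g hg

end EC6
end

section
set_option linter.unusedSimpArgs false
set_option linter.unusedVariables false
set_option linter.unusedSectionVars false

open ArithmeticFunction.vonMangoldt in
lemma resclass_prime_bound {N : ℕ} [NeZero N] (M : ℕ) (hM : M ≠ 0) {r : ZMod N} (hr : IsUnit r) :
    ∃ C : ℝ, ∀ x ∈ Set.Ioc (1:ℝ) 2,
      Summable (fun n : ℕ => (if n.Prime ∧ ¬ n ∣ M ∧ (n : ZMod N) = r then Real.log n else 0) / (n:ℝ)^x) ∧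
      (N.totient : ℝ)⁻¹ / (x - 1) - C ≤
        ∑' n : ℕ, (if n.Prime ∧ ¬ n ∣ M ∧ (n : ZMod N) = r then Real.log n else 0) / (n:ℝ)^x := by
  obtain ⟨C, hC⟩ := LSeries_residueClass_lower_bound hr
  have hs1 := summable_residueClass_non_primes_div r
  have hs2 : Summable (fun n : ℕ => if n ∣ M then Real.log n else 0) := by
    apply summable_of_ne_finset_zero (s := M.divisors)
    intro b hb
    rw [if_neg]
    intro h
    exact hb (Nat.mem_divisors.2 ⟨h, hM⟩)
  refine ⟨C + (∑' n : ℕ, (if n.Prime then 0 else residueClass r n) / n) +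
    ∑' n : ℕ, (if n ∣ M then Real.log n else 0), fun x hx => ?_⟩
  have hsr : Summable (fun n : ℕ => residueClass r n / (n:ℝ)^x) := by
    apply LSeries.summable_real_of_abscissaOfAbsConv_lt
    refine (abscissaOfAbsConv_residueClass_le_one r).trans_lt ?_
    exact_mod_cast hx.1
  have hle1 : ∀ n : ℕ, n ≠ 0 → (n:ℝ) ≤ (n:ℝ)^x := by
    intro n hn
    have : (1:ℝ) ≤ n := by exact_mod_cast Nat.one_le_iff_ne_zero.2 hn
    calc (n:ℝ) = (n:ℝ)^(1:ℝ) := by simp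
      _ ≤ _ := Real.rpow_le_rpow_of_exponent_le this hx.1.le
  have hlog : ∀ n : ℕ, 0 ≤ Real.log n := fun n => Real.log_natCast_nonneg n
  have hS : Summable (fun n : ℕ => (if n.Prime ∧ ¬ n ∣ M ∧ (n : ZMod N) = r then Real.log n else 0) / (n:ℝ)^x) := by
    refine Summable.of_nonneg_of_le (fun n => ?_) (fun n => ?_) hsr
    · have := hlog n
      split_ifs <;> positivity
    · apply div_le_div_of_nonneg_right _ (by positivity)
      split_ifs with h
      · have : residueClass r n = Real.log n := by
          rw [residueClass, Set.indicator_of_mem (by exact h.2.2)]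
          exact ArithmeticFunction.vonMangoldt_apply_prime h.1
        exact this.ge
      · exact residueClass_nonneg r n
  refine ⟨hS, ?_⟩
  have h1 := hC hx
  have h2 : ∑' n, residueClass r n / (n : ℝ) ^ x ≤
      ∑' n : ℕ, ((if n.Prime ∧ ¬ n ∣ M ∧ (n : ZMod N) = r then Real.log n else 0) / (n:ℝ)^x
        + (if n.Prime then 0 else residueClass r n) / n + (if n ∣ M then Real.log n else 0)) := by
    refine Summable.tsum_le_tsum (fun n => ?_) hsr ((hS.add hs1).add hs2)
    rcases Nat.eq_zero_or_pos n with rfl | hn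
    · simp
    have hp : (0:ℝ) < n := by exact_mod_cast hn
    have hx1 := hle1 n hn.ne'
    have hx0 : (0:ℝ) < (n:ℝ)^x := by positivity
    have hone : (1:ℝ) ≤ (n:ℝ)^x := le_trans (by exact_mod_cast hn) hx1
    have hn0 := residueClass_nonneg r n
    by_cases hpr : n.Prime
    · by_cases hd : n ∣ M
      · simp only [hpr, hd, if_true, not_true, false_and, and_false, if_false, zero_div, zero_add]
        have : residueClass r n ≤ Real.log n := by
          refine (residueClass_le r n).trans ?_
          exact (ArithmeticFunction.vonMangoldt_apply_prime hpr).le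
        exact (div_le_self hn0 hone).trans this
      · simp only [hpr, hd, if_true, not_false_iff, true_and, if_false, zero_div, add_zero]
        apply div_le_div_of_nonneg_right _ hx0.le
        split_ifs with h
        · refine (residueClass_le r n).trans ?_
          exact (ArithmeticFunction.vonMangoldt_apply_prime hpr).le
        · rw [residueClass, Set.indicator_of_notMem (by exact h)]
    · simp only [hpr, false_and, if_false, zero_div, zero_add]
      have : residueClass r n / (n:ℝ)^x ≤ residueClass r n / n :=
        div_le_div_of_nonneg_left hn0 hp hx1
      have : 0 ≤ (if n ∣ M then Real.log n else 0) := by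
        split_ifs
        · exact hlog n
        · exact le_rfl
      linarith
  rw [Summable.tsum_add (hS.add hs1) hs2, Summable.tsum_add hS hs1] at h2
  linarith

lemma unit_val_odd {n : ℕ} (hn : 0 < n) (r : (ZMod (4*n))ˣ) : Odd (r : ZMod (4*n)).val := by
  have h := ZMod.val_coe_unit_coprime r
  have : Nat.Coprime (r : ZMod (4*n)).val 2 := h.coprime_dvd_right ⟨2*n, by ring⟩
  exact Nat.coprime_two_right.mp this

/-- the quadratic character on units of `ZMod (4n)` -/
noncomputable def chin (n : ℕ) (hn : 0 < n) : (ZMod (4*n))ˣ →* ℤ where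
  toFun r := jacobiSym (-n) (r : ZMod (4*n)).val
  map_one' := by
    haveI : Fact (1 < 4*n) := ⟨by omega⟩
    simp [ZMod.val_one]
  map_mul' := by
    intro r s
    haveI : NeZero (4*n) := ⟨by omega⟩
    rw [← jacobiSym.mul_right' _ (unit_val_odd hn r).pos.ne' (unit_val_odd hn s).pos.ne',
      jacobiSym.mod_right _ ((unit_val_odd hn r).mul (unit_val_odd hn s)), Units.val_mul, ZMod.val_mul]
    simp

lemma chin_cases {n : ℕ} (hn : 0 < n) (r : (ZMod (4*n))ˣ) : chin n hn r = 1 ∨ chin n hn r = -1 := by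
  apply jacobiSym.eq_one_or_neg_one
  have h := ZMod.val_coe_unit_coprime r
  have : Nat.Coprime n (r : ZMod (4*n)).val := (h.coprime_dvd_right ⟨4, by ring⟩).symm
  rw [Int.gcd_comm]
  simpa [Int.gcd, Nat.coprime_comm] using this.symm

lemma chin_ker_card {n : ℕ} (hn : 0 < n) [NeZero (4*n)] [DecidableEq ℤ] :
    (4*n).totient ≤ 2 * (Finset.univ.filter (fun r : (ZMod (4*n))ˣ => chin n hn r = 1)).card := by
  classical
  rw [← ZMod.card_units_eq_totient, ← Finset.card_univ,
    ← Finset.card_filter_add_card_filter_not (s := Finset.univ) (fun r : (ZMod (4*n))ˣ => chin n hn r = 1), two_mul]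
  apply Nat.add_le_add_left
  by_cases h : ∃ r0 : (ZMod (4*n))ˣ, ¬ chin n hn r0 = 1
  · obtain ⟨r0, h0⟩ := h
    refine Finset.card_le_card_of_injOn (fun r => r0 * r) ?_ ?_
    · intro r hr
      simp only [Finset.coe_filter, Finset.mem_univ, true_and, Set.mem_setOf_eq, Finset.mem_coe, Finset.mem_filter] at hr ⊢
      have a1 := (chin_cases hn r).resolve_left hr
      have a2 := (chin_cases hn r0).resolve_left h0
      rw [map_mul, a1, a2]; norm_num
    · intro a _ b _ hab
      exact mul_left_cancel hab
  · push Not at h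
    rw [Finset.filter_false_of_mem]
    · simp
    · intro r _; simpa using h r

def splitP (n M : ℕ) : Set ℕ := {q | q.Prime ∧ ¬ q ∣ M ∧ jacobiSym (-n) q = 1}

lemma split_log_bound {n : ℕ} (hn : 0 < n) (M : ℕ) (hM : M ≠ 0) :
    ∃ (g : ℕ → ℝ) (C : ℝ), (∀ q, q ∉ splitP n M → g q = 0) ∧ (∀ q, 0 ≤ g q) ∧ (∀ q, g q ≤ Real.log q) ∧
      ∀ x ∈ Set.Ioc (1:ℝ) 2, Summable (fun q : ℕ => g q / (q:ℝ)^x) ∧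
        (1/2) / (x-1) - C ≤ ∑' q : ℕ, g q / (q:ℝ)^x := by
  classical
  haveI : NeZero (4*n) := ⟨by omega⟩
  choose C hC using fun r : (ZMod (4*n))ˣ => resclass_prime_bound M hM r.isUnit
  set Kf := Finset.univ.filter (fun r : (ZMod (4*n))ˣ => chin n hn r = 1) with hK
  set g : ℕ → ℝ := fun q => ∑ r ∈ Kf, (if q.Prime ∧ ¬ q ∣ M ∧ (q : ZMod (4*n)) = r then Real.log q else 0) with hg
  refine ⟨g, ∑ r ∈ Kf, C r, ?_, ?_, ?_, ?_⟩
  · intro q hq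
    apply Finset.sum_eq_zero
    intro r hr
    rw [if_neg]
    rintro ⟨h1, h2, h3⟩
    apply hq
    refine ⟨h1, h2, ?_⟩
    have hr1 : chin n hn r = 1 := (Finset.mem_filter.1 hr).2
    change jacobiSym (-n) (r : ZMod (4*n)).val = 1 at hr1
    rw [← h3, ZMod.val_natCast] at hr1
    have hodd := unit_val_odd hn r
    rw [← h3, ZMod.val_natCast] at hodd
    have hqo : Odd q := by
      have h2 : q % 2 = (q % (4*n)) % 2 := by
        rw [Nat.mod_mod_of_dvd]; exact ⟨2*n, by ring⟩
      rw [Nat.odd_iff] at hodd ⊢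
      omega
    rw [jacobiSym.mod_right _ hqo]
    simpa using hr1
  · intro q
    apply Finset.sum_nonneg
    intro r _
    have := Real.log_natCast_nonneg q
    split_ifs <;> positivity
  · intro q
    by_cases h : ∃ r ∈ Kf, (q : ZMod (4*n)) = r
    · obtain ⟨r, hr, hqr⟩ := h
      simp only [hg]
      rw [Finset.sum_eq_single r]
      · have := Real.log_natCast_nonneg q
        split_ifs <;> simp [this]
      · intro s _ hs
        rw [if_neg]
        rintro ⟨_, _, h⟩
        exact hs (Units.ext (h.symm.trans hqr))
      · intro h; exact absurd hr h
    · have := Real.log_natCast_nonneg q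
      simp only [hg]
      rw [Finset.sum_eq_zero]
      · exact this
      · intro r hr
        rw [if_neg]
        rintro ⟨_, _, h'⟩
        exact h ⟨r, hr, h'⟩
  · intro x hx
    have hxp : 0 < x - 1 := by linarith [hx.1]
    have e : (fun q : ℕ => g q / (q:ℝ)^x) = fun q : ℕ => ∑ r ∈ Kf, (if q.Prime ∧ ¬ q ∣ M ∧ (q : ZMod (4*n)) = r then Real.log q else 0) / (q:ℝ)^x := by
      funext q
      rw [← Finset.sum_div]
    rw [e]
    refine ⟨summable_sum fun r _ => (hC r x hx).1, ?_⟩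
    rw [Summable.tsum_finsetSum fun r _ => (hC r x hx).1]
    have h1 : ∑ r ∈ Kf, (((4*n).totient : ℝ)⁻¹ / (x - 1) - C r) ≤ ∑ r ∈ Kf, ∑' q : ℕ, (if q.Prime ∧ ¬ q ∣ M ∧ (q : ZMod (4*n)) = r then Real.log q else 0) / (q:ℝ)^x :=
      Finset.sum_le_sum fun r _ => (hC r x hx).2
    rw [Finset.sum_sub_distrib, Finset.sum_const, nsmul_eq_mul] at h1
    have h2 : (1/2 : ℝ) / (x-1) ≤ (Kf.card : ℝ) * (((4*n).totient : ℝ)⁻¹ / (x - 1)) := by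
      rw [← mul_div_assoc]
      apply div_le_div_of_nonneg_right _ hxp.le
      have hc := chin_ker_card hn
      have ht : 0 < (4*n).totient := Nat.totient_pos.2 (by omega)
      have ht' : (0:ℝ) < (4*n).totient := by exact_mod_cast ht
      have hc' : ((4*n).totient : ℝ) ≤ 2 * Kf.card := by
        rw [hK]; exact_mod_cast hc
      rw [← div_eq_mul_inv, le_div_iff₀ ht']
      linarith
    linarith

lemma split_sum_bound {n : ℕ} (hn : 0 < n) (M : ℕ) (hM : M ≠ 0) :
    ∃ C : ℝ, ∀ J : ℕ, ∃ F : Finset ℕ, (∀ q ∈ F, q ∈ splitP n M) ∧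
      (J:ℝ)/4 - C ≤ ∑ q ∈ F, (q:ℝ)^(-(1 + (1/2:ℝ)^J)) := by
  classical
  obtain ⟨g, C, hg0, hgn, hgl, hg⟩ := split_log_bound hn M hM
  set s : ℕ → ℝ := fun j => 1 + (1/2:ℝ)^j with hs
  have hs1 : ∀ j, 1 < s j := fun j => by simp only [hs]; linarith [pow_pos (one_half_pos (α := ℝ)) j]
  have hs2 : ∀ j, s j ≤ 2 := fun j => by
    simp only [hs]; linarith [pow_le_one₀ (n := j) (by norm_num : (0:ℝ) ≤ 1/2) (by norm_num)]
  set f : ℕ → ℕ → ℝ := fun j q => if q ∈ splitP n M then (q:ℝ)^(-(s j)) else 0 with hf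
  have hfs : ∀ j, Summable (f j) := by
    intro j
    refine Summable.of_nonneg_of_le (fun q => ?_) (fun q => ?_) (Real.summable_nat_rpow.2 (by linarith [hs1 j] : -(s j) < -1))
    · simp only [hf]; split_ifs <;> positivity
    · simp only [hf]; split_ifs
      · exact le_rfl
      · positivity
  have hstep : ∀ j, ∑' q, f j q + (1/4 - |C| * (1/2)^(j+1)) ≤ ∑' q, f (j+1) q := by
    intro j
    obtain ⟨hsm, hb⟩ := hg (s j) ⟨hs1 j, hs2 j⟩
    have h1 : ∑' q, (f j q + (1/2)^(j+1) * (g q / (q:ℝ)^(s j))) ≤ ∑' q, f (j+1) q := by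
      refine Summable.tsum_le_tsum (fun q => ?_) ((hfs j).add (hsm.mul_left _)) (hfs (j+1))
      by_cases hq : q ∈ splitP n M
      · have hq0 : (0:ℝ) < q := by exact_mod_cast hq.1.pos
        simp only [hf, if_pos hq]
        have e1 : (q:ℝ)^(-(s (j+1))) = (q:ℝ)^(-(s j)) * (q:ℝ)^((1/2:ℝ)^(j+1)) := by
          rw [← Real.rpow_add hq0]
          congr 1
          simp only [hs]; ring
        rw [e1]
        have e2 : 1 + (1/2)^(j+1) * Real.log q ≤ (q:ℝ)^((1/2:ℝ)^(j+1)) := by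
          rw [Real.rpow_def_of_pos hq0]
          have := Real.add_one_le_exp (Real.log q * (1/2)^(j+1))
          linarith
        have e3 : g q / (q:ℝ)^(s j) = (q:ℝ)^(-(s j)) * g q := by
          rw [Real.rpow_neg hq0.le]; ring
        rw [e3]
        have e4 := hgl q
        have e5 : (0:ℝ) < (q:ℝ)^(-(s j)) := by positivity
        have e6 : (0:ℝ) < (1/2)^(j+1) := by positivity
        calc _ = (q:ℝ)^(-(s j)) * (1 + (1/2)^(j+1) * g q) := by ring
          _ ≤ (q:ℝ)^(-(s j)) * (1 + (1/2)^(j+1) * Real.log q) := by gcongr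
          _ ≤ _ := by gcongr
      · simp [hf, hq, hg0 q hq]
    rw [Summable.tsum_add (hfs j) (hsm.mul_left _), tsum_mul_left] at h1
    have e6 : (0:ℝ) < (1/2)^(j+1) := by positivity
    have h2 : (1/4 - |C| * (1/2)^(j+1)) ≤ (1/2)^(j+1) * ∑' q : ℕ, g q / (q:ℝ)^(s j) := by
      have h3 : (1/2)^(j+1) * ((1/2) / (s j - 1) - C) ≤ (1/2)^(j+1) * ∑' q : ℕ, g q / (q:ℝ)^(s j) := by gcongr
      refine le_trans ?_ h3
      have e7 : s j - 1 = (1/2)^j := by simp only [hs]; ring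
      rw [e7, mul_sub]
      have e8 : (1/2:ℝ)^(j+1) * ((1/2) / (1/2)^j) = 1/4 := by
        have : (1/2:ℝ)^j ≠ 0 := by positivity
        rw [pow_succ]; field_simp; norm_num
      rw [e8]
      have := le_abs_self C
      nlinarith
    linarith
  have hind : ∀ J : ℕ, (J:ℝ)/4 - |C| * (1 - (1/2)^J) ≤ ∑' q, f J q := by
    intro J
    induction J with
    | zero =>
      simp
      exact tsum_nonneg fun q => by simp only [hf]; split_ifs <;> positivity
    | succ j ih =>
      have := hstep j
      push_cast
      rw [pow_succ] at this ⊢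
      linarith
  refine ⟨|C| + 1, fun J => ?_⟩
  have h1 : (J:ℝ)/4 - (|C| + 1) < ∑' q, f J q := by
    have := hind J
    have h3 : 0 ≤ |C| * (1/2)^J := by positivity
    linarith
  obtain ⟨F, hF⟩ := ((hfs J).hasSum.eventually (lt_mem_nhds h1)).exists
  refine ⟨F.filter (· ∈ splitP n M), fun q hq => (Finset.mem_filter.1 hq).2, ?_⟩
  rw [Finset.sum_filter]
  exact hF.le
end

section
set_option linter.unusedSimpArgs false
set_option linter.unusedVariables false
set_option linter.unusedSectionVars false

section E2
variable {K : Type*} [Field K] [NumberField K]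
open NumberField Topology Filter

noncomputable def idealCount (K : Type*) [Field K] [NumberField K] (n : ℕ) : ℕ :=
  Nat.card {I : Ideal (𝓞 K) // Ideal.absNorm I = n}

lemma idealSum_le (T : Finset (Ideal (𝓞 K))) (hT : ∀ I ∈ T, Ideal.absNorm I ≠ 0) (s : ℝ)
    (hs : Summable (fun n : ℕ => (idealCount K n : ℝ) * (n:ℝ)^(-s))) :
    ∑ I ∈ T, (Ideal.absNorm I : ℝ)^(-s) ≤ ∑' n : ℕ, (idealCount K n : ℝ) * (n:ℝ)^(-s) := by
  classical
  rw [Finset.sum_comp (fun n : ℕ => (n:ℝ)^(-s)) (fun I : Ideal (𝓞 K) => Ideal.absNorm I)]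
  refine le_trans ?_ (hs.sum_le_tsum (T.image fun I : Ideal (𝓞 K) => Ideal.absNorm I) fun n _ => by positivity)
  apply Finset.sum_le_sum
  intro n hn
  rw [nsmul_eq_mul]
  gcongr
  obtain ⟨I, hI, rfl⟩ := Finset.mem_image.1 hn
  have hfin : {J : Ideal (𝓞 K) | Ideal.absNorm J = Ideal.absNorm I}.Finite :=
    Ideal.finite_setOfPred_absNorm_eq _
  rw [idealCount]
  have : Nat.card {J : Ideal (𝓞 K) // Ideal.absNorm J = Ideal.absNorm I} = hfin.toFinset.card := by
    rw [← Nat.card_eq_card_finite_toFinset hfin]; rfl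
  rw [this]
  apply Finset.card_le_card
  intro J hJ
  simpa using (Finset.mem_filter.1 hJ).2

lemma prodIdeal_injOn (P : Finset (Ideal (𝓞 K))) (hP : ∀ p ∈ P, (Ideal.absNorm p).Prime) :
    Set.InjOn (fun t : Finset (Ideal (𝓞 K)) => ∏ p ∈ t, p) (P.powerset : Set (Finset (Ideal (𝓞 K)))) := by
  classical
  have hprime : ∀ p ∈ P, p.IsPrime := fun p hp => Ideal.isPrime_of_irreducible_absNorm (hP p hp)
  have hne : ∀ p ∈ P, p ≠ ⊥ := by
    rintro p hp rfl
    have := hP _ hp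
    simp at this
    exact Nat.not_prime_zero this
  have key : ∀ t, t ⊆ P → ∀ p ∈ P, p ∣ (∏ q ∈ t, q) → p ∈ t := by
    intro t ht p hp hd
    have hpp : Prime p := Ideal.prime_of_isPrime (hne p hp) (hprime p hp)
    obtain ⟨q, hq, hpq⟩ := (Prime.dvd_finsetProd_iff hpp _).1 hd
    have hqm : q.IsMaximal := (hprime q (ht hq)).isMaximal (hne q (ht hq))
    have := hqm.eq_of_le (hprime p hp).ne_top (Ideal.le_of_dvd hpq)
    exact this ▸ hq
  intro t ht u hu h
  have ht' : t ⊆ P := by simpa using ht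
  have hu' : u ⊆ P := by simpa using hu
  simp only at h
  ext p
  constructor
  · intro hp
    exact key u hu' p (ht' hp) (h ▸ Finset.dvd_prod_of_mem (fun q => q) hp)
  · intro hp
    exact key t ht' p (hu' hp) (h ▸ Finset.dvd_prod_of_mem (fun q => q) hp)

lemma prod_le_zeta (P : Finset (Ideal (𝓞 K))) (hP : ∀ p ∈ P, (Ideal.absNorm p).Prime) (s : ℝ)
    (hs : Summable (fun n : ℕ => (idealCount K n : ℝ) * (n:ℝ)^(-s))) :
    ∏ p ∈ P, (1 + (Ideal.absNorm p : ℝ)^(-s)) ≤ ∑' n : ℕ, (idealCount K n : ℝ) * (n:ℝ)^(-s) := by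
  classical
  rw [Finset.prod_one_add]
  refine le_trans (le_of_eq ?_) (idealSum_le (P.powerset.image fun t => ∏ p ∈ t, p) ?_ s hs)
  · rw [Finset.sum_image (prodIdeal_injOn P hP)]
    apply Finset.sum_congr rfl
    intro t ht
    rw [map_prod, Nat.cast_prod, Real.finsetProd_rpow]
    intro i _; positivity
  · intro I hI
    obtain ⟨t, ht, rfl⟩ := Finset.mem_image.1 hI
    rw [map_prod, Finset.prod_ne_zero_iff]
    intro p hp
    exact (hP p (Finset.mem_powerset.1 ht hp)).ne_zero

lemma zeta_bound (K : Type*) [Field K] [NumberField K] : ∃ C : ℝ, ∃ J0 : ℕ, ∀ J ≥ J0,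
    Summable (fun n : ℕ => (idealCount K n : ℝ) * (n:ℝ)^(-(1 + (1/2:ℝ)^J))) ∧
    (1/2:ℝ)^J * ∑' n : ℕ, (idealCount K n : ℝ) * (n:ℝ)^(-(1 + (1/2:ℝ)^J)) ≤ C := by
  have h := NumberField.tendsto_sub_one_mul_dedekindZeta_nhdsGT K
  have h2 : Tendsto (fun J : ℕ => 1 + (1/2:ℝ)^J) atTop (𝓝[>] 1) := by
    rw [tendsto_nhdsWithin_iff]
    constructor
    · have := (tendsto_pow_atTop_nhds_zero_of_lt_one (by norm_num : (0:ℝ) ≤ 1/2) (by norm_num)).const_add (1:ℝ)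
      simpa using this
    · filter_upwards with J
      simp
  have h3 := h.comp h2
  have h0 : (dedekindZeta_residue K : ℂ) ≠ 0 := by exact_mod_cast dedekindZeta_residue_ne_zero K
  have e1 := h3.eventually_ne h0
  have e2 := h3.norm.eventually_le_const (show ‖(dedekindZeta_residue K : ℂ)‖ < ‖(dedekindZeta_residue K : ℂ)‖ + 1 by linarith)
  obtain ⟨J0, hJ0⟩ := (e1.and e2).exists_forall_of_atTop
  refine ⟨‖(dedekindZeta_residue K : ℂ)‖ + 1, J0, fun J hJ => ?_⟩
  obtain ⟨a1, a2⟩ := hJ0 J hJ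
  set s : ℝ := 1 + (1/2:ℝ)^J with hs
  have hterm : ∀ n : ℕ, LSeries.term (fun n ↦ ((Nat.card {I : Ideal (𝓞 K) // Ideal.absNorm I = n} : ℕ) : ℂ)) (s:ℂ) n = (((idealCount K n : ℝ) * (n:ℝ)^(-s) : ℝ) : ℂ) := by
    intro n
    rcases Nat.eq_zero_or_pos n with rfl | hn
    · have : s ≠ 0 := by
        have : 0 < (1/2:ℝ)^J := by positivity
        linarith
      simp [LSeries.term, Real.zero_rpow (neg_ne_zero.2 this)]
    · rw [LSeries.term_of_ne_zero hn.ne']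
      push_cast
      rw [Complex.ofReal_cpow (by positivity)]
      push_cast
      rw [Complex.cpow_neg]
      rfl
  have hz : dedekindZeta K (s:ℂ) ≠ 0 := by
    intro hz
    apply a1
    simp only [Function.comp]
    rw [hz, mul_zero]
  have hsum : Summable (fun n : ℕ => (idealCount K n : ℝ) * (n:ℝ)^(-s)) := by
    by_contra hns
    apply hz
    rw [dedekindZeta, LSeries]
    apply tsum_eq_zero_of_not_summable
    intro hsm
    apply hns
    rw [← Complex.summable_ofReal]
    exact hsm.congr hterm
  refine ⟨hsum, ?_⟩
  have hval : dedekindZeta K (s:ℂ) = ((∑' n : ℕ, (idealCount K n : ℝ) * (n:ℝ)^(-s) : ℝ) : ℂ) := by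
    rw [dedekindZeta, LSeries, Complex.ofReal_tsum]
    exact tsum_congr hterm
  simp only [Function.comp] at a2
  rw [hval] at a2
  have e : ((s:ℂ) - 1) * ((∑' n : ℕ, (idealCount K n : ℝ) * (n:ℝ)^(-s) : ℝ) : ℂ) =
    (((1/2:ℝ)^J * ∑' n : ℕ, (idealCount K n : ℝ) * (n:ℝ)^(-s) : ℝ) : ℂ) := by
    simp only [hs]; push_cast; ring
  rw [e, Complex.norm_real] at a2
  exact (le_abs_self _).trans a2

theorem no_split_field {n : ℕ} (hn : 0 < n) (M : ℕ) (hM : M ≠ 0)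
    (H : ∀ q ∈ splitP n M, ∃ P : Finset (Ideal (𝓞 K)), P.card = 3 ∧ ∀ p ∈ P, Ideal.absNorm p = q) : False := by
  classical
  obtain ⟨C, hC⟩ := split_sum_bound hn M hM
  obtain ⟨C2, J0, hz⟩ := zeta_bound K
  choose! P hPc hPn using H
  set B : ℝ := ∑' n : ℕ, (n:ℝ)^(-2:ℝ) with hB
  have hBs : Summable (fun n : ℕ => (n:ℝ)^(-2:ℝ)) := Real.summable_nat_rpow.2 (by norm_num)
  have main : ∀ J ≥ J0, Real.exp ((3/4 - Real.log 2) * J - 3*C - 3*B) ≤ C2 := by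
    intro J hJ
    obtain ⟨F, hF, hsum⟩ := hC J
    obtain ⟨hs, hb⟩ := hz J hJ
    set s : ℝ := 1 + (1/2:ℝ)^J with hsd
    have hs1 : 1 ≤ s := by
      have : 0 < (1/2:ℝ)^J := by positivity
      linarith
    have hdisj : (F : Set ℕ).PairwiseDisjoint P := by
      intro q hq q' hq' hne
      rw [Function.onFun, Finset.disjoint_left]
      intro p hp hp'
      exact hne ((hPn q (hF q hq) p hp).symm.trans (hPn q' (hF q' hq') p hp'))
    have h1 := prod_le_zeta (F.biUnion P) (by
      intro p hp
      obtain ⟨q, hq, hpq⟩ := Finset.mem_biUnion.1 hp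
      rw [hPn q (hF q hq) p hpq]
      exact (hF q hq).1) s hs
    rw [Finset.prod_biUnion hdisj] at h1
    have h2 : ∀ q ∈ F, ∏ p ∈ P q, (1 + (Ideal.absNorm p : ℝ)^(-s)) = (1 + (q:ℝ)^(-s))^3 := by
      intro q hq
      rw [Finset.prod_congr rfl (fun p hp => by rw [hPn q (hF q hq) p hp]), Finset.prod_const, hPc q (hF q hq)]
    rw [Finset.prod_congr rfl h2] at h1
    have h3 : Real.exp (∑ q ∈ F, (3*(q:ℝ)^(-s) - 3 * (q:ℝ)^(-2:ℝ))) ≤ ∏ q ∈ F, (1 + (q:ℝ)^(-s))^3 := by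
      rw [Real.exp_sum]
      apply Finset.prod_le_prod
      · intro q _; positivity
      · intro q hq
        have hq1 : (1:ℝ) ≤ q := by exact_mod_cast (hF q hq).1.one_lt.le
        have hq0 : (0:ℝ) < q := by linarith
        set x := (q:ℝ)^(-s) with hx
        have hx0 : 0 < x := by positivity
        have hx2 : x^2 ≤ (q:ℝ)^(-2:ℝ) := by
          rw [hx, ← Real.rpow_natCast, ← Real.rpow_mul hq0.le]
          apply Real.rpow_le_rpow_of_exponent_le hq1
          push_cast; linarith
        have hl := Real.one_sub_inv_le_log_of_pos (show 0 < 1 + x by linarith)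
        have hxx : x - x^2 ≤ 1 - (1+x)⁻¹ := by
          have : 1 - (1+x)⁻¹ = x/(1+x) := by field_simp; ring
          rw [this, le_div_iff₀ (by linarith)]
          nlinarith [pow_pos hx0 3]
        calc Real.exp (3*x - 3 * (q:ℝ)^(-2:ℝ)) ≤ Real.exp (3 * Real.log (1+x)) := by
              apply Real.exp_le_exp.2; linarith
          _ = (1+x)^3 := by
              rw [show (3:ℝ) * Real.log (1+x) = ((3:ℕ):ℝ) * Real.log (1+x) by norm_num, Real.exp_nat_mul,
                Real.exp_log (by linarith)]
    have h4 : (3:ℝ)/4 * J - 3*C - 3*B ≤ ∑ q ∈ F, (3*(q:ℝ)^(-s) - 3 * (q:ℝ)^(-2:ℝ)) := by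
      rw [Finset.sum_sub_distrib, ← Finset.mul_sum, ← Finset.mul_sum]
      have : ∑ q ∈ F, (q:ℝ)^(-2:ℝ) ≤ B := hBs.sum_le_tsum F fun i _ => by positivity
      linarith
    have h5 : Real.exp ((3:ℝ)/4 * J - 3*C - 3*B) ≤ ∑' n : ℕ, (idealCount K n : ℝ) * (n:ℝ)^(-s) :=
      (Real.exp_le_exp.2 h4).trans (h3.trans h1)
    have h6 : (1/2:ℝ)^J = Real.exp (- (Real.log 2 * J)) := by
      rw [show -(Real.log 2 * J) = (J:ℝ) * (-(Real.log 2)) by ring, Real.exp_nat_mul, Real.exp_neg, Real.exp_log (by norm_num)]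
      norm_num
    refine le_trans ?_ hb
    rw [show (3/4 - Real.log 2) * J - 3*C - 3*B = - (Real.log 2 * J) + ((3:ℝ)/4 * J - 3*C - 3*B) by ring, Real.exp_add, ← h6]
    gcongr
  have hl2 : 0 < 3/4 - Real.log 2 := by linarith [Real.log_two_lt_d9]
  have ht : Tendsto (fun J : ℕ => Real.exp ((3/4 - Real.log 2) * J - 3*C - 3*B)) atTop atTop := by
    apply Real.tendsto_exp_atTop.comp
    apply tendsto_atTop_add_const_right
    apply tendsto_atTop_add_const_right
    exact tendsto_natCast_atTop_atTop.const_mul_atTop hl2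
  obtain ⟨J, hJ1, hJ2⟩ := ((ht.eventually_gt_atTop C2).and (eventually_ge_atTop J0)).exists
  exact absurd (main J hJ2) (not_le.2 hJ1)
end E2
end

section
set_option linter.unusedSimpArgs false
set_option linter.unusedVariables false
set_option linter.unusedSectionVars false
set_option linter.style.haveILetI false

section E3
open Polynomial NumberField

lemma idealP_ne_top {K : Type*} [Field K] [NumberField K] (G : ℤ[X]) (hG : G.Monic)
    (hirr : Irreducible (G.map (algebraMap ℤ ℚ))) (θ : 𝓞 K) (hθ : aeval θ G = 0) (q : ℕ) [Fact q.Prime]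
    (r : ℤ) (hr : (q:ℤ) ∣ G.eval r) : Ideal.span {(q : 𝓞 K), θ - (r : 𝓞 K)} ≠ ⊤ := by
  let f : AdjoinRoot G →+* 𝓞 K := AdjoinRoot.lift (algebraMap ℤ (𝓞 K)) θ (by simpa [aeval_def] using hθ)
  let g : AdjoinRoot G →+* ZMod q := AdjoinRoot.lift (Int.castRingHom (ZMod q)) (r : ZMod q) (by
    have : eval₂ (Int.castRingHom (ZMod q)) ((Int.castRingHom (ZMod q)) r) G = Int.castRingHom (ZMod q) (G.eval r) := by
      rw [eval₂_at_apply]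
    simp only [eq_intCast] at this
    rw [this]
    exact (ZMod.intCast_zmod_eq_zero_iff_dvd _ _).2 hr)
  have hinj : Function.Injective f := by
    rw [injective_iff_map_eq_zero]
    intro x hx
    obtain ⟨p, rfl⟩ := AdjoinRoot.mk_surjective x
    simp only [f, AdjoinRoot.lift_mk] at hx
    rw [AdjoinRoot.mk_eq_zero]
    have h1 : aeval (algebraMap (𝓞 K) K θ) (p.map (algebraMap ℤ ℚ)) = 0 := by
      rw [aeval_map_algebraMap, aeval_algebraMap_apply, aeval_def, hx, map_zero]
    have h2 : aeval (algebraMap (𝓞 K) K θ) (G.map (algebraMap ℤ ℚ)) = 0 := by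
      rw [aeval_map_algebraMap, aeval_algebraMap_apply, hθ, map_zero]
    have h3 : G.map (algebraMap ℤ ℚ) = minpoly ℚ (algebraMap (𝓞 K) K θ) :=
      minpoly.eq_of_irreducible_of_monic hirr h2 (hG.map _)
    have h4 := minpoly.dvd ℚ _ h1
    rw [← h3] at h4
    exact (Polynomial.map_dvd_map _ (algebraMap ℤ ℚ).injective_int hG).1 h4
  letI : Algebra (AdjoinRoot G) (𝓞 K) := f.toAlgebra
  haveI : IsScalarTower ℤ (AdjoinRoot G) (𝓞 K) := IsScalarTower.of_algebraMap_eq' (RingHom.ext_int _ _)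
  haveI : Algebra.IsIntegral (AdjoinRoot G) (𝓞 K) := ⟨fun x => (Algebra.IsIntegral.isIntegral (R := ℤ) x).tower_top⟩
  haveI : (RingHom.ker g).IsPrime := RingHom.ker_isPrime g
  obtain ⟨Q, -, hQp, hQ⟩ := Ideal.exists_ideal_over_prime_of_isIntegral (S := 𝓞 K) (RingHom.ker g) (⊥ : Ideal (𝓞 K)) (by
    intro x hx
    have : f x = 0 := hx
    rw [(injective_iff_map_eq_zero f).1 hinj x this]
    exact Ideal.zero_mem _)
  have hmem : ∀ x, g x = 0 → f x ∈ Q := by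
    intro x hx
    have : x ∈ Q.comap (algebraMap (AdjoinRoot G) (𝓞 K)) := by rw [hQ]; exact hx
    exact this
  intro htop
  apply hQp.ne_top
  rw [eq_top_iff, ← htop, Ideal.span_le]
  intro y hy
  rcases hy with rfl | rfl
  · have := hmem (q : AdjoinRoot G) (by simp)
    simpa using this
  · have := hmem (AdjoinRoot.root G - (r : AdjoinRoot G)) (by simp [g])
    simpa [f] using this

lemma three_norms {a b c q e : ℕ} (hq : q.Prime) (ha : a ≠ 1) (hb : b ≠ 1) (hc : c ≠ 1)
    (h : a * b * c * e = q^3) : a = q ∧ b = q ∧ c = q := by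
  have ha' : a ∣ q^3 := ⟨b*c*e, by rw [← h]; ring⟩
  have hb' : b ∣ q^3 := ⟨a*c*e, by rw [← h]; ring⟩
  have hc' : c ∣ q^3 := ⟨a*b*e, by rw [← h]; ring⟩
  have he' : e ∣ q^3 := ⟨a*b*c, by rw [← h]; ring⟩
  obtain ⟨i, hi, rfl⟩ := (Nat.dvd_prime_pow hq).1 ha'
  obtain ⟨j, hj, rfl⟩ := (Nat.dvd_prime_pow hq).1 hb'
  obtain ⟨k, hk, rfl⟩ := (Nat.dvd_prime_pow hq).1 hc'
  obtain ⟨l, hl, rfl⟩ := (Nat.dvd_prime_pow hq).1 he'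
  rw [← pow_add, ← pow_add, ← pow_add] at h
  have := Nat.pow_right_injective hq.two_le h
  have hi0 : i ≠ 0 := by rintro rfl; simp at ha
  have hj0 : j ≠ 0 := by rintro rfl; simp at hb
  have hk0 : k ≠ 0 := by rintro rfl; simp at hc
  have : i = 1 ∧ j = 1 ∧ k = 1 := by omega
  obtain ⟨rfl, rfl, rfl⟩ := this
  simp

theorem exists_root_of_split (G : ℤ[X]) (hG : G.Monic) (hdeg : G.natDegree = 3) {n : ℕ} (hn : 0 < n)
    (M : ℕ) (hM : M ≠ 0)
    (H : ∀ q ∈ splitP n M, ∃ r1 r2 r3 : ℤ, (q:ℤ) ∣ G.eval r1 ∧ (q:ℤ) ∣ G.eval r2 ∧ (q:ℤ) ∣ G.eval r3 ∧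
      ¬ (q:ℤ) ∣ r1 - r2 ∧ ¬ (q:ℤ) ∣ r1 - r3 ∧ ¬ (q:ℤ) ∣ r2 - r3) :
    ∃ x : ℚ, (G.map (algebraMap ℤ ℚ)).eval x = 0 := by
  classical
  by_contra hno
  push Not at hno
  set P := G.map (algebraMap ℤ ℚ) with hP
  have hPm : P.Monic := hG.map _
  have hPd : P.natDegree = 3 := by rw [hP, hG.natDegree_map, hdeg]
  have hirr : Irreducible P := by
    rw [hPm.irreducible_iff_roots_eq_zero_of_degree_le_three (by omega) (by omega)]
    rw [Multiset.eq_zero_iff_forall_notMem]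
    intro x hx
    exact hno x ((mem_roots hPm.ne_zero).1 hx)
  haveI : Fact (Irreducible P) := ⟨hirr⟩
  letI : Module.Finite ℚ (AdjoinRoot P) := (AdjoinRoot.powerBasis hPm.ne_zero).finite
  haveI : NumberField (AdjoinRoot P) := { to_charZero := charZero_of_injective_algebraMap (algebraMap ℚ _).injective, to_finiteDimensional := inferInstance }
  have hfr : Module.finrank ℚ (AdjoinRoot P) = 3 := by
    rw [(AdjoinRoot.powerBasis hPm.ne_zero).finrank, AdjoinRoot.powerBasis_dim, hPd]
  have hroot : aeval (AdjoinRoot.root P) G = 0 := by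
    have e : algebraMap ℤ (AdjoinRoot P) = (AdjoinRoot.of P).comp (algebraMap ℤ ℚ) := RingHom.ext_int _ _
    rw [aeval_def, e, ← eval₂_map]
    exact AdjoinRoot.eval₂_root P
  let θ : 𝓞 (AdjoinRoot P) := ⟨AdjoinRoot.root P, ⟨G, hG, hroot⟩⟩
  have hθ : aeval θ G = 0 := by
    apply RingOfIntegers.coe_injective
    have : algebraMap (𝓞 (AdjoinRoot P)) (AdjoinRoot P) (aeval θ G) = aeval (algebraMap (𝓞 (AdjoinRoot P)) (AdjoinRoot P) θ) G := by
      rw [aeval_algebraMap_apply]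
    rw [this, map_zero]
    exact hroot
  refine no_split_field (K := AdjoinRoot P) hn M hM fun q hq => ?_
  haveI : Fact q.Prime := ⟨hq.1⟩
  obtain ⟨r1, r2, r3, h1, h2, h3, h12, h13, h23⟩ := H q hq
  let I : ℤ → Ideal (𝓞 (AdjoinRoot P)) := fun r => Ideal.span {(q : 𝓞 (AdjoinRoot P)), θ - (r : 𝓞 (AdjoinRoot P))}
  have hIt : ∀ r : ℤ, (q:ℤ) ∣ G.eval r → I r ≠ ⊤ := fun r hr => idealP_ne_top G hG hirr θ hθ q r hr
  have hcop : ∀ r s : ℤ, ¬ (q:ℤ) ∣ r - s → IsCoprime (I r) (I s) := by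
    intro r s hrs
    rw [Ideal.isCoprime_iff_add, Ideal.one_eq_top, Ideal.eq_top_iff_one]
    have hc : IsCoprime (q:ℤ) (r - s) := (Nat.prime_iff_prime_int.1 hq.1).coprime_iff_not_dvd.2 hrs
    obtain ⟨a, b, hab⟩ := hc
    have hq1 : (q : 𝓞 (AdjoinRoot P)) ∈ I r + I s := Ideal.mem_sup_left (Ideal.subset_span (by simp))
    have hr1 : θ - (r : 𝓞 (AdjoinRoot P)) ∈ I r + I s := Ideal.mem_sup_left (Ideal.subset_span (by simp))
    have hs1 : θ - (s : 𝓞 (AdjoinRoot P)) ∈ I r + I s := Ideal.mem_sup_right (Ideal.subset_span (by simp))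
    have e : (1 : 𝓞 (AdjoinRoot P)) = a * q + b * ((θ - s) - (θ - r)) := by
      have : ((a * q + b * (r - s) : ℤ) : 𝓞 (AdjoinRoot P)) = 1 := by rw [hab]; simp
      rw [← this]; push_cast; ring
    rw [e]
    exact Ideal.add_mem _ (Ideal.mul_mem_left _ _ hq1) (Ideal.mul_mem_left _ _ (Ideal.sub_mem _ hs1 hr1))
  have hdq : ∀ r, I r ∣ Ideal.span {(q : 𝓞 (AdjoinRoot P))} := by
    intro r
    rw [Ideal.dvd_iff_le, Ideal.span_le]
    intro y hy
    rw [Set.mem_singleton_iff] at hy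
    subst hy
    exact Ideal.subset_span (by simp)
  have hprod : I r1 * I r2 * I r3 ∣ Ideal.span {(q : 𝓞 (AdjoinRoot P))} := by
    apply IsCoprime.mul_dvd
    · exact (hcop _ _ h13).mul_left (hcop _ _ h23)
    · exact (hcop _ _ h12).mul_dvd (hdq _) (hdq _)
    · exact hdq _
  have hnq : Ideal.absNorm (Ideal.span {(q : 𝓞 (AdjoinRoot P))}) = q^3 := by
    rw [Ideal.absNorm_span_natCast, RingOfIntegers.rank, hfr]
  obtain ⟨Q, hQ⟩ := hprod
  have hnn := congrArg Ideal.absNorm hQ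
  rw [hnq, map_mul, map_mul, map_mul] at hnn
  have hne1 : ∀ r : ℤ, (q:ℤ) ∣ G.eval r → Ideal.absNorm (I r) ≠ 1 := fun r hr h => hIt r hr (Ideal.absNorm_eq_one_iff.1 h)
  obtain ⟨n1, n2, n3⟩ := three_norms hq.1 (hne1 _ h1) (hne1 _ h2) (hne1 _ h3) hnn.symm
  have hne : ∀ r s : ℤ, (q:ℤ) ∣ G.eval r → ¬ (q:ℤ) ∣ r - s → I r ≠ I s := by
    intro r s hr hrs he
    have := hcop r s hrs
    rw [← he, isCoprime_self] at this
    exact hIt r hr (Ideal.isUnit_iff.1 this)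
  refine ⟨{I r1, I r2, I r3}, ?_, ?_⟩
  · rw [Finset.card_eq_three]
    exact ⟨_, _, _, hne _ _ h1 h12, hne _ _ h1 h13, hne _ _ h2 h23, rfl⟩
  · intro p hp
    simp only [Finset.mem_insert, Finset.mem_singleton] at hp
    rcases hp with rfl | rfl | rfl <;> assumption
end E3
end

section
set_option linter.unusedSimpArgs false
set_option linter.unusedVariables false
set_option linter.unusedSectionVars false
set_option linter.style.haveILetI false

/-- The Eisenstein integers. -/
abbrev Eis := QuadraticAlgebra ℤ (-1) (-1)

open scoped QuadraticAlgebra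

namespace Eis

def om : Eis := ⟨0, 1⟩

lemma norm_formula (z : Eis) : QuadraticAlgebra.norm z = z.re^2 - z.re * z.im + z.im^2 := by
  rw [QuadraticAlgebra.norm_def]; ring

lemma mul_star_self (z : Eis) : z * star z = ((QuadraticAlgebra.norm z : ℤ) : Eis) := by
  have := QuadraticAlgebra.algebraMap_norm_eq_mul_star z
  rw [← this]; simp

lemma norm_eq_zero {z : Eis} (h : QuadraticAlgebra.norm z = 0) : z = 0 := by
  rw [norm_formula] at h
  have h1 : z.re = 0 := by nlinarith [sq_nonneg (z.re - 2 * z.im), sq_nonneg (z.re), sq_nonneg (2*z.re - z.im)]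
  have h2 : z.im = 0 := by nlinarith [sq_nonneg (z.re - 2 * z.im), sq_nonneg (z.re), sq_nonneg (2*z.re - z.im)]
  ext <;> simp [h1, h2]

instance : IsDomain Eis := by
  haveI : NoZeroDivisors Eis := ⟨by
    intro a b h
    have := congrArg QuadraticAlgebra.norm h
    rw [map_mul, QuadraticAlgebra.norm_zero, mul_eq_zero] at this
    exact this.imp norm_eq_zero norm_eq_zero⟩
  haveI : Nontrivial Eis := ⟨0, 1, by intro h; have := congrArg QuadraticAlgebra.re h; simp at this⟩
  exact NoZeroDivisors.to_isDomain _

lemma om_sq : om^2 + om + 1 = 0 := by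
  ext <;> simp [om, pow_two]

lemma om_cube : om^3 = 1 := by
  have := om_sq
  linear_combination (om - 1) * this

lemma om_ne_one : om ≠ 1 := by
  intro h; have := congrArg QuadraticAlgebra.im h; simp [om] at this

lemma om_prim : IsPrimitiveRoot om 3 := IsPrimitiveRoot.mk_of_lt _ (by norm_num) om_cube (by
  intro l hl hl3 h
  interval_cases l
  · exact om_ne_one (by simpa using h)
  · have h2 := om_sq
    rw [h] at h2
    have := congrArg QuadraticAlgebra.im h2
    simp [om] at this)

lemma star_om : star om = om^2 := by
  ext <;> simp [om, pow_two]

lemma eq_add_om (z : Eis) : z = (z.re : Eis) + (z.im : Eis) * om := by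
  ext <;> simp [om]

lemma cube_one_cases {z : Eis} (h : z^3 = 1) : z = 1 ∨ z = om ∨ z = om^2 := by
  have : (z - 1) * ((z - om) * (z - om^2)) = 0 := by
    linear_combination h + (- z^2 + z * om) * om_sq - om_cube
  rcases mul_eq_zero.1 this with h | h
  · exact Or.inl (sub_eq_zero.1 h)
  · rcases mul_eq_zero.1 h with h | h
    · exact Or.inr (Or.inl (sub_eq_zero.1 h))
    · exact Or.inr (Or.inr (sub_eq_zero.1 h))

lemma star_of_cube {z : Eis} (h : z^3 = 1) : star z = z^2 := by
  rcases cube_one_cases h with rfl | rfl | rfl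
  · simp
  · exact star_om
  · rw [star_pow, star_om]

section hom
variable {F : Type*} [Field F] (φ : Eis →+* F)

lemma hom_om : φ om ^ 2 + φ om + 1 = 0 := by
  have := congrArg φ om_sq
  simpa using this

lemma hom_om_cube : φ om ^ 3 = 1 := by rw [← map_pow, om_cube, map_one]

lemma hom_om_ne (h3 : (3:F) ≠ 0) : φ om ≠ 1 := by
  intro h
  have := hom_om φ
  rw [h] at this
  apply h3
  linear_combination this

lemma hom_inj_mu (h3 : (3:F) ≠ 0) {z w : Eis} (hz : z^3 = 1) (hw : w^3 = 1) (h : φ z = φ w) : z = w := by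
  have h1 := hom_om_ne φ h3
  have h0 : φ om ≠ 0 := by
    intro h; have := hom_om_cube φ; rw [h] at this; norm_num at this
  have h2 : φ om ^ 2 ≠ 1 := by
    intro h2
    have := hom_om_cube φ
    rw [pow_succ, h2, one_mul] at this
    exact h1 this
  have h3 : φ om ^ 2 ≠ φ om := by
    intro h3
    rw [pow_two] at h3
    exact h1 (mul_right_cancel₀ h0 (by rw [h3, one_mul]))
  rcases cube_one_cases hz with rfl | rfl | rfl <;> rcases cube_one_cases hw with rfl | rfl | rfl <;>
    simp only [map_one, map_pow] at h <;> first | rfl | exact absurd h h1 | exact absurd h.symm h1 | exact absurd h h2 | exact absurd h.symm h2 | exact absurd h h3 | exact absurd h.symm h3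

lemma hom_frob1 (q : ℕ) [Fact q.Prime] [CharP F q] (hq : q % 3 = 1) (z : Eis) : φ z ^ q = φ z := by
  have hom : φ om ^ q = φ om := by
    conv_lhs => rw [← Nat.div_add_mod q 3, hq, pow_add, pow_mul, hom_om_cube, one_pow, one_mul, pow_one]
  rw [eq_add_om z, map_add, map_mul, map_intCast, map_intCast, add_pow_char, mul_pow, hom]
  congr 2
  · rw [← frobenius_def, map_intCast]
  · rw [← frobenius_def, map_intCast]

lemma hom_frob2 (q : ℕ) [Fact q.Prime] [CharP F q] (hq : q % 3 = 2) (z : Eis) : φ z ^ q = φ (star z) := by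
  have hom : φ om ^ q = φ (star om) := by
    rw [star_om, map_pow]
    conv_lhs => rw [← Nat.div_add_mod q 3, hq, pow_add, pow_mul, hom_om_cube, one_pow, one_mul]
  have e : star z = (z.re : Eis) + (z.im : Eis) * star om := by
    conv_lhs => rw [eq_add_om z]
    simp [mul_comm]
  rw [e]
  conv_lhs => rw [eq_add_om z]
  rw [map_add, map_mul, map_intCast, map_intCast, add_pow_char, mul_pow, hom, map_add, map_mul, map_intCast, map_intCast]
  congr 2
  · rw [← frobenius_def, map_intCast]
  · rw [← frobenius_def, map_intCast]

/-- the relation `ζ = cubic symbol of γ at q`. -/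
def Rel (q : ℕ) (φ : Eis →+* F) (ζ γ : Eis) : Prop :=
  (q % 3 = 1 → φ ζ * φ (star γ) ^ ((q-1)/3) = φ γ ^ ((q-1)/3)) ∧
  (q % 3 = 2 → φ ζ * φ γ ^ ((q+1)/3) = φ (star γ) ^ ((q+1)/3))

lemma Rel.mul {q : ℕ} {φ : Eis →+* F} {ζ γ ζ' γ' : Eis} (h : Rel q φ ζ γ) (h' : Rel q φ ζ' γ') :
    Rel q φ (ζ * ζ') (γ * γ') := by
  constructor
  · intro hq
    simp only [star_mul', map_mul, mul_pow]
    rw [← h.1 hq, ← h'.1 hq]; ring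
  · intro hq
    simp only [star_mul', map_mul, mul_pow]
    rw [← h.2 hq, ← h'.2 hq]; ring

lemma Rel.int (q : ℕ) (φ : Eis →+* F) (m : ℤ) : Rel q φ 1 (m : Eis) := by
  constructor <;> intro _ <;> simp

end hom

section jac
variable {p : ℕ} [Fact p.Prime] (χ : MulChar (ZMod p) Eis)

lemma char_cube (hχ : orderOf χ = 3) {x : ZMod p} (hx : x ≠ 0) : χ x ^ 3 = 1 := by
  have h := pow_orderOf_eq_one χ
  rw [hχ] at h
  rw [← MulChar.pow_apply' χ (by norm_num), h, MulChar.one_apply (Ne.isUnit hx)]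

lemma star_char (hχ : orderOf χ = 3) (x : ZMod p) : star (χ x) = χ⁻¹ x := by
  have h := pow_orderOf_eq_one χ
  rw [hχ] at h
  have hinv : χ⁻¹ = χ^2 := by
    rw [inv_eq_iff_mul_eq_one]
    rw [← pow_succ']; exact h
  rw [hinv, MulChar.pow_apply' _ (by norm_num)]
  by_cases hx : x = 0
  · subst hx; rw [MulChar.map_zero]; simp
  · exact star_of_cube (char_cube χ hχ hx)

lemma star_jac (hχ : orderOf χ = 3) : star (jacobiSum χ χ) = jacobiSum χ⁻¹ χ⁻¹ := by
  simp only [jacobiSum, star_sum, star_mul', star_char χ hχ]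

lemma comp_order (hχ : orderOf χ = 3) {F : Type*} [Field F] (φ : Eis →+* F) (h3 : (3:F) ≠ 0) : orderOf (χ.ringHomComp φ) = 3 := by
  haveI : Fact (Nat.Prime 3) := ⟨by norm_num⟩
  apply orderOf_eq_prime
  · ext x
    have := char_cube χ hχ (x := (x : ZMod p)) x.ne_zero
    rw [MulChar.pow_apply' _ (by norm_num)]
    simp [MulChar.ringHomComp_apply, ← map_pow, this]
  · intro h
    have h1 : χ = 1 := by
      refine MulChar.ext fun x => ?_
      have h2 : (χ.ringHomComp φ) x = 1 := by rw [h]; simp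
      rw [MulChar.ringHomComp_apply] at h2
      have := hom_inj_mu φ h3 (char_cube χ hχ (x := (x : ZMod p)) x.ne_zero) (one_pow 3) (by rw [h2, map_one])
      rw [this]; simp
    rw [h1, orderOf_one] at hχ
    norm_num at hχ

lemma inv_comp (hχ : orderOf χ = 3) {F : Type*} [Field F] (φ : Eis →+* F) : (χ.ringHomComp φ)⁻¹ = (χ⁻¹).ringHomComp φ := by
  ext x
  rw [MulChar.inv_apply', MulChar.ringHomComp_apply, MulChar.ringHomComp_apply, MulChar.inv_apply']

lemma jac_mul (hχ : orderOf χ = 3) {F : Type*} [Field F] (φ : Eis →+* F) (h3 : (3:F) ≠ 0) (hp : (p:F) ≠ 0) :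
    φ (jacobiSum χ χ) * φ (star (jacobiSum χ χ)) = p := by
  have ho := comp_order χ hχ φ h3
  have h1 : χ.ringHomComp φ ≠ 1 := by
    intro h; rw [h, orderOf_one] at ho; norm_num at ho
  have h2 : χ.ringHomComp φ * χ.ringHomComp φ ≠ 1 := by
    rw [← pow_two]
    exact pow_ne_one_of_lt_orderOf (by norm_num) (by rw [ho]; norm_num)
  have := jacobiSum_mul_jacobiSum_inv (F := ZMod p) (F' := F) (by
    intro h
    rw [ZMod.ringChar_zmod_n] at h
    exact hp ((ringChar.spec F p).2 (by rw [h]))) h1 h1 h2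
  rw [inv_comp χ hχ, jacobiSum_ringHomComp, jacobiSum_ringHomComp, ← star_jac χ hχ, ZMod.card] at this
  exact this

end jac

noncomputable def toC : Eis →+* ℂ :=
  ((QuadraticAlgebra.lift (R := ℤ) (A := ℂ) (a := -1) (b := -1)
    ⟨Complex.exp (2 * Real.pi * Complex.I / 3), by
      have h := (Complex.isPrimitiveRoot_exp 3 (by norm_num)).isRoot_cyclotomic (by norm_num)
      rw [Polynomial.cyclotomic_three] at h
      simp at h
      have h' : Complex.exp (2 * Real.pi * Complex.I / 3) ^ 2 + Complex.exp (2 * Real.pi * Complex.I / 3) + 1 = 0 := by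
        exact_mod_cast h
      simp
      linear_combination h'⟩ : Eis →ₐ[ℤ] ℂ) : Eis →+* ℂ)

lemma jac_norm {p : ℕ} [Fact p.Prime] (χ : MulChar (ZMod p) Eis) (hχ : orderOf χ = 3) :
    QuadraticAlgebra.norm (jacobiSum χ χ) = p := by
  have := jac_mul χ hχ toC (by norm_num) (by exact_mod_cast (Fact.out : p.Prime).ne_zero)
  rw [← map_mul, mul_star_self, map_intCast] at this
  exact_mod_cast this

lemma jac_primary {p : ℕ} [Fact p.Prime] (hp : p % 3 = 1) (χ : MulChar (ZMod p) Eis) (hχ : orderOf χ = 3) :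
    (3 : Eis) ∣ jacobiSum χ χ + 1 := by
  have h := pow_orderOf_eq_one χ
  rw [hχ] at h
  obtain ⟨z, -, hz⟩ := exists_jacobiSum_eq_neg_one_add (n := 3) (by norm_num) h h (by
    rw [ZMod.card]; omega) om_prim
  rw [hz]
  refine ⟨- om * z, ?_⟩
  linear_combination z * om_sq

theorem jac_rel {p : ℕ} [Fact p.Prime] (χ : MulChar (ZMod p) Eis) (hχ : orderOf χ = 3)
    (q : ℕ) [Fact q.Prime] (hqp : q ≠ p) (hq3 : q ≠ 3) (F : Type*) [Field F] [IsAlgClosed F] [CharP F q] (φ : Eis →+* F) :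
    Rel q φ (χ (q : ZMod p)) (jacobiSum χ χ) := by
  have hpF : (p:F) ≠ 0 := by
    intro h
    rw [CharP.cast_eq_zero_iff F q] at h
    exact hqp ((Nat.prime_dvd_prime_iff_eq Fact.out Fact.out).1 h)
  have h3 : (3:F) ≠ 0 := by
    intro h
    have h' : ((3:ℕ):F) = 0 := by exact_mod_cast h
    rw [CharP.cast_eq_zero_iff F q] at h'
    exact hq3 ((Nat.prime_dvd_prime_iff_eq Fact.out (by norm_num)).1 h')
  haveI : NeZero (p:F) := ⟨hpF⟩
  obtain ⟨ζ, hζ⟩ := HasEnoughRootsOfUnity.exists_primitiveRoot F p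
  set ψ := AddChar.zmodChar p hζ.pow_eq_one with hψ
  have hψp : ψ.IsPrimitive := AddChar.zmodChar_primitive_of_primitive_root p hζ
  set χF := χ.ringHomComp φ with hχF
  have ho : orderOf χF = 3 := comp_order χ hχ φ h3
  have hne : χF ≠ 1 := by
    intro h; rw [h, orderOf_one] at ho; norm_num at ho
  have hc3 : χF ^ 3 = 1 := by rw [← ho]; exact pow_orderOf_eq_one _
  have hm1 : χF (-1) = 1 := by
    have a1 : χF (-1) ^ 3 = 1 := by
      rw [← MulChar.pow_apply' _ (by norm_num), hc3]
      exact MulChar.one_apply (by simp)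
    have a2 : χF (-1) ^ 2 = 1 := by
      rw [← map_pow]; simp
    rw [pow_succ, a2, one_mul] at a1
    exact a1
  set g := gaussSum χF ψ with hg
  set J := jacobiSum χ χ with hJ
  have hg0 : g ≠ 0 := gaussSum_ne_zero_of_nontrivial (by rw [ZMod.card]; exact hpF) hne hψp
  have hg3 : g ^ 3 = p * φ J := by
    have := gaussSum_pow_eq_prod_jacobiSum (χ := χF) (ψ := ψ) (by rw [ho]; norm_num) hψp
    rw [ho, hm1, ZMod.card] at this
    rw [hg, this]
    simp [hχF, jacobiSum_ringHomComp, hJ]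
  have hJJ : φ J * φ (star J) = p := jac_mul χ hχ φ h3 hpF
  have hJ0 : φ J ≠ 0 := left_ne_zero_of_mul (hJJ ▸ hpF)
  have hJs0 : φ (star J) ≠ 0 := right_ne_zero_of_mul (hJJ ▸ hpF)
  have hqu : (q : ZMod p) ≠ 0 := by
    intro h
    rw [ZMod.natCast_eq_zero_iff] at h
    exact hqp ((Nat.prime_dvd_prime_iff_eq Fact.out Fact.out).1 h).symm
  have hqU : IsUnit (q : ZMod p) := Ne.isUnit hqu
  have hfrob : g ^ q = gaussSum (χF ^ q) (ψ.mulShift q) := by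
    rw [hg, gaussSum_frob, AddChar.pow_mulShift]
  have hshift : ∀ η : MulChar (ZMod p) F, η q * gaussSum η (ψ.mulShift q) = gaussSum η ψ := by
    intro η
    have := gaussSum_mulShift η ψ hqU.unit
    simpa using this
  have hg3' : g^3 = φ J ^ 2 * φ (star J) := by rw [hg3, ← hJJ]; ring
  constructor
  · intro hq
    set e := (q-1)/3 with he
    have hq' : q = 3 * e + 1 := by omega
    have hχq : χF ^ q = χF := by rw [hq', pow_add, pow_mul, hc3, one_pow, one_mul, pow_one]
    rw [hχq] at hfrob
    have h1 := hshift χF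
    rw [← hfrob] at h1
    have h2 : φ (χ q) * (g^3)^e = 1 := by
      apply mul_right_cancel₀ hg0
      rw [one_mul]
      have hgq : g^q = (g^3)^e * g := by
        conv_lhs => rw [hq']
        rw [pow_succ g (3*e), pow_mul]
      rw [hχF, MulChar.ringHomComp_apply] at h1
      calc φ (χ q) * (g^3)^e * g = φ (χ q) * g ^ q := by
            rw [hgq]; ring
        _ = g := h1
    have h3 : (φ J ^ 3) ^ e = 1 := by
      have := hom_frob1 φ q hq J
      rw [← pow_mul]
      apply mul_right_cancel₀ hJ0
      rw [one_mul, ← pow_succ, ← hq']; exact this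
    rw [hg3', mul_pow] at h2
    have e1 : (φ J ^ 3) ^ e = (φ J ^ 2)^e * φ J ^ e := by rw [← mul_pow]; ring
    have hne2 : (φ J ^ 2)^e ≠ 0 := by positivity
    apply mul_left_cancel₀ hne2
    rw [← e1, h3, ← h2]; ring
  · intro hq
    set e := (q+1)/3 with he
    have hq' : q + 1 = 3 * e := by omega
    have hχq : χF ^ q = χF⁻¹ := by
      rw [eq_inv_iff_mul_eq_one, ← pow_succ, hq', pow_mul, hc3, one_pow]
    rw [hχq] at hfrob
    have h1 := hshift χF⁻¹
    rw [← hfrob] at h1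
    have h2 : g * gaussSum χF⁻¹ ψ = p := by
      have := gaussSum_mul_gaussSum_pow_orderOf_sub_one hne hψp
      rw [ho, hm1, one_mul, ZMod.card] at this
      have hinv : χF⁻¹ = χF^(3-1) := by
        rw [inv_eq_iff_mul_eq_one]
        rw [← pow_succ']; exact hc3
      rw [hinv]; exact this
    have hx : χF q * χF⁻¹ q = 1 := by
      rw [← MulChar.mul_apply, mul_inv_cancel]; exact MulChar.one_apply hqU
    have h4 : (g^3)^e = p * χF q := by
      rw [← pow_mul, ← hq', pow_succ, ← h2, ← h1]
      linear_combination - g * g^q * hx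
    have h5 : (φ J ^ 3)^e = φ J * φ (star J) := by
      rw [← pow_mul, ← hq', pow_succ, hom_frob2 φ q hq J, mul_comm]
    rw [hg3', mul_pow, ← hJJ, ← h5] at h4
    have e1 : (φ J ^ 3) ^ e = (φ J ^ 2)^e * φ J ^ e := by rw [← mul_pow]; ring
    have hne2 : (φ J ^ 2)^e ≠ 0 := by positivity
    apply mul_left_cancel₀ hne2
    rw [h4, e1, hχF, MulChar.ringHomComp_apply]; ring

end Eis
end

section
set_option linter.unusedSimpArgs false
set_option linter.unusedVariables false
set_option linter.unusedSectionVars false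
set_option linter.style.haveILetI false
open scoped QuadraticAlgebra

namespace Eis

/-- packaged properties of the cubic residue character attached to `γ`. -/
def IsCubChar (γ : Eis) (χ : ℤ →* Eis) : Prop :=
  (∀ m : ℤ, IsCoprime m (QuadraticAlgebra.norm γ) → χ m ^ 3 = 1) ∧
  (∀ m m' : ℤ, γ ∣ ((m - m' : ℤ) : Eis) → χ m = χ m') ∧
  (∀ (q : ℕ) [Fact q.Prime], q ≠ 3 → ¬ (q:ℤ) ∣ QuadraticAlgebra.norm γ →
    ∀ (F : Type) [Field F] [IsAlgClosed F] [CharP F q] (φ : Eis →+* F), Rel q φ (χ q) γ)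

lemma norm_nonneg (z : Eis) : 0 ≤ QuadraticAlgebra.norm z := by
  rw [norm_formula]; nlinarith [sq_nonneg (z.re - z.im), sq_nonneg (z.re), sq_nonneg (z.im), sq_nonneg (2*z.re - z.im)]

lemma inert_dvd {p : ℕ} [Fact p.Prime] (hp : p % 3 = 2) (x y : ZMod p) (h : x^2 - x*y + y^2 = 0) (h3 : (3 : ZMod p) ≠ 0) :
    x = 0 ∧ y = 0 := by
  have key : ∀ z : ZMod p, (z^3)^(2*(p/3)+1) = z := by
    intro z
    by_cases hz : z = 0
    · subst hz; simp
    · rw [← pow_mul]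
      have : 3 * (2*(p/3)+1) = p + (p - 1) := by omega
      rw [this, pow_add, ZMod.pow_card, ZMod.pow_card_sub_one_eq_one hz, mul_one]
  have h1 : x^3 = (-y)^3 := by linear_combination (x + y) * h
  have h2 : x = -y := by rw [← key x, h1, key]
  have h4 : 3 * (y * y) = 0 := by rw [h2] at h; linear_combination h
  have h5 : y = 0 := by
    rcases mul_eq_zero.1 h4 with h | h
    · exact absurd h h3
    · exact mul_self_eq_zero.1 h
  exact ⟨by rw [h2, h5, neg_zero], h5⟩

lemma dvd_of_components {p : ℤ} {z : Eis} (h1 : p ∣ z.re) (h2 : p ∣ z.im) : ∃ d : Eis, z = (p : Eis) * d := by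
  obtain ⟨a, ha⟩ := h1
  obtain ⟨b, hb⟩ := h2
  exact ⟨⟨a, b⟩, by ext <;> simp [ha, hb]⟩

lemma split_dvd {p : ℕ} (hp : p.Prime) {π γ : Eis} (hπ : QuadraticAlgebra.norm π = p)
    (hγ : (p:ℤ) ∣ QuadraticAlgebra.norm γ) : π ∣ γ ∨ star π ∣ γ := by
  have hpp : Prime (p:ℤ) := Nat.prime_iff_prime_int.1 hp
  have hprod : (p:ℤ) ∣ (γ * π).im * (γ * star π).im := by
    have e : (γ * π).im * (γ * star π).im = γ.im^2 * QuadraticAlgebra.norm π - π.im^2 * QuadraticAlgebra.norm γ := by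
      rw [norm_formula, norm_formula]
      simp
      ring
    rw [e, hπ]
    exact dvd_sub (Dvd.intro_left _ rfl) (Dvd.dvd.mul_left hγ _)
  have hfull : ∀ w : Eis, QuadraticAlgebra.norm w = p → (p:ℤ) ∣ (γ * w).im → ∃ d, γ * w = ((p:ℤ):Eis) * d := by
    intro w hw him
    have hn : (p:ℤ) ∣ QuadraticAlgebra.norm (γ * w) := by
      rw [map_mul, hw]; exact Dvd.intro_left _ rfl
    rw [norm_formula] at hn
    have hre : (p:ℤ) ∣ (γ * w).re^2 := by
      have : (γ * w).re^2 = ((γ * w).re^2 - (γ * w).re * (γ * w).im + (γ * w).im^2) + (γ * w).im * ((γ * w).re - (γ*w).im) := by ring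
      rw [this]
      exact dvd_add hn (Dvd.dvd.mul_right him _)
    exact dvd_of_components (hpp.dvd_of_dvd_pow hre) him
  have hpe : ((p:ℤ):Eis) = π * star π := by rw [mul_star_self, hπ]
  have hπ0 : π ≠ 0 := by
    rintro rfl
    rw [QuadraticAlgebra.norm_zero] at hπ
    exact hp.ne_zero (by exact_mod_cast hπ.symm)
  have hs0 : star π ≠ 0 := by simpa using hπ0
  rcases hpp.dvd_or_dvd hprod with h | h
  · obtain ⟨d, hd⟩ := hfull π hπ h
    right
    refine ⟨d, mul_right_cancel₀ hπ0 ?_⟩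
    rw [hd, hpe]; ring
  · obtain ⟨d, hd⟩ := hfull (star π) (by rw [QuadraticAlgebra.norm_star, hπ]) h
    left
    refine ⟨d, mul_right_cancel₀ hs0 ?_⟩
    rw [hd, hpe]; ring

lemma exists_cubic_char (p : ℕ) [Fact p.Prime] (hp : p % 3 = 1) : ∃ χ : MulChar (ZMod p) Eis, orderOf χ = 3 := by
  apply MulChar.exists_mulChar_orderOf (F := ZMod p) (n := 3)
  · rw [ZMod.card]; omega
  · exact om_prim

lemma cubChar_step {p : ℕ} [Fact p.Prime] (hp : p % 3 = 1) (η : MulChar (ZMod p) Eis) (hη : orderOf η = 3)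
    {δ : Eis} {χ : ℤ →* Eis} (h : IsCubChar δ χ) :
    ∃ χ' : ℤ →* Eis, IsCubChar (jacobiSum η η * δ) χ' := by
  have hN := jac_norm η hη
  refine ⟨(η.toMonoidHom.comp (Int.castRingHom (ZMod p)).toMonoidHom) * χ, ?_, ?_, ?_⟩
  · intro m hm
    rw [map_mul, hN] at hm
    have h1 := h.1 m hm.of_mul_right_right
    have hm0 : (m : ZMod p) ≠ 0 := by
      intro h0
      rw [ZMod.intCast_zmod_eq_zero_iff_dvd] at h0
      have hc := hm.of_mul_right_left
      have := hc.isUnit_of_dvd' h0 dvd_rfl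
      exact (Nat.prime_iff_prime_int.1 (Fact.out : p.Prime)).not_isUnit this
    have h2 := char_cube η hη hm0
    change (η (m : ZMod p) * χ m)^3 = 1
    rw [mul_pow, h1, h2, one_mul]
  · intro m m' hd
    change η (m : ZMod p) * χ m = η (m' : ZMod p) * χ m'
    rw [h.2.1 m m' ((Dvd.intro_left _ rfl).trans hd)]
    congr 1
    obtain ⟨c, hc⟩ := (Dvd.intro _ rfl : jacobiSum η η ∣ jacobiSum η η * δ).trans hd
    have := congrArg QuadraticAlgebra.norm hc
    rw [map_mul, hN, QuadraticAlgebra.norm_intCast] at this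
    have hdv : (p:ℤ) ∣ m - m' :=
      (Nat.prime_iff_prime_int.1 (Fact.out : p.Prime)).dvd_of_dvd_pow (Dvd.intro _ (by exact_mod_cast this.symm) : (p:ℤ) ∣ (m-m')^2)
    have : ((m - m' : ℤ) : ZMod p) = 0 := by rwa [ZMod.intCast_zmod_eq_zero_iff_dvd]
    push_cast at this
    rw [sub_eq_zero.1 this]
  · intro q _ hq3 hq F _ _ _ φ
    rw [map_mul, hN] at hq
    have hqp : q ≠ p := by rintro rfl; exact hq (Dvd.intro _ rfl)
    have h2 := h.2.2 q hq3 (fun h => hq (h.mul_left _)) F φ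
    have h1 := jac_rel η hη q hqp hq3 F φ
    have := h1.mul h2
    change Rel q φ (η (((q:ℤ) : ZMod p)) * χ q) _
    rw [Int.cast_natCast]
    exact this

theorem exists_cubChar : ∀ (N : ℕ) (γ : Eis), (QuadraticAlgebra.norm γ).natAbs = N → 3 ∣ γ.im → ¬ 3 ∣ γ.re →
    ∃ χ : ℤ →* Eis, IsCubChar γ χ := by
  intro N
  induction N using Nat.strong_induction_on with
  | _ N ih =>
  intro γ hN him hre
  have hn0 := norm_nonneg γ
  have hNform := norm_formula γ
  have hN3 : ¬ 3 ∣ N := by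
    intro h
    have h' : (3:ℤ) ∣ QuadraticAlgebra.norm γ := by
      rw [← Int.dvd_natAbs, hN]; exact_mod_cast h
    apply hre
    rw [hNform] at h'
    have : (3:ℤ) ∣ γ.re^2 := by
      have e : γ.re^2 = (γ.re^2 - γ.re * γ.im + γ.im^2) + γ.im * (γ.re - γ.im) := by ring
      rw [e]; exact dvd_add h' (Dvd.dvd.mul_right him _)
    exact Int.prime_three.dvd_of_dvd_pow this
  by_cases h1 : N = 1
  · have hnorm : QuadraticAlgebra.norm γ = 1 := by omega
    have him0 : γ.im = 0 := by
      obtain ⟨t, ht⟩ := him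
      have ht2 : t = 0 := by
        rw [hNform, ht] at hnorm
        have : t^2 < 1 := by nlinarith [sq_nonneg (2*γ.re - 3*t)]
        nlinarith [sq_nonneg t]
      rw [ht, ht2]; rfl
    have hγ : γ = ((γ.re : ℤ) : Eis) := by ext <;> simp [him0]
    refine ⟨1, ?_, ?_, ?_⟩
    · intro m _; simp
    · intro m m' _; simp
    · intro q _ _ _ F _ _ _ φ
      rw [hγ]; simpa using Rel.int q φ γ.re
  · obtain ⟨p, hp, hpN⟩ := Nat.exists_prime_and_dvd h1
    haveI : Fact p.Prime := ⟨hp⟩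
    have hpn : (p:ℤ) ∣ QuadraticAlgebra.norm γ := by
      rw [← Int.dvd_natAbs, hN]; exact_mod_cast hpN
    have hNpos : 0 < N := by
      rcases Nat.eq_zero_or_pos N with h | h
      · exact absurd (h ▸ dvd_zero 3) hN3
      · exact h
    have hp3 : p % 3 ≠ 0 := by
      intro h
      have : p = 3 := ((Nat.prime_dvd_prime_iff_eq (by norm_num) hp).1 (Nat.dvd_of_mod_eq_zero h)).symm
      exact hN3 (this ▸ hpN)
    have hcop : IsCoprime (3:ℤ) (p:ℤ) := by
      rw [Int.isCoprime_iff_gcd_eq_one]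
      exact_mod_cast (Nat.coprime_primes (by norm_num) hp).2 (by rintro rfl; simp at hp3)
    rcases (by omega : p % 3 = 1 ∨ p % 3 = 2) with hp1 | hp2
    · obtain ⟨χ0, h0⟩ := exists_cubic_char p hp1
      have : ∃ η : MulChar (ZMod p) Eis, orderOf η = 3 ∧ jacobiSum η η ∣ γ := by
        rcases split_dvd hp (jac_norm χ0 h0) hpn with h | h
        · exact ⟨χ0, h0, h⟩
        · exact ⟨χ0⁻¹, by rw [orderOf_inv, h0], by rw [← star_jac χ0 h0]; exact h⟩
      obtain ⟨η, hη, δ, hδ⟩ := this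
      obtain ⟨c, hc⟩ := jac_primary hp1 η hη
      set J := jacobiSum η η with hJ
      have hJim : (3:ℤ) ∣ J.im := by
        have := congrArg QuadraticAlgebra.im hc
        simp at this
        exact ⟨_, this⟩
      have hJre : ¬ (3:ℤ) ∣ J.re := by
        have := congrArg QuadraticAlgebra.re hc
        simp at this
        omega
      have e1 : γ.im = J.re * δ.im + J.im * (δ.re - δ.im) := by rw [hδ]; simp; ring
      have e2 : γ.re = J.re * δ.re - J.im * δ.im := by rw [hδ]; simp; ring
      have hδim : (3:ℤ) ∣ δ.im := by
        have : (3:ℤ) ∣ J.re * δ.im := by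
          have : J.re * δ.im = γ.im - J.im * (δ.re - δ.im) := by rw [e1]; ring
          rw [this]; exact dvd_sub him (hJim.mul_right _)
        exact (Int.prime_three.dvd_or_dvd this).resolve_left hJre
      have hδre : ¬ (3:ℤ) ∣ δ.re := by
        intro h
        exact hre (e2 ▸ dvd_sub (h.mul_left _) (hJim.mul_right _))
      have hnn : QuadraticAlgebra.norm γ = p * QuadraticAlgebra.norm δ := by
        rw [hδ, map_mul, jac_norm η hη]
      have hlt : (QuadraticAlgebra.norm δ).natAbs < N := by
        rw [← hN, hnn, Int.natAbs_mul, Int.natAbs_natCast]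
        have : 0 < (QuadraticAlgebra.norm δ).natAbs := by
          rw [Nat.pos_iff_ne_zero]; intro h
          rw [hnn, Int.natAbs_mul, h, mul_zero] at hN; omega
        nlinarith [hp.two_le]
      obtain ⟨χ, hχ⟩ := ih _ hlt δ rfl hδim hδre
      rw [hδ]
      exact cubChar_step hp1 η hη hχ
    · have hx : ((γ.re : ZMod p)) = 0 ∧ ((γ.im : ZMod p)) = 0 := by
        apply inert_dvd hp2
        · have : ((QuadraticAlgebra.norm γ : ℤ) : ZMod p) = 0 := by rwa [ZMod.intCast_zmod_eq_zero_iff_dvd]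
          rw [hNform] at this; push_cast at this; exact this
        · intro h
          have : ((3:ℕ) : ZMod p) = 0 := by exact_mod_cast h
          rw [ZMod.natCast_eq_zero_iff] at this
          have := (Nat.prime_dvd_prime_iff_eq hp (by norm_num)).1 this
          omega
      rw [ZMod.intCast_zmod_eq_zero_iff_dvd, ZMod.intCast_zmod_eq_zero_iff_dvd] at hx
      obtain ⟨δ, hδ⟩ := dvd_of_components hx.1 hx.2
      have hnn : QuadraticAlgebra.norm γ = p^2 * QuadraticAlgebra.norm δ := by
        rw [hδ, map_mul, QuadraticAlgebra.norm_intCast]; simp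
      have hlt : (QuadraticAlgebra.norm δ).natAbs < N := by
        have hpos : 0 < (QuadraticAlgebra.norm δ).natAbs := by
          rw [Nat.pos_iff_ne_zero]; intro h
          rw [hnn, Int.natAbs_mul, h, mul_zero] at hN; omega
        rw [← hN, hnn, Int.natAbs_mul, Int.natAbs_pow, Int.natAbs_natCast]
        have := Nat.pow_le_pow_left hp.two_le 2
        nlinarith [hp.two_le]
      have e1 : γ.im = p * δ.im := by rw [hδ]; simp
      have e2 : γ.re = p * δ.re := by rw [hδ]; simp
      obtain ⟨χ, hχ⟩ := ih _ hlt δ rfl (hcop.dvd_of_dvd_mul_left (e1 ▸ him)) (fun h => hre (e2 ▸ h.mul_left _))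
      refine ⟨χ, ?_, ?_, ?_⟩
      · intro m hm
        rw [hnn] at hm
        exact hχ.1 m hm.of_mul_right_right
      · intro m m' h
        exact hχ.2.1 m m' ((Dvd.intro_left _ hδ.symm).trans h)
      · intro q _ hq3 hq F _ _ _ φ
        rw [hnn] at hq
        have := (Rel.int q φ (p:ℤ)).mul (hχ.2.2 q hq3 (fun h => hq (h.mul_left _)) F φ)
        rw [one_mul, ← hδ] at this
        exact this

end Eis
end

section
set_option linter.unusedSimpArgs false
set_option linter.unusedVariables false
set_option linter.unusedSectionVars false
set_option linter.style.haveILetI false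
open scoped QuadraticAlgebra

/-- discriminant parameters `n` such that `ℤ[√-n]` is a maximal order with unit group `±1`. -/
class GoodN (n : ℤ) : Prop where
  sf : Squarefree n
  gt : 1 < n
  md : n % 4 = 1 ∨ n % 4 = 2

abbrev RR (n : ℤ) := QuadraticAlgebra ℤ (-n) 0
abbrev KK (n : ℤ) := QuadraticAlgebra ℚ (-(n:ℚ)) 0

namespace RR
variable (n : ℤ)

def toK : RR n →+* KK n where
  toFun z := ⟨z.re, z.im⟩
  map_one' := by ext <;> simp
  map_zero' := by ext <;> simp
  map_mul' x y := by ext <;> simp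
  map_add' x y := by ext <;> simp

instance : Algebra (RR n) (KK n) := (toK n).toAlgebra

variable {n}
@[simp] lemma algebraMap_re (z : RR n) : (algebraMap (RR n) (KK n) z).re = z.re := rfl
@[simp] lemma algebraMap_im (z : RR n) : (algebraMap (RR n) (KK n) z).im = z.im := rfl

lemma norm_formula (z : RR n) : QuadraticAlgebra.norm z = z.re^2 + n * z.im^2 := by
  rw [QuadraticAlgebra.norm_def]; ring

lemma mul_star_self (z : RR n) : z * star z = ((QuadraticAlgebra.norm z : ℤ) : RR n) := by
  have := QuadraticAlgebra.algebraMap_norm_eq_mul_star z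
  rw [← this]; simp

variable [hn : GoodN n]

instance factK : Fact (∀ r : ℚ, r ^ 2 ≠ -(n:ℚ) + 0 * r) := ⟨by
  intro r h
  have : (0:ℚ) < n := by exact_mod_cast (lt_trans one_pos hn.gt)
  nlinarith [sq_nonneg r]⟩

lemma algebraMap_inj : Function.Injective (algebraMap (RR n) (KK n)) := by
  intro x y h
  have h1 := congrArg QuadraticAlgebra.re h
  have h2 := congrArg QuadraticAlgebra.im h
  simp at h1 h2
  ext <;> assumption

instance : IsDomain (RR n) := (algebraMap_inj (n := n)).isDomain

instance : IsScalarTower ℤ (RR n) (KK n) := IsScalarTower.of_algebraMap_eq (by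
  intro x
  ext <;> simp)

lemma int_of_nsq {r : ℚ} {m : ℤ} (h : (n:ℚ) * r^2 = m) : ∃ k : ℤ, r = k := by
  have hd : (r.den : ℤ)^2 ∣ n := by
    have h1 : (n:ℚ) * r.num^2 = m * r.den^2 := by
      have := Rat.num_div_den r
      have hd0 : (r.den : ℚ) ≠ 0 := by exact_mod_cast r.den_ne_zero
      rw [← this] at h
      field_simp at h
      linarith
    have h2 : n * r.num^2 = m * (r.den:ℤ)^2 := by exact_mod_cast h1
    have hc : IsCoprime ((r.den:ℤ)^2) (r.num^2) := by
      apply IsCoprime.pow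
      rw [Int.isCoprime_iff_gcd_eq_one]
      have := r.reduced
      rw [Int.gcd_comm]; simpa [Int.gcd, Nat.Coprime] using this
    exact hc.dvd_of_dvd_mul_right (Dvd.intro_left _ h2.symm)
  have hu := hn.sf (r.den:ℤ) (by rw [← pow_two]; exact hd)
  have : r.den = 1 := by
    rw [Int.isUnit_iff] at hu
    omega
  exact ⟨r.num, by conv_lhs => rw [← Rat.num_div_den r, this]; simp⟩

lemma isIntegral_exists {x : KK n} (hx : IsIntegral ℤ x) : ∃ z : RR n, algebraMap (RR n) (KK n) z = x := by
  have hstar : IsIntegral ℤ (star x) := by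
    have := hx.map ((starRingEnd (KK n)).toIntAlgHom)
    exact this
  have hQ : ∀ r : ℚ, IsIntegral ℤ (algebraMap ℚ (KK n) r) → ∃ k : ℤ, r = k := by
    intro r hr
    rw [isIntegral_algebraMap_iff (FaithfulSMul.algebraMap_injective ℚ (KK n))] at hr
    obtain ⟨k, hk⟩ := IsIntegrallyClosed.isIntegral_iff.1 hr
    exact ⟨k, by simpa using hk.symm⟩
  obtain ⟨P, hP⟩ := hQ (QuadraticAlgebra.trace x) (by
    have e : algebraMap ℚ (KK n) (QuadraticAlgebra.trace x) = x + star x := by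
      rw [← QuadraticAlgebra.algebraMap_trace_eq_add_star]
      exact RingHom.congr_fun (Subsingleton.elim _ _) _
    rw [e]; exact hx.add hstar)
  obtain ⟨N, hN⟩ := hQ (QuadraticAlgebra.norm x) (by
    have e : algebraMap ℚ (KK n) (QuadraticAlgebra.norm x) = x * star x := by
      rw [← QuadraticAlgebra.algebraMap_norm_eq_mul_star]
      exact RingHom.congr_fun (Subsingleton.elim _ _) _
    rw [e]; exact hx.mul hstar)
  rw [QuadraticAlgebra.trace_def] at hP
  rw [QuadraticAlgebra.norm_def] at hN
  obtain ⟨Q, hQ⟩ := int_of_nsq (n := n) (r := 2 * x.im) (m := 4 * N - P^2) (by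
    push_cast
    rw [← hP, ← hN]; ring)
  have hintg : n * Q^2 = 4 * N - P^2 := by
    have : (n:ℚ) * Q^2 = 4 * N - P^2 := by
      rw [← hQ, ← hP, ← hN]; ring
    exact_mod_cast this
  have hev : P % 2 = 0 ∧ Q % 2 = 0 := by
    have h4 : (n * Q^2 + P^2) % 4 = 0 := by rw [hintg]; omega
    have := hn.md
    rcases Int.emod_two_eq_zero_or_one P with hp | hp <;> rcases Int.emod_two_eq_zero_or_one Q with hq | hq
    · exact ⟨hp, hq⟩
    all_goals
      exfalso
      obtain ⟨p', hp'⟩ : ∃ p', P = 2 * p' + P % 2 := ⟨P / 2, by omega⟩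
      obtain ⟨q', hq'⟩ : ∃ q', Q = 2 * q' + Q % 2 := ⟨Q / 2, by omega⟩
      rw [hp] at hp'
      rw [hq] at hq'
      have e : n * Q^2 + P^2 = 4 * (n * (q'^2 + (Q%2)*q') + p'^2 + (P%2)*p') + n * (Q % 2) + P%2 := by
        rw [hp, hq, hp', hq']; ring
      rw [hp, hq] at e
      omega
  refine ⟨⟨P / 2, Q / 2⟩, ?_⟩
  obtain ⟨p', rfl⟩ : ∃ p', P = 2 * p' := ⟨P / 2, by omega⟩
  obtain ⟨q', rfl⟩ : ∃ q', Q = 2 * q' := ⟨Q / 2, by omega⟩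
  ext
  · simp; push_cast at hP; linarith
  · simp; push_cast at hQ; linarith

instance : Module.Finite ℤ (RR n) := Module.Finite.of_basis (QuadraticAlgebra.basis (-n) 0)
instance : Module.Free ℤ (RR n) := Module.Free.of_basis (QuadraticAlgebra.basis (-n) 0)

instance : IsIntegralClosure (RR n) ℤ (KK n) where
  algebraMap_injective := algebraMap_inj
  isIntegral_iff := by
    intro x
    constructor
    · exact isIntegral_exists
    · rintro ⟨z, rfl⟩
      exact (Algebra.IsIntegral.isIntegral (R := ℤ) z).map (Algebra.ofId (RR n) (KK n) |>.restrictScalars ℤ)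

instance : FiniteDimensional ℚ (KK n) := Module.Finite.of_basis (QuadraticAlgebra.basis (-(n:ℚ)) 0)

instance : IsFractionRing (RR n) (KK n) := IsIntegralClosure.isFractionRing_of_finite_extension ℤ ℚ (KK n) (RR n)
instance : IsDedekindDomain (RR n) := IsIntegralClosure.isDedekindDomain ℤ ℚ (KK n) (RR n)
noncomputable instance : Fintype (ClassGroup (RR n)) :=
  ClassGroup.fintypeOfAdmissibleOfFinite ℚ (KK n) AbsoluteValue.absIsAdmissible


lemma natAbs_norm (z : RR n) : Ideal.absNorm (Ideal.span {z}) = (QuadraticAlgebra.norm z).natAbs := by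
  rw [Ideal.absNorm_span_singleton]
  have : Algebra.norm ℤ z = QuadraticAlgebra.norm z := by
    rw [Algebra.norm_apply, ← QuadraticAlgebra.det_toLinearMap_eq_norm]
    congr 1
  rw [this]

lemma norm_nonneg (z : RR n) : 0 ≤ QuadraticAlgebra.norm z := by
  rw [norm_formula]
  have := hn.gt
  positivity

lemma unit_cases {u : RR n} (h : IsUnit u) : u = 1 ∨ u = -1 := by
  rw [QuadraticAlgebra.isUnit_iff_norm_isUnit, Int.isUnit_iff, norm_formula] at h
  have hg := hn.gt
  have him : u.im = 0 := by
    by_contra h0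
    have : 1 ≤ u.im^2 := by have := sq_nonneg u.im; have := pow_ne_zero 2 h0; omega
    rcases h with h | h <;> nlinarith [sq_nonneg u.re]
  rw [him] at h
  have : u.re^2 = 1 := by rcases h with h | h <;> nlinarith [sq_nonneg u.re]
  rcases (show u.re = 1 ∨ u.re = -1 from by simpa using this) with h | h
  · left; ext <;> simp [h, him]
  · right; ext <;> simp [h, him]
end RR
end

section
set_option linter.unusedSimpArgs false
set_option linter.unusedVariables false
set_option linter.unusedSectionVars false
set_option linter.style.haveILetI false
open scoped QuadraticAlgebra
open UniqueFactorizationMonoid in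
theorem Ideal.exists_cube {S : Type*} [CommRing S] [IsDedekindDomain S] {Z : Ideal S} (hZ : Z ≠ ⊥)
    (H : ∀ P : Ideal S, Prime P → P ∣ Z → ∃ c : ℕ, emultiplicity P Z = ((3 * c : ℕ) : ℕ∞)) : ∃ I : Ideal S, I^3 = Z := by
  classical
  refine ⟨∏ P ∈ (normalizedFactors Z).toFinset, P ^ ((normalizedFactors Z).count P / 3), ?_⟩
  rw [← Finset.prod_pow]
  conv_rhs => rw [← Ideal.prod_normalizedFactors_eq_self hZ, Finset.prod_multiset_count]
  apply Finset.prod_congr rfl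
  intro P hP
  rw [Multiset.mem_toFinset] at hP
  have hpr := prime_of_normalized_factor P hP
  obtain ⟨c, hc⟩ := H P hpr (dvd_of_mem_normalizedFactors hP)
  rw [emultiplicity_eq_count_normalizedFactors hpr.irreducible hZ, normalize_eq, Nat.cast_inj] at hc
  rw [← pow_mul, hc]
  congr 1
  omega

namespace RR
variable {n : ℤ} [hn : GoodN n]

/-- `√-n` -/
def sq (n : ℤ) : RR n := ⟨0, 1⟩

lemma sq_sq : sq n * sq n = ((-n : ℤ) : RR n) := by
  ext <;> simp [sq]

lemma eq_add_sq (z : RR n) : z = (z.re : RR n) + (z.im : RR n) * sq n := by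
  ext <;> simp [sq]

lemma star_eq_sub_sq (z : RR n) : star z = (z.re : RR n) - (z.im : RR n) * sq n := by
  ext <;> simp [sq]

lemma star_mem_of_sq_mem {P : Ideal (RR n)} (h : sq n ∈ P) {z : RR n} (hz : z ∈ P) : star z ∈ P := by
  have : star z = z - 2 * z.im * sq n := by
    ext <;> simp [sq]; ring
  rw [this]
  exact P.sub_mem hz (P.mul_mem_left _ h)

lemma star_mem_pow {P : Ideal (RR n)} (h : sq n ∈ P) {z : RR n} (k : ℕ) (hz : z ∈ P^k) : star z ∈ P^k := by
  have h1 : Ideal.map (starRingEnd (RR n)) P ≤ P := by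
    rw [Ideal.map_le_iff_le_comap]
    intro w hw
    exact star_mem_of_sq_mem h hw
  have h2 := Ideal.mem_map_of_mem (starRingEnd (RR n)) hz
  rw [Ideal.map_pow] at h2
  exact Ideal.pow_right_mono h1 k h2

theorem isCube_of {z : RR n} (hz : z ≠ 0) (r : ℤ) (hN : z * star z = (r : RR n)^3)
    (H : ∀ P : Ideal (RR n), P.IsPrime → z ∈ P → star z ∈ P → sq n ∈ P) : ∃ I : Ideal (RR n), I^3 = Ideal.span {z} := by
  have hz0 : Ideal.span {z} ≠ ⊥ := by simpa using hz
  have hs : star z ≠ 0 := by simpa using hz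
  have hs0 : Ideal.span {star z} ≠ ⊥ := by simpa using hs
  have hr : (r : RR n) ≠ 0 := by
    intro h; rw [h] at hN
    exact mul_ne_zero hz hs (by rw [hN]; simp)
  have hr0 : Ideal.span {(r : RR n)} ≠ ⊥ := by simpa using hr
  have hprod : Ideal.span {z} * Ideal.span {star z} = Ideal.span {(r : RR n)} ^ 3 := by
    rw [Ideal.span_singleton_mul_span_singleton, hN, Ideal.span_singleton_pow]
  apply Ideal.exists_cube hz0
  intro P hP hPz
  have hfin : ∀ I : Ideal (RR n), I ≠ ⊥ → ∃ c : ℕ, emultiplicity P I = c := by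
    intro I hI
    classical
    exact ⟨_, UniqueFactorizationMonoid.emultiplicity_eq_count_normalizedFactors hP.irreducible hI⟩
  have he := congrArg (emultiplicity P) hprod
  rw [emultiplicity_mul hP, emultiplicity_pow hP] at he
  obtain ⟨a, ha⟩ := hfin _ hz0
  obtain ⟨b, hb⟩ := hfin _ hs0
  obtain ⟨c, hc⟩ := hfin _ hr0
  rw [ha, hb, hc] at he
  have he' : a + b = 3 * c := by exact_mod_cast he
  haveI := Ideal.isPrime_of_prime hP
  rw [Ideal.dvd_span_singleton] at hPz
  by_cases hsP : star z ∈ P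
  · have hsq := H P inferInstance hPz hsP
    have hab : emultiplicity P (Ideal.span {z}) = emultiplicity P (Ideal.span {star z}) := by
      rw [emultiplicity_eq_emultiplicity_iff]
      intro k
      rw [Ideal.dvd_span_singleton, Ideal.dvd_span_singleton]
      exact ⟨star_mem_pow hsq k, fun h => by simpa using star_mem_pow hsq k h⟩
    rw [ha, hb] at hab
    have hab' : a = b := by exact_mod_cast hab
    exact ⟨a / 3, by rw [ha]; congr 1; omega⟩
  · have hb0 : emultiplicity P (Ideal.span {star z}) = 0 := by
      rw [emultiplicity_eq_zero, Ideal.dvd_span_singleton]; exact hsP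
    rw [hb] at hb0
    have hb0' : b = 0 := by exact_mod_cast hb0
    exact ⟨c, by rw [ha]; congr 1; omega⟩
end RR

/-- lowest terms for integral Mordell curves -/
theorem lowest_terms {a : ℤ} {x y : ℚ} (h : y^2 = x^3 + a) :
    ∃ r s t : ℤ, t ≠ 0 ∧ IsCoprime r t ∧ IsCoprime s t ∧ x = r / t^2 ∧ y = s / t^3 ∧ s^2 = r^3 + a * t^6 := by
  set p := x.num
  set q : ℤ := (x.den : ℤ)
  set u := y.num
  set v : ℤ := (y.den : ℤ)
  have hx : x = p / q := (Rat.num_div_den x).symm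
  have hy : y = u / v := (Rat.num_div_den y).symm
  have hq0 : q ≠ 0 := by simp [q]
  have hv0 : v ≠ 0 := by simp [v]
  have hpq : IsCoprime p q := by
    rw [Int.isCoprime_iff_gcd_eq_one]; exact x.reduced
  have huv : IsCoprime u v := by
    rw [Int.isCoprime_iff_gcd_eq_one]; exact y.reduced
  have hqQ : (q:ℚ) ≠ 0 := by exact_mod_cast hq0
  have hvQ : (v:ℚ) ≠ 0 := by exact_mod_cast hv0
  have hE : u^2 * q^3 = v^2 * (p^3 + a * q^3) := by
    rw [hx, hy] at h
    field_simp at h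
    have : (u:ℚ)^2 * q^3 = v^2 * (p^3 + a * q^3) := by linarith
    exact_mod_cast this
  have h1 : v^2 ∣ q^3 := (huv.symm.pow (m := 2) (n := 2)).dvd_of_dvd_mul_left (Dvd.intro _ hE.symm)
  have h2 : q^3 ∣ v^2 := by
    have hc : IsCoprime (q^3) (p^3 + a * q^3) := by
      have := (hpq.symm.pow (m := 3) (n := 3))
      exact IsCoprime.add_mul_right_right this a
    exact hc.dvd_of_dvd_mul_right (Dvd.intro_left _ hE)
  have h3 : v^2 = q^3 := Int.dvd_antisymm (by positivity) (by positivity) h1 h2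
  have hqv : q ∣ v := by
    rw [← Int.pow_dvd_pow_iff (n := 2) (by norm_num), h3]; exact pow_dvd_pow _ (by norm_num)
  obtain ⟨t, ht⟩ := hqv
  have hq : q = t^2 := by
    have : q^2 * q = q^2 * t^2 := by rw [ht] at h3; linarith
    exact mul_left_cancel₀ (by positivity) this
  have hv : v = t^3 := by rw [ht, hq]; ring
  have ht0 : t ≠ 0 := by rintro rfl; simp at hq; exact hq0 hq
  have htQ : (t:ℚ) ≠ 0 := by exact_mod_cast ht0
  refine ⟨p, u, t, ht0, ?_, ?_, ?_, ?_, ?_⟩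
  · rw [hq] at hpq; exact (IsCoprime.pow_right_iff (by norm_num)).1 hpq
  · rw [hv] at huv; exact (IsCoprime.pow_right_iff (by norm_num)).1 huv
  · rw [hx, hq]; push_cast; rfl
  · rw [hy, hv]; push_cast; rfl
  · rw [hq, hv] at hE
    have : t^6 * u^2 = t^6 * (p^3 + a * t^6) := by linear_combination hE
    exact mul_left_cancel₀ (by positivity) this
end

section
set_option linter.unusedSimpArgs false
set_option linter.unusedVariables false
set_option linter.unusedSectionVars false
set_option linter.style.haveILetI false
open scoped QuadraticAlgebra

namespace RR
variable {n : ℤ} [hn : GoodN n]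

lemma int_mem_of_coprime {P : Ideal (RR n)} (hP : P.IsPrime) {s t : ℤ} (h : IsCoprime s t)
    (hs : (s : RR n) ∈ P) (ht : (t : RR n) ∈ P) : False := by
  obtain ⟨a, b, hab⟩ := h
  apply hP.ne_top
  rw [Ideal.eq_top_iff_one]
  have : (1 : RR n) = a * s + b * t := by exact_mod_cast hab.symm
  rw [this]
  exact P.add_mem (P.mul_mem_left _ hs) (P.mul_mem_left _ ht)

lemma sq_mem_of {P : Ideal (RR n)} (hP : P.IsPrime) (h : (n : RR n) ∈ P) : sq n ∈ P := by
  have : sq n * sq n ∈ P := by rw [sq_sq]; push_cast; exact P.neg_mem h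
  exact (hP.mem_or_mem this).elim id id

end RR

section Cplus
lemma D_ne (A D : ℤ) [hn : GoodN (A * D)] : D ≠ 0 := by
  rintro rfl
  have := hn.gt
  simp at this

variable {A D : ℤ} [hn : GoodN (A * D)]
theorem point_cube {r s t : ℤ} (ht0 : t ≠ 0) (hrt : IsCoprime r t) (hst : IsCoprime s t)
    (h : s^2 = r^3 + (-(A * D^3)) * t^6) :
    ∃ I : Ideal (RR (A * D)), I^3 = Ideal.span {(⟨s, D * t^3⟩ : RR (A * D))} := by
  have hD : D ≠ 0 := D_ne A D
  apply RR.isCube_of (r := r)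
  · intro h0
    have := congrArg QuadraticAlgebra.im h0
    simp at this
    rcases this with h | h
    · exact hD h
    · exact ht0 h
  · rw [RR.mul_star_self, RR.norm_formula, ← Int.cast_pow]
    congr 1
    linear_combination h
  · intro P hP hz hsz
    have hr : (r : RR (A*D)) ∈ P := by
      have h1 := P.mul_mem_right (star (⟨s, D * t^3⟩ : RR (A * D))) hz
      rw [RR.mul_star_self, RR.norm_formula] at h1
      have : s^2 + A * D * (D * t^3)^2 = r^3 := by linear_combination h
      simp only at h1
      rw [this] at h1
      push_cast at h1
      exact hP.mem_of_pow_mem _ h1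
    have h2s : ((2 * s : ℤ) : RR (A*D)) ∈ P := by
      have := P.add_mem hz hsz
      convert this using 1
      ext <;> simp
      ring
    by_cases h2 : (2 : RR (A*D)) ∈ P
    · rcases hn.md with hmd | hmd
      · exfalso
        have hreven : r % 2 = 0 := by
          by_contra hodd
          refine RR.int_mem_of_coprime hP (s := r) (t := 2) ?_ hr (by exact_mod_cast h2)
          have : r = 2 * (r/2) + 1 := by omega
          exact ⟨1, -(r/2), by linarith⟩
        obtain ⟨r', rfl⟩ : ∃ r', r = 2 * r' := ⟨r / 2, by omega⟩
        have hDo : D % 2 = 1 := by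
          by_contra h
          have : D % 2 = 0 := by omega
          have : (A * D) % 2 = 0 := by rw [Int.mul_emod, this]; simp
          omega
        have key : (s^2 + A * D * (D * t^3)^2) % 4 = 0 := by
          have : s^2 + A * D * (D * t^3)^2 = 4 * (2 * r'^3) := by linear_combination h
          rw [this]; simp
        set v := D * t^3 with hv
        have hs2 : ∀ w : ℤ, w^2 % 4 = w % 2 := by
          intro w
          rcases Int.emod_two_eq_zero_or_one w with hw | hw
          · obtain ⟨w', rfl⟩ : ∃ w', w = 2 * w' := ⟨w/2, by omega⟩
            have : (2 * w')^2 = 4 * w'^2 := by ring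
            omega
          · obtain ⟨w', rfl⟩ : ∃ w', w = 2 * w' + 1 := ⟨w/2, by omega⟩
            have : (2 * w' + 1)^2 = 4 * (w'^2 + w') + 1 := by ring
            omega
        have h1 := hs2 s
        have h2 := hs2 v
        have h3 : (A * D * v^2) % 4 = v % 2 := by
          rw [Int.mul_emod, hmd, h2]; omega
        have hv2 : v % 2 = 0 ∧ s % 2 = 0 := by omega
        have htt : (2:ℤ) ∣ t := by
          have : (2:ℤ) ∣ D * t^3 := by rw [← hv]; omega
          rcases Int.prime_two.dvd_or_dvd this with h | h
          · omega
          · exact Int.prime_two.dvd_of_dvd_pow h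
        exact Int.prime_two.not_isUnit (hst.isUnit_of_dvd' (by omega) htt)
      · apply RR.sq_mem_of hP
        obtain ⟨m, hm⟩ : ∃ m, A * D = 2 * m := ⟨A*D/2, by omega⟩
        have : ((A*D : ℤ) : RR (A*D)) = 2 * (m : RR (A*D)) := by
          have := congrArg (fun z : ℤ => (z : RR (A*D))) hm
          push_cast at this ⊢
          exact this
        rw [this]
        exact P.mul_mem_right _ h2
    · have hs : (s : RR (A*D)) ∈ P := by
        push_cast at h2s
        exact (hP.mem_or_mem h2s).resolve_left h2
      have h3 : ((D * t^3 : ℤ) : RR (A*D)) * RR.sq (A*D) ∈ P := by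
        have := P.sub_mem hz hs
        convert this using 1
        generalize D * t^3 = v
        ext
        · simp only [RR.sq, QuadraticAlgebra.re_mul, QuadraticAlgebra.re_intCast, QuadraticAlgebra.im_intCast, QuadraticAlgebra.re_sub]
          simp
        · simp only [RR.sq, QuadraticAlgebra.im_mul, QuadraticAlgebra.re_intCast, QuadraticAlgebra.im_intCast, QuadraticAlgebra.im_sub]
          simp
      rcases hP.mem_or_mem h3 with h4 | h4
      · push_cast at h4
        rcases hP.mem_or_mem h4 with h5 | h5
        · apply RR.sq_mem_of hP
          push_cast
          exact P.mul_mem_left _ h5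
        · exact (RR.int_mem_of_coprime hP hst hs (hP.mem_of_pow_mem _ h5)).elim
      · exact h4

/-- change of generator `√-n = √a / D`. -/
def psiHom (A D : ℤ) (hD : D ≠ 0) (a : ℚ) (ha : a = -(A * D^3)) : KK (A * D) →+* QuadraticAlgebra ℚ a 0 where
  toFun z := ⟨z.re, z.im / D⟩
  map_one' := by ext <;> simp
  map_zero' := by ext <;> simp
  map_mul' x y := by
    have : (D:ℚ) ≠ 0 := by exact_mod_cast hD
    ext
    · simp only [QuadraticAlgebra.re_mul]
      rw [ha]; push_cast; field_simp
    · simp only [QuadraticAlgebra.im_mul]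
      field_simp
      ring
  map_add' x y := by ext <;> simp; ring

theorem exists_repr (a : ℤ) (ha : a = -(A * D^3)) (P : (MC (a:ℚ)).Point) :
    ∃ (z : RR (A*D)) (I : Ideal (RR (A*D))) (t : ℚ), z ≠ 0 ∧ t ≠ 0 ∧ I^3 = Ideal.span {z} ∧
      (⟨z.re, z.im / D⟩ : QuadraticAlgebra ℚ (a:ℚ) 0) = ⟨t, 0⟩^3 * kap (a:ℚ) P := by
  have hD : D ≠ 0 := D_ne A D
  have hDQ : (D:ℚ) ≠ 0 := by exact_mod_cast hD
  rcases P with _ | ⟨x, y, hxy⟩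
  · exact ⟨1, 1, 1, one_ne_zero, one_ne_zero, by simp [Ideal.one_eq_top], by ext <;> simp [kap, pow_succ]⟩
  · have hE := mc_equation.1 hxy.1
    obtain ⟨r, s, t, ht0, hrt, hst, hx, hy, h⟩ := lowest_terms hE
    rw [ha] at h
    obtain ⟨I, hI⟩ := point_cube (A := A) (D := D) ht0 hrt hst h
    have htQ : (t:ℚ) ≠ 0 := by exact_mod_cast ht0
    refine ⟨⟨s, D * t^3⟩, I, t, ?_, htQ, hI, ?_⟩
    · intro h0
      have := congrArg QuadraticAlgebra.im h0
      simp at this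
      rcases this with h | h
      · exact hD h
      · exact ht0 h
    · ext
      · simp [kap, pow_succ, hy]; field_simp
      · simp [kap, pow_succ, hy]; field_simp

theorem Cplus (a : ℤ) (ha : a = -(A * D^3)) :
    ∃ f : (MC (a:ℚ)).Point → {c : ClassGroup (RR (A*D)) // c^3 = 1}, ∀ P Q, f P = f Q → CubeK (a:ℚ) (P - Q) := by
  have hD : D ≠ 0 := D_ne A D
  have hA : A ≠ 0 := by
    rintro rfl
    have := hn.gt
    simp at this
  have hDQ : (D:ℚ) ≠ 0 := by exact_mod_cast hD
  have haQ : (a:ℚ) ≠ 0 := by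
    rw [ha]; exact_mod_cast neg_ne_zero.2 (mul_ne_zero hA (pow_ne_zero _ hD))
  haveI Hab : Fact (∀ r : ℚ, r ^ 2 ≠ (a:ℚ) + 0 * r) := ⟨by
    intro r h
    have h1 : (0:ℚ) < A * D := by exact_mod_cast (lt_trans one_pos hn.gt)
    rw [ha] at h
    push_cast at h
    have h2 : (0:ℚ) < D^2 := by positivity
    nlinarith [sq_nonneg r, mul_pos h1 h2]⟩
  choose z I t hz ht hI hk using fun P => exists_repr (A := A) (D := D) a ha P
  have hI0 : ∀ P, I P ≠ ⊥ := by
    intro P h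
    have := hI P
    rw [h, ← Ideal.zero_eq_bot, zero_pow (by norm_num), eq_comm, Ideal.zero_eq_bot, Ideal.span_singleton_eq_bot] at this
    exact hz P this
  let J : ∀ P, nonZeroDivisors (Ideal (RR (A*D))) := fun P => ⟨I P, mem_nonZeroDivisors_of_ne_zero (hI0 P)⟩
  refine ⟨fun P => ⟨ClassGroup.mk0 (J P), ?_⟩, ?_⟩
  · rw [← map_pow, ClassGroup.mk0_eq_one_iff]
    change ((I P)^3).IsPrincipal
    rw [hI P]
    exact ⟨z P, rfl⟩
  · intro P Q h
    rw [Subtype.mk.injEq, ClassGroup.mk0_eq_mk0_iff] at h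
    obtain ⟨x, y, hx, hy, hxy⟩ := h
    change Ideal.span {x} * I P = Ideal.span {y} * I Q at hxy
    have h3 := congrArg (fun K : Ideal (RR (A*D)) => K^3) hxy
    simp only [mul_pow, hI, Ideal.span_singleton_pow, Ideal.span_singleton_mul_span_singleton] at h3
    rw [Ideal.span_singleton_eq_span_singleton] at h3
    obtain ⟨u, hu⟩ := h3
    have hu' : ∃ e : ℤ, (e = 1 ∨ e = -1) ∧ x^3 * z P * (e : RR (A*D)) = y^3 * z Q := by
      rcases RR.unit_cases u.isUnit with h | h
      · exact ⟨1, Or.inl rfl, by rw [h] at hu; simpa using hu⟩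
      · exact ⟨-1, Or.inr rfl, by rw [h] at hu; simpa using hu⟩
    obtain ⟨e, he, heq⟩ := hu'
    set ψ := (psiHom A D hD a (by rw [ha]; push_cast; rfl)).comp (algebraMap (RR (A*D)) (KK (A*D))) with hψ
    have hψk : ∀ P, ψ (z P) = ⟨t P, 0⟩^3 * kap _ P := fun P => hk P
    have hψinj : ∀ w, ψ w = 0 → w = 0 := by
      intro w hw
      have h1 := congrArg QuadraticAlgebra.re hw
      have h2 := congrArg QuadraticAlgebra.im hw
      change ((w.re : ℤ) : ℚ) = 0 at h1
      change ((w.im : ℤ) : ℚ) / D = 0 at h2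
      rw [div_eq_zero_iff, or_iff_left hDQ] at h2
      ext
      · simpa using h1
      · simpa using h2
    have h4 := congrArg ψ heq
    rw [map_mul, map_mul, map_mul, map_pow, map_pow, hψk, hψk, map_intCast] at h4
    have hx' : ψ x ≠ 0 := fun h => hx (hψinj _ h)
    have htP : (⟨t P, 0⟩ : QuadraticAlgebra ℚ (a : ℚ) 0) ≠ 0 := by
      intro h
      exact ht P (congrArg QuadraticAlgebra.re h)
    have hee : (e : QuadraticAlgebra ℚ (a : ℚ) 0) * e = 1 := by
      rcases he with rfl | rfl <;> simp
    refine cubeK_sub haQ P Q (e : ℚ) (ψ y * ⟨t Q, 0⟩ / (ψ x * ⟨t P, 0⟩)) ?_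
    have e1 : (⟨(e:ℚ), 0⟩ : QuadraticAlgebra ℚ (a : ℚ) 0) = (e : QuadraticAlgebra ℚ (a : ℚ) 0) := by
      ext <;> simp
    rw [e1, div_pow, mul_div_assoc', div_mul_eq_mul_div, eq_div_iff (pow_ne_zero _ (mul_ne_zero hx' htP))]
    linear_combination (e : QuadraticAlgebra ℚ (a : ℚ) 0) * h4 - ψ x ^3 * ⟨t P, 0⟩^3 * kap _ P * hee
end Cplus
end

section
set_option linter.unusedSimpArgs false
set_option linter.unusedVariables false
set_option linter.unusedSectionVars false
set_option linter.style.haveILetI false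
open scoped QuadraticAlgebra

namespace Eis
/-- `u - v √-3` -/
def gam (u v : ℤ) : Eis := ⟨u - v, -2 * v⟩

lemma gam_norm (u v : ℤ) : QuadraticAlgebra.norm (gam u v) = u^2 + 3 * v^2 := by
  rw [norm_formula]; simp only [gam]; ring

lemma gam_star (u v : ℤ) : star (gam u v) = gam u (-v) := by
  ext <;> simp [gam]; ring

lemma gam_eq (u v : ℤ) : gam u v = (u : Eis) - v * (1 + 2 * om) := by
  ext <;> simp [gam, om]; ring

lemma gam_mul_int (k u v : ℤ) : (k : Eis) * gam u v = gam (k * u) (k * v) := by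
  rw [gam_eq, gam_eq]; push_cast; ring

lemma gam_primary {u v : ℤ} (hu : ¬ 3 ∣ u) (hv : 3 ∣ v) : 3 ∣ (gam u v).im ∧ ¬ 3 ∣ (gam u v).re := by
  simp only [gam]; omega

section
variable {F : Type} [Field F] {q : ℕ} [hqF : Fact q.Prime] [CharP F q] (φ : Eis →+* F)

lemma hom_int_ne {m : ℤ} (h : ¬ (q:ℤ) ∣ m) : φ (m : Eis) ≠ 0 := by
  rw [map_intCast]
  intro h0
  exact h ((CharP.intCast_eq_zero_iff F q m).1 h0)

lemma hom_ne {z : Eis} (h : ¬ (q:ℤ) ∣ QuadraticAlgebra.norm z) : φ z ≠ 0 := by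
  intro h0
  apply hom_int_ne φ h
  rw [← mul_star_self, map_mul, h0, zero_mul]

lemma hom_gam_congr {u v u' v' : ℤ} (h1 : (q:ℤ) ∣ u - u') (h2 : (q:ℤ) ∣ v - v') : φ (gam u v) = φ (gam u' v') := by
  have e1 : ((u:ℤ):F) = u' := by
    rw [← sub_eq_zero, ← Int.cast_sub]; exact (CharP.intCast_eq_zero_iff F q _).2 h1
  have e2 : ((v:ℤ):F) = v' := by
    rw [← sub_eq_zero, ← Int.cast_sub]; exact (CharP.intCast_eq_zero_iff F q _).2 h2
  rw [gam_eq, gam_eq]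
  simp [e1, e2]

lemma three_ne (h3 : q ≠ 3) : (3:F) ≠ 0 := by
  intro h
  have : ((3:ℕ):F) = 0 := by exact_mod_cast h
  rw [CharP.cast_eq_zero_iff F q] at this
  exact h3 ((Nat.prime_dvd_prime_iff_eq hqF.out Nat.prime_three).1 this)

variable {φ}
lemma Rel.congr {ζ γ γ' : Eis} (h : Rel q φ ζ γ) (h1 : φ γ = φ γ') (h2 : φ (star γ) = φ (star γ')) : Rel q φ ζ γ' := by
  unfold Rel at *
  rw [← h1, ← h2]; exact h

lemma Rel.star {ζ γ : Eis} (hζ : ζ^3 = 1) (h : Rel q φ ζ γ) : Rel q φ (star ζ) (star γ) := by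
  rw [star_of_cube hζ]
  have e : φ ζ ^ 3 = 1 := by rw [← map_pow, hζ, map_one]
  constructor
  · intro hq
    rw [star_star, map_pow, ← h.1 hq]
    linear_combination φ (Star.star γ) ^ ((q-1)/3) * e
  · intro hq
    rw [star_star, map_pow, ← h.2 hq]
    linear_combination φ γ ^ ((q+1)/3) * e

lemma mod3 (h3 : q ≠ 3) : q % 3 = 1 ∨ q % 3 = 2 := by
  have : ¬ 3 ∣ q := fun h => h3 ((Nat.prime_dvd_prime_iff_eq Nat.prime_three hqF.out).1 h).symm
  omega

lemma Rel.unique {ζ ζ' γ : Eis} (h3 : q ≠ 3) (hN : ¬ (q:ℤ) ∣ QuadraticAlgebra.norm γ) (hζ : ζ^3 = 1) (hζ' : ζ'^3 = 1)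
    (h : Rel q φ ζ γ) (h' : Rel q φ ζ' γ) : ζ = ζ' := by
  have n1 := hom_ne φ hN
  have n2 : φ (Star.star γ) ≠ 0 := by
    apply hom_ne (q := q)
    rwa [QuadraticAlgebra.norm_star]
  apply hom_inj_mu φ (three_ne (F := F) h3) hζ hζ'
  rcases mod3 h3 with hq | hq
  · exact mul_right_cancel₀ (pow_ne_zero _ n2) ((h.1 hq).trans (h'.1 hq).symm)
  · exact mul_right_cancel₀ (pow_ne_zero _ n1) ((h.2 hq).trans (h'.2 hq).symm)

/-- self conjugate up to sign -/
lemma Rel.triv {ζ γ : Eis} (ε : F) (hε : ε^2 = 1) (h3 : q ≠ 3) (hN : ¬ (q:ℤ) ∣ QuadraticAlgebra.norm γ) (hζ : ζ^3 = 1)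
    (hs : φ (Star.star γ) = ε * φ γ) (h : Rel q φ ζ γ) : ζ = 1 := by
  have n1 := hom_ne φ hN
  have hpm : ∀ k : ℕ, (ε^k)^2 = 1 := by intro k; rw [← pow_mul, mul_comm, pow_mul, hε, one_pow]
  have key : φ ζ ^ 2 = 1 := by
    rcases mod3 h3 with hq | hq
    · have e := h.1 hq
      rw [hs, mul_pow] at e
      have : φ ζ * ε ^ ((q-1)/3) = 1 := mul_right_cancel₀ (pow_ne_zero ((q-1)/3) n1) (by rw [mul_assoc, e, one_mul])
      have t := hpm ((q-1)/3)
      calc φ ζ^2 = φ ζ^2 * (ε ^ ((q-1)/3))^2 := by rw [t, mul_one]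
        _ = (φ ζ * ε ^ ((q-1)/3))^2 := by ring
        _ = 1 := by rw [this, one_pow]
    · have e := h.2 hq
      rw [hs, mul_pow] at e
      have : φ ζ = ε ^ ((q+1)/3) := mul_right_cancel₀ (pow_ne_zero ((q+1)/3) n1) e
      rw [this]; exact hpm _
  have h2 : ζ^2 = 1 := by
    apply hom_inj_mu φ (three_ne (F := F) h3) (by rw [← pow_mul, mul_comm, pow_mul, hζ, one_pow]) (one_pow 3)
    rw [map_pow, key, map_one]
  calc ζ = ζ^3 := by rw [pow_succ, h2, one_mul]
    _ = 1 := hζ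
end

/-- an algebraically closed test field and map exist for each prime. -/
lemma exists_phi (q : ℕ) [Fact q.Prime] : Nonempty (Eis →+* AlgebraicClosure (ZMod q)) := by
  obtain ⟨x, hx⟩ := IsAlgClosed.exists_root (k := AlgebraicClosure (ZMod q))
    (Polynomial.X^2 + Polynomial.X + 1 : Polynomial (AlgebraicClosure (ZMod q))) (by
      have : (Polynomial.X^2 + Polynomial.X + 1 : Polynomial (AlgebraicClosure (ZMod q))).degree = 2 := by
        compute_degree!
      rw [this]; norm_num)
  simp [Polynomial.IsRoot] at hx
  refine ⟨(QuadraticAlgebra.lift (R := ℤ) (a := -1) (b := -1) ⟨x, ?_⟩).toRingHom⟩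
  simp
  linear_combination hx

lemma chi_int_one {χ : ℤ →* Eis} {m : ℤ} (hm0 : m ≠ 0) (hneg : χ (-1) = 1)
    (H : ∀ q : ℕ, q.Prime → (q:ℤ) ∣ m → χ q = 1) : χ m = 1 := by
  have hnat : ∀ k : ℕ, k ≠ 0 → (∀ q : ℕ, q.Prime → q ∣ k → χ q = 1) → χ (k:ℤ) = 1 := by
    intro k
    induction k using induction_on_primes with
    | zero => intro h; exact absurd rfl h
    | one => intro _ _; simp
    | prime_mul p a hp ih =>
      intro h0 h
      push_cast
      rw [map_mul, h p hp (dvd_mul_right _ _), one_mul]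
      exact ih (right_ne_zero_of_mul h0) (fun q hq hqa => h q hq (hqa.mul_left _))
  rcases Int.natAbs_eq m with h | h
  · rw [h]; exact hnat _ (by omega) (fun q hq hqm => H q hq (Int.natCast_dvd.2 hqm))
  · have e : m = (-1) * (m.natAbs : ℤ) := by rw [neg_one_mul]; exact h
    rw [e, map_mul, hneg, one_mul]
    exact hnat _ (by omega) (fun q hq hqm => H q hq (Int.natCast_dvd.2 hqm))

lemma chi_neg {γ : Eis} {χ : ℤ →* Eis} (h : IsCubChar γ χ) : χ (-1) = 1 := by
  have h3 := h.1 (-1) (isCoprime_one_left.neg_left)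
  have h2 : χ (-1) * χ (-1) = 1 := by rw [← map_mul]; simp
  calc χ (-1) = χ (-1) ^3 := by rw [pow_succ, pow_two, h2, one_mul]
    _ = 1 := h3

theorem chi_N {n u v κ c x y : ℤ} (hcop : IsCoprime u v) (hu3 : ¬ 3 ∣ u) (hv3 : 3 ∣ v)
    (hN : u^2 - 3 * n * v^2 = κ * c^3) (hκ : ∀ q : ℕ, q.Prime → (q:ℤ) ∣ κ → (q:ℤ) ∣ u ∧ (q:ℤ) ∣ n)
    (hxy : IsCoprime x y) (hx3 : ¬ 3 ∣ x) (hy3 : ¬ 3 ∣ y)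
    (hNb : IsCoprime (x^2 + n*y^2) (n * κ * c)) :
    ∃ (h u1 v1 : ℤ) (χ : ℤ →* Eis), u * y = h * u1 ∧ v * x = h * v1 ∧
      (∀ q : ℕ, q.Prime → (q:ℤ) ∣ x^2 + n*y^2 → ¬ (q:ℤ) ∣ h) ∧
      (∀ q : ℕ, q.Prime → (q:ℤ) ∣ x^2 + n*y^2 → ¬ (q:ℤ) ∣ QuadraticAlgebra.norm (gam u1 (-v1))) ∧
      IsCubChar (gam u1 (-v1)) χ ∧ χ (x^2 + n*y^2) = 1 := by
  have hu0 : u ≠ 0 := by rintro rfl; simp at hu3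
  have hx0 : x ≠ 0 := by rintro rfl; simp at hx3
  have hy0 : y ≠ 0 := by rintro rfl; simp at hy3
  obtain ⟨x1, u1, h1, hh1, hxu, rfl, rfl⟩ : ∃ x1 u1 h1 : ℤ, 0 < h1 ∧ IsCoprime x1 u1 ∧ x = x1 * h1 ∧ u = u1 * h1 := by
    have hg : 0 < Int.gcd x u := Int.gcd_pos_of_ne_zero_left _ hx0
    obtain ⟨a, b, hab, h1, h2⟩ := Int.exists_gcd_one hg
    exact ⟨a, b, Int.gcd x u, by exact_mod_cast hg, Int.isCoprime_iff_gcd_eq_one.2 hab, h1, h2⟩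
  obtain ⟨y1, v1, h2, hh2, hyv, rfl, rfl⟩ : ∃ x1 u1 h1 : ℤ, 0 < h1 ∧ IsCoprime x1 u1 ∧ y = x1 * h1 ∧ v = u1 * h1 := by
    have hg : 0 < Int.gcd y v := Int.gcd_pos_of_ne_zero_left _ hy0
    obtain ⟨a, b, hab, h1, h2⟩ := Int.exists_gcd_one hg
    exact ⟨a, b, Int.gcd y v, by exact_mod_cast hg, Int.isCoprime_iff_gcd_eq_one.2 hab, h1, h2⟩
  have p3 : Prime (3:ℤ) := Int.prime_three
  have hu1 : ¬ 3 ∣ u1 := fun h => hu3 (h.mul_right _)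
  have hy1 : ¬ 3 ∣ y1 := fun h => hy3 (h.mul_right _)
  have hv1 : 3 ∣ v1 := (p3.dvd_or_dvd hv3).resolve_right (fun h => hy3 (h.mul_left _))
  have huy : ¬ 3 ∣ u1 * y1 := fun h => (p3.dvd_or_dvd h).elim hu1 hy1
  have hprim := gam_primary huy (show (3:ℤ) ∣ -(v1 * x1) from (hv1.mul_right _).neg_right)
  obtain ⟨χ, hχ⟩ := exists_cubChar _ (gam (u1*y1) (-(v1*x1))) rfl hprim.1 hprim.2
  set γ := gam (u1*y1) (-(v1*x1)) with hγ
  set N := (x1*h1)^2 + n * (y1*h2)^2 with hNd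
  have hnorm : QuadraticAlgebra.norm γ = u1^2*y1^2 + 3 * v1^2*x1^2 := by rw [hγ, gam_norm]; ring
  have cu1v1 : IsCoprime u1 v1 := hcop.of_mul_left_left.of_mul_right_left
  have cx1y1 : IsCoprime x1 y1 := hxy.of_mul_left_left.of_mul_right_left
  have c3u : IsCoprime u1 3 := ((Int.isCoprime_iff_gcd_eq_one).2 (by
    have := (Int.prime_three.coprime_iff_not_dvd (n := u1)).2 hu1
    exact Int.isCoprime_iff_gcd_eq_one.1 this.symm))
  have cop_u : IsCoprime u1 (QuadraticAlgebra.norm γ) := by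
    rw [hnorm]
    have : IsCoprime u1 (3 * v1^2*x1^2) := (c3u.mul_right (cu1v1.pow_right)).mul_right (hxu.symm.pow_right)
    have h := IsCoprime.add_mul_left_right this (u1 * y1^2)
    have e : 3 * v1^2*x1^2 + u1 * (u1 * y1^2) = u1^2*y1^2 + 3 * v1^2*x1^2 := by ring
    rwa [e] at h
  have cop_x : IsCoprime x1 (QuadraticAlgebra.norm γ) := by
    rw [hnorm]
    have : IsCoprime x1 (u1^2*y1^2) := (hxu.pow_right).mul_right (cx1y1.pow_right)
    have h := IsCoprime.add_mul_left_right this (3 * v1^2 * x1)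
    have e : u1^2*y1^2 + x1 * (3 * v1^2 * x1) = u1^2*y1^2 + 3 * v1^2*x1^2 := by ring
    rwa [e] at h
  have ident : u1^2 * N = n * h2^2 * QuadraticAlgebra.norm γ + x1^2 * (κ * c^3) := by
    rw [hnorm, ← hN, hNd]; ring
  have hn0 : u1 ≠ 0 := by rintro rfl; simp at hu1
  have hx10 : x1 ≠ 0 := by rintro rfl; simp at hx0
  have hy10 : y1 ≠ 0 := by rintro rfl; simp at hy1
  have hNm0 : QuadraticAlgebra.norm γ ≠ 0 := by rw [hnorm]; positivity
  have cop_kc : IsCoprime (κ * c) (QuadraticAlgebra.norm γ) := by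
    refine isCoprime_of_prime_dvd (fun h => hNm0 h.2) ?_
    intro p hp hp1 hp2
    have h1 : p ∣ u1^2 * N := by
      rw [ident]
      refine dvd_add (hp2.mul_left _) (Dvd.dvd.mul_left ?_ _)
      exact hp1.trans ⟨c^2, by ring⟩
    rcases hp.dvd_or_dvd h1 with h | h
    · exact hp.not_isUnit (cop_u.isUnit_of_dvd' (hp.dvd_of_dvd_pow h) hp2)
    · exact hp.not_isUnit (hNb.isUnit_of_dvd' h (hp1.trans ⟨n, by ring⟩))
  have cop_N : ∀ q : ℕ, q.Prime → (q:ℤ) ∣ N → ¬ (q:ℤ) ∣ QuadraticAlgebra.norm γ := by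
    intro q hq hqN hqn
    have hp := Nat.prime_iff_prime_int.1 hq
    have h1 : (q:ℤ) ∣ x1^2 * (κ * c^3) := by
      have := dvd_sub (hqN.mul_left (u1^2)) (hqn.mul_left (n * h2^2))
      rw [ident] at this
      simpa using this
    rcases hp.dvd_or_dvd h1 with h | h
    · exact hp.not_isUnit (cop_x.isUnit_of_dvd' (hp.dvd_of_dvd_pow h) hqn)
    · have : (q:ℤ) ∣ κ * c := by
        rcases hp.dvd_or_dvd h with h | h
        · exact h.mul_right _
        · exact (hp.dvd_of_dvd_pow h).mul_left _
      exact hp.not_isUnit (cop_kc.isUnit_of_dvd' this hqn)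
  have hneg := chi_neg hχ
  have triv_u : ∀ q : ℕ, q.Prime → (q:ℤ) ∣ u1 → χ q = 1 := by
    intro q hq hqu
    haveI : Fact q.Prime := ⟨hq⟩
    have hp := Nat.prime_iff_prime_int.1 hq
    have hq3 : q ≠ 3 := by rintro rfl; exact hu1 hqu
    have hcq : IsCoprime (q:ℤ) (QuadraticAlgebra.norm γ) := cop_u.of_isCoprime_of_dvd_left hqu
    have hNq : ¬ (q:ℤ) ∣ QuadraticAlgebra.norm γ := fun h => hp.not_isUnit (hcq.isUnit_of_dvd' dvd_rfl h)
    obtain ⟨φ⟩ := exists_phi q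
    refine Rel.triv (φ := φ) (-1) (by ring) hq3 hNq (hχ.1 _ hcq) ?_ (hχ.2.2 q hq3 hNq _ φ)
    have e0 : φ (gam (u1*y1) (-(v1*x1))) = φ (gam 0 (-(v1*x1))) := hom_gam_congr φ (by simpa using hqu.mul_right y1) (by simp)
    have e1 : φ (gam (u1*y1) (v1*x1)) = φ (gam 0 (v1*x1)) := hom_gam_congr φ (by simpa using hqu.mul_right y1) (by simp)
    rw [hγ, gam_star, neg_neg, e0, e1, gam_eq, gam_eq]
    simp
  have triv_x : ∀ q : ℕ, q.Prime → (q:ℤ) ∣ x1 → χ q = 1 := by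
    intro q hq hqu
    haveI : Fact q.Prime := ⟨hq⟩
    have hp := Nat.prime_iff_prime_int.1 hq
    have hq3 : q ≠ 3 := by rintro rfl; exact hx3 (hqu.mul_right _)
    have hcq : IsCoprime (q:ℤ) (QuadraticAlgebra.norm γ) := cop_x.of_isCoprime_of_dvd_left hqu
    have hNq : ¬ (q:ℤ) ∣ QuadraticAlgebra.norm γ := fun h => hp.not_isUnit (hcq.isUnit_of_dvd' dvd_rfl h)
    obtain ⟨φ⟩ := exists_phi q
    refine Rel.triv (φ := φ) 1 (by ring) hq3 hNq (hχ.1 _ hcq) ?_ (hχ.2.2 q hq3 hNq _ φ)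
    have e0 : φ (gam (u1*y1) (-(v1*x1))) = φ (gam (u1*y1) 0) := hom_gam_congr φ (by simp) (by simpa using hqu.mul_left v1)
    have e1 : φ (gam (u1*y1) (v1*x1)) = φ (gam (u1*y1) 0) := hom_gam_congr φ (by simp) (by simpa using hqu.mul_left v1)
    rw [hγ, gam_star, neg_neg, e0, e1, one_mul]
  have hκc0 : κ * c^3 ≠ 0 := by
    intro h
    rw [h] at hN
    apply hu3
    have : (3:ℤ) ∣ (u1*h1)^2 := ⟨n * (v1*h2)^2, by linarith⟩
    exact p3.dvd_of_dvd_pow this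
  have cu : χ u1 = 1 := chi_int_one hn0 hneg triv_u
  have cx : χ x1 = 1 := chi_int_one hx10 hneg triv_x
  have ck : χ κ = 1 := by
    refine chi_int_one (left_ne_zero_of_mul hκc0) hneg ?_
    intro q hq hqk
    obtain ⟨a1, a2⟩ := hκ q hq hqk
    have hp := Nat.prime_iff_prime_int.1 hq
    apply triv_u q hq
    refine (hp.dvd_or_dvd a1).resolve_right ?_
    intro h
    refine hp.not_isUnit (hNb.isUnit_of_dvd' (x := (q:ℤ)) ?_ ((a2.mul_right _).mul_right _))
    exact dvd_add (dvd_pow (h.mul_left _) two_ne_zero) (a2.mul_right _)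
  have cc : χ c ^ 3 = 1 := hχ.1 _ (cop_kc.of_mul_left_right)
  refine ⟨h1 * h2, u1 * y1, v1 * x1, χ, by ring, by ring, ?_, cop_N, hχ, ?_⟩
  · intro q hq hqN hqh
    have hp := Nat.prime_iff_prime_int.1 hq
    have hqn : ¬ (q:ℤ) ∣ n := fun h => hp.not_isUnit (hNb.isUnit_of_dvd' hqN ((h.mul_right _).mul_right _))
    have key : (q:ℤ) ∣ x1*h1 ∧ (q:ℤ) ∣ y1*h2 := by
      rcases hp.dvd_or_dvd hqh with h | h
      · have h1 : (q:ℤ) ∣ x1 * h1 := h.mul_left _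
        refine ⟨h1, ?_⟩
        have h2 : (q:ℤ) ∣ n * (y1*h2)^2 := by
          have := dvd_sub hqN (dvd_pow h1 two_ne_zero)
          simpa [hNd] using this
        exact hp.dvd_of_dvd_pow ((hp.dvd_or_dvd h2).resolve_left hqn)
      · have h3 : (q:ℤ) ∣ y1 * h2 := h.mul_left _
        refine ⟨?_, h3⟩
        have h2 : (q:ℤ) ∣ (x1*h1)^2 := by
          have := dvd_sub hqN ((dvd_pow h3 two_ne_zero).mul_left n)
          simpa [hNd] using this
        exact hp.dvd_of_dvd_pow h2
    exact hp.not_isUnit (hxy.isUnit_of_dvd' key.1 key.2)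
  · have hd := hχ.2.1 (u1^2 * N) (x1^2 * (κ*c^3)) ?_
    · simpa [map_mul, map_pow, cu, cx, ck, cc] using hd
    · rw [ident, add_sub_cancel_right]
      push_cast
      rw [← mul_star_self]
      exact (dvd_mul_right _ _).mul_left _
end Eis
end

section
set_option linter.unusedSimpArgs false
set_option linter.unusedVariables false
set_option linter.unusedSectionVars false
set_option linter.style.haveILetI false
open scoped QuadraticAlgebra

namespace RR
variable {n : ℤ} [hn : GoodN n]

lemma absNorm_of {P : Ideal (RR n)} (hP : P.IsPrime) {q : ℕ} (hq : q.Prime) {w : ℤ} (h1 : (q : RR n) ∈ P)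
    (h2 : sq n - w ∈ P) : Ideal.absNorm P = q := by
  haveI : Fact q.Prime := ⟨hq⟩
  have h0 : ((q:ℕ) : RR n ⧸ P) = 0 := by
    have := Ideal.Quotient.eq_zero_iff_mem.2 h1
    simpa using this
  haveI : CharP (RR n ⧸ P) q := (CharP.charP_iff_prime_eq_zero hq).2 h0
  let f : ZMod q →+* RR n ⧸ P := ZMod.castHom dvd_rfl _
  have hb : Function.Bijective f := by
    refine ⟨f.injective, ?_⟩
    intro x
    obtain ⟨z, rfl⟩ := Ideal.Quotient.mk_surjective x
    refine ⟨((z.re + z.im * w : ℤ) : ZMod q), ?_⟩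
    rw [map_intCast]
    have e : (Ideal.Quotient.mk P) z = Ideal.Quotient.mk P (((z.re + z.im * w : ℤ) : RR n)) := by
      rw [Ideal.Quotient.mk_eq_mk_iff_sub_mem]
      have : z - ((z.re + z.im * w : ℤ) : RR n) = z.im * (sq n - w) := by
        have := eq_add_sq z
        push_cast
        linear_combination this
      rw [this]; exact P.mul_mem_left _ h2
    rw [e, map_intCast]
  rw [Ideal.absNorm_apply, Submodule.cardQuot_apply]
  have := Nat.card_congr (Equiv.ofBijective f hb)
  rw [Nat.card_zmod] at this
  exact this.symm

lemma int_dvd_of_mem {P : Ideal (RR n)} (hP : P.IsPrime) {q : ℕ} (hq : q.Prime) (h1 : (q : RR n) ∈ P) {m : ℤ}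
    (hm : (m : RR n) ∈ P) : (q:ℤ) ∣ m := by
  by_contra h
  exact int_mem_of_coprime hP (((Nat.prime_iff_prime_int.1 hq).coprime_iff_not_dvd).2 h) (by simpa using h1) hm

lemma prime_unique {P : Ideal (RR n)} (hP : P.IsPrime) {q q' : ℕ} (hq : q.Prime) (hq' : q'.Prime)
    (h1 : (q : RR n) ∈ P) (h2 : (q' : RR n) ∈ P) : q = q' := by
  have := int_dvd_of_mem hP hq h1 (m := q') (by simpa using h2)
  exact (Nat.prime_dvd_prime_iff_eq hq hq').1 (by exact_mod_cast this)
end RR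

/-- data attached to a point on the 3-isogenous curve. -/
structure PDat (n : ℤ) where
  u : ℤ
  v : ℤ
  κ : ℤ
  c : ℤ
  cop : IsCoprime u v
  u3 : ¬ 3 ∣ u
  v3 : 3 ∣ v
  nrm : u^2 - 3 * n * v^2 = κ * c^3
  hκ : ∀ q : ℕ, q.Prime → (q:ℤ) ∣ κ → (q:ℤ) ∣ u ∧ (q:ℤ) ∣ n

namespace PDat
open Eis RR
variable {n : ℤ} [hn : GoodN n] (d : PDat n)

def B : ℤ := 3 * (n * d.κ * d.c)

lemma kc_ne : d.κ * d.c^3 ≠ 0 := by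
  intro h
  have hN := d.nrm
  rw [h] at hN
  apply d.u3
  have : (3:ℤ) ∣ (d.u)^2 := ⟨n * (d.v)^2, by linarith⟩
  exact Int.prime_three.dvd_of_dvd_pow this

lemma B_ne : d.B ≠ 0 := by
  have h1 := d.kc_ne
  have h2 := hn.gt
  unfold B
  have : d.κ ≠ 0 := left_ne_zero_of_mul h1
  have : d.c ≠ 0 := by intro h; rw [h] at h1; simp at h1
  have : n ≠ 0 := by omega
  positivity

def IsTau (P : Ideal (RR n)) (ζ : Eis) : Prop :=
  ∃ (q : ℕ) (w : ℤ), q.Prime ∧ (q : RR n) ∈ P ∧ RR.sq n - w ∈ P ∧ ¬ (q:ℤ) ∣ d.B ∧ ζ^3 = 1 ∧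
    ∀ [Fact q.Prime] (F : Type) [Field F] [IsAlgClosed F] [CharP F q] (φ : Eis →+* F), Rel q φ ζ (gam d.u (d.v * w))

lemma w_sq {P : Ideal (RR n)} (hP : P.IsPrime) {q : ℕ} (hq : q.Prime) (h1 : (q : RR n) ∈ P) {w : ℤ}
    (h2 : RR.sq n - w ∈ P) : (q:ℤ) ∣ w^2 + n := by
  apply int_dvd_of_mem hP hq h1
  have : ((w^2 + n : ℤ) : RR n) = - ((RR.sq n - w) * (RR.sq n + w)) := by
    have := RR.sq_sq (n := n)
    push_cast at this ⊢
    linear_combination this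
  rw [this]
  exact P.neg_mem (P.mul_mem_right _ h2)

lemma q_norm {q : ℕ} (hq : q.Prime) {w : ℤ} (hw : (q:ℤ) ∣ w^2 + n) (hB : ¬ (q:ℤ) ∣ d.B) :
    q ≠ 3 ∧ ¬ (q:ℤ) ∣ QuadraticAlgebra.norm (gam d.u (d.v * w)) := by
  have hp := Nat.prime_iff_prime_int.1 hq
  refine ⟨?_, ?_⟩
  · rintro rfl; apply hB; exact dvd_mul_right _ _
  · rw [gam_norm]
    intro h
    have h1 : (q:ℤ) ∣ d.κ * d.c^3 := by
      rw [← d.nrm]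
      have := dvd_sub h (hw.mul_left (3 * d.v^2))
      have e : d.u ^ 2 + 3 * (d.v * w) ^ 2 - 3 * d.v ^ 2 * (w ^ 2 + n) = d.u ^ 2 - 3 * n * d.v ^ 2 := by ring
      rwa [e] at this
    apply hB
    unfold B
    rcases hp.dvd_or_dvd h1 with h | h
    · exact ((h.mul_left n).mul_right _).mul_left _
    · exact ((hp.dvd_of_dvd_pow h).mul_left _).mul_left _

lemma exists_isTau {P : Ideal (RR n)} (hP : P.IsPrime) {q : ℕ} (hq : q.Prime) (h1 : (q : RR n) ∈ P) {w : ℤ}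
    (h2 : RR.sq n - w ∈ P) (hB : ¬ (q:ℤ) ∣ d.B) : ∃ ζ, d.IsTau P ζ := by
  have hw := w_sq hP hq h1 h2
  obtain ⟨h3, hN⟩ := d.q_norm hq hw hB
  have hprim := gam_primary d.u3 (d.v3.mul_right w)
  obtain ⟨χ, hχ⟩ := exists_cubChar _ (gam d.u (d.v * w)) rfl hprim.1 hprim.2
  refine ⟨χ q, q, w, hq, h1, h2, hB, hχ.1 _ ?_, ?_⟩
  · exact ((Nat.prime_iff_prime_int.1 hq).coprime_iff_not_dvd).2 hN
  · intro _ F _ _ _ φ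
    exact hχ.2.2 q h3 hN F φ

/-- key uniqueness -/
lemma isTau_unique {P : Ideal (RR n)} (hP : P.IsPrime) {ζ ζ' : Eis} (h : d.IsTau P ζ) (h' : d.IsTau P ζ') : ζ = ζ' := by
  obtain ⟨q, w, hq, h1, h2, hB, hz, hR⟩ := h
  obtain ⟨q', w', hq', h1', h2', hB', hz', hR'⟩ := h'
  obtain rfl := prime_unique hP hq hq' h1 h1'
  have hww : (q:ℤ) ∣ w' - w := by
    apply int_dvd_of_mem hP hq h1
    have := P.sub_mem h2 h2'
    convert this using 1
    push_cast; ring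
  obtain ⟨h3, hN⟩ := d.q_norm hq (w_sq hP hq h1 h2) hB
  haveI : Fact q.Prime := ⟨hq⟩
  obtain ⟨φ⟩ := exists_phi q
  refine Rel.unique (φ := φ) h3 hN hz hz' (hR _ φ) ((hR' _ φ).congr ?_ ?_)
  · apply hom_gam_congr φ (by simp)
    rw [← mul_sub]; exact hww.mul_left _
  · rw [gam_star, gam_star]
    apply hom_gam_congr φ (by simp)
    have : -(d.v * w') - -(d.v*w) = - (d.v * (w' - w)) := by ring
    rw [this]; exact (hww.mul_left _).neg_right

open Classical in
noncomputable def tau (P : Ideal (RR n)) : Eis := if h : ∃ ζ, d.IsTau P ζ then h.choose else 1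

lemma tau_eq {P : Ideal (RR n)} (hP : P.IsPrime) {ζ : Eis} (h : d.IsTau P ζ) : d.tau P = ζ := by
  have h' : ∃ ζ, d.IsTau P ζ := ⟨ζ, h⟩
  rw [tau, dif_pos h']
  exact d.isTau_unique hP h'.choose_spec h

lemma tau_cube (P : Ideal (RR n)) : d.tau P ^ 3 = 1 := by
  unfold tau
  split_ifs with h
  · obtain ⟨q, w, _, _, _, _, hz, _⟩ := h.choose_spec
    exact hz
  · simp

def cj : RR n ≃+* RR n := RingEquiv.ofRingHom (starRingEnd (RR n)) (starRingEnd (RR n)) (by ext <;> simp) (by ext <;> simp)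

lemma cj_apply (z : RR n) : cj z = star z := rfl
lemma mem_cj {P : Ideal (RR n)} {z : RR n} : z ∈ P.map cj ↔ star z ∈ P := by
  have := Ideal.mem_map_of_equiv (cj (n := n)) (I := P) z
  rw [this]
  constructor
  · rintro ⟨x, hx, rfl⟩
    rw [cj_apply, star_star]; exact hx
  · intro h
    exact ⟨star z, h, by rw [cj_apply, star_star]⟩

lemma star_sq : star (RR.sq n) = - RR.sq n := by ext <;> simp [RR.sq]

lemma isTau_cj {P : Ideal (RR n)} {ζ : Eis} (h : d.IsTau P ζ) : d.IsTau (P.map cj) (star ζ) := by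
  obtain ⟨q, w, hq, h1, h2, hB, hz, hR⟩ := h
  refine ⟨q, -w, hq, ?_, ?_, hB, ?_, ?_⟩
  · rw [mem_cj]; simpa using h1
  · rw [mem_cj, star_sub, star_sq]
    have := P.neg_mem h2
    convert this using 1
    simp; ring
  · rw [← star_pow, hz, star_one]
  · intro _ F _ _ _ φ
    have := (hR F φ).star hz
    rwa [gam_star, ← mul_neg] at this

lemma cj_cj (P : Ideal (RR n)) : (P.map cj).map cj = P := by
  ext z; rw [mem_cj, mem_cj, star_star]

lemma tau_cj {P : Ideal (RR n)} (hP : P.IsPrime) : d.tau (P.map cj) = star (d.tau P) := by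
  by_cases h : ∃ ζ, d.IsTau P ζ
  · obtain ⟨ζ, hζ⟩ := h
    rw [d.tau_eq hP hζ, d.tau_eq (Ideal.map_isPrime_of_equiv cj) (d.isTau_cj hζ)]
  · have h' : ¬ ∃ ζ, d.IsTau (P.map cj) ζ := by
      rintro ⟨ζ, hζ⟩
      have := d.isTau_cj hζ
      rw [cj_cj] at this
      exact h ⟨_, this⟩
    rw [tau, dif_neg h', tau, dif_neg h, star_one]

open UniqueFactorizationMonoid in
noncomputable def tt (I : Ideal (RR n)) : Eis := ((normalizedFactors I).map d.tau).prod

open UniqueFactorizationMonoid in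
lemma tt_mul {I J : Ideal (RR n)} (hI : I ≠ ⊥) (hJ : J ≠ ⊥) : d.tt (I * J) = d.tt I * d.tt J := by
  rw [tt, normalizedFactors_mul hI hJ, Multiset.map_add, Multiset.prod_add]; rfl

lemma tt_one : d.tt (1 : Ideal (RR n)) = 1 := by simp [tt, -Ideal.one_eq_top]

lemma tt_cube (I : Ideal (RR n)) : d.tt I ^ 3 = 1 := by
  rw [tt, ← Multiset.prod_map_pow]
  apply Multiset.prod_eq_one
  intro x hx
  rw [Multiset.mem_map] at hx
  obtain ⟨P, _, rfl⟩ := hx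
  exact d.tau_cube P

open UniqueFactorizationMonoid in
lemma tt_cj {I : Ideal (RR n)} (hI : I ≠ ⊥) : d.tt (I.map cj) = star (d.tt I) := by
  have h1 : I.map cj = ((normalizedFactors I).map (Ideal.map (cj (n := n)))).prod := by
    conv_lhs => rw [← Ideal.prod_normalizedFactors_eq_self hI]
    have := map_multiset_prod (Ideal.mapHom (cj (n := n))) (normalizedFactors I)
    exact this
  have h2 : normalizedFactors (I.map cj) = (normalizedFactors I).map (Ideal.map (cj (n := n))) := by
    rw [h1]
    apply normalizedFactors_prod_of_prime
    intro P hP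
    rw [Multiset.mem_map] at hP
    obtain ⟨Q, hQ, rfl⟩ := hP
    have hQp := prime_of_normalized_factor Q hQ
    haveI := Ideal.isPrime_of_prime hQp
    refine (Ideal.prime_iff_isPrime ?_).2 (Ideal.map_isPrime_of_equiv cj)
    intro h
    have := congrArg (Ideal.map (cj (n := n))) h
    rw [cj_cj, Ideal.map_bot] at this
    exact hQp.ne_zero this
  rw [tt, h2, Multiset.map_map, tt]
  have := map_multiset_prod (starRingEnd Eis) ((normalizedFactors I).map d.tau)
  rw [starRingEnd_apply] at this
  rw [this, Multiset.map_map]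
  congr 1
  apply Multiset.map_congr rfl
  intro P hP
  haveI := Ideal.isPrime_of_prime (prime_of_normalized_factor P hP)
  exact d.tau_cj this

lemma tt_int {k : ℤ} (hk : k ≠ 0) : d.tt (Ideal.span {(k : RR n)}) = 1 := by
  have h0 : Ideal.span {(k : RR n)} ≠ ⊥ := by
    rw [Ne, Ideal.span_singleton_eq_bot]; exact_mod_cast hk
  have h1 := d.tt_cj h0
  rw [Ideal.map_span, Set.image_singleton, cj_apply, star_intCast] at h1
  have h3 := d.tt_cube (Ideal.span {(k : RR n)})
  rw [star_of_cube h3] at h1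
  rcases cube_one_cases h3 with h | h | h
  · exact h
  · rw [h] at h1
    have := congrArg QuadraticAlgebra.re h1
    simp [om, pow_two] at this
  · rw [h] at h1
    have := congrArg QuadraticAlgebra.re h1
    simp [om, pow_two] at this
end PDat
end

section
set_option linter.unusedSimpArgs false
set_option linter.unusedVariables false
set_option linter.unusedSectionVars false
set_option linter.style.haveILetI false
open scoped QuadraticAlgebra

namespace RR
variable {n : ℤ} [hn : GoodN n]
lemma exists_prime_mem {P : Ideal (RR n)} (hP : P.IsPrime) : ∀ m : ℕ, m ≠ 0 → (m : RR n) ∈ P →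
    ∃ q : ℕ, q.Prime ∧ q ∣ m ∧ (q : RR n) ∈ P := by
  intro m
  induction m using induction_on_primes with
  | zero => intro h; exact absurd rfl h
  | one => intro _ h; exact absurd ((Ideal.eq_top_iff_one _).2 (by simpa using h)) hP.ne_top
  | prime_mul p a hp ih =>
    intro h0 h
    push_cast at h
    rcases hP.mem_or_mem h with h | h
    · exact ⟨p, hp, dvd_mul_right _ _, h⟩
    · obtain ⟨q, hq, hqa, hqP⟩ := ih (right_ne_zero_of_mul h0) h
      exact ⟨q, hq, hqa.mul_left _, hqP⟩
end RR

namespace PDat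
open Eis RR
variable {n : ℤ} [hn : GoodN n] (d : PDat n)

open UniqueFactorizationMonoid in
theorem tt_prim {x y : ℤ} (hxy : IsCoprime x y) (hx3 : ¬ 3 ∣ x) (hy3 : ¬ 3 ∣ y)
    (hNb : IsCoprime (x^2 + n*y^2) d.B) : d.tt (Ideal.span {(⟨x, y⟩ : RR n)}) = 1 := by
  obtain ⟨h, u1, v1, χ, e1, e2, hqh, hqN, hχ, hχN⟩ := chi_N (n := n) d.cop d.u3 d.v3 d.nrm d.hκ hxy hx3 hy3
    (hNb.of_mul_right_right)
  set z : RR n := ⟨x, y⟩ with hz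
  have hzN : QuadraticAlgebra.norm z = x^2 + n * y^2 := by rw [RR.norm_formula]
  have hz0 : z ≠ 0 := by
    intro h0
    have := congrArg QuadraticAlgebra.re h0
    simp [hz] at this
    rw [this] at hx3
    simp at hx3
  have hI0 : Ideal.span {z} ≠ ⊥ := by rwa [Ne, Ideal.span_singleton_eq_bot]
  have hNpos : 0 < x^2 + n * y^2 := by
    have h0 : x ≠ 0 := by rintro rfl; simp at hx3
    have := hn.gt
    positivity
  have key : ∀ P ∈ normalizedFactors (Ideal.span {z}), d.tau P = χ (Ideal.absNorm P : ℤ) := by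
    intro P hP
    have hPp := Ideal.isPrime_of_prime (prime_of_normalized_factor P hP)
    have hzP : z ∈ P := (Ideal.dvd_span_singleton).1 (dvd_of_mem_normalizedFactors hP)
    have hNP : ((x^2 + n*y^2 : ℤ) : RR n) ∈ P := by
      rw [← hzN, ← RR.mul_star_self]
      exact P.mul_mem_right _ hzP
    obtain ⟨q, hq, hqd, hqP⟩ := exists_prime_mem hPp (x^2 + n*y^2).natAbs (by omega) (by
      have : (((x^2 + n*y^2).natAbs : ℤ) : RR n) ∈ P := by
        rw [Int.natAbs_of_nonneg hNpos.le]; exact hNP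
      simpa using this)
    have hqd' : (q:ℤ) ∣ x^2 + n*y^2 := Int.natCast_dvd.2 hqd
    have hp := Nat.prime_iff_prime_int.1 hq
    have hqB : ¬ (q:ℤ) ∣ d.B := fun h => hp.not_isUnit (hNb.isUnit_of_dvd' hqd' h)
    have hqy : ¬ (q:ℤ) ∣ y := by
      intro hy
      have : (q:ℤ) ∣ x^2 := by
        have := dvd_sub hqd' ((dvd_pow hy two_ne_zero).mul_left n)
        simpa using this
      exact hp.not_isUnit (hxy.isUnit_of_dvd' (hp.dvd_of_dvd_pow this) hy)
    obtain ⟨b, a, hab⟩ := (hp.coprime_iff_not_dvd).2 hqy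
    haveI : Fact q.Prime := ⟨hq⟩
    have hw : RR.sq n - ((-(x * a) : ℤ) : RR n) ∈ P := by
      have e : RR.sq n - ((-(x * a) : ℤ) : RR n) = a * z + b * RR.sq n * q := by
        have h1 := eq_add_sq z
        have h2 : ((b:ℤ) : RR n) * q + a * y = 1 := by exact_mod_cast hab
        simp only [hz] at h1
        rw [hz]
        push_cast
        rw [h1]
        linear_combination -(RR.sq n) * h2
      rw [e]
      exact P.add_mem (P.mul_mem_left _ hzP) (P.mul_mem_left _ hqP)
    have hq3 := (d.q_norm hq (w_sq hPp hq hqP hw) hqB).1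
    rw [absNorm_of hPp hq hqP hw]
    apply d.tau_eq hPp
    refine ⟨q, _, hq, hqP, hw, hqB, hχ.1 _ ((hp.coprime_iff_not_dvd).2 (hqN q hq hqd')), ?_⟩
    intro _ F _ _ _ φ
    have hR := (Rel.int q φ (a * h)).mul (hχ.2.2 q hq3 (hqN q hq hqd') F φ)
    rw [one_mul, gam_mul_int] at hR
    have c1 : (q:ℤ) ∣ a * h * u1 - d.u := by
      have : a * h * u1 - d.u = - (q * (b * d.u)) := by
        linear_combination -a * e1 + d.u * hab
      rw [this]; exact (dvd_mul_right _ _).neg_right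
    have c2 : a * h * -v1 = d.v * -(x*a) := by linear_combination a * e2
    refine hR.congr ?_ ?_
    · exact hom_gam_congr φ c1 (by rw [c2]; simp)
    · rw [gam_star, gam_star]
      exact hom_gam_congr φ c1 (by rw [c2]; simp)
  rw [tt, Multiset.map_congr rfl key]
  have h1 : ((normalizedFactors (Ideal.span {z})).map (fun P => χ (Ideal.absNorm P : ℤ))).prod
      = χ ((Ideal.absNorm (Ideal.span {z}) : ℕ) : ℤ) := by
    conv_rhs => rw [← Ideal.prod_normalizedFactors_eq_self hI0, map_multiset_prod]
    rw [Nat.cast_multiset_prod, map_multiset_prod, Multiset.map_map, Multiset.map_map]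
    rfl
  rw [h1, RR.natAbs_norm, hzN, Int.natAbs_of_nonneg hNpos.le, hχN]

/-- `B` without factors of three -/
lemma exists_M (B : ℤ) (hB : B ≠ 0) : ∃ M : ℤ, M % 3 = 1 ∧ ∀ p : ℤ, Prime p → p ∣ B → p ∣ 3 ∨ p ∣ M := by
  obtain ⟨M, h0, hM⟩ := (Int.finiteMultiplicity_iff.2 ⟨by norm_num, hB⟩ : FiniteMultiplicity (3:ℤ) B).exists_eq_pow_mul_and_not_dvd
  rw [h0]
  refine ⟨M * M, ?_, ?_⟩
  · rw [Int.mul_emod]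
    have : M % 3 = 1 ∨ M % 3 = 2 := by omega
    rcases this with h | h <;> rw [h] <;> norm_num
  · intro p hp h
    rcases hp.dvd_or_dvd h with h | h
    · exact Or.inl (hp.dvd_of_dvd_pow h)
    · exact Or.inr (h.mul_right _)

/-- primitive part -/
theorem tt_elt3 {x y : ℤ} (hx3 : ¬ 3 ∣ x) (hy3 : ¬ 3 ∣ y)
    (hNb : IsCoprime (x^2 + n*y^2) d.B) : d.tt (Ideal.span {(⟨x, y⟩ : RR n)}) = 1 := by
  have hx0 : x ≠ 0 := by rintro rfl; simp at hx3
  have hg : 0 < Int.gcd x y := Int.gcd_pos_of_ne_zero_left _ hx0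
  obtain ⟨x1, y1, hc, h1, h2⟩ := Int.exists_gcd_one hg
  set k : ℤ := (Int.gcd x y : ℤ) with hk
  have hk0 : k ≠ 0 := by omega
  rw [h1] at hx3 hNb
  rw [h2] at hy3 hNb
  have e : (⟨x, y⟩ : RR n) = ((k : ℤ) : RR n) * ⟨x1, y1⟩ := by
    rw [h1, h2]
    ext <;> simp <;> ring
  have hx1 : ¬ 3 ∣ x1 := fun h => hx3 (h.mul_right _)
  have hy1 : ¬ 3 ∣ y1 := fun h => hy3 (h.mul_right _)
  have hx10 : x1 ≠ 0 := by rintro rfl; simp at hx1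
  rw [e, ← Ideal.span_singleton_mul_span_singleton, d.tt_mul, d.tt_int hk0, one_mul]
  · apply d.tt_prim (Int.isCoprime_iff_gcd_eq_one.2 hc) hx1 hy1
    have : (x1 * k)^2 + n * (y1*k)^2 = k^2 * (x1^2 + n*y1^2) := by ring
    rw [this] at hNb
    exact hNb.of_mul_left_right
  · rw [Ne, Ideal.span_singleton_eq_bot]; exact_mod_cast hk0
  · rw [Ne, Ideal.span_singleton_eq_bot]
    intro h
    exact hx10 (congrArg QuadraticAlgebra.re h)

theorem tt_elt (hn3 : n % 3 = 1) {z : RR n} (hNb : IsCoprime (QuadraticAlgebra.norm z) d.B) :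
    d.tt (Ideal.span {z}) = 1 := by
  by_cases h : (¬ 3 ∣ z.re) ∧ (¬ 3 ∣ z.im)
  · rw [RR.norm_formula] at hNb
    exact d.tt_elt3 h.1 h.2 hNb
  · have hz3 : ¬ (3 ∣ z.re ∧ 3 ∣ z.im) := by
      rintro ⟨h1, h2⟩
      refine Int.prime_three.not_isUnit (hNb.isUnit_of_dvd' ?_ (show (3:ℤ) ∣ d.B from dvd_mul_right _ _))
      rw [RR.norm_formula]
      exact dvd_add (dvd_pow h1 two_ne_zero) ((dvd_pow h2 two_ne_zero).mul_left _)
    obtain ⟨M, hM3, hM⟩ := exists_M d.B d.B_ne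
    have hδ : IsCoprime ((1:ℤ)^2 + n * M^2) d.B := by
      refine isCoprime_of_prime_dvd (fun h => d.B_ne h.2) ?_
      intro p hp h1 h2
      rcases hM p hp h2 with h3 | h3
      · have : (3:ℤ) ∣ 1^2 + n*M^2 := by
          have : Associated p 3 := (hp.dvd_prime_iff_associated Int.prime_three).1 h3
          exact this.dvd'.trans h1
        obtain ⟨m, hm⟩ : ∃ m, M = 3 * m + 1 := ⟨M/3, by omega⟩
        obtain ⟨l, hl⟩ : ∃ l, n = 3 * l + 1 := ⟨n/3, by omega⟩
        rw [hm, hl] at this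
        have e : (1:ℤ)^2 + (3*l+1) * (3*m+1)^2 = 3 * (l * (3*m+1)^2 + 3 * m^2 + 2*m) + 2 := by ring
        omega
      · have : p ∣ 1 := by
          have := dvd_sub h1 ((dvd_pow h3 two_ne_zero).mul_left n)
          simpa using this
        exact hp.not_isUnit (isUnit_of_dvd_one this)
    have hδ1 : d.tt (Ideal.span {(⟨1, M⟩ : RR n)}) = 1 := d.tt_elt3 (by norm_num) (by omega) hδ
    have hδ0 : Ideal.span {(⟨1, M⟩ : RR n)} ≠ ⊥ := by
      rw [Ne, Ideal.span_singleton_eq_bot]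
      intro h
      have := congrArg QuadraticAlgebra.re h
      simp at this
    have hz0 : Ideal.span {z} ≠ ⊥ := by
      rw [Ne, Ideal.span_singleton_eq_bot]
      rintro rfl
      simp at hz3
    have hmul := d.tt_mul hz0 hδ0
    rw [hδ1, mul_one, Ideal.span_singleton_mul_span_singleton] at hmul
    rw [← hmul]
    have e : z * (⟨1, M⟩ : RR n) = ⟨z.re - n * (z.im * M), z.re * M + z.im⟩ := by
      ext <;> simp <;> ring
    have hcop : IsCoprime (QuadraticAlgebra.norm (z * (⟨1, M⟩ : RR n))) d.B := by
      rw [map_mul]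
      refine hNb.mul_left ?_
      rw [RR.norm_formula]; exact hδ
    rw [RR.norm_formula, e] at hcop
    rw [e]
    obtain ⟨m, hm⟩ : ∃ m, M = 3 * m + 1 := ⟨M/3, by omega⟩
    obtain ⟨l, hl⟩ : ∃ l, n = 3 * l + 1 := ⟨n/3, by omega⟩
    refine d.tt_elt3 ?_ ?_ hcop
    · have : z.re - n * (z.im * M) = z.re - z.im - 3 * (l * z.im * M + z.im * m) := by
        linear_combination -z.im * M * hl - z.im * hm
      omega
    · have : z.re * M + z.im = z.re + z.im + 3 * (z.re * m) := by rw [hm]; ring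
      omega
end PDat
end

section
set_option linter.unusedSimpArgs false
set_option linter.unusedVariables false
set_option linter.unusedSectionVars false
set_option linter.style.haveILetI false
open scoped QuadraticAlgebra nonZeroDivisors

namespace RR
variable {n : ℤ} [hn : GoodN n]

lemma absNorm_int (m : ℤ) : Ideal.absNorm (Ideal.span {(m : RR n)}) = m.natAbs^2 := by
  rw [natAbs_norm, norm_formula]
  simp [Int.natAbs_pow]

open UniqueFactorizationMonoid in
lemma prime_of_dvd_absNorm {I : Ideal (RR n)} (hI : I ≠ ⊥) {p : ℕ} (hp : p.Prime) (h : p ∣ Ideal.absNorm I) :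
    ∃ P : Ideal (RR n), P.IsPrime ∧ I ≤ P ∧ (p : RR n) ∈ P := by
  rw [← Ideal.prod_normalizedFactors_eq_self hI, map_multiset_prod] at h
  obtain ⟨a, ha, hpa⟩ := (Nat.prime_iff.1 hp).exists_mem_multiset_dvd h
  rw [Multiset.mem_map] at ha
  obtain ⟨P, hP, rfl⟩ := ha
  have hPp := prime_of_normalized_factor P hP
  have hPi := Ideal.isPrime_of_prime hPp
  refine ⟨P, hPi, Ideal.dvd_iff_le.1 (dvd_of_mem_normalizedFactors hP), ?_⟩
  have h0 : Ideal.absNorm P ≠ 0 := by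
    rw [Ne, Ideal.absNorm_eq_zero_iff]; exact hPp.ne_zero
  obtain ⟨q, hq, hqd, hqP⟩ := exists_prime_mem hPi (Ideal.absNorm P) h0 (Ideal.absNorm_mem P)
  have h1 : Ideal.absNorm P ∣ q^2 := by
    have := Ideal.absNorm_dvd_absNorm_of_le ((Ideal.span_singleton_le_iff_mem P).2 (show ((q:ℤ) : RR n) ∈ P by simpa using hqP))
    rw [absNorm_int] at this
    simpa using this
  have : p = q := (Nat.prime_dvd_prime_iff_eq hp hq).1 (hp.dvd_of_dvd_pow (hpa.trans h1))
  rw [this]; exact hqP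

theorem exists_coprime_ideal {B : ℤ} (hB : B ≠ 0) (hB1 : ¬ IsUnit B) (c : ClassGroup (RR n)) :
    ∃ I : (Ideal (RR n))⁰, ClassGroup.mk0 I = c ∧ IsCoprime ((Ideal.absNorm (I : Ideal (RR n)) : ℕ) : ℤ) B := by
  obtain ⟨J, hJ⟩ := ClassGroup.mk0_surjective c⁻¹
  have hJ0 : (J : Ideal (RR n)) ≠ 0 := nonZeroDivisors.coe_ne_zero J
  have hB0 : Ideal.span {(B : RR n)} ≠ 0 := by
    rw [Ideal.zero_eq_bot, Ne, Ideal.span_singleton_eq_bot]; exact_mod_cast hB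
  obtain ⟨a, ha⟩ := IsDedekindDomain.exists_sup_span_eq (I := (J : Ideal (RR n)) * Ideal.span {(B : RR n)}) (J := (J : Ideal (RR n))) Ideal.mul_le_left (mul_ne_zero hJ0 hB0)
  have ha1 : (J : Ideal (RR n)) ∣ Ideal.span {a} := by
    rw [Ideal.dvd_iff_le]; conv_rhs => rw [← ha]
    exact le_sup_right
  obtain ⟨A', hA'⟩ := ha1
  have htop : Ideal.span {(B : RR n)} ⊔ A' = ⊤ := by
    rw [hA', ← Ideal.mul_sup] at ha
    have : (J : Ideal (RR n)) * (Ideal.span {(B : RR n)} ⊔ A') = J * ⊤ := by rw [ha, Ideal.mul_top]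
    exact mul_left_cancel₀ hJ0 this
  have hA0 : A' ≠ 0 := by
    rintro rfl
    rw [Ideal.zero_eq_bot, sup_bot_eq] at htop
    have := congrArg Ideal.absNorm htop
    rw [absNorm_int, Ideal.absNorm_top] at this
    have h1 : B.natAbs = 1 := by simpa using this
    exact hB1 (Int.isUnit_iff_natAbs_eq.2 h1)
  have ha0 : a ≠ 0 := by
    rintro rfl
    rw [Ideal.span_singleton_eq_bot.2 rfl, ← Ideal.zero_eq_bot, eq_comm, mul_eq_zero] at hA'
    exact hA'.elim hJ0 hA0
  refine ⟨⟨A', mem_nonZeroDivisors_of_ne_zero hA0⟩, ?_, ?_⟩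
  · rw [← inv_inv c, ← hJ, ClassGroup.mk0_eq_mk0_inv_iff]
    exact ⟨a, ha0, by rw [hA', mul_comm]⟩
  · refine isCoprime_of_prime_dvd (fun h => hB h.2) ?_
    intro p hp h1 h2
    have hpn : p.natAbs.Prime := Int.prime_iff_natAbs_prime.1 hp
    obtain ⟨P, hP, hAP, hpP⟩ := prime_of_dvd_absNorm (n := n) (I := A') hA0 hpn (by
      exact Int.natAbs_dvd_natAbs.2 h1)
    apply hP.ne_top
    rw [eq_top_iff, ← htop, sup_le_iff]
    refine ⟨?_, hAP⟩
    rw [Ideal.span_singleton_le_iff_mem]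
    obtain ⟨r, hr⟩ := Int.natAbs_dvd.2 h2
    rw [hr]
    push_cast
    apply P.mul_mem_right
    rw [Int.abs_eq_natAbs]; push_cast; simpa using hpP
end RR

namespace PDat
open Eis RR
variable {n : ℤ} [hn : GoodN n] (d : PDat n)

lemma B_nu : ¬ IsUnit d.B := fun h => Int.prime_three.not_isUnit (isUnit_of_dvd_unit (dvd_mul_right _ _) h)

theorem tt_class (hn3 : n % 3 = 1) {I J : (Ideal (RR n))⁰} (h : ClassGroup.mk0 I = ClassGroup.mk0 J)
    (hI : IsCoprime ((Ideal.absNorm (I : Ideal (RR n)) : ℕ) : ℤ) d.B)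
    (hJ : IsCoprime ((Ideal.absNorm (J : Ideal (RR n)) : ℕ) : ℤ) d.B) : d.tt I = d.tt J := by
  obtain ⟨K, hK, hKB⟩ := exists_coprime_ideal d.B_ne d.B_nu (ClassGroup.mk0 I)⁻¹
  have key : ∀ L : (Ideal (RR n))⁰, ClassGroup.mk0 K = (ClassGroup.mk0 L)⁻¹ →
     IsCoprime ((Ideal.absNorm (L : Ideal (RR n)) : ℕ) : ℤ) d.B → d.tt K * d.tt L = 1 := by
    intro L hL hLB
    rw [ClassGroup.mk0_eq_mk0_inv_iff] at hL
    obtain ⟨x, hx, hx2⟩ := hL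
    rw [← d.tt_mul (nonZeroDivisors.coe_ne_zero K) (nonZeroDivisors.coe_ne_zero L), hx2]
    apply d.tt_elt hn3
    have := congrArg Ideal.absNorm hx2
    rw [map_mul, natAbs_norm] at this
    rw [← Int.natAbs_of_nonneg (RR.norm_nonneg x), ← this]
    push_cast
    exact hKB.mul_left hLB
  have h1 := key I hK hI
  have h2 := key J (by rw [hK, h]) hJ
  have : d.tt K ≠ 0 := left_ne_zero_of_mul (by rw [h1]; exact one_ne_zero)
  exact mul_left_cancel₀ this (h1.trans h2.symm)

theorem exists_hom (hn3 : n % 3 = 1) : ∃ f : ClassGroup (RR n) →* Eis, (∀ c, f c ^3 = 1) ∧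
    ∀ I : (Ideal (RR n))⁰, IsCoprime ((Ideal.absNorm (I : Ideal (RR n)) : ℕ) : ℤ) d.B → f (ClassGroup.mk0 I) = d.tt I := by
  choose J hJ hJB using fun c => exists_coprime_ideal (n := n) d.B_ne d.B_nu c
  have key : ∀ I : (Ideal (RR n))⁰, IsCoprime ((Ideal.absNorm (I : Ideal (RR n)) : ℕ) : ℤ) d.B →
      d.tt (J (ClassGroup.mk0 I)) = d.tt I := fun I hI => d.tt_class hn3 (hJ _) (hJB _) hI
  refine ⟨{ toFun := fun c => d.tt (J c), map_one' := ?_, map_mul' := ?_ }, fun c => d.tt_cube _, key⟩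
  · have := key 1 (by simpa using isCoprime_one_left)
    rw [map_one] at this
    rw [this]
    exact d.tt_one
  · intro x y
    have := key (J x * J y) (by
      rw [Submonoid.coe_mul, map_mul]; push_cast; exact (hJB x).mul_left (hJB y))
    rw [map_mul, hJ, hJ] at this
    rw [this, Submonoid.coe_mul, d.tt_mul (nonZeroDivisors.coe_ne_zero _) (nonZeroDivisors.coe_ne_zero _)]

end PDat

/-- The ideal `(q, √-n - w)`. -/
def idQ (n : ℤ) (q : ℕ) (w : ℤ) : Ideal (RR n) := Ideal.span {(q : RR n), RR.sq n - w}

namespace RR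
variable {n : ℤ} [hn : GoodN n]
lemma mem_idQ_im {q : ℕ} {w : ℤ} (hw : (q:ℤ) ∣ w^2 + n) {z : RR n} (hz : z ∈ idQ n q w) : (q:ℤ) ∣ z.re + z.im * w := by
  rw [idQ, Ideal.mem_span_pair] at hz
  obtain ⟨a, b, rfl⟩ := hz
  obtain ⟨k, hk⟩ := hw
  refine ⟨a.re + a.im * w - b.im * k, ?_⟩
  simp [RR.sq]
  linear_combination -b.im * hk

lemma idQ_prime {q : ℕ} (hq : q.Prime) {w : ℤ} (hw : (q:ℤ) ∣ w^2 + n) : (idQ n q w).IsPrime := by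
  constructor
  · intro h
    have h1 : (1 : RR n) ∈ idQ n q w := by rw [h]; trivial
    have := mem_idQ_im hw h1
    simp at this
    have := Int.natAbs_dvd_natAbs.2 this
    simp at this
    exact hq.one_lt.ne' this
  · intro x y hxy
    have h := mem_idQ_im hw hxy
    have hmem : ∀ z : RR n, (q:ℤ) ∣ z.re + z.im * w → z ∈ idQ n q w := by
      intro z hz
      obtain ⟨k, hk⟩ := hz
      rw [idQ, Ideal.mem_span_pair]
      refine ⟨(k : RR n), (z.im : RR n), ?_⟩
      have h1 := eq_add_sq z
      have h2 : ((z.re : RR n)) + z.im * w = q * k := by exact_mod_cast congrArg (Int.cast (R := RR n)) hk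
      linear_combination -h1 - h2
    have hp := Nat.prime_iff_prime_int.1 hq
    obtain ⟨k, hk⟩ := hw
    have e : (q:ℤ) ∣ (x.re + x.im * w) * (y.re + y.im * w) := by
      have : (x.re + x.im * w) * (y.re + y.im * w) = ((x*y).re + (x*y).im * w) + q * (x.im * y.im * k) := by
        simp
        linear_combination x.im * y.im * hk
      rw [this]
      exact dvd_add h (dvd_mul_right _ _)
    exact (hp.dvd_or_dvd e).imp (hmem x) (hmem y)

lemma idQ_ne {q : ℕ} (hq : q.Prime) {w : ℤ} : idQ n q w ≠ 0 := by
  intro h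
  have : (q : RR n) ∈ idQ n q w := Ideal.subset_span (by simp)
  rw [h] at this
  have := congrArg QuadraticAlgebra.re ((Submodule.mem_bot _).1 this)
  simp at this
  exact hq.ne_zero this
end RR

open Eis RR in
theorem pairing {n : ℤ} [hn : GoodN n] (hn3 : n % 3 = 1) (d : PDat n) :
    ∃ f : ClassGroup (RR n) →* Eis, (∀ c, f c ^3 = 1) ∧ ∀ (q : ℕ) (hq : q.Prime) (w : ℤ), (q:ℤ) ∣ w^2 + n → ¬ (q:ℤ) ∣ d.B →
      ∀ [Fact q.Prime] (F : Type) [Field F] [IsAlgClosed F] [CharP F q] (φ : Eis →+* F),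
        Rel q φ (f (ClassGroup.mk0 ⟨idQ n q w, mem_nonZeroDivisors_of_ne_zero (RR.idQ_ne hq)⟩)) (gam d.u (d.v * w)) := by
  obtain ⟨f, hf, hI⟩ := d.exists_hom hn3
  refine ⟨f, hf, ?_⟩
  intro q hq w hw hB _ F _ _ _ φ
  have h1 : (q : RR n) ∈ idQ n q w := Ideal.subset_span (by simp)
  have h2 : RR.sq n - w ∈ idQ n q w := Ideal.subset_span (by simp)
  have hP := idQ_prime (n := n) hq hw
  have hN := absNorm_of hP hq h1 h2
  rw [hI]
  swap
  · change IsCoprime ((Ideal.absNorm (idQ n q w) : ℕ) : ℤ) d.B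
    rw [hN]
    exact ((Nat.prime_iff_prime_int.1 hq).coprime_iff_not_dvd).2 hB
  have htau : d.tt (idQ n q w) = d.tau (idQ n q w) := by
    rw [PDat.tt, UniqueFactorizationMonoid.normalizedFactors_irreducible]
    · simp
    · exact ((Ideal.prime_iff_isPrime (idQ_ne hq)).2 hP).irreducible
  change Rel q φ (d.tt (idQ n q w)) _
  rw [htau]
  obtain ⟨ζ, hζ⟩ := d.exists_isTau hP hq h1 h2 hB
  rw [d.tau_eq hP hζ]
  obtain ⟨q', w', hq', h1', h2', hB', hz', hR'⟩ := hζ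
  obtain rfl := prime_unique hP hq hq' h1 h1'
  have hww : (q:ℤ) ∣ w' - w := by
    apply int_dvd_of_mem hP hq h1
    have := (idQ n q w).sub_mem h2 h2'
    convert this using 1
    push_cast; ring
  refine (hR' _ φ).congr ?_ ?_
  · apply hom_gam_congr φ (by simp)
    rw [← mul_sub]; exact hww.mul_left _
  · rw [gam_star, gam_star]
    apply hom_gam_congr φ (by simp)
    have : -(d.v * w') - -(d.v*w) = - (d.v * (w' - w)) := by ring
    rw [this]; exact (hww.mul_left _).neg_right
end

section
set_option linter.unusedSimpArgs false
set_option linter.unusedVariables false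
set_option linter.unusedSectionVars false
set_option linter.style.haveILetI false
open scoped QuadraticAlgebra nonZeroDivisors

namespace Eis
variable {q : ℕ} [Fact q.Prime] {F : Type} [Field F] [IsAlgClosed F] [CharP F q]

lemma frob_pow_int (m : ℤ) : (m : F)^q = m := by
  have := ZMod.pow_card (p := q) (m : ZMod q)
  have h := congrArg (ZMod.castHom (dvd_refl q) F) this
  rwa [map_pow, map_intCast] at h

lemma intCast_of_frob {x : F} (h : x^q = x) : ∃ r : ℤ, (r : F) = x := by
  have := (Subfield.mem_bot_iff_pow_eq_self (p := q) (F := F)).2 h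
  exact (mem_bot_iff_intCast q F).1 this

lemma loc_root (φ : Eis →+* F) (h3 : q ≠ 3) (h2 : (2:F) ≠ 0) {n w U V : ℤ} (hw : (q:ℤ) ∣ w^2 + n) (hV : ¬ (q:ℤ) ∣ V) (hnq : ¬ (q:ℤ) ∣ n)
    (hN : ¬ (q:ℤ) ∣ U^2 - 3 * n * V^2) (hR : Rel q φ 1 (gam U (V * w))) {s z : F} (hs : s = w * (1 + 2 * φ om))
    (hz : z^3 * (U - V * s) = U + V * s) : z ≠ 1 ∧ ∃ r : ℤ, (r : F) * (z - 1) = V * s * (z + 1) ∧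
      (q:ℤ) ∣ r^3 - 3 * U * r^2 + 9 * n * V^2 * r - 3 * n * U * V^2 := by
  have hq := (Fact.out : q.Prime)
  have cast0 : ∀ m : ℤ, (m : F) = 0 ↔ (q:ℤ) ∣ m := fun m => CharP.intCast_eq_zero_iff F q m
  have h3F : (3:F) ≠ 0 := three_ne (q := q) h3
  have hom := hom_om φ
  have hs2 : s^2 = 3 * n := by
    have := (cast0 _).2 hw
    push_cast at this
    rw [hs]
    linear_combination (-3) * this + 4 * (w:F)^2 * hom
  have hnF : (n:F) ≠ 0 := fun h => hnq ((cast0 _).1 h)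
  have hVF : (V:F) ≠ 0 := fun h => hV ((cast0 _).1 h)
  have hs0 : s ≠ 0 := by
    intro h; rw [h] at hs2
    have : (3:F) * n = 0 := by rw [← hs2]; ring
    exact (mul_ne_zero h3F hnF) this
  have hNF : ((U:F) - V * s) * (U + V * s) ≠ 0 := by
    intro h
    apply hN
    rw [← cast0]; push_cast
    linear_combination h + V^2 * hs2
  have hm0 := left_ne_zero_of_mul hNF
  have hp0 := right_ne_zero_of_mul hNF
  have hz1 : z ≠ 1 := by
    rintro rfl
    have : 2 * V * s = 0 := by linear_combination -hz
    exact mul_ne_zero (mul_ne_zero h2 hVF) hs0 this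
  have hz1' : z - 1 ≠ 0 := sub_ne_zero.2 hz1
  have p2 : φ 2 = 2 := map_ofNat φ 2
  have g1 : φ (gam U (V * w)) = U - V * s := by
    rw [gam_eq, hs]; simp [p2]; ring
  have g2 : φ (Star.star (gam U (V * w))) = U + V * s := by
    rw [gam_star, gam_eq, hs]; simp [p2]; ring
  have hz0 : z ≠ 0 := by
    rintro rfl
    apply hp0; rw [← hz]; ring
  rw [Rel, g1, g2] at hR
  have hsq : s^q = s * (if q % 3 = 1 then 1 else -1) := by
    have e : s = φ ((w : Eis) * (1 + 2 * om)) := by rw [hs]; simp [p2]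
    split_ifs with h
    · rw [e, hom_frob1 φ q h, mul_one]
    · have h' := (mod3 h3).resolve_left h
      rw [e, hom_frob2 φ q h']
      have : Star.star ((w : Eis) * (1 + 2 * om)) = -((w : Eis) * (1 + 2 * om)) := by
        ext <;> simp [om]
      rw [this, map_neg]; ring
  have hadd : ∀ x y : F, (x + y)^q = x^q + y^q := fun x y => add_pow_char x y q
  have hsub : ∀ x y : F, (x - y)^q = x^q - y^q := fun x y => sub_pow_char x y
  set T : F := V * s * (z + 1) / (z - 1) with hT
  have hTz : T * (z - 1) = V * s * (z + 1) := by rw [hT]; field_simp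
  have hfr : T^q = T := by
    have e1 : T^q = V * s^q * (z^q + 1) / (z^q - 1) := by
      rw [hT, div_pow, mul_pow, mul_pow, hadd, hsub, frob_pow_int, one_pow]
    rw [e1, hsq]
    rcases mod3 h3 with h | h
    · have h1 := hR.1 h
      rw [map_one, one_mul, ← hz, mul_pow, ← pow_mul] at h1
      have h5 : z^(3 * ((q-1)/3)) = 1 := by
        have := pow_ne_zero ((q-1)/3) hm0
        apply mul_right_cancel₀ this; rw [h1, one_mul]
      have h6 : z^q = z := by
        have : q = 3 * ((q-1)/3) + 1 := by omega
        conv_lhs => rw [this]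
        rw [pow_succ, h5, one_mul]
      rw [h6, if_pos h, mul_one]
    · have h1 := hR.2 h
      rw [map_one, one_mul, ← hz, mul_pow, ← pow_mul] at h1
      have h5 : z^(3 * ((q+1)/3)) = 1 := by
        have := pow_ne_zero ((q+1)/3) hm0
        apply mul_right_cancel₀ this; rw [← h1, one_mul]
      have h6 : z^q = z⁻¹ := by
        rw [← mul_eq_one_iff_eq_inv₀ hz0, ← pow_succ, ← h5]
        congr 1; omega
      rw [h6, if_neg (by omega), hT]
      have : z⁻¹ - 1 ≠ 0 := by
        intro h; apply hz1; have := sub_eq_zero.1 h; simpa using this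
      rw [div_eq_div_iff this hz1']
      field_simp
      ring
  obtain ⟨r, hr⟩ := intCast_of_frob (q := q) hfr
  refine ⟨hz1, r, by rw [hr, hTz], ?_⟩
  rw [← cast0]; push_cast; rw [hr]
  -- z = (T + V s)/(T - V s)
  have hd : T - V * s ≠ 0 := by
    intro h
    have : 2 * V * s = 0 := by linear_combination (z-1) * h - hTz
    exact mul_ne_zero (mul_ne_zero h2 hVF) hs0 this
  have hzT : z = (T + V * s) / (T - V * s) := by
    rw [eq_div_iff hd]; linear_combination hTz
  rw [hzT] at hz
  field_simp at hz
  have hk : 2 * V * s ≠ 0 := mul_ne_zero (mul_ne_zero h2 hVF) hs0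
  apply mul_left_cancel₀ hk
  linear_combination -hz - 2 * V * s * V^2 * (3 * T - U) * hs2

lemma loc_split (φ : Eis →+* F) (h3 : q ≠ 3) (h2 : q ≠ 2) {n w U V : ℤ} (hw : (q:ℤ) ∣ w^2 + n) (hV : ¬ (q:ℤ) ∣ V) (hnq : ¬ (q:ℤ) ∣ n)
    (hN : ¬ (q:ℤ) ∣ U^2 - 3 * n * V^2) (hR : Rel q φ 1 (gam U (V * w))) :
    ∃ r : Fin 3 → ℤ, (∀ i, (q:ℤ) ∣ (r i)^3 - 3 * U * (r i)^2 + 9 * n * V^2 * (r i) - 3 * n * U * V^2) ∧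
      ∀ i j, (q:ℤ) ∣ r i - r j → i = j := by
  have hq := (Fact.out : q.Prime)
  have cast0 : ∀ m : ℤ, (m : F) = 0 ↔ (q:ℤ) ∣ m := fun m => CharP.intCast_eq_zero_iff F q m
  have h3F : (3:F) ≠ 0 := three_ne (q := q) h3
  have h2F : (2:F) ≠ 0 := by
    intro h
    have := (cast0 2).1 (by exact_mod_cast h)
    exact h2 ((Nat.prime_dvd_prime_iff_eq hq Nat.prime_two).1 (by exact_mod_cast this))
  have hom := hom_om φ
  set s : F := w * (1 + 2 * φ om) with hs
  have hs2 : s^2 = 3 * n := by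
    have := (cast0 _).2 hw
    push_cast at this
    rw [hs]
    linear_combination (-3) * this + 4 * (w:F)^2 * hom
  have hNF : ((U:F) - V * s) * (U + V * s) ≠ 0 := by
    intro h
    apply hN
    rw [← cast0]; push_cast
    linear_combination h + V^2 * hs2
  have hm0 := left_ne_zero_of_mul hNF
  have hp0 := right_ne_zero_of_mul hNF
  obtain ⟨z, hz⟩ := IsAlgClosed.exists_pow_nat_eq (((U:F) + V * s) / (U - V * s)) (show 0 < 3 by norm_num)
  have hz' : z^3 * (U - V * s) = U + V * s := by rw [hz]; field_simp
  have hz0 : z ≠ 0 := by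
    rintro rfl
    apply hp0; rw [← hz']; ring
  have hc := hom_om_cube φ
  have hzi : ∀ i : Fin 3, (z * φ om^(i:ℕ))^3 * (U - V * s) = U + V * s := by
    intro i
    rw [mul_pow, ← pow_mul, mul_comm (i:ℕ) 3, pow_mul, hc, one_pow, mul_one, hz']
  choose h1 r hr hG using fun i => loc_root φ h3 h2F hw hV hnq hN hR hs (hzi i)
  refine ⟨r, hG, ?_⟩
  intro i j hij
  have e : (r i : F) = r j := by
    have := (cast0 _).2 hij
    push_cast at this; exact sub_eq_zero.1 this
  have hVF : (V:F) ≠ 0 := fun h => hV ((cast0 _).1 h)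
  have hnF : (n:F) ≠ 0 := fun h => hnq ((cast0 _).1 h)
  have hs0 : s ≠ 0 := by
    intro h; rw [h] at hs2
    have : (3:F) * n = 0 := by rw [← hs2]; ring
    exact (mul_ne_zero h3F hnF) this
  have hk : 2 * V * s ≠ 0 := mul_ne_zero (mul_ne_zero h2F hVF) hs0
  have a1 := hr i
  have a2 := hr j
  rw [e] at a1
  set x := z * φ om^(i:ℕ)
  set y := z * φ om^(j:ℕ)
  have hxy : x = y := by
    apply mul_left_cancel₀ hk
    linear_combination (y - 1) * a1 - (x - 1) * a2
  have hpow : φ om^(i:ℕ) = φ om^(j:ℕ) := mul_left_cancel₀ hz0 hxy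
  have hprim : IsPrimitiveRoot (φ om) 3 := IsPrimitiveRoot.mk_of_lt _ (by norm_num) hc (by
    intro l hl hl3
    have hne := hom_om_ne φ h3F
    interval_cases l
    · simpa using hne
    · intro h
      apply hne
      linear_combination hc - φ om * h)
  exact Fin.ext (hprim.pow_inj i.2 j.2 hpow)

end Eis
end

section
set_option linter.unusedSimpArgs false
set_option linter.unusedVariables false
set_option linter.unusedSectionVars false
set_option linter.style.haveILetI false
open scoped QuadraticAlgebra nonZeroDivisors

namespace Eis
lemma gam_mul (u v u' v' : ℤ) : gam u v * gam u' v' = gam (u * u' - 3 * (v * v')) (u * v' + v * u') := by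
  ext <;> simp [gam] <;> ring
end Eis

namespace PDat
variable {n : ℤ} [hn : GoodN n]

noncomputable def pf (hn3 : n % 3 = 1) (d : PDat n) : ClassGroup (RR n) →* Eis := (pairing hn3 d).choose

lemma not_dvd_nrm (d : PDat n) {q : ℕ} (hq : q.Prime) (hB : ¬ (q:ℤ) ∣ d.B) : ¬ (q:ℤ) ∣ d.u^2 - 3 * n * d.v^2 := by
  have hp := Nat.prime_iff_prime_int.1 hq
  rw [d.nrm]
  intro h
  apply hB
  unfold B
  rcases hp.dvd_or_dvd h with h | h
  · exact ((h.mul_left n).mul_right _).mul_left _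
  · exact ((hp.dvd_of_dvd_pow h).mul_left _).mul_left _

open Eis Polynomial in
theorem pf_eq (hn3 : n % 3 = 1) (d d' : PDat n) (h : d.pf hn3 = d'.pf hn3) :
    ∃ r T e : ℚ, ((d.u * d'.u - 3 * n * (d.v * d'.v) : ℤ) : ℚ) = r * (T^3 + 9 * n * T * e^2) ∧
      ((d.v * d'.u - d.u * d'.v : ℤ) : ℚ) = r * (3 * T^2 * e + 3 * n * e^3) := by
  set U := d.u * d'.u - 3 * n * (d.v * d'.v) with hU
  set V := d.v * d'.u - d.u * d'.v with hVd
  by_cases hV : V = 0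
  · exact ⟨U, 1, 0, by simp, by simp [hV]⟩
  have hn0 : n ≠ 0 := by have := hn.gt; omega
  have hnp : 0 < n := by have := hn.gt; omega
  obtain ⟨hc, hP⟩ := (pairing hn3 d).choose_spec
  obtain ⟨hc', hP'⟩ := (pairing hn3 d').choose_spec
  change ∀ c, d.pf hn3 c ^ 3 = 1 at hc
  set M : ℕ := (6 * n * d.B * d'.B * V).natAbs with hM
  have hM0 : M ≠ 0 := by
    rw [hM, Int.natAbs_ne_zero]
    exact mul_ne_zero (mul_ne_zero (mul_ne_zero (mul_ne_zero (by norm_num) hn0) d.B_ne) d'.B_ne) hV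
  set G : ℤ[X] := X^3 + (C (-3 * U) * X^2 + C (9 * n * V^2) * X + C (-3 * n * U * V^2)) with hG
  have hlt : (C (-3 * U) * X^2 + C (9 * n * V^2) * X + C (-3 * n * U * V^2)).degree < ((3:ℕ) : WithBot ℕ) :=
    lt_of_le_of_lt degree_quadratic_le (by norm_cast)
  have hGm : G.Monic := monic_X_pow_add hlt
  have hGd : G.natDegree = 3 := by
    apply natDegree_eq_of_degree_eq_some
    rw [hG, degree_add_eq_left_of_degree_lt (by rw [degree_X_pow]; exact hlt), degree_X_pow]
  have hGe : ∀ r : ℤ, G.eval r = r^3 - 3 * U * r^2 + 9 * n * V^2 * r - 3 * n * U * V^2 := by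
    intro r; simp [hG]; ring
  obtain ⟨x, hx⟩ := exists_root_of_split G hGm hGd (n := n.toNat) (by omega) M hM0 (by
    rintro q ⟨hq, hqM, hj⟩
    have hqM' : ¬ (q:ℤ) ∣ 6 * n * d.B * d'.B * V := by
      rwa [hM, ← Int.natCast_dvd] at hqM
    haveI : Fact q.Prime := ⟨hq⟩
    have hqB : ¬ (q:ℤ) ∣ d.B := fun h => hqM' (((h.mul_left _).mul_right _).mul_right _)
    have hqB' : ¬ (q:ℤ) ∣ d'.B := fun h => hqM' ((h.mul_left _).mul_right _)
    have hqV : ¬ (q:ℤ) ∣ V := fun h => hqM' (h.mul_left _)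
    have hqn : ¬ (q:ℤ) ∣ n := fun h => hqM' ((((h.mul_left _).mul_right _).mul_right _).mul_right _)
    have hq6 : ¬ (q:ℤ) ∣ 6 := fun h => hqM' ((((h.mul_right _).mul_right _).mul_right _).mul_right _)
    have hq2 : q ≠ 2 := by rintro rfl; apply hq6; norm_num
    have hq3 : q ≠ 3 := by rintro rfl; apply hq6; norm_num
    have hsq : IsSquare ((-n : ℤ) : ZMod q) := by
      apply ZMod.isSquare_of_jacobiSym_eq_one
      rwa [Int.toNat_of_nonneg hnp.le] at hj
    obtain ⟨w0, hw0⟩ := hsq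
    obtain ⟨w, rfl⟩ := ZMod.intCast_surjective w0
    have hw : (q:ℤ) ∣ w^2 + n := by
      rw [← ZMod.intCast_zmod_eq_zero_iff_dvd _ q]
      push_cast at hw0 ⊢
      linear_combination -hw0
    obtain ⟨φ⟩ := exists_phi q
    have R1 := hP q hq w hw hqB _ φ
    have R2 := hP' q hq w hw hqB' _ φ
    change Rel q φ (d.pf hn3 _) _ at R1
    change Rel q φ (d'.pf hn3 _) _ at R2
    rw [← h] at R2
    set ζ := d.pf hn3 (ClassGroup.mk0 ⟨idQ n q w, mem_nonZeroDivisors_of_ne_zero (RR.idQ_ne hq)⟩) with hζ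
    have hζ3 : ζ^3 = 1 := hc _
    have R3 := R1.mul (R2.star hζ3)
    have e1 : ζ * star ζ = 1 := by rw [star_of_cube hζ3, ← hζ3]; ring
    rw [e1, gam_star, gam_mul] at R3
    have R4 : Rel q φ 1 (gam U (V * w)) := by
      have k1 : (q:ℤ) ∣ d.u * d'.u - 3 * (d.v * w * -(d'.v * w)) - U := by
        have : d.u * d'.u - 3 * (d.v * w * -(d'.v * w)) - U = 3 * d.v * d'.v * (w^2 + n) := by rw [hU]; ring
        rw [this]; exact hw.mul_left _
      have k2 : d.u * -(d'.v * w) + d.v * w * d'.u = V * w := by rw [hVd]; ring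
      rw [k2] at R3
      refine R3.congr (hom_gam_congr φ k1 (by simp)) ?_
      rw [gam_star, gam_star]
      exact hom_gam_congr φ k1 (by simp)
    have hN : ¬ (q:ℤ) ∣ U^2 - 3 * n * V^2 := by
      have : U^2 - 3 * n * V^2 = (d.u^2 - 3 * n * d.v^2) * (d'.u^2 - 3 * n * d'.v^2) := by rw [hU, hVd]; ring
      rw [this]
      intro hh
      rcases (Nat.prime_iff_prime_int.1 hq).dvd_or_dvd hh with h1 | h1
      · exact d.not_dvd_nrm hq hqB h1
      · exact d'.not_dvd_nrm hq hqB' h1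
    obtain ⟨r, hr1, hr2⟩ := loc_split φ hq3 hq2 hw hqV hqn hN R4
    refine ⟨r 0, r 1, r 2, ?_, ?_, ?_, ?_, ?_, ?_⟩
    · rw [hGe]; exact hr1 0
    · rw [hGe]; exact hr1 1
    · rw [hGe]; exact hr1 2
    · intro hh; exact absurd (hr2 _ _ hh) (by decide)
    · intro hh; exact absurd (hr2 _ _ hh) (by decide)
    · intro hh; exact absurd (hr2 _ _ hh) (by decide))
  have hx' : x^3 - 3 * U * x^2 + 9 * n * V^2 * x - 3 * n * U * V^2 = 0 := by
    have := hx
    simp [hG, Polynomial.map_add, Polynomial.map_mul] at this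
    linear_combination this
  have hVq : (V:ℚ) ≠ 0 := by exact_mod_cast hV
  have hnq : (0:ℚ) < n := by exact_mod_cast hnp
  have hden : 3 * (x / V)^2 + 3 * (n:ℚ) ≠ 0 := by positivity
  refine ⟨V / (3 * (x/V)^2 + 3 * n), x / V, 1, ?_, ?_⟩
  · rw [div_mul_eq_mul_div, eq_div_iff hden]
    field_simp
    linear_combination -hx'
  · rw [div_mul_eq_mul_div, eq_div_iff hden]; ring

end PDat
end

section
set_option linter.unusedSimpArgs false
set_option linter.unusedVariables false
set_option linter.unusedSectionVars false
set_option linter.style.haveILetI false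
open scoped QuadraticAlgebra nonZeroDivisors

lemma sqfree_dvd_of_sq_dvd_cube {h r : ℤ} (hh : Squarefree h) (hd : h^2 ∣ r^3) : h ∣ r :=
  (hh.dvd_pow_iff_dvd (by norm_num : 3 ≠ 0)).1 ((dvd_pow_self h two_ne_zero).trans hd)

section pts
variable {A D : ℤ}

lemma goodN_sqD (hn : GoodN (A * D)) : Squarefree D := (hn.sf).squarefree_of_dvd (dvd_mul_left _ _)
lemma goodN_sqA (hn : GoodN (A * D)) : Squarefree A := (hn.sf).squarefree_of_dvd (dvd_mul_right _ _)
lemma goodN_cop (hn : GoodN (A * D)) : IsCoprime A D := ((squarefree_mul_iff.1 hn.sf).1).isCoprime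

variable [hn : GoodN (A * D)]

def PDat.triv (n : ℤ) : PDat n where
  u := 1
  v := 0
  κ := 1
  c := 1
  cop := isCoprime_one_left
  u3 := by norm_num
  v3 := by norm_num
  nrm := by norm_num
  hκ := fun q hq h => by
    exfalso
    have := Int.eq_one_of_dvd_one (by positivity) h
    have := hq.one_lt
    omega

/-- first case : `3 ∤ s` -/
lemma pt_case1 {r s t : ℤ} (ht0 : t ≠ 0) (hst : IsCoprime s t) (h3 : ¬ 3 ∣ s)
    (h : s^2 = r^3 + (27 * A * D^3) * t^6) : ∃ (d : PDat (A * D)) (k : ℤ), k ≠ 0 ∧ s = k * d.u ∧ 3 * D * t^3 = k * d.v := by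
  have hD : D ≠ 0 := D_ne A D
  have hsqD := goodN_sqD hn
  obtain ⟨k, s', D', hk0, hcop, hs', hD'⟩ : ∃ k s' D' : ℤ, k ≠ 0 ∧ IsCoprime s' D' ∧ s = k * s' ∧ D = k * D' := by
    obtain ⟨s', hs'⟩ := Int.gcd_dvd_left s D
    obtain ⟨D', hD'⟩ := Int.gcd_dvd_right s D
    refine ⟨Int.gcd s D, s', D', ?_, ?_, hs', hD'⟩
    · intro h0; rw [h0] at hD'; simp at hD'; exact hD hD'
    · have h0 : 0 < Int.gcd s D := Int.gcd_pos_of_ne_zero_right _ hD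
      have := Int.isCoprime_iff_gcd_eq_one.2 (Int.gcd_div_gcd_div_gcd h0)
      have e1 : s / (Int.gcd s D : ℤ) = s' := Int.ediv_eq_of_eq_mul_right (by positivity) hs'
      have e2 : D / (Int.gcd s D : ℤ) = D' := Int.ediv_eq_of_eq_mul_right (by positivity) hD'
      rwa [e1, e2] at this
  have hkD : Squarefree k := hsqD.squarefree_of_dvd ⟨D', hD'⟩
  obtain ⟨r', hr'⟩ : k ∣ r := sqfree_dvd_of_sq_dvd_cube hkD
    ⟨s'^2 - 27 * A * k * D'^3 * t^6, by rw [hs', hD'] at h; linear_combination -h⟩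
  have key : s'^2 = k * (r'^3 + 27 * A * D'^3 * t^6) := by
    apply mul_left_cancel₀ (pow_ne_zero 2 hk0)
    rw [hs', hr', hD'] at h
    linear_combination h
  refine ⟨⟨s', 3 * D' * t^3, k, r', ?_, ?_, ?_, ?_, ?_⟩, k, hk0, hs', ?_⟩
  · rw [hs'] at hst h3
    have h3' : ¬ (3:ℤ) ∣ s' := fun hh => h3 (hh.mul_left _)
    have c3 : IsCoprime s' 3 := ((Int.prime_three.coprime_iff_not_dvd).2 h3').symm
    exact (c3.mul_right hcop).mul_right (hst.of_mul_left_right).pow_right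
  · intro hh; apply h3; rw [hs']; exact hh.mul_left _
  · exact ⟨D' * t^3, by ring⟩
  · rw [hD']
    linear_combination key
  · intro q hq hqk
    refine ⟨?_, ?_⟩
    · apply (Nat.prime_iff_prime_int.1 hq).dvd_of_dvd_pow (n := 2)
      rw [key]; exact hqk.mul_right _
    · rw [hD']; exact (hqk.mul_right _).mul_left _
  · simp only; rw [hD']; ring

lemma cube_mod9 (r : ℤ) : r^3 % 9 = 0 ∨ r^3 % 9 = 1 ∨ r^3 % 9 = 8 := by
  have h : r % 9 = 0 ∨ r % 9 = 1 ∨ r % 9 = 2 ∨ r % 9 = 3 ∨ r % 9 = 4 ∨ r % 9 = 5 ∨ r % 9 = 6 ∨ r % 9 = 7 ∨ r % 9 = 8 := by omega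
  rcases h with h | h | h | h | h | h | h | h | h <;> simp [pow_succ, Int.mul_emod, h]

lemma case2_mod {A D r s t : ℤ} (hA : A % 9 = 1 ∨ A % 9 = 7) (hD : D % 3 = 1) (ht : ¬ 3 ∣ t)
    (h : 3 * s^2 = r^3 + A * D^3 * t^6) : 3 ∣ s := by
  by_contra hs
  have hs2 : 3 * s^2 % 9 = 3 := by
    have : s % 9 = 1 ∨ s % 9 = 2 ∨ s % 9 = 4 ∨ s % 9 = 5 ∨ s % 9 = 7 ∨ s % 9 = 8 := by omega
    rcases this with h | h | h | h | h | h <;> simp [pow_succ, Int.mul_emod, h]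
  have hD3 : D^3 % 9 = 1 := by
    have : D % 9 = 1 ∨ D % 9 = 4 ∨ D % 9 = 7 := by omega
    rcases this with h | h | h <;> simp [pow_succ, Int.mul_emod, h]
  have ht6 : t^6 % 9 = 1 := by
    have : t % 9 = 1 ∨ t % 9 = 2 ∨ t % 9 = 4 ∨ t % 9 = 5 ∨ t % 9 = 7 ∨ t % 9 = 8 := by omega
    rcases this with h | h | h | h | h | h <;> simp [pow_succ, Int.mul_emod, h]
  have h1 : A * D^3 * t^6 % 9 = A % 9 := by
    rw [Int.mul_emod, ht6, Int.mul_emod A, hD3]; simp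
  have hr := cube_mod9 r
  omega

lemma pt_case2 (hA : A % 9 = 1 ∨ A % 9 = 7) (hD3 : D % 3 = 1) {r s t : ℤ} (ht0 : t ≠ 0) (hst : IsCoprime s t) (h3 : 3 ∣ s)
    (h : s^2 = r^3 + (27 * A * D^3) * t^6) : ∃ (d : PDat (A * D)) (k : ℤ), k ≠ 0 ∧ 9 * (A * D^2 * t^3) = k * d.u ∧ s = k * d.v := by
  have hD : D ≠ 0 := D_ne A D
  have hsqD := goodN_sqD hn
  have hsqA := goodN_sqA hn
  have hAD := goodN_cop hn
  have ht3 : ¬ 3 ∣ t := fun hh => Int.prime_three.not_isUnit (hst.isUnit_of_dvd' h3 hh)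
  obtain ⟨s1, rfl⟩ := h3
  have : (3:ℤ) ∣ r^3 := ⟨3 * s1^2 - 9 * A * D^3 * t^6, by linear_combination -h⟩
  obtain ⟨r', rfl⟩ := Int.prime_three.dvd_of_dvd_pow this
  have : (3:ℤ) ∣ s1^2 := ⟨r'^3 + A * D^3 * t^6, by linarith⟩
  obtain ⟨s', rfl⟩ := Int.prime_three.dvd_of_dvd_pow this
  have h : 3 * s'^2 = r'^3 + A * D^3 * t^6 := by linarith
  have hs3 := case2_mod hA hD3 ht3 h
  obtain ⟨k, s1, D', hk0, hcop, hs', hD'⟩ : ∃ k s1 D' : ℤ, k ≠ 0 ∧ IsCoprime s1 D' ∧ s' = k * s1 ∧ D = k * D' := by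
    obtain ⟨s1, hs'⟩ := Int.gcd_dvd_left s' D
    obtain ⟨D', hD'⟩ := Int.gcd_dvd_right s' D
    refine ⟨Int.gcd s' D, s1, D', ?_, ?_, hs', hD'⟩
    · intro h0; rw [h0] at hD'; simp at hD'; exact hD hD'
    · have h0 : 0 < Int.gcd s' D := Int.gcd_pos_of_ne_zero_right _ hD
      have := Int.isCoprime_iff_gcd_eq_one.2 (Int.gcd_div_gcd_div_gcd h0)
      have e1 : s' / (Int.gcd s' D : ℤ) = s1 := Int.ediv_eq_of_eq_mul_right (by positivity) hs'
      have e2 : D / (Int.gcd s' D : ℤ) = D' := Int.ediv_eq_of_eq_mul_right (by positivity) hD'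
      rwa [e1, e2] at this
  have hkD : Squarefree k := hsqD.squarefree_of_dvd ⟨D', hD'⟩
  obtain ⟨r1, hr'⟩ : k ∣ r' := sqfree_dvd_of_sq_dvd_cube hkD
    ⟨3 * s1^2 - A * k * D'^3 * t^6, by rw [hs', hD'] at h; linear_combination -h⟩
  have key : 3 * s1^2 = k * (r1^3 + A * D'^3 * t^6) := by
    apply mul_left_cancel₀ (pow_ne_zero 2 hk0)
    rw [hs', hr', hD'] at h
    linear_combination h
  have hD30 : ¬ (3:ℤ) ∣ D := by omega
  have hk3 : IsCoprime k 3 := ((Int.prime_three.coprime_iff_not_dvd).2 (fun hh => hD30 (by rw [hD']; exact hh.mul_right _))).symm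
  obtain ⟨s2, hs1⟩ : k ∣ s1 := (hkD.dvd_pow_iff_dvd two_ne_zero).1 (hk3.dvd_of_dvd_mul_left ⟨_, key⟩)
  have key2 : 3 * k * s2^2 = r1^3 + A * D'^3 * t^6 := by
    apply mul_left_cancel₀ hk0
    rw [hs1] at key
    linear_combination key
  have hs2s : s2 ∣ 3 * (3 * s') := ⟨9 * k^2, by rw [hs', hs1]; ring⟩
  have hs2t : IsCoprime s2 t := hst.of_isCoprime_of_dvd_left hs2s
  have hs2D : IsCoprime s2 D' := hcop.of_isCoprime_of_dvd_left ⟨k, by rw [hs1]; ring⟩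
  have hs2A : IsCoprime s2 A := by
    refine isCoprime_of_prime_dvd ?_ ?_
    · rintro ⟨-, h0⟩
      have := hn.gt
      rw [h0] at this; simp at this
    · intro p hp h1 h2
      have hpr : p ∣ r1 := by
        apply hp.dvd_of_dvd_pow (n := 3)
        have : r1^3 = 3 * k * s2^2 - A * D'^3 * t^6 := by linarith
        rw [this]
        exact dvd_sub ((dvd_pow h1 two_ne_zero).mul_left _) ((h2.mul_right _).mul_right _)
      have hp2 : p^2 ∣ A * D'^3 * t^6 := by
        have : A * D'^3 * t^6 = 3 * k * s2^2 - r1^3 := by linarith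
        rw [this]
        exact dvd_sub ((pow_dvd_pow_of_dvd h1 2).mul_left _) ((pow_dvd_pow_of_dvd hpr 2).trans (pow_dvd_pow _ (by norm_num)))
      have c1 : IsCoprime (p^2) (t^6) := by
        apply IsCoprime.pow
        exact hs2t.of_isCoprime_of_dvd_left h1
      have c2 : IsCoprime (p^2) (D'^3) := by
        apply IsCoprime.pow
        exact hs2D.of_isCoprime_of_dvd_left h1
      have := c2.dvd_of_dvd_mul_right (c1.dvd_of_dvd_mul_right hp2)
      exact hp.not_isUnit (hsqA p (by rwa [← pow_two]))
  have hA3 : ¬ (3:ℤ) ∣ A := by omega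
  have hD'3 : ¬ (3:ℤ) ∣ D' := fun hh => hD30 (by rw [hD']; exact hh.mul_left _)
  refine ⟨⟨A * D'^2 * t^3, s2, -(A * D'), r1, ?_, ?_, ?_, ?_, ?_⟩, 9 * k^2, by positivity, ?_, ?_⟩
  · exact ((hs2A.mul_right hs2D.pow_right).mul_right hs2t.pow_right).symm
  · intro hh
    rcases Int.prime_three.dvd_or_dvd hh with h1 | h1
    · rcases Int.prime_three.dvd_or_dvd h1 with h1 | h1
      · exact hA3 h1
      · exact hD'3 (Int.prime_three.dvd_of_dvd_pow h1)
    · exact ht3 (Int.prime_three.dvd_of_dvd_pow h1)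
  · have : (3:ℤ) ∣ s2 * k^2 := by
      have e : s2 * k^2 = s' := by rw [hs', hs1]; ring
      rwa [e]
    exact (hk3.symm.pow_right).dvd_of_dvd_mul_right this
  · rw [hD']
    linear_combination (-A * D') * key2
  · intro q hq hqk
    rw [Int.dvd_neg] at hqk
    refine ⟨?_, ?_⟩
    · have : A * D'^2 * t^3 = A * D' * (D' * t^3) := by ring
      rw [this]; exact hqk.mul_right _
    · rw [hD']
      have : A * (k * D') = A * D' * k := by ring
      rw [this]; exact hqk.mul_right _
  · simp only; rw [hD']; ring
  · simp only; rw [hs', hs1]; ring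

theorem exists_repr' (hA : A % 9 = 1 ∨ A % 9 = 7) (hD3 : D % 3 = 1) (a : ℤ) (ha : a = 27 * A * D^3) (P : (MC (a:ℚ)).Point) :
    ∃ (d : PDat (A*D)) (r : ℚ) (z : QuadraticAlgebra ℚ (a:ℚ) 0), r ≠ 0 ∧ z ≠ 0 ∧ 
      (⟨d.u, d.v / (3 * D)⟩ : QuadraticAlgebra ℚ (a:ℚ) 0) = ⟨r, 0⟩ * z^3 * kap (a:ℚ) P := by
  have hD : D ≠ 0 := D_ne A D
  have hDQ : (D:ℚ) ≠ 0 := by exact_mod_cast hD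
  have hA0 : A ≠ 0 := by omega
  have hAQ : (A:ℚ) ≠ 0 := by exact_mod_cast hA0
  rcases P with _ | ⟨x, y, hxy⟩
  · exact ⟨PDat.triv _, 1, 1, one_ne_zero, one_ne_zero, by ext <;> simp [kap, PDat.triv]⟩
  · have hE := mc_equation.1 hxy.1
    obtain ⟨r, s, t, ht0, hrt, hst, hx, hy, h⟩ := lowest_terms hE
    rw [ha] at h
    have htQ : (t:ℚ) ≠ 0 := by exact_mod_cast ht0
    by_cases h3 : 3 ∣ s
    · obtain ⟨d, k, hk, h1, h2⟩ := pt_case2 hA hD3 ht0 hst h3 h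
      have hkQ : (k:ℚ) ≠ 0 := by exact_mod_cast hk
      have h1' : 9 * ((A:ℚ) * D^2 * t^3) = k * d.u := by exact_mod_cast h1
      have h2' : (s:ℚ) = k * d.v := by exact_mod_cast h2
      have haQ : (a:ℚ) = 27 * A * D^3 := by rw [ha]; push_cast; rfl
      have haQ0 : (a:ℚ) ≠ 0 := by rw [haQ]; positivity
      refine ⟨d, t^3 / (3 * D * k * a), ⟨0, 1⟩, by positivity, ?_, ?_⟩
      · intro h; have := congrArg QuadraticAlgebra.im h; simp at this
      · ext
        · simp [kap, pow_succ]
          rw [haQ]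
          field_simp
          linear_combination (-3) * h1'
        · simp [kap, pow_succ]
          rw [hy, h2']
          field_simp
    · obtain ⟨d, k, hk, h1, h2⟩ := pt_case1 (A := A) (D := D) ht0 hst h3 h
      have hkQ : (k:ℚ) ≠ 0 := by exact_mod_cast hk
      have h1' : (s:ℚ) = k * d.u := by exact_mod_cast h1
      have h2' : 3 * (D:ℚ) * t^3 = k * d.v := by exact_mod_cast h2
      refine ⟨d, t^3 / k, 1, by positivity, one_ne_zero, ?_⟩
      ext
      · simp [kap, pow_succ]
        rw [hy, h1']
        field_simp
      · simp [kap, pow_succ]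
        field_simp
        linear_combination -h2'

theorem Cminus (hA : A % 9 = 1 ∨ A % 9 = 7) (hD3 : D % 3 = 1) (a : ℤ) (ha : a = 27 * A * D^3) :
    ∃ f : (MC (a:ℚ)).Point → {f : ClassGroup (RR (A*D)) →* Eis // ∀ c, f c^3 = 1}, ∀ P Q, f P = f Q → CubeK (a:ℚ) (P - Q) := by
  have hD : D ≠ 0 := D_ne A D
  have hA0 : A ≠ 0 := by omega
  have hDQ : (D:ℚ) ≠ 0 := by exact_mod_cast hD
  have hAQ : (A:ℚ) ≠ 0 := by exact_mod_cast hA0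
  have haQ : (a:ℚ) = 27 * A * D^3 := by rw [ha]; push_cast; rfl
  have haQ0 : (a:ℚ) ≠ 0 := by rw [haQ]; positivity
  have hn3 : (A * D) % 3 = 1 := by
    have : A % 3 = 1 := by omega
    rw [Int.mul_emod, this, hD3]; rfl
  haveI Hab : Fact (∀ r : ℚ, r ^ 2 ≠ (a:ℚ) + 0 * r) := ⟨by
    intro r h
    have h1 : IsSquare (((3 * (A * D) : ℤ)) : ℚ) := ⟨r / (3 * D), by
      rw [haQ] at h
      push_cast
      field_simp
      linear_combination -h⟩
    rw [Rat.isSquare_intCast_iff] at h1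
    obtain ⟨m, hm⟩ := h1
    have : (3:ℤ) ∣ m := by
      have : (3:ℤ) ∣ m * m := ⟨_, hm.symm⟩
      rcases Int.prime_three.dvd_or_dvd this with h | h <;> exact h
    obtain ⟨m', rfl⟩ := this
    have : A * D = 3 * (m' * m') := by linarith
    omega⟩
  choose d r z hr hz hk using fun P => exists_repr' (A := A) (D := D) hA hD3 a ha P
  refine ⟨fun P => ⟨(d P).pf hn3, (pairing hn3 (d P)).choose_spec.1⟩, ?_⟩
  intro P Q h
  replace h : (d P).pf hn3 = (d Q).pf hn3 := congrArg Subtype.val h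
  obtain ⟨ρ, T, e, h1, h2⟩ := PDat.pf_eq hn3 _ _ h
  push_cast at h1 h2
  set N : ℚ := ((d Q).u:ℚ)^2 - 3 * (A * D) * ((d Q).v:ℚ)^2 with hN
  have hN0 : N ≠ 0 := by
    have := (d Q).kc_ne
    rw [← (d Q).nrm] at this
    rw [hN]; exact_mod_cast this
  have hrel : (⟨(d P).u, (d P).v / (3 * D)⟩ : QuadraticAlgebra ℚ (a:ℚ) 0) = 
      ⟨ρ / N, 0⟩ * ⟨T, e / (3 * D)⟩^3 * ⟨(d Q).u, (d Q).v / (3 * D)⟩ := by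
    have e1 : (⟨ρ / N, 0⟩ * ⟨T, e / (3 * D)⟩^3 : QuadraticAlgebra ℚ (a:ℚ) 0) =
       ⟨(((d P).u:ℚ) * (d Q).u - 3 * (A * D) * ((d P).v * (d Q).v)) / N, (((d P).v:ℚ) * (d Q).u - (d P).u * (d Q).v) / N / (3 * D)⟩ := by
      rw [h1, h2]
      ext
      · simp [pow_succ]
        rw [haQ]
        field_simp
        ring
      · simp [pow_succ]
        rw [haQ]
        field_simp
        ring
    rw [e1]
    ext
    · simp
      rw [haQ]
      field_simp
      rw [hN]; ring
    · simp
      field_simp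
      rw [hN]; ring
  rw [hk P, hk Q] at hrel
  have hrP : (⟨r P, 0⟩ : QuadraticAlgebra ℚ (a:ℚ) 0) ≠ 0 := fun h => hr P (congrArg QuadraticAlgebra.re h)
  have hmul : ∀ x y : ℚ, (⟨x * y, 0⟩ : QuadraticAlgebra ℚ (a:ℚ) 0) = ⟨x, 0⟩ * ⟨y, 0⟩ := by
    intro x y; ext <;> simp
  refine cubeK_sub haQ0 P Q ((r P)⁻¹ * (ρ / N) * r Q) (⟨T, e / (3 * D)⟩ * z Q / z P) ?_
  have hinv : (⟨(r P)⁻¹, 0⟩ : QuadraticAlgebra ℚ (a:ℚ) 0) * ⟨r P, 0⟩ = 1 := by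
    rw [← hmul, inv_mul_cancel₀ (hr P)]; rfl
  have hzP := hz P
  have hzP3 : (z P)^3 ≠ 0 := pow_ne_zero 3 hzP
  apply mul_left_cancel₀ (mul_ne_zero hrP hzP3)
  rw [hrel, hmul, hmul, div_pow, mul_pow]
  have : (z P)^3 * ((⟨T, e / (3 * D)⟩^3 * z Q^3) / z P ^3) = ⟨T, e / (3 * D)⟩^3 * z Q^3 := by
    rw [mul_div_cancel₀ _ hzP3]
  linear_combination (- (⟨r P, 0⟩ : QuadraticAlgebra ℚ (a:ℚ) 0) * ⟨(r P)⁻¹, 0⟩ * ⟨ρ / N, 0⟩ * ⟨r Q, 0⟩ * kap _ Q) * this - 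
    (⟨T, e / (3 * D)⟩^3 * z Q^3 * ⟨ρ / N, 0⟩ * ⟨r Q, 0⟩ * kap _ Q) * hinv
end pts
end

section
set_option linter.unusedSimpArgs false
set_option linter.unusedVariables false
set_option linter.unusedSectionVars false
set_option linter.style.haveILetI false
open scoped QuadraticAlgebra nonZeroDivisors

section dual
variable (G : Type) [CommGroup G] [Finite G]

lemma card_quot_cube : Nat.card (G ⧸ (powMonoidHom 3 : G →* G).range) = Nat.card {c : G // c^3 = 1} := by
  have h1 := Subgroup.card_eq_card_quotient_mul_card_subgroup (powMonoidHom 3 : G →* G).range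
  have h2 := Subgroup.card_eq_card_quotient_mul_card_subgroup (powMonoidHom 3 : G →* G).ker
  have h3 := Nat.card_congr (QuotientGroup.quotientKerEquivRange (powMonoidHom 3 : G →* G)).toEquiv
  have h4 : Nat.card (powMonoidHom 3 : G →* G).ker = Nat.card {c : G // c^3 = 1} := rfl
  rw [← h4]
  rw [h3] at h2
  have h5 : 0 < Nat.card (powMonoidHom 3 : G →* G).range := Nat.card_pos
  apply Nat.eq_of_mul_eq_mul_right h5
  rw [← h1, h2, mul_comm]

lemma dual_inj : ∃ F : {f : G →* Eis // ∀ c, f c^3 = 1} → ((G ⧸ (powMonoidHom 3 : G →* G).range) →* ℂˣ), Function.Injective F := by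
  have key : ∀ f : {f : G →* Eis // ∀ c, f c^3 = 1}, ∃ g : ((G ⧸ (powMonoidHom 3 : G →* G).range) →* ℂˣ),
      ∀ c, ((g (QuotientGroup.mk c) : ℂˣ) : ℂ) = Eis.toC (f.1 c) := by
    intro f
    let h : G →* ℂˣ := ((Eis.toC : Eis →* ℂ).comp f.1).toHomUnits
    have hh : ∀ c, ((h c : ℂˣ) : ℂ) = Eis.toC (f.1 c) := fun c => rfl
    refine ⟨QuotientGroup.lift _ h ?_, fun c => hh c⟩
    rintro _ ⟨c, rfl⟩
    ext
    rw [MonoidHom.map_pow (f := h) c 3 |> fun e => (show h ((powMonoidHom 3) c) = h c ^3 from e)]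
    push_cast
    rw [hh, ← map_pow, f.2, map_one]
  choose F hF using key
  refine ⟨F, ?_⟩
  intro f g hfg
  ext1
  ext1 c
  have h1 := hF f c
  rw [hfg, hF g c] at h1
  exact (Eis.hom_inj_mu Eis.toC (by norm_num) (g.2 c) (f.2 c) h1).symm

lemma card_dual_le : Finite {f : G →* Eis // ∀ c, f c^3 = 1} ∧
    Nat.card {f : G →* Eis // ∀ c, f c^3 = 1} ≤ Nat.card {c : G // c^3 = 1} := by
  obtain ⟨F, hF⟩ := dual_inj G
  haveI : Finite ((G ⧸ (powMonoidHom 3 : G →* G).range) →* ℂˣ) := by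
    apply Nat.finite_of_card_ne_zero
    rw [CommGroup.card_monoidHom_of_hasEnoughRootsOfUnity]
    exact Nat.card_pos.ne'
  refine ⟨Finite.of_injective F hF, ?_⟩
  rw [← card_quot_cube, ← CommGroup.card_monoidHom_of_hasEnoughRootsOfUnity (G ⧸ (powMonoidHom 3 : G →* G).range) ℂ]
  exact Nat.card_le_card_of_injective F hF

lemma card_three_tors (k : ℕ) (h : Nat.card {c : G // c^3 = 1} < 3^(k+1)) : Nat.card {c : G // c^3 = 1} ≤ 3^k := by
  haveI : Fact (Nat.Prime 3) := ⟨Nat.prime_three⟩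
  have hp : IsPGroup 3 (powMonoidHom 3 : G →* G).ker := by
    intro g
    refine ⟨1, ?_⟩
    ext
    have := g.2
    rw [MonoidHom.mem_ker] at this
    simpa using this
  obtain ⟨m, hm⟩ := IsPGroup.iff_card.1 hp
  have h4 : Nat.card (powMonoidHom 3 : G →* G).ker = Nat.card {c : G // c^3 = 1} := rfl
  rw [← h4, hm] at h ⊢
  have := (Nat.pow_lt_pow_iff_right (by norm_num : 1 < 3)).1 h
  exact Nat.pow_le_pow_right (by norm_num) (by omega)
end dual

theorem rank_bound {A D : ℤ} [hn : GoodN (A * D)] (hA : A % 9 = 1 ∨ A % 9 = 7) (hD3 : D % 3 = 1) (k : ℕ)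
    (h : Nat.card {c : ClassGroup (RR (A * D)) // c^3 = 1} < 3^(k+1)) :
    Module.finrank ℤ (MC ((-(A * D^3) : ℤ) : ℚ)).Point ≤ 2 * k := by
  have hD : D ≠ 0 := D_ne A D
  have hA0 : A ≠ 0 := by omega
  have ha0 : -(A * D^3) ≠ 0 := neg_ne_zero.2 (mul_ne_zero hA0 (pow_ne_zero _ hD))
  have ha0' : 27 * A * D^3 ≠ 0 := mul_ne_zero (mul_ne_zero (by norm_num) hA0) (pow_ne_zero _ hD)
  obtain ⟨f₁, h₁⟩ := Cplus (A := A) (D := D) _ rfl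
  obtain ⟨f₂, h₂⟩ := Cminus (A := A) (D := D) hA hD3 _ rfl
  obtain ⟨g, hg⟩ := index_lemma (a := ((-(A * D^3) : ℤ) : ℚ)) (a' := ((27 * A * D^3 : ℤ) : ℚ))
    (by exact_mod_cast ha0) (by exact_mod_cast ha0') (by push_cast; ring) f₁ f₂ h₁ h₂
  obtain ⟨hfin, hcard⟩ := card_dual_le (ClassGroup (RR (A*D)))
  have h1 := mc_rank_le (a := ((-(A * D^3) : ℤ) : ℚ)) (by exact_mod_cast ha0) g hg
  rw [Nat.card_prod] at h1
  have h2 := card_three_tors _ k h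
  have h3 : 3 ^ Module.finrank ℤ (MC ((-(A * D^3) : ℤ) : ℚ)).Point ≤ 3^(2*k) := by
    refine h1.trans ((Nat.mul_le_mul h2 (hcard.trans h2)).trans (le_of_eq ?_))
    rw [two_mul, pow_add]
  exact (Nat.pow_le_pow_iff_right (by norm_num : 1 < 3)).1 h3
end

section
set_option linter.unusedSimpArgs false
set_option linter.unusedVariables false
set_option linter.unusedSectionVars false
set_option linter.style.haveILetI false
open scoped QuadraticAlgebra nonZeroDivisors

namespace RR
variable {n : ℤ}

/-- the ideal `(P, β + √-n)` -/
def Ip (n P β : ℤ) : Ideal (RR n) := Ideal.span {(P : RR n), (β : RR n) + RR.sq n}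

lemma Ip_ne_bot {P β : ℤ} (hP : 0 < P) : Ip n P β ≠ ⊥ := by
  intro h
  have h1 : (P : RR n) ∈ Ip n P β := Ideal.subset_span (by simp)
  rw [h, Ideal.mem_bot] at h1
  have := congrArg QuadraticAlgebra.re h1
  simp at this
  omega

lemma Ip_shift (P β k : ℤ) : Ip n P (β + k * P) = Ip n P β := by
  apply le_antisymm
  · refine Ideal.span_le.2 ?_
    rintro z (rfl | rfl)
    · exact Ideal.subset_span (by simp)
    · refine Ideal.mem_span_pair.2 ⟨(k : RR n), 1, ?_⟩
      push_cast; ring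
  · refine Ideal.span_le.2 ?_
    rintro z (rfl | rfl)
    · exact Ideal.subset_span (by simp)
    · refine Ideal.mem_span_pair.2 ⟨(-k : RR n), 1, ?_⟩
      push_cast; ring

lemma exists_comb [hn : GoodN n] {P β R : ℤ} (h : P * R = β^2 + n) :
    ∃ u v w : ℤ, u * P + v * (2 * β) + w * R = 1 := by
  by_contra hcon
  have hg : Ideal.span ({P, 2*β, R} : Set ℤ) ≠ ⊤ := by
    intro htop
    apply hcon
    have h1 : (1:ℤ) ∈ Ideal.span ({P, 2*β, R} : Set ℤ) := by rw [htop]; trivial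
    obtain ⟨u, z, hz, h2⟩ := Ideal.mem_span_insert.1 h1
    obtain ⟨v, w, h3⟩ := Ideal.mem_span_pair.1 hz
    exact ⟨u, v, w, by rw [h2, ← h3]; ring⟩
  obtain ⟨M, hM, hle⟩ := Ideal.exists_le_maximal _ hg
  obtain ⟨p, hp⟩ := (IsPrincipalIdealRing.principal M).principal
  have hpM : ∀ x, x ∈ M ↔ p ∣ x := fun x => by rw [hp]; exact Ideal.mem_span_singleton
  have hP : p ∣ P := (hpM _).1 (hle (Ideal.subset_span (by simp)))
  have hβ : p ∣ 2 * β := (hpM _).1 (hle (Ideal.subset_span (by simp)))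
  have hR : p ∣ R := (hpM _).1 (hle (Ideal.subset_span (by simp)))
  have hpu : ¬ IsUnit p := fun hu => hM.ne_top (by rw [hp]; exact Ideal.span_singleton_eq_top.2 hu)
  have hprime : ∀ x y, p ∣ x * y → p ∣ x ∨ p ∣ y := fun x y hxy => by
    have := hM.isPrime.mem_or_mem ((hpM _).2 hxy)
    simpa [hpM] using this
  obtain ⟨P', rfl⟩ := hP
  obtain ⟨R', rfl⟩ := hR
  by_cases hb : p ∣ β
  · obtain ⟨b', rfl⟩ := hb
    have : p * p ∣ n := ⟨P' * R' - b'^2, by linear_combination -h⟩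
    exact hpu (hn.sf p this)
  · have h2 : p ∣ 2 := (hprime _ _ hβ).resolve_right hb
    have h3 : p = 2 ∨ p = -2 := by
      have h4 : p.natAbs ∣ 2 := by simpa using Int.natAbs_dvd_natAbs.2 h2
      have h5 := (Nat.dvd_prime Nat.prime_two).1 h4
      have h6 : p.natAbs ≠ 1 := fun h => hpu (Int.isUnit_iff_natAbs_eq.2 h)
      omega
    have h4 : (4:ℤ) ∣ β^2 + n := by
      rw [← h]
      rcases h3 with rfl | rfl
      · exact ⟨P' * R', by ring⟩
      · exact ⟨P' * R', by ring⟩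
    have h5 := hn.md
    obtain ⟨t, rfl | rfl⟩ : ∃ t, β = 2 * t ∨ β = 2 * t + 1 := ⟨β / 2, by omega⟩
    · ring_nf at h4; omega
    · ring_nf at h4; omega

lemma Ip_mul_conj [hn : GoodN n] {P β R : ℤ} (h : P * R = β^2 + n) :
    Ip n P β * Ip n P (-β) = Ideal.span {(P : RR n)} := by
  have hs : RR.sq n * RR.sq n = -(n : RR n) := by rw [sq_sq]; push_cast; rfl
  have hc : (P : RR n) * (R : RR n) = (β : RR n)^2 + (n : RR n) := by exact_mod_cast congrArg (Int.cast : ℤ → RR n) h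
  unfold Ip
  rw [Ideal.span_pair_mul_span_pair]
  apply le_antisymm
  · refine Ideal.span_le.2 ?_
    rintro z (rfl | rfl | rfl | rfl)
    · exact Ideal.mem_span_singleton.2 ⟨_, rfl⟩
    · exact Ideal.mem_span_singleton.2 ⟨_, rfl⟩
    · exact Ideal.mem_span_singleton.2 ⟨_, mul_comm _ _⟩
    · exact Ideal.mem_span_singleton.2 ⟨-(R : RR n), by push_cast; linear_combination hs + hc⟩
  · rw [Ideal.span_singleton_le_iff_mem]
    obtain ⟨u, v, w, huvw⟩ := exists_comb h
    have hcc : (u : RR n) * P + v * (2 * β) + w * R = 1 := by exact_mod_cast congrArg (Int.cast : ℤ → RR n) huvw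
    have e : (P : RR n) = u * ((P : RR n) * P) + v * (((β : RR n) + RR.sq n) * P)
        + (-v) * ((P : RR n) * (((-β : ℤ) : RR n) + RR.sq n))
        + (-w) * (((β : RR n) + RR.sq n) * (((-β : ℤ) : RR n) + RR.sq n)) := by
      push_cast
      linear_combination (-(P : RR n)) * hcc + w * hs + w * hc
    refine (congrArg (· ∈ _) e).mpr ?_
    refine Ideal.add_mem _ (Ideal.add_mem _ (Ideal.add_mem _ ?_ ?_) ?_) ?_ <;>
    · apply Ideal.mul_mem_left
      exact Ideal.subset_span (by simp)

lemma map_star_Ip (P β : ℤ) : Ideal.map (starRingEnd (RR n)) (Ip n P β) = Ip n P (-β) := by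
  unfold Ip
  rw [Ideal.map_span, Set.image_pair]
  have h1 : starRingEnd (RR n) (P : RR n) = P := by simp
  have h2 : starRingEnd (RR n) ((β : RR n) + RR.sq n) = -(((-β : ℤ) : RR n) + RR.sq n) := by
    rw [starRingEnd_apply]
    ext <;> simp [RR.sq]
  rw [h1, h2]
  apply le_antisymm
  · refine Ideal.span_le.2 ?_
    rintro z (rfl | rfl)
    · exact Ideal.subset_span (by simp)
    · exact neg_mem (Ideal.subset_span (by simp))
  · refine Ideal.span_le.2 ?_
    rintro z (rfl | rfl)
    · exact Ideal.subset_span (by simp)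
    · rw [← neg_neg (((-β : ℤ) : RR n) + RR.sq n)]
      exact neg_mem (Ideal.subset_span (by simp))

lemma norm_of_cube [hn : GoodN n] {P β R : ℤ} (hP : 0 < P) (h : P * R = β^2 + n) {γ : RR n}
    (hγ : Ip n P β ^ 3 = Ideal.span {γ}) : γ.re^2 + n * γ.im^2 = P^3 := by
  have h1 := congrArg (Ideal.map (starRingEnd (RR n))) hγ
  rw [Ideal.map_pow, map_star_Ip, Ideal.map_span, Set.image_singleton] at h1
  have h2 : Ideal.span {γ * star γ} = Ideal.span {((P : RR n))^3} := by
    rw [← Ideal.span_singleton_mul_span_singleton, ← hγ, ← starRingEnd_apply, ← h1, ← mul_pow,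
      Ip_mul_conj h, Ideal.span_singleton_pow]
  rw [mul_star_self] at h2
  have h3 := congrArg Ideal.absNorm h2
  have h4 : ((P : RR n))^3 = ((P^3 : ℤ) : RR n) := by push_cast; rfl
  rw [h4, natAbs_norm, natAbs_norm, norm_formula, norm_formula, norm_formula] at h3
  simp only [QuadraticAlgebra.re_intCast, QuadraticAlgebra.im_intCast] at h3
  have hn0 := hn.gt
  have h5 : 0 ≤ γ.re^2 + n * γ.im^2 := by positivity
  have h6 : (γ.re^2 + n * γ.im^2)^2 = (P^3)^2 := by
    have : ((γ.re^2 + n * γ.im^2)^2).natAbs = ((P^3)^2).natAbs := by simpa [Int.natAbs_pow, Int.natAbs_mul, pow_two] using h3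
    have h7 := congrArg (Nat.cast : ℕ → ℤ) this
    rwa [Int.natAbs_of_nonneg (by positivity), Int.natAbs_of_nonneg (by positivity)] at h7
  exact (pow_left_inj₀ h5 (by positivity) (by norm_num)).1 h6

end RR
end

section
set_option linter.unusedSimpArgs false
set_option linter.unusedVariables false
set_option linter.unusedSectionVars false
set_option linter.style.haveILetI false
open scoped QuadraticAlgebra nonZeroDivisors

namespace RR
variable {n : ℤ}

lemma span_sing_mul_pair (x y z : RR n) : Ideal.span {x} * Ideal.span {y, z} = Ideal.span {x * y, x * z} := by
  rw [Ideal.span_mul_span', Set.singleton_mul, Set.image_pair]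

/-- `c` is the class of `(P, β + √-n)` -/
def IsRep (n : ℤ) [GoodN n] (c : ClassGroup (RR n)) (P β : ℤ) : Prop :=
  0 < P ∧ P ∣ β^2 + n ∧ ∃ h : Ip n P β ∈ (Ideal (RR n))⁰, ClassGroup.mk0 ⟨Ip n P β, h⟩ = c

variable [hn : GoodN n]

lemma Ip_nzd {P β : ℤ} (hP : 0 < P) : Ip n P β ∈ (Ideal (RR n))⁰ :=
  mem_nonZeroDivisors_of_ne_zero (Ip_ne_bot hP)

lemma IsRep.shift {c : ClassGroup (RR n)} {P β : ℤ} (h : IsRep n c P β) (k : ℤ) : IsRep n c P (β + k * P) := by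
  obtain ⟨h1, ⟨R, h2⟩, h3, h4⟩ := h
  refine ⟨h1, ⟨R + 2 * β * k + k^2 * P, by linear_combination h2⟩, Ip_nzd h1, ?_⟩
  rw [← h4]
  congr 1
  exact Subtype.ext (Ip_shift P β k)

lemma IsRep.inj {c c' : ClassGroup (RR n)} {P β : ℤ} (h : IsRep n c P β) (h' : IsRep n c' P β) : c = c' := by
  obtain ⟨h1, h2, h3, h4⟩ := h
  obtain ⟨h1', h2', h3', h4'⟩ := h'
  rw [← h4, ← h4']

lemma IsRep.flip {c : ClassGroup (RR n)} {P β R : ℤ} (h : IsRep n c P β) (hR : P * R = β^2 + n) :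
    IsRep n c R (-β) := by
  obtain ⟨h1, h2, h3, h4⟩ := h
  have hn0 := hn.gt
  have hR0 : 0 < R := by
    have : 0 < P * R := by rw [hR]; positivity
    exact pos_of_mul_pos_right this h1.le |> fun h => h
  refine ⟨hR0, ⟨P, by linear_combination -hR⟩, Ip_nzd hR0, ?_⟩
  rw [← h4, ClassGroup.mk0_eq_mk0_iff]
  have hs : RR.sq n * RR.sq n = -(n : RR n) := by rw [sq_sq]; push_cast; rfl
  have hc : (P : RR n) * (R : RR n) = (β : RR n)^2 + (n : RR n) := by exact_mod_cast congrArg (Int.cast : ℤ → RR n) hR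
  refine ⟨(P : RR n), ((-β : ℤ) : RR n) + RR.sq n, ?_, ?_, ?_⟩
  · intro h; have := congrArg QuadraticAlgebra.re h; simp at this; omega
  · intro h; have := congrArg QuadraticAlgebra.im h; simp [RR.sq] at this
  · simp only [Ip]
    rw [span_sing_mul_pair, span_sing_mul_pair]
    have e1 : (((-β : ℤ) : RR n) + RR.sq n) * ((β : RR n) + RR.sq n) = -((P : RR n) * R) := by
      push_cast; linear_combination hs + hc
    rw [e1, mul_comm (((-β : ℤ) : RR n) + RR.sq n) (P : RR n)]
    apply le_antisymm
    · refine Ideal.span_le.2 ?_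
      rintro z (rfl | rfl)
      · rw [← neg_neg ((P : RR n) * R)]
        exact neg_mem (Ideal.subset_span (by simp))
      · exact Ideal.subset_span (by simp)
    · refine Ideal.span_le.2 ?_
      rintro z (rfl | rfl)
      · exact Ideal.subset_span (by simp)
      · exact neg_mem (Ideal.subset_span (by simp))

lemma exists_rep (c : ClassGroup (RR n)) : ∃ P β, IsRep n c P β := by
  obtain ⟨⟨J, hJ⟩, rfl⟩ := ClassGroup.mk0_surjective c
  have hJ0 : J ≠ ⊥ := nonZeroDivisors.ne_zero hJ
  obtain ⟨z, hz, hz0⟩ := Submodule.exists_mem_ne_zero_of_ne_bot hJ0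
  have hs : RR.sq n * RR.sq n = -(n : RR n) := by rw [sq_sq]; push_cast; rfl
  -- imaginary parts
  let G : AddSubgroup ℤ := J.toAddSubgroup.map
    ({ toFun := fun z : RR n => z.im, map_zero' := rfl, map_add' := fun _ _ => rfl } : RR n →+ ℤ)
  have hG : ∀ y, y ∈ G ↔ ∃ z ∈ J, z.im = y := fun y => Iff.rfl
  obtain ⟨g, hg⟩ := Int.subgroup_cyclic G
  have hgd : ∀ z ∈ J, g ∣ z.im := by
    intro z hz
    have : z.im ∈ G := (hG _).2 ⟨z, hz, rfl⟩
    rw [hg, AddSubgroup.mem_closure_singleton] at this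
    obtain ⟨k, hk⟩ := this
    exact ⟨k, by rw [← hk]; simp [mul_comm]⟩
  obtain ⟨ε, hε, hεg⟩ : ∃ z ∈ J, z.im = g := (hG _).1 (by rw [hg]; exact AddSubgroup.mem_closure_singleton_self g)
  have hgr : ∀ z ∈ J, g ∣ z.re := by
    intro z hz
    have := hgd _ (J.mul_mem_left (RR.sq n) hz)
    simpa [RR.sq] using this
  have hg0 : g ≠ 0 := by
    rintro rfl
    apply hz0
    ext
    · simpa using hgr z hz
    · simpa using hgd z hz
  -- integers
  let Z : Ideal ℤ := J.comap (Int.castRingHom (RR n))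
  obtain ⟨e, he⟩ := (IsPrincipalIdealRing.principal Z).principal
  have hZ : ∀ m : ℤ, (m : RR n) ∈ J ↔ e ∣ m := by
    intro m
    have h1 : (m : RR n) ∈ J ↔ m ∈ Z := by
      change _ ↔ (Int.castRingHom (RR n)) m ∈ J
      simp
    rw [h1, he]; exact Ideal.mem_span_singleton
  have hsa : ∀ z ∈ J, ∀ w : RR n, z * w ∈ J := fun z hz w => J.mul_mem_right w hz
  obtain ⟨P, rfl⟩ : g ∣ e := by
    have h1 : (e : RR n) ∈ J := (hZ e).2 dvd_rfl
    have := hgr _ h1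
    simpa using this
  obtain ⟨β, hβ⟩ := hgr ε hε
  have hεe : ε = (g : RR n) * ((β : RR n) + RR.sq n) := by
    ext
    · simp [RR.sq, hβ]
    · simp [RR.sq, hεg]
  have hP0 : P ≠ 0 := by
    rintro rfl
    have h1 := hsa z hz (star z)
    rw [mul_star_self, hZ, norm_formula, mul_zero, zero_dvd_iff] at h1
    have hn0 := hn.gt
    apply hz0
    have h2 : z.re^2 ≥ 0 := sq_nonneg _
    have h3 : n * z.im^2 ≥ 0 := by positivity
    have h4 : z.re^2 = 0 := by linarith
    have h5 : n * z.im^2 = 0 := by linarith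
    ext
    · simpa using h4
    · have : z.im = 0 ∨ n = 0 := by simpa [or_comm] using h5
      simp; omega
  have hPd : P ∣ β^2 + n := by
    have h1 : ((g * (β^2 + n) : ℤ) : RR n) ∈ J := by
      have e1 : ((g * (β^2 + n) : ℤ) : RR n) = ε * ((β : RR n) - RR.sq n) := by
        rw [hεe]; push_cast; linear_combination (g : RR n) * hs
      rw [e1]; exact hsa _ hε _
    rw [hZ] at h1
    exact (mul_dvd_mul_iff_left hg0).1 h1
  -- ideal equality
  have hJe : J = Ideal.span {(g : RR n)} * Ip n P β := by
    rw [Ip, span_sing_mul_pair]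
    apply le_antisymm
    · intro w hw
      obtain ⟨v, hv⟩ := hgd w hw
      have h1 : w - (v : RR n) * ε = ((w.re - v * (g * β) : ℤ) : RR n) := by
        ext
        · simp [hβ]
        · simp [hεg, hv]; ring
      have h2 : w - (v : RR n) * ε ∈ J := J.sub_mem hw (J.mul_mem_left _ hε)
      rw [h1, hZ] at h2
      obtain ⟨u, hu⟩ := h2
      rw [Ideal.mem_span_pair]
      refine ⟨u, v, ?_⟩
      have h3 : w = ((w.re - v * (g * β) : ℤ) : RR n) + (v : RR n) * ε := by rw [← h1]; ring
      conv_rhs => rw [h3, hu, hεe]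
      push_cast; ring
    · refine Ideal.span_le.2 ?_
      rintro w (rfl | rfl)
      · have := (hZ (g * P)).2 dvd_rfl
        push_cast at this; exact this
      · rw [← hεe]; exact hε
  have key : ∀ Q : ℤ, 0 < Q → Q ∣ β^2 + n → Ip n P β = Ip n Q β → ∃ P β, IsRep n (ClassGroup.mk0 ⟨J, hJ⟩) P β := by
    intro Q hQ hQd hQe
    refine ⟨Q, β, hQ, hQd, Ip_nzd hQ, ?_⟩
    rw [ClassGroup.mk0_eq_mk0_iff]
    refine ⟨(g : RR n), 1, ?_, one_ne_zero, ?_⟩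
    · intro h; have := congrArg QuadraticAlgebra.re h; simp at this; exact hg0 this
    · simp only []
      rw [← hQe, ← hJe]; simp
  rcases lt_or_gt_of_ne hP0 with h | h
  · refine key (-P) (by omega) (by simpa using hPd) ?_
    unfold Ip
    apply le_antisymm
    · refine Ideal.span_le.2 ?_
      rintro w (rfl | rfl)
      · rw [← neg_neg (P : RR n)]
        exact neg_mem (Ideal.subset_span (by simp))
      · exact Ideal.subset_span (by simp)
    · refine Ideal.span_le.2 ?_
      rintro w (rfl | rfl)
      · push_cast
        exact neg_mem (Ideal.subset_span (by simp))
      · exact Ideal.subset_span (by simp)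
  · exact key P h hPd rfl

lemma exists_min_rep (c : ClassGroup (RR n)) : ∃ P β, IsRep n c P β ∧ 3 * P^2 ≤ 4 * n := by
  classical
  have hex : ∃ m : ℕ, ∃ β, IsRep n c (m : ℤ) β := by
    obtain ⟨P, β, h⟩ := exists_rep c
    refine ⟨P.toNat, β, ?_⟩
    rwa [Int.toNat_of_nonneg h.1.le]
  obtain ⟨β, hβ⟩ := Nat.find_spec hex
  set m := Nat.find hex with hm
  have hm0 : (0:ℤ) < m := hβ.1
  -- reduce β
  obtain ⟨k, hk1, hk2⟩ : ∃ k : ℤ, -(m:ℤ) ≤ 2 * (β + k * m) ∧ 2 * (β + k * m) ≤ m := by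
    refine ⟨-((2 * β + m) / (2 * m)), ?_⟩
    have h1 := Int.emod_add_mul_ediv (2 * β + m) (2 * m)
    have h2 := Int.emod_nonneg (2 * β + m) (show (2 * (m:ℤ)) ≠ 0 by omega)
    have h3 := Int.emod_lt_of_pos (2 * β + m) (show 0 < 2 * (m:ℤ) by omega)
    constructor <;> nlinarith
  have hb := hβ.shift k
  set b := β + k * m with hbdef
  obtain ⟨R, hR⟩ := hb.2.1
  have hfl := hb.flip hR.symm
  have hle : (m:ℤ) ≤ R := by
    have h1 : m ≤ R.toNat := Nat.find_min' hex ⟨-b, by rwa [Int.toNat_of_nonneg hfl.1.le]⟩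
    have := hfl.1
    omega
  refine ⟨m, b, hb, ?_⟩
  nlinarith
end RR
end

section
set_option linter.unusedSimpArgs false
set_option linter.unusedVariables false
set_option linter.unusedSectionVars false
set_option linter.style.haveILetI false
open scoped QuadraticAlgebra nonZeroDivisors

namespace RR

lemma ideal_div_aux1 {S : Type*} [CommRing S] {I K : Ideal S} {γ ε : S}
    (hγ : γ ∈ I^3) (hε : ε ∈ K) {i : ℕ} : γ * ε^i ∈ I ^ 3 * K ^ i := Ideal.mul_mem_mul hγ (Ideal.pow_mem_pow hε i)

lemma ideal_div_aux2 {S : Type*} [CommRing S] {I K : Ideal S} {p : S} (hI : I * K = Ideal.span {p})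
     {i : ℕ} (hi : i ≤ 3) : I ^ 3 * K ^ i = Ideal.span {p^i} * I ^ (3 - i) := by
  rw [← Ideal.span_singleton_pow, ← hI, mul_pow]
  obtain ⟨j, hj⟩ := Nat.exists_eq_add_of_le hi
  rw [hj, Nat.add_sub_cancel_left, pow_add, mul_right_comm]

lemma ideal_div_aux {S : Type*} [CommRing S] {I K : Ideal S} {p γ ε : S} (hI : I * K = Ideal.span {p})
    (hγ : γ ∈ I^3) (hε : ε ∈ K) {i : ℕ} (hi : i ≤ 3) : ∃ w, γ * ε^i = p^i * w := by
  have h1 := ideal_div_aux1 hγ hε (i := i)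
  rw [ideal_div_aux2 hI hi] at h1
  generalize I ^ (3 - i) = Z at h1
  exact Ideal.mem_span_singleton.1 (Ideal.mul_le_left h1)

lemma form_arith {n P β R x a b c d x1 x2 : ℤ} (hP : 0 < P) (hR : P * R = β^2 + n)
    (hN : x^2 + n * a^2 = P^3) (e1 : P * x1 = β * x + n * a) (e2 : P * b = β * a - x)
    (e3 : P * x2 = β * x1 + n * b) (e4 : P * c = β * b - x1) (e5 : P * d = β * c - x2) :
    b^2 - a * c = P ∧ b * c - a * d = 2 * β ∧ c^2 - b * d = R := by
  have hP0 : P ≠ 0 := hP.ne'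
  have hx : x = β * a - P * b := by linarith
  have hx1 : x1 = β * b - P * c := by linarith
  have hx2 : x2 = β * c - P * d := by linarith
  subst hx hx1 hx2
  have r1 : R * a = 2 * β * b - P * c := by
    apply mul_left_cancel₀ hP0
    linear_combination a * hR - e1
  have r2 : R * b = 2 * β * c - P * d := by
    apply mul_left_cancel₀ hP0
    linear_combination b * hR - e3
  have r3 : b^2 - a * c = P := by
    apply mul_left_cancel₀ (pow_ne_zero 2 hP0)
    linear_combination hN + a^2 * hR - P * a * r1
  refine ⟨r3, ?_, ?_⟩
  · apply mul_left_cancel₀ hP0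
    linear_combination b * r1 - a * r2 + 2 * β * r3
  · apply mul_left_cancel₀ hP0
    linear_combination R * r3 + c * r1 - b * r2

variable {n : ℤ} [hn : GoodN n]

lemma form_int {P β R : ℤ} (hP : 0 < P) (hR : P * R = β^2 + n) {γ : RR n}
    (hγ : Ip n P β ^ 3 = Ideal.span {γ}) : ∃ b c d : ℤ, P * b = β * γ.im - γ.re ∧
    b^2 - γ.im * c = P ∧ b * c - γ.im * d = 2 * β ∧ c^2 - b * d = R := by
  have hN := norm_of_cube hP hR hγ
  have hP0 : (P : RR n) ≠ 0 := by intro h; have := congrArg QuadraticAlgebra.re h; simp at this; omega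
  have hI := Ip_mul_conj hR
  set ε : RR n := ((-β : ℤ) : RR n) + RR.sq n with hεd
  have hε : ε ∈ Ip n P (-β) := Ideal.subset_span (by simp [hεd])
  have hγm : γ ∈ Ip n P β ^ 3 := by rw [hγ]; exact Ideal.mem_span_singleton_self _
  have hk : ∀ i, i ≤ 3 → ∃ w, γ * ε^i = (P : RR n)^i * w := by
    intro i hi
    exact ideal_div_aux hI hγm hε hi
  obtain ⟨w1, h1⟩ := hk 1 (by norm_num)
  obtain ⟨w2, h2⟩ := hk 2 (by norm_num)
  obtain ⟨w3, h3⟩ := hk 3 (by norm_num)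
  have g1 : (P : RR n) * w1 = γ * ε := by linear_combination -h1
  have g2 : (P : RR n) * w2 = w1 * ε := by
    apply mul_left_cancel₀ hP0
    linear_combination -h2 - ε * g1
  have g3 : (P : RR n) * w3 = w2 * ε := by
    apply mul_left_cancel₀ (pow_ne_zero 2 hP0)
    linear_combination -h3 - ε^2 * g1 - P * ε * g2
  have a1 := congrArg QuadraticAlgebra.re g1
  have a2 := congrArg QuadraticAlgebra.im g1
  have a3 := congrArg QuadraticAlgebra.re g2
  have a4 := congrArg QuadraticAlgebra.im g2
  have a5 := congrArg QuadraticAlgebra.im g3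
  simp [hεd, RR.sq] at a1 a2 a3 a4 a5
  refine ⟨-w1.im, w2.im, -w3.im, by linarith, ?_⟩
  refine form_arith (x := γ.re) (x1 := -w1.re) (x2 := w2.re) hP hR hN ?_ ?_ ?_ ?_ ?_
  · linarith
  · linarith
  · linarith
  · linarith
  · linarith

theorem class_form (cl : ClassGroup (RR n)) (h3 : cl^3 = 1) (h1 : cl ≠ 1) : ∃ a b c d β : ℤ,
    1 ≤ a ∧ -a < 2 * b ∧ 2 * b ≤ a ∧ b * c - a * d = 2 * β ∧ 0 < b^2 - a * c ∧
    n = (b^2 - a * c) * (c^2 - b * d) - β^2 ∧ 3 * (b^2 - a * c)^2 ≤ 4 * n ∧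
    IsRep n cl (b^2 - a * c) β := by
  obtain ⟨P, β, hrep, hmin⟩ := exists_min_rep cl
  have hP := hrep.1
  have hn0 := hn.gt
  obtain ⟨γ, hγ⟩ : ∃ γ : RR n, Ip n P β ^ 3 = Ideal.span {γ} := by
    obtain ⟨_, _, hm, rfl⟩ := hrep
    rw [← map_pow, ClassGroup.mk0_eq_one_iff] at h3
    exact h3.principal
  have hall : ∀ k : ℤ, IsRep n cl P (β + k * P) ∧ Ip n P (β + k * P) ^ 3 = Ideal.span {γ} := fun k =>
    ⟨hrep.shift k, by rw [Ip_shift, hγ]⟩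
  obtain ⟨R, hR⟩ := hrep.2.1
  have hN := norm_of_cube hP hR.symm hγ
  have ha0 : γ.im ≠ 0 := by
    intro ha
    obtain ⟨b, c, d, e1, e2, e3, e4⟩ := form_int hP hR.symm hγ
    rw [ha] at e2 e3
    simp at e2 e3
    have hd : b * b ∣ 2 * 2 * n := ⟨4 * R - c^2, by rw [← e2] at hR; linear_combination 4 * hR + (b * c + 2 * β) * e3⟩
    have hb0 : b ≠ 0 := by rintro rfl; simp at e2; omega
    by_cases h2 : (2:ℤ) ∣ b
    · obtain ⟨t, rfl⟩ := h2
      have e5 : β = t * c := by linarith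
      have h4 : (4:ℤ) ∣ n + (t * c)^2 := ⟨t^2 * R, by rw [← e2, e5] at hR; linear_combination hR⟩
      have hmd := hn.md
      obtain ⟨s, hs | hs⟩ : ∃ s, t * c = 2 * s ∨ t * c = 2 * s + 1 := ⟨t * c / 2, by omega⟩
      · rw [hs] at h4; ring_nf at h4; omega
      · rw [hs] at h4; ring_nf at h4; omega
    · have hc : IsCoprime (b * b) (2 * 2) := by
        have : IsCoprime b 2 := by
          rw [isCoprime_comm]
          exact (Int.prime_two.coprime_iff_not_dvd).2 h2
        exact (this.mul_left this).mul_right (this.mul_left this)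
      have := hn.sf b (hc.dvd_of_dvd_mul_left hd)
      have hP1 : P = 1 := by
        rw [← e2]
        rcases Int.isUnit_iff.1 this with rfl | rfl <;> norm_num
      subst hP1
      apply h1
      obtain ⟨_, _, hm, rfl⟩ := hrep
      rw [ClassGroup.mk0_eq_one_iff]
      have : Ip n 1 β = ⊤ := by
        rw [Ideal.eq_top_iff_one]
        exact Ideal.subset_span (by simp)
      simp only [this]
      infer_instance
  obtain ⟨γ, hall, ha⟩ : ∃ γ : RR n, (∀ k : ℤ, IsRep n cl P (β + k * P) ∧ Ip n P (β + k * P) ^ 3 = Ideal.span {γ})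
      ∧ 0 < γ.im := by
    rcases lt_or_gt_of_ne ha0 with h | h
    · refine ⟨-γ, fun k => ⟨(hall k).1, ?_⟩, by simpa using h⟩
      rw [Ideal.span_singleton_neg]; exact (hall k).2
    · exact ⟨γ, hall, h⟩
  have hγ' : Ip n P β ^ 3 = Ideal.span {γ} := by simpa using (hall 0).2
  obtain ⟨b0, _, _, eb0, _⟩ := form_int hP hR.symm hγ'
  set a := γ.im with had
  obtain ⟨k, hk1, hk2⟩ : ∃ k : ℤ, -a < 2 * (b0 + k * a) ∧ 2 * (b0 + k * a) ≤ a := by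
    refine ⟨((a - 2 * b0) / (2 * a)), ?_⟩
    have h1 := Int.emod_add_mul_ediv (a - 2 * b0) (2 * a)
    have h2 := Int.emod_nonneg (a - 2 * b0) (show (2 * a) ≠ 0 by omega)
    have h3 := Int.emod_lt_of_pos (a - 2 * b0) (show 0 < 2 * a by omega)
    constructor <;> nlinarith
  obtain ⟨hr, hc⟩ := hall k
  obtain ⟨R', hR'⟩ := hr.2.1
  obtain ⟨b, c, d, e1, e2, e3, e4⟩ := form_int hP hR'.symm hc
  have hb : b = b0 + k * a := by
    apply mul_left_cancel₀ hP.ne'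
    rw [e1]; linear_combination -eb0
  rw [← hb] at hk1 hk2
  rw [← had] at e2 e3
  refine ⟨a, b, c, d, β + k * P, by omega, hk1, hk2, e3, by omega, ?_, ?_, ?_⟩
  · rw [e2, e4]; linarith
  · rw [e2]; exact hmin
  · rw [e2]; exact hr
end RR
end

section
set_option linter.unusedSimpArgs false
set_option linter.unusedVariables false
set_option linter.unusedSectionVars false
open intervalIntegral in
lemma ap_mono_sum {h : ℝ → ℝ} {x s : ℝ} (hs : 0 < s) (m : ℕ) (hm : MonotoneOn h (Set.Icc x (x + s * m))) :
    s * ∑ k ∈ Finset.range m, h (x + s * k) ≤ ∫ t in x..(x + s * m), h t := by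
  induction m with
  | zero => simp
  | succ m ih =>
    have hx : x ≤ x + s * m := by nlinarith [mul_nonneg hs.le (Nat.cast_nonneg (α := ℝ) m)]
    have hx2 : x + s * m ≤ x + s * ((m+1 : ℕ) : ℝ) := by push_cast; linarith
    have h1 := ih (hm.mono (Set.Icc_subset_Icc le_rfl hx2))
    have hi1 : IntervalIntegrable h MeasureTheory.volume x (x + s * m) :=
      (MonotoneOn.intervalIntegrable (by rw [Set.uIcc_of_le hx]; exact hm.mono (Set.Icc_subset_Icc le_rfl hx2)))
    have hi2 : IntervalIntegrable h MeasureTheory.volume (x + s * m) (x + s * ((m+1 : ℕ) : ℝ)) :=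
      (MonotoneOn.intervalIntegrable (by rw [Set.uIcc_of_le hx2]; exact hm.mono (Set.Icc_subset_Icc hx le_rfl)))
    rw [Finset.sum_range_succ, mul_add, ← integral_add_adjacent_intervals hi1 hi2]
    have h2 : s * h (x + s * m) ≤ ∫ t in (x + s * m)..(x + s * ((m+1 : ℕ) : ℝ)), h t := by
      have h3 : ∫ t in (x + s * m)..(x + s * ((m+1 : ℕ) : ℝ)), h (x + s * m) = s * h (x + s * m) := by
        rw [integral_const, smul_eq_mul]; push_cast; ring
      rw [← h3]
      refine integral_mono_on hx2 (by simp) hi2 ?_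
      intro t ht
      exact hm ⟨hx, hx2⟩ ⟨hx.trans ht.1, ht.2⟩ ht.1
    linarith

open intervalIntegral in
lemma ap_anti_sum {h : ℝ → ℝ} {x s : ℝ} (hs : 0 < s) (m : ℕ) (hm : AntitoneOn h (Set.Icc (x - s) (x - s + s * m))) :
    s * ∑ k ∈ Finset.range m, h (x + s * k) ≤ ∫ t in (x - s)..(x - s + s * m), h t := by
  induction m with
  | zero => simp
  | succ m ih =>
    have hx : x - s ≤ x - s + s * m := by nlinarith [mul_nonneg hs.le (Nat.cast_nonneg (α := ℝ) m)]
    have hx2 : x - s + s * m ≤ x - s + s * ((m+1 : ℕ) : ℝ) := by push_cast; linarith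
    have h1 := ih (hm.mono (Set.Icc_subset_Icc le_rfl hx2))
    have hi1 : IntervalIntegrable h MeasureTheory.volume (x - s) (x - s + s * m) :=
      (AntitoneOn.intervalIntegrable (by rw [Set.uIcc_of_le hx]; exact hm.mono (Set.Icc_subset_Icc le_rfl hx2)))
    have hi2 : IntervalIntegrable h MeasureTheory.volume (x - s + s * m) (x - s + s * ((m+1 : ℕ) : ℝ)) :=
      (AntitoneOn.intervalIntegrable (by rw [Set.uIcc_of_le hx2]; exact hm.mono (Set.Icc_subset_Icc hx le_rfl)))
    rw [Finset.sum_range_succ, mul_add, ← integral_add_adjacent_intervals hi1 hi2]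
    have h2 : s * h (x + s * m) ≤ ∫ t in (x - s + s * m)..(x - s + s * ((m+1 : ℕ) : ℝ)), h t := by
      have h3 : ∫ t in (x - s + s * m)..(x - s + s * ((m+1 : ℕ) : ℝ)), h (x + s * m) = s * h (x + s * m) := by
        rw [integral_const, smul_eq_mul]; push_cast; ring
      have e : x - s + s * ((m+1 : ℕ) : ℝ) = x + s * m := by push_cast; ring
      rw [← h3]
      refine integral_mono_on hx2 (by simp) hi2 ?_
      intro t ht
      have ht2 := ht.2
      rw [e] at ht2
      exact hm ⟨hx.trans ht.1, ht.2⟩ ⟨by linarith [ht.1], by rw [e]⟩ ht2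
    linarith

/-- lower sum -/
lemma ap_mono_sum_ge {h : ℝ → ℝ} {x s : ℝ} (hs : 0 < s) (m : ℕ) (hm : Monotone h) :
    ∫ t in (x - s)..(x - s + s * m), h t ≤ s * ∑ k ∈ Finset.range m, h (x + s * k) := by
  have := ap_anti_sum (h := fun t => - h t) (x := x) hs m (fun a _ b _ hab => neg_le_neg (hm hab))
  rw [intervalIntegral.integral_neg, Finset.sum_neg_distrib] at this
  linarith

open intervalIntegral in
/-- difference of two monotone functions along a progression -/
lemma ap_diff_sum {F g : ℝ → ℝ} (hF : Monotone F) (hg : Monotone g) (hF0 : ∀ t ≤ 0, F t = 0) (hg0 : ∀ t ≤ 0, g t = 0)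
    {x s M : ℝ} (hs : 0 < s) (hx : 0 < x) (hxs : x ≤ s) (hM : 0 ≤ M) (m : ℕ)
    (h1 : x + s * m - s ≤ M) (h2 : M ≤ x + s * m) :
    s * ∑ k ∈ Finset.range m, (F (x + s * k) - g (x + s * k)) ≤ (∫ t in (0:ℝ)..M, (F t - g t)) + s * (F M + g M) := by
  have hFn : ∀ t, 0 ≤ F t := fun t => by
    rcases le_total t 0 with h | h
    · rw [hF0 t h]
    · rw [← hF0 0 le_rfl]; exact hF h
  have hgn : ∀ t, 0 ≤ g t := fun t => by
    rcases le_total t 0 with h | h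
    · rw [hg0 t h]
    · rw [← hg0 0 le_rfl]; exact hg h
  have iF : ∀ a b, IntervalIntegrable F MeasureTheory.volume a b := fun a b => hF.intervalIntegrable
  have ig : ∀ a b, IntervalIntegrable g MeasureTheory.volume a b := fun a b => hg.intervalIntegrable
  -- upper for F using clamped function
  have hF1 : s * ∑ k ∈ Finset.range m, F (x + s * k) ≤ (∫ t in (0:ℝ)..M, F t) + s * F M := by
    have hc : Monotone (fun t => F (min t M)) := fun a b hab => hF (min_le_min hab le_rfl)
    have e1 := ap_mono_sum (h := fun t => F (min t M)) (x := x) hs m (hc.monotoneOn _)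
    have e2 : ∑ k ∈ Finset.range m, F (min (x + s * k) M) = ∑ k ∈ Finset.range m, F (x + s * k) := by
      apply Finset.sum_congr rfl
      intro k hk
      have hk' : (k:ℝ) + 1 ≤ m := by exact_mod_cast Finset.mem_range.1 hk
      rw [min_eq_left (by nlinarith)]
    rw [e2] at e1
    have ic : ∀ a b, IntervalIntegrable (fun t => F (min t M)) MeasureTheory.volume a b := fun a b => hc.intervalIntegrable
    have e3 : ∫ t in x..(x + s * m), F (min t M) ≤ ∫ t in (0:ℝ)..(M + s), F (min t M) := by
      refine integral_mono_interval hx.le (by nlinarith [mul_nonneg hs.le (Nat.cast_nonneg (α := ℝ) m)]) (by linarith) ?_ (ic _ _)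
      exact Filter.Eventually.of_forall fun t => hFn _
    have e4 : ∫ t in (0:ℝ)..(M + s), F (min t M) = (∫ t in (0:ℝ)..M, F t) + s * F M := by
      rw [← integral_add_adjacent_intervals (ic 0 M) (ic M (M+s))]
      congr 1
      · apply integral_congr
        intro t ht
        rw [Set.uIcc_of_le hM] at ht
        simp [min_eq_left ht.2]
      · have : ∫ t in M..(M+s), F (min t M) = ∫ t in M..(M+s), F M := by
          apply integral_congr
          intro t ht
          rw [Set.uIcc_of_le (by linarith)] at ht
          simp [min_eq_right ht.1]
        rw [this, integral_const, smul_eq_mul]; ring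
    linarith
  have hg1 : (∫ t in (0:ℝ)..M, g t) - s * g M ≤ s * ∑ k ∈ Finset.range m, g (x + s * k) := by
    have e1 := ap_mono_sum_ge (x := x) hs m hg
    have e2 : ∫ t in (x - s)..M, g t = ∫ t in (0:ℝ)..M, g t := by
      rw [← integral_add_adjacent_intervals (ig (x-s) 0) (ig 0 M)]
      have : ∫ t in (x-s)..0, g t = ∫ t in (x-s)..0, (0:ℝ) := by
        apply integral_congr
        intro t ht
        rw [Set.uIcc_of_le (by linarith)] at ht
        exact hg0 t ht.2
      rw [this]; simp
    have e3 := integral_add_adjacent_intervals (ig (x-s) (x - s + s * m)) (ig (x - s + s * m) M)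
    have e4 : ∫ t in (x - s + s * m)..M, g t ≤ s * g M := by
      have h3 : ∫ t in (x - s + s * m)..M, g t ≤ ∫ t in (x - s + s * m)..M, g M :=
        integral_mono_on (by linarith) (ig _ _) (by simp) (fun t ht => hg ht.2)
      rw [integral_const, smul_eq_mul] at h3
      have : (M - (x - s + s * m)) * g M ≤ s * g M := mul_le_mul_of_nonneg_right (by linarith) (hgn M)
      linarith
    linarith
  rw [Finset.sum_sub_distrib, mul_sub, integral_sub (iF _ _) (ig _ _)]
  linarith

/-- unimodal sum -/
lemma ap_unimodal_sum {φ : ℝ → ℝ} {x s u : ℝ} (hs : 0 < s) (hxu : x ≤ u) (m : ℕ)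
    (h1 : MonotoneOn φ (Set.Icc x u)) (h2 : AntitoneOn φ (Set.Ici u)) (h0 : ∀ t ∈ Set.Ici u, 0 ≤ φ t) :
    s * ∑ k ∈ Finset.range m, φ (x + s * k) ≤ (∫ t in x..(x + s * m), φ t) + s * φ u := by
  have hm1 : MonotoneOn (fun t => φ (min t u)) (Set.Icc x (x + s * m)) := by
    intro a ha b hb hab
    exact h1 ⟨le_min ha.1 hxu, min_le_right _ _⟩ ⟨le_min hb.1 hxu, min_le_right _ _⟩ (min_le_min hab le_rfl)
  have hm2 : Antitone (fun t => φ (max t u)) := by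
    intro a b hab
    exact h2 (Set.mem_Ici.2 (le_max_right _ _)) (Set.mem_Ici.2 (le_max_right _ _)) (max_le_max hab le_rfl)
  have e1 := ap_mono_sum hs m hm1
  have e2 := ap_anti_sum (x := x) hs m (hm2.antitoneOn _)
  have i2 : ∀ a b, IntervalIntegrable (fun t => φ (max t u)) MeasureTheory.volume a b := fun a b => hm2.intervalIntegrable
  have hx : x ≤ x + s * m := by nlinarith [mul_nonneg hs.le (Nat.cast_nonneg (α := ℝ) m)]
  have i1 : IntervalIntegrable (fun t => φ (min t u)) MeasureTheory.volume x (x + s * m) :=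
    MonotoneOn.intervalIntegrable (by rw [Set.uIcc_of_le hx]; exact hm1)
  have e3 : ∀ t, φ t = φ (min t u) + φ (max t u) - φ u := by
    intro t
    rcases le_total t u with h | h
    · simp [h]
    · simp [h]
  have e4 : ∫ t in (x - s)..(x - s + s * m), φ (max t u) ≤ (∫ t in x..(x + s * m), φ (max t u)) + s * φ u := by
    have a1 := intervalIntegral.integral_add_adjacent_intervals (i2 (x-s) x) (i2 x (x + s * m))
    have a2 := intervalIntegral.integral_add_adjacent_intervals (i2 (x-s) (x - s + s * m)) (i2 (x - s + s * m) (x + s * m))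
    have a3 : 0 ≤ ∫ t in (x - s + s * m)..(x + s * m), φ (max t u) :=
      intervalIntegral.integral_nonneg (by linarith) (fun t _ => h0 _ (Set.mem_Ici.2 (le_max_right _ _)))
    have a4 : ∫ t in (x-s)..x, φ (max t u) ≤ ∫ t in (x-s)..x, φ u :=
      intervalIntegral.integral_mono_on (by linarith) (i2 _ _) (by simp)
        (fun t _ => h2 (Set.mem_Ici.2 le_rfl) (Set.mem_Ici.2 (le_max_right _ _)) (le_max_right _ _))
    rw [intervalIntegral.integral_const, smul_eq_mul] at a4
    linarith
  have e5 : ∫ t in x..(x + s * m), φ t = (∫ t in x..(x + s * m), φ (min t u)) + (∫ t in x..(x + s * m), φ (max t u)) - (s * m) * φ u := by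
    rw [← intervalIntegral.integral_add i1 (i2 _ _)]
    have : (s * m) * φ u = ∫ t in x..(x + s * m), φ u := by
      rw [intervalIntegral.integral_const, smul_eq_mul]; ring
    rw [this, ← intervalIntegral.integral_sub (i1.add (i2 _ _)) (by simp)]
    exact intervalIntegral.integral_congr (fun t _ => e3 t)
  have e6 : ∑ k ∈ Finset.range m, φ (x + s * k) = ∑ k ∈ Finset.range m, φ (min (x + s * k) u)
      + ∑ k ∈ Finset.range m, φ (max (x + s * k) u) - m * φ u := by
    rw [← Finset.sum_add_distrib]
    have : (m:ℝ) * φ u = ∑ k ∈ Finset.range m, φ u := by simp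
    rw [this, ← Finset.sum_sub_distrib]
    exact Finset.sum_congr rfl (fun k _ => e3 _)
  rw [e6, e5]
  linarith
end

section
set_option linter.unusedSimpArgs false
set_option linter.unusedVariables false
set_option linter.unusedSectionVars false

namespace Cnt
noncomputable def FF (a P : ℝ) : ℝ := √(P^2 * (4 * P - 3 * a^2))
noncomputable def GG (N a P : ℝ) : ℝ := √(4 * P^3 - 4 * a^2 * N)
noncomputable def phi (N P a : ℝ) : ℝ := (FF a P - GG N a P) / a^2

lemma FF_nonneg (a P : ℝ) : 0 ≤ FF a P := Real.sqrt_nonneg _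
lemma GG_nonneg (N a P : ℝ) : 0 ≤ GG N a P := Real.sqrt_nonneg _

lemma FF_zero {a P : ℝ} (h : 4 * P ≤ 3 * a^2) : FF a P = 0 :=
  Real.sqrt_eq_zero_of_nonpos (mul_nonpos_of_nonneg_of_nonpos (sq_nonneg _) (by linarith))

lemma FF_mono (a : ℝ) : Monotone (FF a) := by
  intro P Q h
  rcases le_total (4 * P) (3 * a^2) with h1 | h1
  · rw [FF_zero h1]; exact FF_nonneg _ _
  · have hP : 0 ≤ P := by nlinarith [sq_nonneg a]
    apply Real.sqrt_le_sqrt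
    apply mul_le_mul (pow_le_pow_left₀ hP h 2) (by linarith) (by linarith) (by positivity)

lemma GG_mono (N a : ℝ) : Monotone (GG N a) := by
  intro P Q h
  apply Real.sqrt_le_sqrt
  have : P^3 ≤ Q^3 := (Odd.strictMono_pow (by decide : Odd 3)).monotone h
  linarith

lemma GG_zero {N a P : ℝ} (h : P^3 ≤ a^2 * N) : GG N a P = 0 :=
  Real.sqrt_eq_zero_of_nonpos (by linarith)

lemma GG_zero' {N a P : ℝ} (hN : 0 ≤ N) (h : P ≤ 0) : GG N a P = 0 := by
  apply GG_zero
  have : P^3 ≤ 0 := by nlinarith [sq_nonneg P]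
  have : 0 ≤ a^2 * N := by positivity
  linarith

lemma FF_zero' {a P : ℝ} (h : P ≤ 0) : FF a P = 0 := FF_zero (by nlinarith [sq_nonneg a])

lemma GG_le_FF {N a P : ℝ} (h : 3 * P^2 ≤ 4 * N) : GG N a P ≤ FF a P := by
  apply Real.sqrt_le_sqrt
  nlinarith [sq_nonneg a]

lemma phi_nonneg {N a P : ℝ} (h : 3 * P^2 ≤ 4 * N) : 0 ≤ phi N P a :=
  div_nonneg (by linarith [GG_le_FF (a := a) h]) (sq_nonneg a)

lemma FF_anti {P a b : ℝ} (ha : 0 ≤ a) (h : a ≤ b) : FF b P ≤ FF a P := by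
  apply Real.sqrt_le_sqrt
  have : a^2 ≤ b^2 := pow_le_pow_left₀ ha h 2
  nlinarith [sq_nonneg P]

lemma GG_anti {N P a b : ℝ} (hN : 0 ≤ N) (ha : 0 ≤ a) (h : a ≤ b) : GG N b P ≤ GG N a P := by
  apply Real.sqrt_le_sqrt
  have : a^2 ≤ b^2 := pow_le_pow_left₀ ha h 2
  nlinarith

lemma phi_anti {N P u : ℝ} (hN : 0 ≤ N) (hu : 0 < u) (h : P^3 ≤ u^2 * N) : AntitoneOn (phi N P) (Set.Ici u) := by
  have key : ∀ a ∈ Set.Ici u, phi N P a = FF a P / a^2 := by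
    intro a ha
    have : u^2 ≤ a^2 := pow_le_pow_left₀ hu.le ha 2
    rw [phi, GG_zero (by nlinarith), sub_zero]
  intro a ha b hb hab
  rw [key a ha, key b hb]
  have ha0 : 0 < a := lt_of_lt_of_le hu ha
  exact div_le_div₀ (FF_nonneg _ _) (FF_anti ha0.le hab) (by positivity) (pow_le_pow_left₀ ha0.le hab 2)

lemma phi_mono {N P u x : ℝ} (hN : 0 < N) (hP : 0 < P) (hPN : 3 * P^2 ≤ 4 * N) (hx : 0 < x) (h : u^2 * N ≤ P^3) :
    MonotoneOn (phi N P) (Set.Icc x u) := by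
  have key : ∀ a ∈ Set.Icc x u, 0 < a ∧ FF a P^2 = P^2 * (4 * P - 3 * a^2) ∧ GG N a P^2 = 4 * P^3 - 4 * a^2 * N := by
    intro a ha
    have ha0 : 0 < a := lt_of_lt_of_le hx ha.1
    have h1 : a^2 ≤ u^2 := pow_le_pow_left₀ ha0.le ha.2 2
    have h2 : a^2 * N ≤ P^3 := by nlinarith
    have h3 : 0 ≤ 4 * P^3 - 4 * a^2 * N := by linarith
    refine ⟨ha0, Real.sq_sqrt ?_, Real.sq_sqrt h3⟩
    nlinarith [sq_nonneg a]
  intro a ha b hb hab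
  obtain ⟨ha0, hFa, hGa⟩ := key a ha
  obtain ⟨hb0, hFb, hGb⟩ := key b hb
  have h1 := FF_anti (P := P) ha0.le hab
  have h2 := GG_anti (P := P) hN.le ha0.le hab
  rcases eq_or_lt_of_le hPN with hD | hD
  · have : ∀ c ∈ Set.Icc x u, phi N P c = 0 := by
      intro c hc
      obtain ⟨hc0, hF, hG⟩ := key c hc
      have : FF c P = GG N c P := by
        apply (pow_left_inj₀ (FF_nonneg _ _) (GG_nonneg _ _ _) two_ne_zero).1
        rw [hF, hG]; nlinarith
      rw [phi, this]; simp
    rw [this a ha, this b hb]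
  · have hs : ∀ c ∈ Set.Icc x u, 0 < FF c P + GG N c P ∧ phi N P c = (4 * N - 3 * P^2) / (FF c P + GG N c P) := by
      intro c hc
      obtain ⟨hc0, hF, hG⟩ := key c hc
      have h0 : 0 < FF c P := by
        rcases (FF_nonneg c P).lt_or_eq with h | h
        · exact h
        · exfalso
          rw [← h] at hF
          have : 0 < c^2 * (4 * N - 3 * P^2) := by
            apply mul_pos (by positivity); linarith
          have := sq_nonneg (GG N c P)
          nlinarith
      have h3 : 0 < FF c P + GG N c P := by linarith [GG_nonneg N c P]
      refine ⟨h3, ?_⟩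
      rw [phi, div_eq_div_iff (by positivity) h3.ne']
      linear_combination hF - hG
    obtain ⟨sa, ea⟩ := hs a ha
    obtain ⟨sb, eb⟩ := hs b hb
    rw [ea, eb]
    exact div_le_div_of_nonneg_left (by linarith) sb (by linarith)

lemma FF_le {a P : ℝ} (hP : 0 < P) : FF a P ≤ 2 * √(P^3) := by
  have : (2:ℝ) * √(P^3) = √(4 * P^3) := by
    rw [Real.sqrt_mul (by norm_num)]; congr 1
    rw [show (4:ℝ) = 2^2 by norm_num, Real.sqrt_sq (by norm_num)]
  rw [this]
  apply Real.sqrt_le_sqrt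
  nlinarith [sq_nonneg a, sq_nonneg P, mul_nonneg (sq_nonneg a) (sq_nonneg P)]

lemma phi_le1 {N P a : ℝ} (hP : 0 < P) (ha : 1 ≤ a) : phi N P a ≤ 2 * √(P^3) := by
  rw [phi, div_le_iff₀ (by positivity)]
  have := FF_le (a := a) hP
  have h2 := GG_nonneg N a P
  have h3 : 0 ≤ √(P^3) := Real.sqrt_nonneg _
  nlinarith [one_le_pow₀ ha (n := 2)]

lemma phi_le2 {N P a : ℝ} (hN : 0 < N) (hP : 0 < P) (ha : 0 < a) : phi N P a ≤ 2 * N / √(P^3) := by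
  have hp : 0 < √(P^3) := Real.sqrt_pos.2 (by positivity)
  have hp2 : √(P^3)^2 = P^3 := Real.sq_sqrt (by positivity)
  rw [phi, div_le_div_iff₀ (by positivity) hp]
  have h1 := FF_le (a := a) hP
  have h2 := GG_nonneg N a P
  set p := √(P^3)
  rcases le_total (P^3) (a^2 * N) with h | h
  · have : FF a P * p ≤ 2 * p * p := mul_le_mul_of_nonneg_right h1 hp.le
    nlinarith
  · have h3 : GG N a P^2 = 4 * P^3 - 4 * a^2 * N := Real.sq_sqrt (by linarith)
    have h4 : GG N a P ≤ 2 * p := by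
      apply (pow_le_pow_iff_left₀ h2 (by positivity) two_ne_zero).1
      rw [h3, mul_pow, hp2]
      have : 0 < a^2 * N := by positivity
      linarith
    have h5 : GG N a P * GG N a P ≤ 2 * p * GG N a P := mul_le_mul_of_nonneg_right h4 h2
    have h6 : FF a P * p ≤ 2 * p * p := mul_le_mul_of_nonneg_right h1 hp.le
    nlinarith

lemma phi_le3 {N P a : ℝ} (hN : 0 < N) (hP : 0 < P) (ha : 1 ≤ a) : phi N P a ≤ 2 * √N := by
  have hp : 0 < √(P^3) := Real.sqrt_pos.2 (by positivity)
  rcases le_total (√(P^3)) (√N) with h | h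
  · exact (phi_le1 hP ha).trans (by linarith)
  · refine (phi_le2 hN hP (by linarith)).trans ?_
    rw [div_le_iff₀ hp]
    have : √N * √N = N := Real.mul_self_sqrt hN.le
    have h2 : 0 ≤ √N := Real.sqrt_nonneg _
    nlinarith

lemma phi_le4 {N P Q a : ℝ} (hN : 0 < N) (hQ : 0 < Q) (hP : Q^2 ≤ P) (ha : 1 ≤ a) : phi N P a ≤ 2 * N / Q^3 := by
  have hP0 : 0 < P := lt_of_lt_of_le (by positivity) hP
  refine (phi_le2 hN hP0 (by linarith)).trans ?_
  apply div_le_div_of_nonneg_left (by positivity) (by positivity)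
  apply Real.le_sqrt_of_sq_le
  calc (Q^3)^2 = (Q^2)^3 := by ring
    _ ≤ P^3 := pow_le_pow_left₀ (by positivity) hP 3
end Cnt
end

section
set_option linter.unusedSimpArgs false
set_option linter.unusedVariables false
set_option linter.unusedSectionVars false

namespace Cnt
noncomputable def psi (s : ℝ) : ℝ := √(1 - s^2) + s * Real.arcsin s

lemma psi_cont : Continuous psi := by unfold psi; fun_prop

lemma psi_ge_one {s : ℝ} (h : 1 ≤ s) : psi s = s * (Real.pi / 2) := by
  rw [psi, Real.arcsin_of_one_le h, Real.sqrt_eq_zero_of_nonpos (by nlinarith), zero_add]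

lemma psi_deriv {s : ℝ} (h0 : 0 < s) (h1 : s ≠ 1) : HasDerivAt psi (Real.arcsin s) s := by
  rcases lt_or_gt_of_ne h1 with h | h
  · have hpos : 0 < 1 - s^2 := by nlinarith
    have d1 : HasDerivAt (fun s : ℝ => 1 - s^2) (-(2 * s)) s := by
      simpa using ((hasDerivAt_id s).pow 2).const_sub 1
    have d2 := d1.sqrt hpos.ne'
    have d3 := (hasDerivAt_id s).mul (Real.hasDerivAt_arcsin (by linarith) h1)
    have d4 := d2.add d3
    refine d4.congr_deriv ?_
    simp only [id]
    have : √(1 - s^2) ≠ 0 := (Real.sqrt_pos.2 hpos).ne'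
    field_simp
    ring
  · have : psi =ᶠ[nhds s] fun t => t * (Real.pi / 2) := by
      filter_upwards [lt_mem_nhds h] with t ht
      exact psi_ge_one ht.le
    rw [Real.arcsin_of_one_le h.le]
    refine HasDerivAt.congr_of_eventuallyEq ?_ this
    simpa using (hasDerivAt_id s).mul_const (Real.pi / 2)

lemma psi_mono : MonotoneOn psi (Set.Ici 0) := by
  have m1 : MonotoneOn psi (Set.Icc 0 1) := by
    apply monotoneOn_of_hasDerivWithinAt_nonneg (f' := Real.arcsin) (convex_Icc 0 1) psi_cont.continuousOn
    · intro x hx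
      rw [interior_Icc] at hx
      exact (psi_deriv hx.1 hx.2.ne).hasDerivWithinAt
    · intro x hx
      rw [interior_Icc] at hx
      exact Real.arcsin_nonneg.2 hx.1.le
  have m2 : MonotoneOn psi (Set.Ici 1) := by
    intro a ha b hb hab
    rw [psi_ge_one ha, psi_ge_one hb]
    exact mul_le_mul_of_nonneg_right hab (by positivity)
  intro a ha b hb hab
  rcases le_total b 1 with h | h
  · exact m1 ⟨ha, hab.trans h⟩ ⟨hb, h⟩ hab
  · rcases le_total a 1 with h' | h'
    · exact (m1 ⟨ha, h'⟩ ⟨zero_le_one, le_rfl⟩ h').trans (m2 (Set.mem_Ici.2 le_rfl) h h)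
    · exact m2 h' h hab

lemma integral_sqrt_div {α β x y : ℝ} (hα : 0 < α) (hβ : 0 < β) (hx : 0 < x) (hxy : x ≤ y) :
    ∫ t in x..y, √(α^2 - β^2 * t^2) / t^2 = α / x * psi (β * x / α) - α / y * psi (β * y / α) := by
  have hc : ContinuousOn (fun t : ℝ => √(α^2 - β^2 * t^2) / t^2) (Set.uIcc x y) := by
    rw [Set.uIcc_of_le hxy]
    apply ContinuousOn.div
    · fun_prop
    · fun_prop
    · intro t ht
      have : 0 < t := lt_of_lt_of_le hx ht.1
      positivity
  have := MeasureTheory.integral_eq_of_hasDerivAt_off_countable (E := ℝ) (fun t => -(α / t * psi (β * t / α)))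
    (fun t => √(α^2 - β^2 * t^2) / t^2) (a := x) (b := y) (s := {α / β}) (Set.countable_singleton _) ?_ ?_ hc.intervalIntegrable
  · rw [this]; ring
  · rw [Set.uIcc_of_le hxy]
    apply ContinuousOn.neg
    apply ContinuousOn.mul
    · apply ContinuousOn.div continuousOn_const continuousOn_id
      intro t ht
      exact (lt_of_lt_of_le hx ht.1).ne'
    · exact (psi_cont.comp (by fun_prop)).continuousOn
  · rintro t ⟨ht, hne⟩
    rw [min_eq_left hxy] at ht
    have ht0 : 0 < t := hx.trans ht.1
    have hs0 : 0 < β * t / α := by positivity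
    have hs1 : β * t / α ≠ 1 := by
      intro h
      apply hne
      rw [div_eq_one_iff_eq hα.ne'] at h
      rw [Set.mem_singleton_iff, eq_div_iff hβ.ne', ← h]; ring
    have d1 : HasDerivAt (fun t : ℝ => β * t / α) (β / α) t := by
      simpa using ((hasDerivAt_id t).const_mul β).div_const α
    have d2 := (psi_deriv hs0 hs1).comp t d1
    have d3 : HasDerivAt (fun t : ℝ => α / t) (-(α / t^2)) t := by
      have := (hasDerivAt_inv ht0.ne').const_mul α
      refine (this.congr_deriv ?_)
      field_simp
    have d4 := (d3.mul d2).neg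
    refine d4.congr_deriv ?_
    have e1 : √(α^2 - β^2 * t^2) = α * √(1 - (β * t / α)^2) := by
      rw [show α^2 - β^2 * t^2 = α^2 * (1 - (β * t / α)^2) by field_simp]
      rw [Real.sqrt_mul (by positivity), Real.sqrt_sq hα.le]
    rw [e1]
    simp only [Function.comp, psi]
    field_simp
    ring

lemma phi_integral {N P x y : ℝ} (hN : 0 < N) (hP : 0 < P) (hPN : 3 * P^2 ≤ 4 * N) (hx : 0 < x) (hxy : x ≤ y) :
    ∫ t in x..y, phi N P t ≤ Real.pi * (√N - √3 / 2 * P) := by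
  set α := 2 * √(P^3) with hα
  have hα0 : 0 < α := by have : 0 < √(P^3) := Real.sqrt_pos.2 (by positivity)
                         positivity
  have hα2 : α^2 = 4 * P^3 := by rw [hα, mul_pow, Real.sq_sqrt (by positivity)]; norm_num
  set βf := √3 * P with hf
  set βg := 2 * √N with hg
  have hf0 : 0 < βf := by positivity
  have hg0 : 0 < βg := by positivity
  have hf2 : βf^2 = 3 * P^2 := by rw [hf, mul_pow, Real.sq_sqrt (by norm_num)]
  have hg2 : βg^2 = 4 * N := by rw [hg, mul_pow, Real.sq_sqrt hN.le]; norm_num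
  have hfg : βf ≤ βg := by
    apply (pow_le_pow_iff_left₀ hf0.le hg0.le two_ne_zero).1
    rw [hf2, hg2]; exact hPN
  have cont : ∀ β : ℝ, ∀ z w : ℝ, 0 < z → z ≤ w → IntervalIntegrable (fun t => √(α^2 - β^2 * t^2) / t^2) MeasureTheory.volume z w := by
    intro β z w hz hzw
    apply ContinuousOn.intervalIntegrable
    rw [Set.uIcc_of_le hzw]
    apply ContinuousOn.div
    · fun_prop
    · fun_prop
    · intro t ht
      have : 0 < t := lt_of_lt_of_le hz ht.1
      positivity
  have e : ∀ t, phi N P t = √(α^2 - βf^2 * t^2) / t^2 - √(α^2 - βg^2 * t^2) / t^2 := by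
    intro t
    rw [phi, FF, GG, hα2, hf2, hg2, sub_div]
    congr 3
    · ring_nf
    · ring_nf
  obtain ⟨Y, hyY, hYf⟩ : ∃ Y, y ≤ Y ∧ α / βf ≤ Y := ⟨max y (α / βf), le_max_left _ _, le_max_right _ _⟩
  have hxY := hxy.trans hyY
  have hY0 : 0 < Y := hx.trans_le hxY
  have ii : ∀ z w, 0 < z → z ≤ w → IntervalIntegrable (phi N P) MeasureTheory.volume z w := by
    intro z w hz hzw
    rw [show phi N P = fun t => _ from funext e]
    exact (cont _ _ _ hz hzw).sub (cont _ _ _ hz hzw)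
  have h1 : ∫ t in x..y, phi N P t ≤ ∫ t in x..Y, phi N P t := by
    rw [← intervalIntegral.integral_add_adjacent_intervals (ii x y hx hxy) (ii y Y (hx.trans_le hxy) hyY)]
    have : 0 ≤ ∫ t in y..Y, phi N P t := intervalIntegral.integral_nonneg hyY (fun t _ => phi_nonneg hPN)
    linarith
  refine h1.trans ?_
  rw [show phi N P = fun t => _ from funext e]
  rw [intervalIntegral.integral_sub (cont _ _ _ hx hxY) (cont _ _ _ hx hxY), integral_sqrt_div hα0 hf0 hx hxY, integral_sqrt_div hα0 hg0 hx hxY]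
  have hYf' : 1 ≤ βf * Y / α := by
    rw [le_div_iff₀ hα0, one_mul]
    rw [div_le_iff₀ hf0] at hYf; linarith
  have hYg' : 1 ≤ βg * Y / α := by
    refine hYf'.trans ?_
    gcongr
  rw [psi_ge_one hYf', psi_ge_one hYg']
  have hm : psi (βf * x / α) ≤ psi (βg * x / α) := by
    apply psi_mono
    · exact Set.mem_Ici.2 (by positivity)
    · exact Set.mem_Ici.2 (by positivity)
    · gcongr
  have hm2 : α / x * psi (βf * x / α) ≤ α / x * psi (βg * x / α) := mul_le_mul_of_nonneg_left hm (by positivity)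
  have e1 : ∀ β, α / Y * (β * Y / α * (Real.pi / 2)) = β * (Real.pi / 2) := by intro β; field_simp
  rw [e1, e1, show Real.pi * (√N - √3 / 2 * P) = βg * (Real.pi / 2) - βf * (Real.pi / 2) by rw [hf, hg]; ring]
  linarith

lemma phi_sum {N P x s : ℝ} (hN : 0 < N) (hP : 0 < P) (hPN : 3 * P^2 ≤ 4 * N) (hx : 1 ≤ x) (hs : 0 < s) (m : ℕ)
    {K : ℝ} (hK : ∀ a, 1 ≤ a → phi N P a ≤ K) :
    s * ∑ k ∈ Finset.range m, phi N P (x + s * k) ≤ Real.pi * (√N - √3 / 2 * P) + s * K := by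
  set u := max x (√(P^3 / N)) with hu
  have hxu : x ≤ u := le_max_left _ _
  have hsq : √(P^3 / N)^2 = P^3 / N := Real.sq_sqrt (by positivity)
  have h1 : MonotoneOn (phi N P) (Set.Icc x u) := by
    rcases le_total (√(P^3 / N)) x with h | h
    · rw [hu, max_eq_left h]
      intro a ha b hb hab
      have : a = b := le_antisymm hab (hb.2.trans ha.1)
      rw [this]
    · rw [hu, max_eq_right h]
      apply phi_mono hN hP hPN (by linarith)
      rw [hsq, div_mul_cancel₀ _ hN.ne']
  have h2 : AntitoneOn (phi N P) (Set.Ici u) := by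
    apply phi_anti hN.le (by linarith)
    have : √(P^3 / N)^2 ≤ u^2 := pow_le_pow_left₀ (Real.sqrt_nonneg _) (le_max_right _ _) 2
    rw [hsq, div_le_iff₀ hN] at this
    exact this
  have h3 := ap_unimodal_sum hs hxu m h1 h2 (fun t _ => phi_nonneg hPN)
  have h4 := phi_integral hN hP hPN (x := x) (y := x + s * m) (by linarith)
    (by nlinarith [mul_nonneg hs.le (Nat.cast_nonneg (α := ℝ) m)])
  have h5 := hK u (hx.trans hxu)
  nlinarith
end Cnt
end

section
set_option linter.unusedSimpArgs false
set_option linter.unusedVariables false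
set_option linter.unusedSectionVars false

namespace Cnt
noncomputable def MM (ν : ℝ) : ℝ := 2 * ν^10 / √3

lemma sqrt3_gt : (1.732 : ℝ) < √3 := by
  apply Real.lt_sqrt_of_sq_lt; norm_num

lemma MM_sq (ν : ℝ) : 3 * MM ν ^ 2 = 4 * ν^20 := by
  rw [MM, div_pow, Real.sq_sqrt (by norm_num)]; ring

lemma MM_pos {ν : ℝ} (h : 1 ≤ ν) : 0 < MM ν := by unfold MM; positivity

lemma MM_le {ν : ℝ} (h : 1 ≤ ν) : MM ν ≤ 1.2 * ν^10 := by
  unfold MM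
  rw [div_le_iff₀ (by positivity)]
  have := sqrt3_gt
  have h2 : 0 < ν^10 := by positivity
  nlinarith

lemma le_MM {ν : ℝ} (h : 1 ≤ ν) : ν^8 ≤ MM ν := by
  unfold MM
  rw [le_div_iff₀ (by positivity)]
  have h3 : √3 ≤ 2 := by rw [Real.sqrt_le_left (by norm_num)]; norm_num
  have h1 : ν^8 ≤ ν^10 := pow_le_pow_right₀ h (by norm_num)
  have h2 : 0 < ν^8 := by positivity
  nlinarith

lemma sqrt_nu {ν : ℝ} (h : 1 ≤ ν) : √(ν^20) = ν^10 := by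
  rw [show ν^20 = (ν^10)^2 by ring, Real.sqrt_sq (by positivity)]

lemma phi_contP (N a : ℝ) : Continuous (fun P => phi N P a) := by
  unfold phi FF GG
  fun_prop

lemma split_bound {ν s : ℝ} (hν : 1 ≤ ν) (hs : 0 ≤ s) {f c : ℝ → ℝ} (hf : Continuous f) (hc : Continuous c)
    (h : ∀ P K, 0 < P → 3 * P^2 ≤ 4 * ν^20 → (∀ a, 1 ≤ a → phi (ν^20) P a ≤ K) → f P ≤ c P + s * K) :
    ∫ P in (0:ℝ)..MM ν, f P ≤ (∫ P in (0:ℝ)..MM ν, c P) + s * (5 * ν^18) := by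
  have hN : 0 < ν^20 := by positivity
  have hle := le_MM hν
  have hM := MM_pos hν
  have h8 : 0 < ν^8 := by positivity
  have hP : ∀ P, 0 < P → P ≤ MM ν → 3 * P^2 ≤ 4 * ν^20 := by
    intro P h0 h1
    rw [← MM_sq]
    have : P^2 ≤ MM ν^2 := pow_le_pow_left₀ h0.le h1 2
    linarith
  rw [← intervalIntegral.integral_add_adjacent_intervals (hf.intervalIntegrable 0 (ν^8)) (hf.intervalIntegrable (ν^8) (MM ν)),
   ← intervalIntegral.integral_add_adjacent_intervals (hc.intervalIntegrable 0 (ν^8)) (hc.intervalIntegrable (ν^8) (MM ν))]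
  have h1 : ∫ P in (0:ℝ)..ν^8, f P ≤ ∫ P in (0:ℝ)..ν^8, (c P + s * (2 * ν^10)) := by
    apply intervalIntegral.integral_mono_on_of_le_Ioo h8.le (hf.intervalIntegrable _ _) ((hc.add continuous_const).intervalIntegrable _ _)
    intro P hPm
    apply h P _ hPm.1 (hP P hPm.1 (hPm.2.le.trans hle))
    intro a ha
    rw [← sqrt_nu hν]
    exact phi_le3 hN hPm.1 ha
  have h2 : ∫ P in ν^8..MM ν, f P ≤ ∫ P in ν^8..MM ν, (c P + s * (2 * ν^8)) := by
    apply intervalIntegral.integral_mono_on_of_le_Ioo hle (hf.intervalIntegrable _ _) ((hc.add continuous_const).intervalIntegrable _ _)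
    intro P hPm
    have hP0 : 0 < P := h8.trans hPm.1
    apply h P _ hP0 (hP P hP0 hPm.2.le)
    intro a ha
    have := phi_le4 (Q := ν^4) (P := P) hN (by positivity) (by rw [← pow_mul]; exact hPm.1.le) ha
    refine this.trans (le_of_eq ?_)
    field_simp
  rw [intervalIntegral.integral_add (hc.intervalIntegrable _ _) (by simp), intervalIntegral.integral_const, smul_eq_mul] at h1 h2
  have h3 := MM_le hν
  have h4 : (MM ν - ν^8) * (s * (2 * ν^8)) ≤ (1.2 * ν^10) * (s * (2 * ν^8)) :=
    mul_le_mul_of_nonneg_right (by linarith) (by positivity)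
  have h5 : (ν^8 - 0) * (s * (2 * ν^10)) + (1.2 * ν^10) * (s * (2 * ν^8)) = s * (4.4 * ν^18) := by ring
  have h6 : s * (4.4 * ν^18) ≤ s * (5 * ν^18) := by
    apply mul_le_mul_of_nonneg_left _ hs
    have : 0 < ν^18 := by positivity
    linarith
  linarith

lemma I_bound {ν a : ℝ} (hν : 1 ≤ ν) (ha : 1 ≤ a) : ∫ P in (0:ℝ)..MM ν, phi (ν^20) P a ≤ 5 * ν^18 := by
  have := split_bound hν (zero_le_one) (phi_contP (ν^20) a) (continuous_const (y := (0:ℝ))) (fun P K _ _ hK => by simpa using hK a ha)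
  simpa using this

lemma I_nonneg {ν a : ℝ} (hν : 1 ≤ ν) : 0 ≤ ∫ P in (0:ℝ)..MM ν, phi (ν^20) P a := by
  apply intervalIntegral.integral_nonneg (MM_pos hν).le
  intro P hP
  apply phi_nonneg
  rw [← MM_sq]
  have : P^2 ≤ MM ν^2 := pow_le_pow_left₀ hP.1 hP.2 2
  linarith

lemma I_sum {ν x s : ℝ} (hν : 1 ≤ ν) (hx : 1 ≤ x) (hs : 0 < s) (m : ℕ) :
    s * ∑ k ∈ Finset.range m, ∫ P in (0:ℝ)..MM ν, phi (ν^20) P (x + s * k) ≤ Real.pi * ν^20 / √3 + s * (5 * ν^18) := by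
  rw [← intervalIntegral.integral_finset_sum (fun k _ => (phi_contP _ _).intervalIntegrable _ _),
    ← intervalIntegral.integral_const_mul]
  have hc : Continuous (fun P : ℝ => Real.pi * (√(ν^20) - √3 / 2 * P)) := by fun_prop
  have hf : Continuous (fun P : ℝ => s * ∑ k ∈ Finset.range m, phi (ν^20) P (x + s * k)) := by
    apply continuous_const.mul
    exact continuous_finset_sum _ (fun k _ => phi_contP _ _)
  refine (split_bound hν hs.le hf hc (fun P K hP hPN hK => phi_sum (by positivity) hP hPN hx hs m hK)).trans ?_
  apply add_le_add_left
  rw [intervalIntegral.integral_const_mul, intervalIntegral.integral_sub (by simp) (by apply Continuous.intervalIntegrable; fun_prop),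
    intervalIntegral.integral_const_mul, intervalIntegral.integral_const, integral_id, sqrt_nu hν, smul_eq_mul]
  have h3 : √3 * √3 = 3 := Real.mul_self_sqrt (by norm_num)
  have h0 : √3 ≠ 0 := by positivity
  apply le_of_eq
  unfold MM
  field_simp
  ring
end Cnt
end

section
set_option linter.unusedSimpArgs false
set_option linter.unusedVariables false
set_option linter.unusedSectionVars false

namespace Cnt

lemma card_fib {α ι : Type*} [DecidableEq ι] (S : Finset α) (U : Finset ι) (g : α → ι) (f : ι → ℝ)
    (hT : ∀ p ∈ S, g p ∈ U) (hf : ∀ t ∈ U, ((S.filter (fun p => g p = t)).card : ℝ) ≤ f t) :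
    (S.card : ℝ) ≤ ∑ t ∈ U, f t := by
  rw [Finset.card_eq_sum_card_fiberwise (f := g) (t := U) hT]
  push_cast
  exact Finset.sum_le_sum hf

lemma ap_card {L : ℕ} (hL : 1 ≤ L) (r : ℤ) {x y : ℝ} (hxy : x ≤ y) (S : Finset ℤ)
    (h : ∀ d ∈ S, (L : ℤ) ∣ d - r ∧ x ≤ d ∧ (d : ℝ) ≤ y) : (S.card : ℝ) ≤ (y - x) / L + 1 := by
  have hL0 : (0:ℝ) < L := by exact_mod_cast hL
  have hLz : (0:ℤ) < L := by exact_mod_cast hL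
  have key : S.card ≤ (Finset.Icc ⌈(x - r) / L⌉ ⌊(y - r) / L⌋).card := by
    apply Finset.card_le_card_of_injOn (fun d => (d - r) / L)
    · intro d hd
      obtain ⟨⟨e, he⟩, h1, h2⟩ := h d hd
      have hd' : (d - r) / (L : ℤ) = e := by rw [he, Int.mul_ediv_cancel_left _ hLz.ne']
      have hR : (d : ℝ) = r + L * e := by
        have : d = r + L * e := by linarith
        exact_mod_cast this
      simp only [Finset.coe_Icc, Set.mem_Icc, hd']
      constructor
      · rw [Int.ceil_le, div_le_iff₀ hL0]; linarith
      · rw [Int.le_floor, le_div_iff₀ hL0]; linarith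
    · intro d hd d' hd' he
      obtain ⟨⟨e, he1⟩, -⟩ := h d hd
      obtain ⟨⟨e', he2⟩, -⟩ := h d' hd'
      simp only [he1, he2, Int.mul_ediv_cancel_left _ hLz.ne'] at he
      rw [he] at he1; linarith
  rw [Int.card_Icc] at key
  have h1 : ((⌊(y - r) / L⌋ + 1 - ⌈(x - r) / L⌉).toNat : ℝ) ≤ (y - x) / L + 1 := by
    have hf := Int.floor_le ((y - r) / (L:ℝ))
    have hc := Int.le_ceil ((x - r) / (L:ℝ))
    have e : (y - x) / (L:ℝ) = (y - r) / L - (x - r) / L := by ring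
    have h0 : 0 ≤ (y - x) / (L:ℝ) := div_nonneg (by linarith) hL0.le
    rcases le_total (⌊(y - r) / (L:ℝ)⌋ + 1 - ⌈(x - r) / (L:ℝ)⌉) 0 with h | h
    · rw [Int.toNat_of_nonpos h]; push_cast; linarith
    · have : (((⌊(y - r) / (L:ℝ)⌋ + 1 - ⌈(x - r) / (L:ℝ)⌉).toNat : ℤ) : ℝ) = ((⌊(y - r) / (L:ℝ)⌋ + 1 - ⌈(x - r) / (L:ℝ)⌉ : ℤ) : ℝ) := by
        rw [Int.toNat_of_nonneg h]
      rw [Int.cast_natCast] at this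
      rw [this]; push_cast; linarith
  calc (S.card : ℝ) ≤ _ := by exact_mod_cast key
    _ ≤ _ := h1

/-- analytic conditions on a form -/
def Fm (N : ℝ) (a b c d : ℤ) : Prop := 1 ≤ a ∧ -a < 2 * b ∧ 2 * b ≤ a ∧ 0 < b^2 - a * c ∧
  ∃ n : ℤ, (n : ℝ) ≤ N ∧ 3 * (b^2 - a * c)^2 ≤ 4 * n ∧
    (a^2 * d - 3 * a * b * c + 2 * b^3)^2 + 4 * n * a^2 = 4 * (b^2 - a * c)^3

lemma Fm.G {N : ℝ} {a b c d : ℤ} (h : Fm N a b c d) :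
    let P : ℝ := b^2 - a * c
    let G : ℝ := a^2 * d - 3 * a * b * c + 2 * b^3
    (GG N a P ≤ G ∧ G ≤ FF a P) ∨ (-FF a P ≤ G ∧ G ≤ - GG N a P) := by
  intro P G
  obtain ⟨h1, h2, h3, h4, n, hn, h5, h6⟩ := h
  have h5' : 3 * P^2 ≤ 4 * n := by simp only [P]; exact_mod_cast h5
  have h6' : G^2 + 4 * n * a^2 = 4 * P^3 := by simp only [P, G]; exact_mod_cast h6
  have ha : (0:ℝ) ≤ (a:ℝ)^2 := sq_nonneg _
  have k1 : GG N a P ≤ |G| := by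
    rw [GG]; apply Real.sqrt_le_iff.2
    refine ⟨abs_nonneg _, ?_⟩
    rw [sq_abs]; nlinarith
  have k2 : |G| ≤ FF a P := by
    apply Real.le_sqrt_of_sq_le
    rw [sq_abs]; nlinarith
  rcases abs_cases G with ⟨e, _⟩ | ⟨e, _⟩
  · left; rw [e] at k1 k2; exact ⟨k1, k2⟩
  · right; rw [e] at k1 k2; constructor <;> linarith

lemma Fm.P3 {N : ℝ} {a b c d : ℤ} (h : Fm N a b c d) : 3 * ((b:ℝ)^2 - a * c)^2 ≤ 4 * N := by
  obtain ⟨h1, h2, h3, h4, n, hn, h5, h6⟩ := h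
  have h5' : 3 * ((b:ℝ)^2 - a * c)^2 ≤ 4 * n := by exact_mod_cast h5
  linarith

lemma Fm.aP {N : ℝ} {a b c d : ℤ} (h : Fm N a b c d) : 3 * (a:ℝ)^2 ≤ 4 * ((b:ℝ)^2 - a * c) := by
  obtain ⟨h1, h2, h3, h4, n, hn, h5, h6⟩ := h
  have : 3 * a^2 ≤ 4 * (b^2 - a * c) := by
    by_contra hc
    push Not at hc
    have hP : 0 < (b^2 - a * c)^2 := by positivity
    nlinarith [sq_nonneg (a^2 * d - 3 * a * b * c + 2 * b^3), sq_nonneg a]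
  exact_mod_cast this

lemma d_level {L : ℕ} (hL : 1 ≤ L) (r4 : ℤ) {N : ℝ} {a b c : ℤ} (S : Finset ℤ)
    (h : ∀ d ∈ S, (L : ℤ) ∣ d - r4 ∧ Fm N a b c d) (hP : 3 * ((b:ℝ)^2 - a * c)^2 ≤ 4 * N) (ha : 1 ≤ a) :
    (S.card : ℝ) ≤ 2 / (a^2 * L) * (FF a (b^2 - a * c) - GG N a (b^2 - a * c)) + 2 := by
  classical
  set P : ℝ := b^2 - a * c with hPd
  have hL0 : (0:ℝ) < L := by exact_mod_cast hL
  have ha0 : (0:ℝ) < (a:ℝ)^2 := by have : (0:ℝ) < a := by exact_mod_cast ha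
                                   positivity
  set h0 : ℝ := 3 * a * b * c - 2 * b^3 with hh0
  have hGF := GG_le_FF (a := (a:ℝ)) hP
  set F := FF a P
  set Gg := GG N a P
  set S1 := S.filter (fun d : ℤ => (Gg + h0) / a^2 ≤ d ∧ (d:ℝ) ≤ (F + h0) / a^2)
  set S2 := S.filter (fun d : ℤ => (-F + h0) / a^2 ≤ d ∧ (d:ℝ) ≤ (-Gg + h0) / a^2)
  have hS : S ⊆ S1 ∪ S2 := by
    intro d hd
    have := (h d hd).2.G
    simp only at this
    rcases this with ⟨q1, q2⟩ | ⟨q1, q2⟩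
    · refine Finset.mem_union_left _ (Finset.mem_filter.2 ⟨hd, ?_, ?_⟩)
      · rw [div_le_iff₀ ha0]; simp only [Gg, hh0, P] at *; linarith
      · rw [le_div_iff₀ ha0]; simp only [F, hh0, P] at *; linarith
    · refine Finset.mem_union_right _ (Finset.mem_filter.2 ⟨hd, ?_, ?_⟩)
      · rw [div_le_iff₀ ha0]; simp only [F, hh0, P] at *; linarith
      · rw [le_div_iff₀ ha0]; simp only [Gg, hh0, P] at *; linarith
  have c1 := ap_card hL r4 (x := (Gg + h0) / a^2) (y := (F + h0) / a^2) (by gcongr) S1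
    (fun d hd => by
      have := Finset.mem_filter.1 hd
      exact ⟨(h d this.1).1, this.2⟩)
  have c2 := ap_card hL r4 (x := (-F + h0) / a^2) (y := (-Gg + h0) / a^2) (by gcongr) S2
    (fun d hd => by
      have := Finset.mem_filter.1 hd
      exact ⟨(h d this.1).1, this.2⟩)
  have c3 : (S.card : ℝ) ≤ S1.card + S2.card := by
    exact_mod_cast (Finset.card_le_card hS).trans (Finset.card_union_le _ _)
  have e1 : ((F + h0) / a^2 - (Gg + h0) / a^2) / L = 1 / (a^2 * L) * (F - Gg) := by field_simp; ring
  have e2 : ((-Gg + h0) / a^2 - (-F + h0) / a^2) / L = 1 / (a^2 * L) * (F - Gg) := by field_simp; ring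
  rw [e1] at c1; rw [e2] at c2
  have e3 : 2 / (a^2 * L) * (F - Gg) = 1 / (a^2 * L) * (F - Gg) + 1 / (a^2 * L) * (F - Gg) := by ring
  rw [e3]; linarith

lemma c_level {L : ℕ} (hL : 1 ≤ L) (r3 r4 : ℤ) {ν : ℝ} (hν : 1 ≤ ν) {a b : ℤ} (S : Finset (ℤ × ℤ)) (ha : 1 ≤ a)
    (h : ∀ p ∈ S, (L : ℤ) ∣ p.1 - r3 ∧ (L : ℤ) ∣ p.2 - r4 ∧ Fm (ν^20) a b p.1 p.2) :
    (S.card : ℝ) ≤ 2 / (a * L^2) * (∫ P in (0:ℝ)..MM ν, phi (ν^20) P a) + 8 * √(MM ν^3) / a^2 + 2 * MM ν / a + 2 := by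
  classical
  have hL0 : (0:ℝ) < L := by exact_mod_cast hL
  have hLz : (0:ℤ) < L := by exact_mod_cast hL
  have ha0 : (0:ℝ) < a := by exact_mod_cast ha
  have hM := MM_pos hν
  set M := MM ν
  set s : ℤ := a * L with hs
  have hs0 : 0 < s := by positivity
  have hsR : (0:ℝ) < s := by exact_mod_cast hs0
  set x : ℤ := (b^2 - a * r3 - 1) % s + 1 with hx
  have hx1 : 1 ≤ x := by have := Int.emod_nonneg (b^2 - a * r3 - 1) hs0.ne'; omega
  have hx2 : x ≤ s := by have := Int.emod_lt_of_pos (b^2 - a * r3 - 1) hs0; omega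
  obtain ⟨w, hw⟩ : s ∣ (b^2 - a * r3) - x := by
    have := Int.mul_ediv_add_emod (b^2 - a * r3 - 1) s
    exact ⟨(b^2 - a * r3 - 1) / s, by linarith⟩
  have hx1R : (0:ℝ) < x := by exact_mod_cast hx1
  have hx2R : (x:ℝ) ≤ s := by exact_mod_cast hx2
  set m : ℕ := if (x:ℝ) ≤ M then ⌊(M - x) / s⌋₊ + 1 else 0 with hm
  have hm1 : (x:ℝ) + s * m - s ≤ M := by
    rw [hm]; split_ifs with hxM
    · have := Nat.floor_le (a := (M - x) / s) (div_nonneg (by linarith) hsR.le)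
      rw [le_div_iff₀ hsR] at this
      push_cast; linarith
    · simp; linarith
  have hm2 : M ≤ (x:ℝ) + s * m := by
    rw [hm]; split_ifs with hxM
    · have := Nat.lt_floor_add_one ((M - x) / (s:ℝ))
      rw [div_lt_iff₀ hsR] at this
      push_cast; linarith
    · simp; linarith
  have hPk : ∀ p ∈ S, ∃ k : ℕ, b^2 - a * p.1 = x + s * k ∧ k < m := by
    intro p hp
    obtain ⟨⟨e, he⟩, -, hF⟩ := h p hp
    have e1 : b^2 - a * p.1 = x + s * (w - e) := by
      have : p.1 = r3 + L * e := by linarith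
      rw [this, hs] at *
      linarith
    have hp4 := hF.2.2.2.1
    have hk : 0 ≤ w - e := by
      by_contra hc
      push Not at hc
      have : s * (w - e) ≤ s * (-1) := mul_le_mul_of_nonneg_left (by omega) hs0.le
      linarith
    refine ⟨(w - e).toNat, by rw [Int.toNat_of_nonneg hk]; exact e1, ?_⟩
    have hP3 := hF.P3
    have hPM : ((b:ℝ)^2 - a * p.1) ≤ M := by
      have := MM_sq ν
      apply abs_le_of_sq_le_sq' _ hM.le |>.2
      linarith
    have e2 : ((b:ℝ)^2 - a * p.1) = x + s * ((w - e).toNat : ℕ) := by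
      have : b^2 - a * p.1 = x + s * ((w - e).toNat : ℕ) := by rw [Int.toNat_of_nonneg hk]; exact e1
      exact_mod_cast this
    rw [e2] at hPM
    have hk0 : (0:ℝ) ≤ ((w-e).toNat : ℝ) := by positivity
    have hxM : (x:ℝ) ≤ M := by nlinarith
    rw [hm, if_pos hxM, Nat.lt_add_one_iff, Nat.le_floor_iff (div_nonneg (by linarith) hsR.le), le_div_iff₀ hsR]
    linarith
  have hcard : (S.card : ℝ) ≤ ∑ k ∈ Finset.range m, (2 / (a^2 * L) * (FF a (x + s * k) - GG (ν^20) a (x + s * k)) + 2) := by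
    apply card_fib S (Finset.range m) (fun p => ((b^2 - a * p.1 - x) / s).toNat)
    · intro p hp
      obtain ⟨k, hk, hkm⟩ := hPk p hp
      simp only [Finset.mem_range]
      rw [hk, add_sub_cancel_left, Int.mul_ediv_cancel_left _ hs0.ne', Int.toNat_natCast]; exact hkm
    · intro k hk
      have hval : ∀ p ∈ S.filter (fun p => ((b^2 - a * p.1 - x) / s).toNat = k), b^2 - a * p.1 = x + s * k := by
        intro p hp
        rw [Finset.mem_filter] at hp
        obtain ⟨k', hk', -⟩ := hPk p hp.1
        have := hp.2
        rw [hk', add_sub_cancel_left, Int.mul_ediv_cancel_left _ hs0.ne', Int.toNat_natCast] at this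
        rw [hk', this]
      set S' := S.filter (fun p => ((b^2 - a * p.1 - x) / s).toNat = k) with hS'
      have hk' := Finset.mem_range.1 hk
      have hPM : (x:ℝ) + s * k ≤ M := by
        have : (k:ℝ) + 1 ≤ m := by exact_mod_cast hk'
        nlinarith
      have hP3 : 3 * ((x:ℝ) + s * k)^2 ≤ 4 * ν^20 := by
        rw [← MM_sq ν]
        have : 0 ≤ (x:ℝ) + s * k := by positivity
        gcongr
      rcases S'.eq_empty_or_nonempty with he | ⟨p0, hp0⟩
      · rw [he]
        simp only [Finset.card_empty, Nat.cast_zero]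
        have := GG_le_FF (a := (a:ℝ)) hP3
        have : 0 ≤ 2 / ((a:ℝ)^2 * L) * (FF a (x + s * k) - GG (ν^20) a (x + s * k)) :=
          mul_nonneg (by positivity) (by linarith)
        linarith
      · have hv0 := hval p0 hp0
        have e0 : ((b:ℝ)^2 - a * p0.1) = x + s * k := by exact_mod_cast hv0
        have hinj : (S'.image Prod.snd).card = S'.card := by
          apply Finset.card_image_of_injOn
          intro p hp q hq hpq
          have h1 := hval p hp
          have h2 := hval q hq
          have : p.1 = q.1 := by
            have : a * p.1 = a * q.1 := by linarith
            exact mul_left_cancel₀ (by omega) this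
          exact Prod.ext this hpq
        rw [← hinj]
        have := d_level hL r4 (N := ν^20) (a := a) (b := b) (c := p0.1) (S'.image Prod.snd) (by
          intro d hd
          obtain ⟨p, hp, rfl⟩ := Finset.mem_image.1 hd
          have h1 := hval p hp
          have hpe : p.1 = p0.1 := by
            have : a * p.1 = a * p0.1 := by linarith
            exact mul_left_cancel₀ (by omega) this
          have := h p (Finset.mem_filter.1 hp).1
          rw [← hpe]; exact this.2) (by rw [e0]; exact hP3) ha
        rw [e0] at this
        exact this
  have hd := ap_diff_sum (F := FF a) (g := GG (ν^20) a) (FF_mono _) (GG_mono _ _) (fun t ht => FF_zero' ht)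
    (fun t ht => GG_zero' (by positivity) ht) hsR hx1R hx2R hM.le m hm1 hm2
  rw [Finset.sum_add_distrib, ← Finset.mul_sum] at hcard
  simp only [Finset.sum_const, Finset.card_range, nsmul_eq_mul] at hcard
  have hI : (∫ t in (0:ℝ)..M, (FF a t - GG (ν^20) a t)) = a^2 * ∫ P in (0:ℝ)..M, phi (ν^20) P a := by
    rw [← intervalIntegral.integral_const_mul]
    congr 1; ext t; rw [phi]; field_simp
  rw [hI] at hd
  set I := ∫ P in (0:ℝ)..M, phi (ν^20) P a
  set Sg := ∑ k ∈ Finset.range m, (FF a (x + s * k) - GG (ν^20) a (x + s * k))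
  have hFM : FF a M + GG (ν^20) a M ≤ 4 * √(M^3) := by
    have := FF_le (a := (a:ℝ)) hM
    have h2 := GG_le_FF (N := ν^20) (a := (a:ℝ)) (P := M) (by rw [MM_sq])
    linarith
  have hSg : Sg ≤ a^2 * I / s + 4 * √(M^3) := by
    have : Sg ≤ (a^2 * I + s * (4 * √(M^3))) / s := by
      rw [le_div_iff₀ hsR]; nlinarith
    calc Sg ≤ _ := this
      _ = _ := by field_simp
  have hmM : (m:ℝ) ≤ M / a + 1 := by
    have e : (s:ℝ) = a * L := by rw [hs]; push_cast; ring
    have h1 : (s:ℝ) * m ≤ M + s := by linarith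
    have hL1 : (1:ℝ) ≤ L := by exact_mod_cast hL
    have h2 : (m:ℝ) ≤ M / s + 1 := by
      rw [← sub_le_iff_le_add, le_div_iff₀ hsR]; linarith
    have h3 : M / s ≤ M / a := by
      rw [e]; gcongr; nlinarith
    linarith
  have hL1 : (1:ℝ) ≤ L := by exact_mod_cast hL
  calc (S.card : ℝ) ≤ _ := hcard
    _ ≤ 2 / (a^2 * L) * (a^2 * I / s + 4 * √(M^3)) + (M / a + 1) * 2 := by gcongr
    _ = 2 / (a * L^2) * I + 8 * √(M^3) / (a^2 * L) + 2 * M / a + 2 := by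
        rw [hs]; push_cast; field_simp; ring
    _ ≤ _ := by
        gcongr
        nlinarith [sq_nonneg (a:ℝ)]

lemma b_level {L : ℕ} (hL : 1 ≤ L) (r2 r3 r4 : ℤ) {ν : ℝ} (hν : 1 ≤ ν) {a : ℤ} (S : Finset (ℤ × ℤ × ℤ)) (ha : 1 ≤ a)
    (h : ∀ p ∈ S, (L : ℤ) ∣ p.1 - r2 ∧ (L : ℤ) ∣ p.2.1 - r3 ∧ (L : ℤ) ∣ p.2.2 - r4 ∧ Fm (ν^20) a p.1 p.2.1 p.2.2) :
    (S.card : ℝ) ≤ 2 / L^3 * (∫ P in (0:ℝ)..MM ν, phi (ν^20) P a) + 2 * (1 / a) * (5 * ν^18) + 16 * √(MM ν^3) * (1 / a)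
      + 4 * MM ν + 4 * a := by
  classical
  have hL0 : (0:ℝ) < L := by exact_mod_cast hL
  have hL1 : (1:ℝ) ≤ L := by exact_mod_cast hL
  have ha1 : (1:ℝ) ≤ a := by exact_mod_cast ha
  have ha0 : (0:ℝ) < a := by linarith
  have hM := MM_pos hν
  have hIb := I_bound hν ha1
  have hI0 := I_nonneg (a := (a:ℝ)) hν
  set I := ∫ P in (0:ℝ)..MM ν, phi (ν^20) P a
  set K : ℝ := 2 / (a * L^2) * I + 8 * √(MM ν^3) / a^2 + 2 * MM ν / a + 2 with hK
  have hK0 : 0 ≤ K := by positivity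
  have h1 : (S.card : ℝ) ≤ ∑ b ∈ S.image Prod.fst, K := by
    apply card_fib S (S.image Prod.fst) Prod.fst
    · intro p hp; exact Finset.mem_image_of_mem _ hp
    · intro b hb
      have hinj : ((S.filter (fun p => p.1 = b)).image Prod.snd).card = (S.filter (fun p => p.1 = b)).card := by
        apply Finset.card_image_of_injOn
        intro p hp q hq hpq
        have hp := (Finset.mem_filter.1 hp).2
        have hq := (Finset.mem_filter.1 hq).2
        exact Prod.ext (hp.trans hq.symm) hpq
      rw [← hinj]
      apply c_level hL r3 r4 hν (b := b) _ ha
      intro q hq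
      obtain ⟨p, hp, rfl⟩ := Finset.mem_image.1 hq
      obtain ⟨hp1, hp2⟩ := Finset.mem_filter.1 hp
      have := h p hp1
      rw [← hp2]; exact this.2
  rw [Finset.sum_const, nsmul_eq_mul] at h1
  have h2 := ap_card hL r2 (x := -(a/2)) (y := a / 2) (by linarith) (S.image Prod.fst) (by
    intro b hb
    obtain ⟨p, hp, rfl⟩ := Finset.mem_image.1 hb
    obtain ⟨g1, -, -, g2⟩ := h p hp
    refine ⟨g1, ?_, ?_⟩
    · have : -(a:ℝ) < 2 * p.1 := by exact_mod_cast g2.2.1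
      linarith
    · have : 2 * (p.1 : ℝ) ≤ a := by exact_mod_cast g2.2.2.1
      linarith)
  have h3 : (a:ℝ) / L + 1 ≤ 2 * a := by
    have : (a:ℝ) / L ≤ a := div_le_self ha0.le hL1
    linarith
  have e : ((a:ℝ) / 2 - -(a / 2)) = a := by ring
  rw [e] at h2
  calc (S.card : ℝ) ≤ _ := h1
    _ ≤ (a / L + 1) * K := by gcongr
    _ = 2 / L^3 * I + 2 * (1 / a) * (1 / L^2 * I) + (a / L + 1) * (8 * √(MM ν^3) / a^2 + 2 * MM ν / a + 2) := by
        rw [hK]; field_simp; ring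
    _ ≤ 2 / L^3 * I + 2 * (1 / a) * (5 * ν^18) + (2 * a) * (8 * √(MM ν^3) / a^2 + 2 * MM ν / a + 2) := by
        have : 1 / (L:ℝ)^2 * I ≤ 5 * ν^18 := by
          have : 1 / (L:ℝ)^2 ≤ 1 := by rw [div_le_one (by positivity)]; nlinarith
          nlinarith
        gcongr
    _ = _ := by field_simp; ring

lemma MM15 {ν : ℝ} (hν : 1 ≤ ν) : √(MM ν^3) ≤ 1.5 * ν^15 := by
  apply Real.sqrt_le_iff.2
  refine ⟨by positivity, ?_⟩
  have := pow_le_pow_left₀ (MM_pos hν).le (MM_le hν) 3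
  have h30 : 0 < ν^30 := by positivity
  nlinarith

theorem a_level {L : ℕ} (hL : 1 ≤ L) (r1 r2 r3 r4 : ℤ) {ν : ℝ} (hν : 1 ≤ ν) (S : Finset (ℤ × ℤ × ℤ × ℤ))
    (h : ∀ p ∈ S, (L : ℤ) ∣ p.1 - r1 ∧ (L : ℤ) ∣ p.2.1 - r2 ∧ (L : ℤ) ∣ p.2.2.1 - r3 ∧ (L : ℤ) ∣ p.2.2.2 - r4 ∧
      Fm (ν^20) p.1 p.2.1 p.2.2.1 p.2.2.2) :
    (S.card : ℝ) ≤ (2 * Real.pi / √3) / L^4 * ν^20 + 300 * ν^19 := by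
  classical
  have hL0 : (0:ℝ) < L := by exact_mod_cast hL
  have hL1 : (1:ℝ) ≤ L := by exact_mod_cast hL
  have hLz : (0:ℤ) < L := by exact_mod_cast hL
  have hM := MM_pos hν
  set x : ℤ := (r1 - 1) % L + 1 with hx
  have hx1 : 1 ≤ x := by have := Int.emod_nonneg (r1 - 1) hLz.ne'; omega
  have hx2 : x ≤ L := by have := Int.emod_lt_of_pos (r1 - 1) hLz; omega
  have hx1R : (1:ℝ) ≤ x := by exact_mod_cast hx1
  obtain ⟨w, hw⟩ : (L:ℤ) ∣ r1 - x := by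
    have := Int.mul_ediv_add_emod (r1 - 1) L
    exact ⟨(r1 - 1) / L, by linarith⟩
  set Y : ℝ := 2 * ν^5 with hY
  have hν5 : 1 ≤ ν^5 := one_le_pow₀ hν
  set m : ℕ := if (x:ℝ) ≤ Y then ⌊(Y - x) / L⌋₊ + 1 else 0 with hm
  have hm1 : ∀ k < m, (x:ℝ) + L * k ≤ Y := by
    intro k hk
    rw [hm] at hk; split_ifs at hk with hxM
    · rw [Nat.lt_add_one_iff, Nat.le_floor_iff (div_nonneg (by linarith) hL0.le), le_div_iff₀ hL0] at hk
      linarith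
    · simp at hk
  have hmY : (m:ℝ) ≤ Y := by
    rcases Nat.eq_zero_or_pos m with h0 | h0
    · rw [h0]; push_cast; positivity
    · have := hm1 (m - 1) (by omega)
      rw [Nat.cast_sub h0] at this
      have h1 : (1:ℝ) ≤ m := by exact_mod_cast h0
      push_cast at this
      nlinarith
  have hPk : ∀ p ∈ S, ∃ k : ℕ, p.1 = x + L * k ∧ k < m := by
    intro p hp
    obtain ⟨⟨e, he⟩, -, -, -, hF⟩ := h p hp
    have e1 : p.1 = x + L * (w + e) := by linarith
    have hp4 := hF.1
    have hk : 0 ≤ w + e := by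
      by_contra hc
      push Not at hc
      have : (L:ℤ) * (w + e) ≤ L * (-1) := mul_le_mul_of_nonneg_left (by omega) hLz.le
      linarith
    refine ⟨(w + e).toNat, by rw [Int.toNat_of_nonneg hk]; exact e1, ?_⟩
    have hP3 := hF.P3
    have hPM : ((p.2.1:ℝ)^2 - p.1 * p.2.2.1) ≤ MM ν := by
      have := MM_sq ν
      apply (abs_le_of_sq_le_sq' _ hM.le).2
      linarith
    have haP := hF.aP
    have haY : (p.1 : ℝ) ≤ Y := by
      have := MM_le hν
      apply (abs_le_of_sq_le_sq' _ (by positivity)).2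
      have : 0 < ν^10 := by positivity
      rw [hY]; nlinarith
    have e2 : (p.1 : ℝ) = x + L * ((w + e).toNat : ℕ) := by
      have : p.1 = x + L * ((w + e).toNat : ℕ) := by rw [Int.toNat_of_nonneg hk]; exact e1
      exact_mod_cast this
    rw [e2] at haY
    have hk0 : (0:ℝ) ≤ ((w+e).toNat : ℝ) := by positivity
    have hxM : (x:ℝ) ≤ Y := by nlinarith
    rw [hm, if_pos hxM, Nat.lt_add_one_iff, Nat.le_floor_iff (div_nonneg (by linarith) hL0.le), le_div_iff₀ hL0]
    linarith
  have hcard : (S.card : ℝ) ≤ ∑ k ∈ Finset.range m, (2 / L^3 * (∫ P in (0:ℝ)..MM ν, phi (ν^20) P (x + L * k)) +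
      (10 * ν^18 + 16 * √(MM ν^3)) * (1 / (x + L * k)) + (4 * MM ν + 4 * Y)) := by
    apply card_fib S (Finset.range m) (fun p => ((p.1 - x) / L).toNat)
    · intro p hp
      obtain ⟨k, hk, hkm⟩ := hPk p hp
      simp only [Finset.mem_range]
      rw [hk, add_sub_cancel_left, Int.mul_ediv_cancel_left _ hLz.ne', Int.toNat_natCast]; exact hkm
    · intro k hk
      have hval : ∀ p ∈ S.filter (fun p => ((p.1 - x) / (L:ℤ)).toNat = k), p.1 = x + L * k := by
        intro p hp
        rw [Finset.mem_filter] at hp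
        obtain ⟨k', hk', -⟩ := hPk p hp.1
        have := hp.2
        rw [hk', add_sub_cancel_left, Int.mul_ediv_cancel_left _ hLz.ne', Int.toNat_natCast] at this
        rw [hk', this]
      set S' := S.filter (fun p => ((p.1 - x) / (L:ℤ)).toNat = k) with hS'
      have hkY := hm1 k (Finset.mem_range.1 hk)
      have hinj : (S'.image Prod.snd).card = S'.card := by
        apply Finset.card_image_of_injOn
        intro p hp q hq hpq
        exact Prod.ext ((hval p hp).trans (hval q hq).symm) hpq
      rw [← hinj]
      have hk0 : (0:ℤ) ≤ L * k := by positivity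
      have := b_level hL r2 r3 r4 hν (a := x + L * k) (S'.image Prod.snd) (by omega) (by
        intro q hq
        obtain ⟨p, hp, rfl⟩ := Finset.mem_image.1 hq
        have := h p (Finset.mem_filter.1 hp).1
        rw [← hval p hp]; exact this.2)
      push_cast at this
      refine this.trans ?_
      linarith
  have hS1 := I_sum hν hx1R hL0 m
  rw [Finset.sum_add_distrib, Finset.sum_add_distrib, ← Finset.mul_sum, ← Finset.mul_sum] at hcard
  simp only [Finset.sum_const, Finset.card_range, nsmul_eq_mul] at hcard
  have hS2 : ∑ k ∈ Finset.range m, (1 / ((x:ℝ) + L * k)) ≤ 5 * ν := by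
    have h1 : ∑ k ∈ Finset.range m, (1 / ((x:ℝ) + L * k)) ≤ (harmonic m : ℝ) := by
      rw [harmonic]; push_cast
      apply Finset.sum_le_sum
      intro k _
      rw [← one_div]
      have : (k:ℝ) ≤ L * k := le_mul_of_one_le_left (by positivity) hL1
      exact one_div_le_one_div_of_le (by positivity) (by linarith)
    have h2 := harmonic_le_one_add_log m
    have h3 : Real.log m ≤ 5 * ν - 1 := by
      rcases Nat.eq_zero_or_pos m with h0 | h0
      · rw [h0]; simp; linarith
      · have hm0 : (0:ℝ) < m := by exact_mod_cast h0
        have := Real.log_le_log hm0 hmY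
        rw [hY, Real.log_mul (by norm_num) (by positivity), Real.log_pow] at this
        have l2 := Real.log_two_lt_d9
        have l3 := Real.log_le_sub_one_of_pos (show 0 < ν by linarith)
        push_cast at this
        linarith
    linarith
  have hM15 := MM15 hν
  have hMl := MM_le hν
  have p1 : ν^16 ≤ ν^19 := pow_le_pow_right₀ hν (by norm_num)
  have p2 : ν^15 ≤ ν^19 := pow_le_pow_right₀ hν (by norm_num)
  have p3 : ν^10 ≤ ν^19 := pow_le_pow_right₀ hν (by norm_num)
  have p4 : ν^18 ≤ ν^19 := pow_le_pow_right₀ hν (by norm_num)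
  have t1 : 2 / (L:ℝ)^3 * (∑ k ∈ Finset.range m, ∫ P in (0:ℝ)..MM ν, phi (ν^20) P (x + L * k)) ≤
      (2 * Real.pi / √3) / L^4 * ν^20 + 10 * ν^18 := by
    have : (∑ k ∈ Finset.range m, ∫ P in (0:ℝ)..MM ν, phi (ν^20) P (x + L * k)) ≤ (Real.pi * ν^20 / √3) / L + 5 * ν^18 := by
      have : (∑ k ∈ Finset.range m, ∫ P in (0:ℝ)..MM ν, phi (ν^20) P (x + L * k)) ≤ (Real.pi * ν^20 / √3 + L * (5 * ν^18)) / L := by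
        rw [le_div_iff₀ hL0]; linarith
      refine this.trans (le_of_eq ?_)
      field_simp
    calc _ ≤ 2 / (L:ℝ)^3 * ((Real.pi * ν^20 / √3) / L + 5 * ν^18) := by gcongr
      _ = (2 * Real.pi / √3) / L^4 * ν^20 + 10 * ν^18 * (1 / L^3) := by field_simp; ring
      _ ≤ _ := by
        have : 1 / (L:ℝ)^3 ≤ 1 := by rw [div_le_one (by positivity)]; exact one_le_pow₀ hL1
        have : 0 < ν^18 := by positivity
        nlinarith
  have t2 : (10 * ν^18 + 16 * √(MM ν^3)) * ∑ k ∈ Finset.range m, (1 / ((x:ℝ) + L * k)) ≤ 50 * ν^19 + 120 * ν^16 := by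
    calc _ ≤ (10 * ν^18 + 16 * (1.5 * ν^15)) * (5 * ν) := by gcongr
      _ = _ := by ring
  have t3 : (m:ℝ) * (4 * MM ν + 4 * Y) ≤ 9.6 * ν^15 + 16 * ν^10 := by
    calc _ ≤ (2 * ν^5) * (4 * (1.2 * ν^10) + 4 * Y) := by gcongr
      _ = _ := by rw [hY]; ring
  linarith

end Cnt
end

section
set_option linter.unusedSimpArgs false
set_option linter.unusedVariables false
set_option linter.unusedSectionVars false

namespace Cnt

/-- four times the invariant `n`, i.e. minus the discriminant -/
def dd {R : Type*} [CommRing R] (v : R × R × R × R) : R :=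
  3 * v.2.1^2 * v.2.2.1^2 - 4 * v.2.1^3 * v.2.2.2 - 4 * v.1 * v.2.2.1^3 + 6 * v.1 * v.2.1 * v.2.2.1 * v.2.2.2
    - v.1^2 * v.2.2.2^2

/-- residue vectors -/
abbrev VV (m : ℕ) := ZMod m × ZMod m × ZMod m × ZMod m

def good4 : VV 4 → Prop := fun v =>
  (v.2.1 * v.2.2.1 - v.1 * v.2.2.2 = 0 ∧ ((v.2.1^2 - v.1 * v.2.2.1) * (v.2.2.1^2 - v.2.1 * v.2.2.2) = 1 ∨
    (v.2.1^2 - v.1 * v.2.2.1) * (v.2.2.1^2 - v.2.1 * v.2.2.2) = 2)) ∨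
  (v.2.1 * v.2.2.1 - v.1 * v.2.2.2 = 2 ∧ ((v.2.1^2 - v.1 * v.2.2.1) * (v.2.2.1^2 - v.2.1 * v.2.2.2) = 2 ∨
    (v.2.1^2 - v.1 * v.2.2.1) * (v.2.2.1^2 - v.2.1 * v.2.2.2) = 3))

instance : DecidablePred good4 := fun v => by unfold good4; infer_instance

def good3 : VV 3 → Prop := fun v => dd v = 1

instance : DecidablePred good3 := fun v => by unfold good3; infer_instance

lemma card4 : (Finset.univ.filter good4).card = 48 := by decide +kernel

lemma card3 : (Finset.univ.filter good3).card = 24 := by decide +kernel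

def goodp (p : ℕ) : VV (p^2) → Prop := fun v => dd v ≠ 0 ∧ ¬ IsUnit (dd v)

section
variable {p : ℕ} [hp : Fact p.Prime]

lemma nu_dvd {x : ZMod (p^2)} (h : ¬ IsUnit x) : ∃ y : ZMod (p^2), x = (p : ZMod (p^2)) * y := by
  have h1 : ¬ Nat.Coprime x.val (p^2) := by
    rwa [← ZMod.isUnit_iff_coprime, ZMod.natCast_zmod_val]
  have h2 : p ∣ x.val := by
    by_contra hc
    exact h1 (((Nat.Prime.coprime_iff_not_dvd hp.out).2 hc).symm.pow_right 2)
  obtain ⟨y, hy⟩ := h2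
  refine ⟨(y : ZMod (p^2)), ?_⟩
  rw [← ZMod.natCast_zmod_val x, hy]; push_cast; rfl

lemma nu_mul {x y : ZMod (p^2)} (hx : ¬ IsUnit x) (hy : ¬ IsUnit y) : x * y = 0 := by
  obtain ⟨a, rfl⟩ := nu_dvd hx
  obtain ⟨b, rfl⟩ := nu_dvd hy
  have : ((p^2 : ℕ) : ZMod (p^2)) = 0 := ZMod.natCast_self _
  push_cast at this
  linear_combination a * b * this

open Classical in
noncomputable def Us (p : ℕ) [Fact p.Prime] : Finset (ZMod (p^2)) := Finset.univ.filter (fun x => IsUnit x)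
open Classical in
noncomputable def Ns (p : ℕ) [Fact p.Prime] : Finset (ZMod (p^2)) := Finset.univ.filter (fun x => ¬ IsUnit x)
open Classical in
noncomputable def Ws (p : ℕ) [Fact p.Prime] : Finset (ZMod (p^2)) := Finset.univ.filter (fun x => x ≠ 0 ∧ ¬ IsUnit x)

lemma mem_Us {x : ZMod (p^2)} : x ∈ Us p ↔ IsUnit x := by simp [Us]
lemma mem_Ns {x : ZMod (p^2)} : x ∈ Ns p ↔ ¬ IsUnit x := by simp [Ns]
lemma mem_Ws {x : ZMod (p^2)} : x ∈ Ws p ↔ x ≠ 0 ∧ ¬ IsUnit x := by simp [Ws]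

lemma card_U : (Us p).card = p * (p - 1) := by
  classical
  have h : Fintype.card (ZMod (p^2))ˣ = p * (p - 1) := by
    rw [ZMod.card_units_eq_totient, Nat.totient_prime_pow hp.out (by norm_num)]; simp
  rw [← h, ← Finset.card_univ]
  symm
  apply Finset.card_bij (fun (u : (ZMod (p^2))ˣ) _ => (u : ZMod (p^2)))
  · intro u _; exact mem_Us.2 u.isUnit
  · intro u _ v _ h; exact Units.ext h
  · intro x hx; obtain ⟨u, hu⟩ := mem_Us.1 hx; exact ⟨u, Finset.mem_univ _, hu⟩

lemma card_N : (Ns p).card = p := by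
  classical
  have h := Finset.card_filter_add_card_filter_not (s := (Finset.univ : Finset (ZMod (p^2)))) (fun x => IsUnit x)
  have h1 := card_U (p := p)
  have h2 : (Finset.univ : Finset (ZMod (p^2))).card = p^2 := by rw [Finset.card_univ, ZMod.card]
  have e1 : (Us p) = Finset.univ.filter (fun x => IsUnit x) := by ext; simp [mem_Us]
  have e2 : (Ns p) = Finset.univ.filter (fun x => ¬ IsUnit x) := by ext; simp [mem_Ns]
  rw [← e1, ← e2, h1, h2] at h
  obtain ⟨q, hq⟩ : ∃ q, p = q + 1 := ⟨p - 1, by have := hp.out.pos; omega⟩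
  have : p * (p - 1) + p = p^2 := by rw [hq]; simp; ring
  omega

lemma card_W : (Ws p).card = p - 1 := by
  classical
  have h : Ws p = (Ns p).erase 0 := by ext x; simp [mem_Ws, mem_Ns]
  have hnt : Nontrivial (ZMod (p^2)) := ZMod.nontrivial_iff.2 (Nat.one_lt_pow (by norm_num) hp.out.one_lt).ne'
  rw [h, Finset.card_erase_of_mem (mem_Ns.2 not_isUnit_zero), card_N]

lemma W_unit_mul {u x : ZMod (p^2)} (hu : IsUnit u) : (u * x ≠ 0 ∧ ¬ IsUnit (u * x)) ↔ (x ≠ 0 ∧ ¬ IsUnit x) := by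
  rw [Ne, hu.mul_right_eq_zero, IsUnit.mul_iff]; simp [hu]

lemma isUnit_two (h2 : p ≠ 2) : IsUnit (2 : ZMod (p^2)) := by
  have : IsUnit ((2 : ℕ) : ZMod (p^2)) := by
    rw [ZMod.isUnit_iff_coprime]
    apply Nat.Coprime.pow_right
    exact (Nat.coprime_primes Nat.prime_two hp.out).2 (Ne.symm h2)
  exact_mod_cast this

open Classical in
lemma card_p (h2 : p ≠ 2) : ((Finset.univ.filter (goodp p)).card) ≤ p^6 * (p - 1) := by
  have u2 := isUnit_two (p := p) h2
  set S := Finset.univ.filter (goodp p) with hS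
  have hmem : ∀ v ∈ S, dd v ≠ 0 ∧ ¬ IsUnit (dd v) := fun v hv => (Finset.mem_filter.1 hv).2
  set S1 := S.filter (fun v => IsUnit v.1)
  set S2 := S.filter (fun v => ¬ IsUnit v.1 ∧ ¬ IsUnit v.2.1)
  set S3 := S.filter (fun v => ¬ IsUnit v.1 ∧ IsUnit v.2.1)
  have hSu : S ⊆ S1 ∪ (S2 ∪ S3) := by
    intro v hv
    simp only [S1, S2, S3, Finset.mem_union, Finset.mem_filter, hv, true_and]
    tauto
  have hc : S.card ≤ S1.card + (S2.card + S3.card) :=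
    (Finset.card_le_card hSu).trans ((Finset.card_union_le _ _).trans (Nat.add_le_add_left (Finset.card_union_le _ _) _))
  have cR : (Finset.univ : Finset (ZMod (p^2))).card = p^2 := by rw [Finset.card_univ, ZMod.card]
  have c1 : S1.card ≤ (p * (p-1)) * (p^2 * ((p * (p-1)) * (p - 1))) := by
    have key : ∀ v ∈ S1, IsUnit v.1 ∧ IsUnit (v.2.1^2 - v.1 * v.2.2.1) ∧
        IsUnit (v.1^2 * v.2.2.2 - 3 * v.1 * v.2.1 * v.2.2.1 + 2 * v.2.1^3) ∧
        (4 * (v.2.1^2 - v.1 * v.2.2.1)^3 - (v.1^2 * v.2.2.2 - 3 * v.1 * v.2.1 * v.2.2.1 + 2 * v.2.1^3)^2 ≠ 0 ∧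
        ¬ IsUnit (4 * (v.2.1^2 - v.1 * v.2.2.1)^3 - (v.1^2 * v.2.2.2 - 3 * v.1 * v.2.1 * v.2.2.1 + 2 * v.2.1^3)^2)) := by
      rintro ⟨a, b, c, d⟩ hv
      obtain ⟨hv, ha⟩ := Finset.mem_filter.1 hv
      have hW := hmem _ hv
      simp only at ha ⊢
      rw [← W_unit_mul (ha.pow 2)] at hW
      have e : a^2 * dd (a, b, c, d) = 4 * (b^2 - a * c)^3 - (a^2 * d - 3 * a * b * c + 2 * b^3)^2 := by
        simp only [dd]; ring
      rw [e] at hW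
      set P := b^2 - a * c
      set G := a^2 * d - 3 * a * b * c + 2 * b^3
      refine ⟨ha, ?_, ?_, hW⟩
      · by_contra hP
        have hPP := nu_mul hP hP
        have e2 : 4 * P^3 - G^2 = -G^2 := by linear_combination 4 * P * hPP
        rw [e2] at hW
        by_cases hG : IsUnit G
        · exact hW.2 (hG.pow 2).neg
        · apply hW.1; linear_combination -nu_mul hG hG
      · by_contra hG
        have hGG := nu_mul hG hG
        have e2 : 4 * P^3 - G^2 = 2 * 2 * P^3 := by linear_combination -hGG
        rw [e2] at hW
        by_cases hP : IsUnit P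
        · exact hW.2 ((u2.mul u2).mul (hP.pow 3))
        · apply hW.1; have := nu_mul hP hP; linear_combination 4 * P * this
    suffices hh : S1.card ≤ ((Us p) ×ˢ (Finset.univ : Finset (ZMod (p^2))) ×ˢ (Us p) ×ˢ (Ws p)).card by
      rwa [Finset.card_product, Finset.card_product, Finset.card_product, card_U, card_W, cR] at hh
    apply Finset.card_le_card_of_injOn (fun v => (v.1, v.2.1,
      (v.1^2 * v.2.2.2 - 3 * v.1 * v.2.1 * v.2.2.1 + 2 * v.2.1^3) * (2 * (v.2.1^2 - v.1 * v.2.2.1))⁻¹,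
      (v.2.1^2 - v.1 * v.2.2.1) - ((v.1^2 * v.2.2.2 - 3 * v.1 * v.2.1 * v.2.2.1 + 2 * v.2.1^3) * (2 * (v.2.1^2 - v.1 * v.2.2.1))⁻¹)^2))
    · rintro ⟨a, b, c, d⟩ hv
      obtain ⟨ha, hP, hG, hW⟩ := key _ hv
      simp only at ha hP hG hW
      simp only [Finset.coe_product, Set.mem_prod, Finset.mem_coe, mem_Us, mem_Ws, Finset.coe_univ, Set.mem_univ, true_and]
      set P := b^2 - a * c
      set G := a^2 * d - 3 * a * b * c + 2 * b^3
      have hi := ZMod.mul_inv_of_unit (2 * P) (u2.mul hP)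
      refine ⟨ha, hG.mul (IsUnit.of_mul_eq_one _ (by rw [mul_comm]; exact hi)), ?_⟩
      rw [← W_unit_mul ((u2.mul hP).pow 2)]
      have e : (2 * P)^2 * (P - (G * (2 * P)⁻¹)^2) = 4 * P^3 - G^2 := by
        linear_combination -(G^2) * (2 * P * (2 * P)⁻¹ + 1) * hi
      rw [e]; exact hW
    · rintro ⟨a, b, c, d⟩ hv ⟨a', b', c', d'⟩ hv' he
      obtain ⟨ha, hP, hG, hW⟩ := key _ hv
      simp only [Prod.mk.injEq] at ha hP hG hW he
      obtain ⟨rfl, rfl, h3, h4⟩ := he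
      rw [← h3] at h4
      have hPP : b^2 - a * c = b^2 - a * c' := by linear_combination h4
      rw [← hPP] at h3
      have hi := ZMod.mul_inv_of_unit (2 * (b^2 - a * c)) (u2.mul hP)
      have hGG : (a^2 * d - 3 * a * b * c + 2 * b^3) = (a^2 * d' - 3 * a * b * c' + 2 * b^3) := by
        linear_combination (2 * (b^2 - a * c)) * h3 - ((a^2 * d - 3 * a * b * c + 2 * b^3) - (a^2 * d' - 3 * a * b * c' + 2 * b^3)) * hi
      have hcc : c = c' := ha.mul_left_cancel (by linear_combination -hPP)
      subst hcc
      have hdd : d = d' := (ha.pow 2).mul_left_cancel (by linear_combination hGG)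
      rw [hdd]
  have c2 : S2.card ≤ (p-1) * (p * ((p * (p-1)) * p^2)) := by
    suffices hh : S2.card ≤ ((Ws p) ×ˢ (Ns p) ×ˢ (Us p) ×ˢ (Finset.univ : Finset (ZMod (p^2)))).card by
      rwa [Finset.card_product, Finset.card_product, Finset.card_product, card_U, card_W, cR, card_N] at hh
    apply Finset.card_le_card
    rintro ⟨a, b, c, d⟩ hv
    obtain ⟨hv, ha, hb⟩ := Finset.mem_filter.1 hv
    have hW := hmem _ hv
    simp only [Finset.mem_product, mem_Us, mem_Ns, mem_Ws, Finset.mem_univ, and_true]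
    have haa := nu_mul ha ha
    have hab := nu_mul ha hb
    have hbb := nu_mul hb hb
    simp only at haa hab hbb
    have e : dd (a, b, c, d) = -4 * a * c^3 := by
      simp only [dd]; linear_combination (3 * c^2 - 4 * b * d) * hbb + 6 * c * d * hab - d^2 * haa
    rw [e] at hW
    refine ⟨⟨fun h0 => hW.1 (by rw [h0]; ring), ha⟩, hb, ?_⟩
    by_contra hcu
    have := nu_mul ha hcu
    simp only at this
    exact hW.1 (by linear_combination -4 * c^2 * this)
  have c3 : S3.card ≤ p * ((p * (p-1)) * (p^2 * (p - 1))) := by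
    suffices hh : S3.card ≤ ((Ns p) ×ˢ (Us p) ×ˢ (Finset.univ : Finset (ZMod (p^2))) ×ˢ (Ws p)).card by
      rwa [Finset.card_product, Finset.card_product, Finset.card_product, card_U, card_W, cR, card_N] at hh
    apply Finset.card_le_card_of_injOn (fun v => (v.1, v.2.1, v.2.2.1, dd v))
    · rintro ⟨a, b, c, d⟩ hv
      obtain ⟨hv, ha, hb⟩ := Finset.mem_filter.1 hv
      have hW := hmem _ hv
      simp only [Finset.coe_product, Set.mem_prod, Finset.mem_coe, mem_Us, mem_Ws, mem_Ns, Finset.coe_univ, Set.mem_univ, true_and]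
      exact ⟨ha, hb, hW⟩
    · rintro ⟨a, b, c, d⟩ hv ⟨a', b', c', d'⟩ hv' he
      obtain ⟨hv, ha, hb⟩ := Finset.mem_filter.1 hv
      simp only [Prod.mk.injEq] at ha hb he
      obtain ⟨rfl, rfl, rfl, h4⟩ := he
      have haa := nu_mul ha ha
      simp only [dd] at h4
      have h5 : (2^4 * b^6) * (d - d') = 0 := by
        linear_combination (-4 * b^3 - 6 * a * b * c) * h4 + (36 * b^2 * c^2 * (d - d') + (d^2 - d'^2) * (-4 * b^3 - 6 * a * b * c)) * haa
      have := ((u2.pow 4).mul (hb.pow 6)).mul_right_eq_zero.1 h5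
      have : d = d' := by linear_combination this
      rw [this]
  refine hc.trans ((Nat.add_le_add c1 (Nat.add_le_add c2 c3)).trans ?_)
  obtain ⟨q, hq⟩ : ∃ q, p = q + 1 := ⟨p - 1, by have := hp.out.pos; omega⟩
  have : p - 1 = q := by omega
  rw [this, hq]
  have : (q + 1) * q * ((q + 1) ^ 2 * ((q + 1) * q * q)) + (q * ((q + 1) * ((q + 1) * q * (q + 1) ^ 2)) + (q + 1) * ((q + 1) * q * ((q + 1) ^ 2 * q)))
    + (q+1)^4 * q = (q+1)^6 * q := by ring
  omega

end
end Cnt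
end

section
set_option linter.unusedSimpArgs false
set_option linter.unusedVariables false
set_option linter.unusedSectionVars false

namespace Cnt

def cv (m : ℕ) (v : ℤ × ℤ × ℤ × ℤ) : VV m := ((v.1 : ZMod m), (v.2.1 : ZMod m), (v.2.2.1 : ZMod m), (v.2.2.2 : ZMod m))

lemma cv_eq {m : ℕ} {v w : ℤ × ℤ × ℤ × ℤ} (h : cv m v = cv m w) :
    (m:ℤ) ∣ v.1 - w.1 ∧ (m:ℤ) ∣ v.2.1 - w.2.1 ∧ (m:ℤ) ∣ v.2.2.1 - w.2.2.1 ∧ (m:ℤ) ∣ v.2.2.2 - w.2.2.2 := by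
  simp only [cv, Prod.mk.injEq] at h
  have k : ∀ {x y : ℤ}, (x : ZMod m) = (y : ZMod m) → (m:ℤ) ∣ x - y := by
    intro x y e
    rw [← ZMod.intCast_zmod_eq_zero_iff_dvd]
    push_cast; rw [e, sub_self]
  exact ⟨k h.1, k h.2.1, k h.2.2.1, k h.2.2.2⟩

lemma L_dvd (Ps : Finset ℕ) (hP : ∀ p ∈ Ps, p.Prime ∧ p ≠ 2 ∧ p ≠ 3) {z : ℤ} (h4 : (4:ℤ) ∣ z) (h3 : (3:ℤ) ∣ z)
    (hp : ∀ p ∈ Ps, ((p^2 : ℕ) : ℤ) ∣ z) : ((12 * ∏ p ∈ Ps, p^2 : ℕ) : ℤ) ∣ z := by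
  have h12 : (12:ℤ) ∣ z := by omega
  rw [Int.natCast_dvd] at *
  have h12' : 12 ∣ z.natAbs := by exact_mod_cast Int.natAbs_dvd_natAbs.2 h12
  apply Nat.Coprime.mul_dvd_of_dvd_of_dvd _ h12'
  · apply Finset.prod_dvd_of_isRelPrime
    · intro p h1 q h2 hne
      have := (Nat.coprime_primes (hP p h1).1 (hP q h2).1).2 hne
      exact Nat.coprime_iff_isRelPrime.1 (this.pow 2 2)
    · intro p hp'; exact Int.natCast_dvd.1 (hp p hp')
  · apply Nat.Coprime.prod_right
    intro p hp'
    obtain ⟨k1, k2, k3⟩ := hP p hp'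
    apply Nat.Coprime.pow_right
    rw [show 12 = 2^2 * 3 by norm_num]
    apply Nat.Coprime.mul_left
    · exact ((Nat.coprime_primes Nat.prime_two k1).2 (Ne.symm k2)).pow_left 2
    · exact (Nat.coprime_primes Nat.prime_three k1).2 (Ne.symm k3)

theorem forms_count (Ps : Finset ℕ) (hP : ∀ p ∈ Ps, p.Prime ∧ p ≠ 2 ∧ p ≠ 3) {ν : ℝ} (hν : 1 ≤ ν)
    (S : Finset (ℤ × ℤ × ℤ × ℤ)) (hF : ∀ v ∈ S, Fm (ν^20) v.1 v.2.1 v.2.2.1 v.2.2.2)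
    (h4 : ∀ v ∈ S, good4 (cv 4 v)) (h3 : ∀ v ∈ S, good3 (cv 3 v)) (hp : ∀ v ∈ S, ∀ p ∈ Ps, goodp p (cv (p^2) v)) :
    (S.card : ℝ) ≤ (48 * (24 * ∏ p ∈ Ps, (p:ℝ)^6 * (p - 1))) *
      ((2 * Real.pi / √3) / ((12 * ∏ p ∈ Ps, p^2 : ℕ) : ℝ)^4 * ν^20 + 300 * ν^19) := by
  classical
  set L : ℕ := 12 * ∏ p ∈ Ps, p^2 with hL
  have hL1 : 1 ≤ L := by
    have : 0 < ∏ p ∈ Ps, p^2 := Finset.prod_pos (fun p hp' => pow_pos (hP p hp').1.pos 2)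
    omega
  have : ∀ p : Ps, Fact (p.1.Prime) := fun p => ⟨(hP p.1 p.2).1⟩
  set U : Finset (VV 4 × VV 3 × (∀ p : Ps, VV (p.1^2))) :=
    (Finset.univ.filter good4) ×ˢ (Finset.univ.filter good3) ×ˢ
      (Fintype.piFinset (fun p : Ps => Finset.univ.filter (goodp p.1))) with hU
  set K : ℝ := (2 * Real.pi / √3) / (L : ℝ)^4 * ν^20 + 300 * ν^19 with hK
  have hK0 : 0 ≤ K := by positivity
  have h1 : (S.card : ℝ) ≤ ∑ u ∈ U, K := by
    apply card_fib S U (fun v => (cv 4 v, cv 3 v, fun p => cv (p.1^2) v))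
    · intro v hv
      simp only [hU, Finset.mem_product, Finset.mem_filter, Finset.mem_univ, true_and, Fintype.mem_piFinset]
      exact ⟨h4 v hv, h3 v hv, fun p => hp v hv p.1 p.2⟩
    · intro u hu
      set S' := S.filter (fun v => (cv 4 v, cv 3 v, fun p : Ps => cv (p.1^2) v) = u) with hS'
      rcases S'.eq_empty_or_nonempty with he | ⟨w, hw⟩
      · rw [he]; simpa using hK0
      · apply a_level hL1 w.1 w.2.1 w.2.2.1 w.2.2.2 hν
        intro v hv
        have hv' := Finset.mem_filter.1 hv
        have hw' := (Finset.mem_filter.1 hw).2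
        have e := hv'.2.trans hw'.symm
        simp only [Prod.mk.injEq] at e
        obtain ⟨e4, e3, ep⟩ := e
        have g4 := cv_eq e4
        have g3 := cv_eq e3
        have gp : ∀ p ∈ Ps, (((p^2 : ℕ):ℤ) ∣ v.1 - w.1 ∧ ((p^2 : ℕ):ℤ) ∣ v.2.1 - w.2.1 ∧ ((p^2 : ℕ):ℤ) ∣ v.2.2.1 - w.2.2.1 ∧ ((p^2 : ℕ):ℤ) ∣ v.2.2.2 - w.2.2.2) :=
          fun p hp' => cv_eq (m := p^2) (congrFun ep ⟨p, hp'⟩)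
        refine ⟨?_, ?_, ?_, ?_, hF v hv'.1⟩
        · exact L_dvd Ps hP g4.1 g3.1 (fun p hp' => (gp p hp').1)
        · exact L_dvd Ps hP g4.2.1 g3.2.1 (fun p hp' => (gp p hp').2.1)
        · exact L_dvd Ps hP g4.2.2.1 g3.2.2.1 (fun p hp' => (gp p hp').2.2.1)
        · exact L_dvd Ps hP g4.2.2.2 g3.2.2.2 (fun p hp' => (gp p hp').2.2.2)
  rw [Finset.sum_const, nsmul_eq_mul] at h1
  refine h1.trans (mul_le_mul_of_nonneg_right ?_ hK0)
  have hc : U.card ≤ 48 * (24 * ∏ p ∈ Ps, p^6 * (p - 1)) := by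
    rw [hU, Finset.card_product, Finset.card_product, card3, Fintype.card_piFinset]
    rw [card4]
    gcongr
    · rw [← Finset.prod_coe_sort Ps (fun p => p^6 * (p - 1))]
      apply Finset.prod_le_prod' 
      intro p _
      convert card_p (p := p.1) (hP p.1 p.2).2.1
  calc (U.card : ℝ) ≤ ((48 * (24 * ∏ p ∈ Ps, p^6 * (p - 1)) : ℕ) : ℝ) := by exact_mod_cast hc
    _ = _ := by
      push_cast
      congr 2
      apply Finset.prod_congr rfl
      intro p hp'
      rw [Nat.cast_sub (hP p hp').1.one_lt.le]; simp

end Cnt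
end

section
set_option linter.unusedSimpArgs false
set_option linter.unusedVariables false
set_option linter.unusedSectionVars false

namespace Cnt

/-- the form `v` has invariant `n` and is reduced -/
def IsForm (n : ℤ) (v : ℤ × ℤ × ℤ × ℤ) : Prop :=
  1 ≤ v.1 ∧ -v.1 < 2 * v.2.1 ∧ 2 * v.2.1 ≤ v.1 ∧ 0 < v.2.1^2 - v.1 * v.2.2.1 ∧
  3 * (v.2.1^2 - v.1 * v.2.2.1)^2 ≤ 4 * n ∧
  ∃ β : ℤ, v.2.1 * v.2.2.1 - v.1 * v.2.2.2 = 2 * β ∧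
    n = (v.2.1^2 - v.1 * v.2.2.1) * (v.2.2.1^2 - v.2.1 * v.2.2.2) - β^2

lemma exists_forms (n : ℤ) [GoodN n] : ∃ F : Finset (ℤ × ℤ × ℤ × ℤ),
    F.card + 1 = Nat.card {c : ClassGroup (RR n) // c^3 = 1} ∧ ∀ v ∈ F, IsForm n v := by
  classical
  have key : ∀ cl : {c : ClassGroup (RR n) // c^3 = 1 ∧ c ≠ 1}, ∃ v : ℤ × ℤ × ℤ × ℤ, IsForm n v ∧
      ∃ β : ℤ, v.2.1 * v.2.2.1 - v.1 * v.2.2.2 = 2 * β ∧ RR.IsRep n cl.1 (v.2.1^2 - v.1 * v.2.2.1) β := by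
    rintro ⟨cl, h3, h1⟩
    obtain ⟨a, b, c, d, β, g1, g2, g3, g4, g5, g6, g7, g8⟩ := RR.class_form cl h3 h1
    exact ⟨(a, b, c, d), ⟨g1, g2, g3, g5, g7, β, g4, g6⟩, β, g4, g8⟩
  choose f hf using key
  have hinj : Function.Injective f := by
    intro x y hxy
    obtain ⟨-, β, e1, r1⟩ := hf x
    obtain ⟨-, β', e2, r2⟩ := hf y
    rw [← hxy] at e2 r2
    have : β = β' := by omega
    subst this
    exact Subtype.ext (r1.inj r2)
  refine ⟨Finset.univ.image f, ?_, ?_⟩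
  · rw [Finset.card_image_of_injective _ hinj, Finset.card_univ, Nat.card_eq_fintype_card,
      Fintype.card_subtype, Fintype.card_subtype]
    have : (Finset.univ.filter (fun c : ClassGroup (RR n) => c^3 = 1)) =
        insert 1 (Finset.univ.filter (fun c : ClassGroup (RR n) => c^3 = 1 ∧ c ≠ 1)) := by
      ext c
      simp only [Finset.mem_filter, Finset.mem_univ, true_and, Finset.mem_insert]
      by_cases h : c = 1
      · simp [h]
      · simp [h]
    rw [this, Finset.card_insert_of_notMem (by simp)]
  · intro v hv
    obtain ⟨x, -, rfl⟩ := Finset.mem_image.1 hv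
    exact (hf x).1

lemma IsForm.dd {n : ℤ} {v : ℤ × ℤ × ℤ × ℤ} (h : IsForm n v) : dd v = 4 * n := by
  obtain ⟨-, -, -, -, -, β, e, e2⟩ := h
  rw [e2, Cnt.dd]
  linear_combination -(v.2.1 * v.2.2.1 - v.1 * v.2.2.2 + 2 * β) * e

lemma IsForm.Fm {n : ℤ} {v : ℤ × ℤ × ℤ × ℤ} {N : ℝ} (h : IsForm n v) (hn : (n:ℝ) ≤ N) :
    Fm N v.1 v.2.1 v.2.2.1 v.2.2.2 := by
  have hd := h.dd
  obtain ⟨h1, h2, h3, h4, h5, -⟩ := h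
  refine ⟨h1, h2, h3, h4, n, hn, h5, ?_⟩
  rw [← hd, Cnt.dd]; ring

lemma dd_cv (m : ℕ) (v : ℤ × ℤ × ℤ × ℤ) : dd (cv m v) = ((dd v : ℤ) : ZMod m) := by
  simp only [dd, cv]; push_cast; ring

lemma IsForm.good3 {n : ℤ} {v : ℤ × ℤ × ℤ × ℤ} (h : IsForm n v) (hn : n % 3 = 1) : good3 (cv 3 v) := by
  rw [Cnt.good3, dd_cv, h.dd]
  obtain ⟨q, hq⟩ : ∃ q, n = 3 * q + 1 := ⟨n / 3, by omega⟩
  rw [hq]; push_cast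
  have : (3 : ZMod 3) = 0 := by decide
  linear_combination (4 * (q : ZMod 3) + 1) * this

lemma IsForm.good4 {n : ℤ} {v : ℤ × ℤ × ℤ × ℤ} (h : IsForm n v) (hn : n % 4 = 1 ∨ n % 4 = 2) : good4 (cv 4 v) := by
  obtain ⟨-, -, -, -, -, β, e, e2⟩ := h
  have h4 : (4 : ZMod 4) = 0 := by decide
  have e' := congrArg (fun z : ℤ => (z : ZMod 4)) e
  have e2' := congrArg (fun z : ℤ => (z : ZMod 4)) e2
  push_cast at e' e2'
  have hn' : (n : ZMod 4) = 1 ∨ (n : ZMod 4) = 2 := by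
    rcases hn with hn | hn
    · left
      obtain ⟨q, hq⟩ : ∃ q, n = 4 * q + 1 := ⟨n / 4, by omega⟩
      rw [hq]; push_cast; linear_combination (q : ZMod 4) * h4
    · right
      obtain ⟨q, hq⟩ : ∃ q, n = 4 * q + 2 := ⟨n / 4, by omega⟩
      rw [hq]; push_cast; linear_combination (q : ZMod 4) * h4
  rw [Cnt.good4]
  simp only [cv]
  rcases Int.even_or_odd' β with ⟨k, hk | hk⟩
  · left
    rw [hk] at e' e2'; push_cast at e' e2'
    refine ⟨by linear_combination e' + (k : ZMod 4) * h4, ?_⟩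
    rcases hn' with h | h <;> rw [h] at e2'
    · left; linear_combination -e2' + (k : ZMod 4)^2 * h4
    · right; linear_combination -e2' + (k : ZMod 4)^2 * h4
  · right
    rw [hk] at e' e2'; push_cast at e' e2'
    refine ⟨by linear_combination e' + (k : ZMod 4) * h4, ?_⟩
    rcases hn' with h | h <;> rw [h] at e2'
    · left; linear_combination -e2' + ((k : ZMod 4)^2 + k) * h4
    · right; linear_combination -e2' + ((k : ZMod 4)^2 + k) * h4

lemma IsForm.goodp {n : ℤ} {v : ℤ × ℤ × ℤ × ℤ} (h : IsForm n v) {p : ℕ} (hp : p.Prime) (h2 : p ≠ 2)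
    (hpn : (p:ℤ) ∣ n) (hsf : Squarefree n) : goodp p (cv (p^2) v) := by
  rw [Cnt.goodp, dd_cv, h.dd]
  have hpz : Prime (p:ℤ) := Nat.prime_iff_prime_int.1 hp
  have hp4 : ¬ (p:ℤ) ∣ 4 := by
    intro h
    have h' : p ∣ 2^2 := by exact_mod_cast h
    exact h2 ((Nat.prime_dvd_prime_iff_eq hp Nat.prime_two).1 (hp.dvd_of_dvd_pow h'))
  obtain ⟨q, hq⟩ := hpn
  constructor
  · rw [Ne, ZMod.intCast_zmod_eq_zero_iff_dvd]
    intro hd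
    have hpq : (p:ℤ) ∣ 4 * q := by
      rw [hq] at hd; push_cast at hd
      rw [pow_two, show (4 * ((p:ℤ) * q)) = p * (4 * q) by ring] at hd
      exact (mul_dvd_mul_iff_left hpz.ne_zero).1 hd
    have hq' := (hpz.dvd_or_dvd hpq).resolve_left hp4
    have : (p:ℤ) * p ∣ n := by rw [hq]; exact mul_dvd_mul_left _ hq'
    exact hpz.not_isUnit (hsf _ this)
  · intro hu
    have hnp : IsUnit ((p : ℕ) : ZMod (p^2)) := by
      rw [hq] at hu; push_cast at hu
      rw [show (4 * ((p:ZMod (p^2)) * q)) = p * (4 * q) by ring] at hu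
      exact isUnit_of_mul_isUnit_left hu
    rw [ZMod.isUnit_iff_coprime] at hnp
    have := Nat.Coprime.coprime_mul_right_right (show Nat.Coprime p (p * p) by rwa [pow_two] at hnp)
    rw [Nat.coprime_self] at this
    exact hp.one_lt.ne' this

open Classical in
/-- number of 3-torsion classes -/
noncomputable def cl3 (n : ℤ) : ℕ := if h : GoodN n then Nat.card {c : ClassGroup (RR n) // c^3 = 1} else 1

lemma cl3_eq (n : ℤ) [h : GoodN n] : cl3 n = Nat.card {c : ClassGroup (RR n) // c^3 = 1} := by
  rw [cl3, dif_pos h]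

theorem class_sum (Ps : Finset ℕ) (hP : ∀ p ∈ Ps, p.Prime ∧ p ≠ 2 ∧ p ≠ 3) {ν : ℝ} (hν : 1 ≤ ν)
    (Ns : Finset ℤ) (hN : ∀ n ∈ Ns, GoodN n ∧ (n:ℝ) ≤ ν^20 ∧ n % 3 = 1 ∧ ∀ p ∈ Ps, (p:ℤ) ∣ n) :
    (∑ n ∈ Ns, ((cl3 n : ℝ) - 1)) ≤ (48 * (24 * ∏ p ∈ Ps, (p:ℝ)^6 * (p - 1))) *
      ((2 * Real.pi / √3) / ((12 * ∏ p ∈ Ps, p^2 : ℕ) : ℝ)^4 * ν^20 + 300 * ν^19) := by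
  classical
  have key : ∀ n : ℤ, ∃ F : Finset (ℤ × ℤ × ℤ × ℤ), n ∈ Ns → 
      (F.card + 1 = cl3 n ∧ ∀ v ∈ F, IsForm n v) := by
    intro n
    by_cases h : n ∈ Ns
    · have := (hN n h).1
      obtain ⟨F, hF⟩ := exists_forms n
      rw [cl3_eq]; exact ⟨F, fun _ => hF⟩
    · exact ⟨∅, fun h' => absurd h' h⟩
  choose F hF using key
  have hS := forms_count Ps hP hν (Ns.biUnion F) ?_ ?_ ?_ ?_
  · refine le_trans (le_of_eq ?_) hS
    rw [Finset.card_biUnion]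
    · push_cast
      apply Finset.sum_congr rfl
      intro n hn
      have := (hF n hn).1
      rw [← this]; push_cast; ring
    · intro n hn m hm hne
      rw [Function.onFun, Finset.disjoint_left]
      intro v hv hv'
      have e1 := ((hF n hn).2 v hv).dd
      have e2 := ((hF m hm).2 v hv').dd
      omega
  all_goals
    intro v hv
    obtain ⟨n, hn, hv⟩ := Finset.mem_biUnion.1 hv
    have hf := (hF n hn).2 v hv
    obtain ⟨g1, g2, g3, g4⟩ := hN n hn
  · exact hf.Fm g2
  · exact hf.good4 g1.md
  · exact hf.good3 g3
  · intro p hp; exact hf.goodp (hP p hp).1 (hP p hp).2.1 (g4 p hp) g1.sf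

end Cnt
end

section
set_option linter.unusedSimpArgs false
set_option linter.unusedVariables false
set_option linter.unusedSectionVars false

namespace Cnt

def Rs (a : ℕ) : Finset ℕ := (Finset.range (12 * a)).filter (fun r => r % 3 = 1 ∧ (r % 4 = 1 ∨ r % 4 = 2) ∧ Nat.Coprime r a)

def Bs (a M : ℕ) : Finset ℕ := (Finset.range M).filter (fun r => r % 3 = 1 ∧ (r % 4 = 1 ∨ r % 4 = 2) ∧ Nat.Coprime r a)

lemma card_Rs {a : ℕ} (ha : 1 ≤ a) (h6 : Nat.Coprime 12 a) : 2 * a.totient ≤ (Rs a).card := by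
  have h1 : (({1, 10} : Finset ℕ) ×ˢ ((Finset.range a).filter (Nat.Coprime a))).card = 2 * a.totient := by
    rw [Finset.card_product]; rfl
  rw [← h1]
  apply Finset.card_le_card_of_injOn (fun x => (Nat.chineseRemainder h6 x.1 x.2 : ℕ))
  · rintro ⟨u, v⟩ h
    simp only [Finset.coe_product, Set.mem_prod, Finset.mem_coe, Finset.mem_insert, Finset.mem_singleton, Finset.mem_filter,
      Finset.mem_range] at h
    obtain ⟨hu, hv, hc⟩ := h
    have hlt := Nat.chineseRemainder_lt_mul h6 u v (by norm_num) (by omega)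
    obtain ⟨e1, e2⟩ := (Nat.chineseRemainder h6 u v).2
    set z := (Nat.chineseRemainder h6 u v : ℕ)
    simp only [Rs, Finset.coe_filter, Set.mem_setOf_eq, Finset.mem_range]
    have e1' : z % 12 = u % 12 := e1
    refine ⟨hlt, by omega, by omega, ?_⟩
    have : Nat.gcd z a = Nat.gcd v a := Nat.ModEq.gcd_eq e2
    rw [Nat.Coprime, this]; exact hc.symm
  · rintro ⟨u, v⟩ h ⟨u', v'⟩ h' he
    simp only [Finset.coe_product, Set.mem_prod, Finset.mem_coe, Finset.mem_insert, Finset.mem_singleton, Finset.mem_filter,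
      Finset.mem_range] at h h'
    obtain ⟨e1, e2⟩ := (Nat.chineseRemainder h6 u v).2
    obtain ⟨e3, e4⟩ := (Nat.chineseRemainder h6 u' v').2
    simp only at he
    rw [he] at e1 e2
    have k1 : u % 12 = u' % 12 := e1.symm.trans e3
    have k2 : v % a = v' % a := e2.symm.trans e4
    rw [Nat.mod_eq_of_lt h.2.1, Nat.mod_eq_of_lt h'.2.1] at k2
    have : u = u' := by omega
    rw [this, k2]

lemma Bs_mod {a M : ℕ} (ha : 1 ≤ a) {D : ℕ} (h : D ∈ Bs a M) : D % (12 * a) ∈ Rs a := by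
  simp only [Bs, Rs, Finset.mem_filter, Finset.mem_range] at *
  refine ⟨Nat.mod_lt _ (by omega), ?_, ?_, ?_⟩
  · rw [Nat.mod_mod_of_dvd _ (by exact ⟨4 * a, by ring⟩)]; exact h.2.1
  · rw [Nat.mod_mod_of_dvd _ (by exact ⟨3 * a, by ring⟩)]; exact h.2.2.1
  · have : Nat.gcd (D % (12 * a)) a = Nat.gcd D a := 
      Nat.ModEq.gcd_eq (Nat.mod_mod_of_dvd _ (by exact ⟨12, by ring⟩))
    rw [Nat.Coprime, this]; exact h.2.2.2

lemma card_Bs {a : ℕ} (ha : 1 ≤ a) (M : ℕ) : ((Rs a).card : ℝ) * (M / (12 * a) - 1) ≤ (Bs a M).card := by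
  have h1 : (Rs a).card * (M / (12 * a)) ≤ (Bs a M).card := by
    rw [← Finset.card_range (M / (12 * a)), ← Finset.card_product]
    apply Finset.card_le_card_of_injOn (fun x => x.1 + 12 * a * x.2)
    · rintro ⟨r, q⟩ h
      simp only [Finset.coe_product, Set.mem_prod, Finset.mem_coe, Finset.mem_range, Rs, Finset.mem_filter] at h
      obtain ⟨⟨h1, h2, h3, h4⟩, h5⟩ := h
      simp only [Bs, Finset.coe_filter, Set.mem_setOf_eq, Finset.mem_range]
      refine ⟨?_, ?_, ?_, ?_⟩
      · have : 12 * a * (M / (12 * a)) ≤ M := Nat.mul_div_le _ _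
        have : 12 * a * (q + 1) ≤ 12 * a * (M / (12 * a)) := Nat.mul_le_mul_left _ h5
        nlinarith
      · rw [show r + 12 * a * q = r + 3 * (4 * a * q) by ring, Nat.add_mul_mod_self_left]; exact h2
      · rw [show r + 12 * a * q = r + 4 * (3 * a * q) by ring, Nat.add_mul_mod_self_left]; exact h3
      · rw [show r + 12 * a * q = r + a * (12 * q) by ring]
        exact (Nat.coprime_add_mul_left_left r a (12 * q)).2 h4
    · rintro ⟨r, q⟩ h ⟨r', q'⟩ h' he
      simp only [Finset.coe_product, Set.mem_prod, Finset.mem_coe, Finset.mem_range, Rs, Finset.mem_filter] at h h'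
      simp only at he
      have k1 : r = r' := by
        have := congrArg (· % (12 * a)) he
        simpa [Nat.add_mul_mod_self_left, Nat.mod_eq_of_lt h.1.1, Nat.mod_eq_of_lt h'.1.1] using this
      subst k1
      have : q = q' := Nat.eq_of_mul_eq_mul_left (show 0 < 12 * a by omega) (by omega)
      rw [this]
  have h2 : (M:ℝ) / (12 * a) - 1 ≤ ((M / (12 * a) : ℕ) : ℝ) := by
    have h3 := Nat.lt_floor_add_one ((M:ℝ) / ((12 * a : ℕ) : ℝ))
    rw [Nat.floor_div_eq_div] at h3
    push_cast at h3 ⊢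
    linarith
  calc _ ≤ ((Rs a).card : ℝ) * ((M / (12 * a) : ℕ) : ℝ) := by gcongr
    _ ≤ _ := by exact_mod_cast h1

lemma card_Bm {a : ℕ} (ha : 1 ≤ a) (M j : ℕ) :
    (((Bs a M).filter (fun D => (2*j+5)^2 ∣ D)).card : ℝ) ≤ (Rs a).card * (M / (12 * a) * (1 / (2*j+5)^2) + 1) := by
  classical
  set m := 2 * j + 5 with hm
  have ha0 : (0:ℝ) < a := by exact_mod_cast ha
  set S := (Bs a M).filter (fun D => m^2 ∣ D) with hS
  have h1 : (S.card : ℝ) ≤ ∑ r ∈ Rs a, ((M:ℝ) / (12 * a) * (1 / (2*j+5)^2) + 1) := by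
    apply card_fib S (Rs a) (fun D => D % (12 * a))
    · intro D hD; exact Bs_mod ha (Finset.mem_filter.1 hD).1
    · intro r hr
      set S' := S.filter (fun D => D % (12 * a) = r) with hS'
      rcases S'.eq_empty_or_nonempty with he | ⟨w, hw⟩
      · rw [he]; simp only [Finset.card_empty, Nat.cast_zero]; positivity
      · have hmem : ∀ D ∈ S', D ∈ Bs a M ∧ m^2 ∣ D ∧ D % (12 * a) = r := by
          intro D hD
          simp only [hS', hS, Finset.mem_filter] at hD
          tauto
        obtain ⟨w1, w2, w3⟩ := hmem w hw
        have hcop : Nat.Coprime (12 * a) (m^2) := by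
          apply Nat.Coprime.pow_right
          have hmw : m ∣ w := (dvd_pow_self m two_ne_zero).trans w2
          simp only [Bs, Finset.mem_filter] at w1
          apply Nat.Coprime.symm
          apply Nat.Coprime.mul_right
          · rw [show 12 = 2^2 * 3 by norm_num]
            apply Nat.Coprime.mul_right
            · apply Nat.Coprime.pow_right
              rw [Nat.coprime_comm, Nat.coprime_two_left]
              exact ⟨j + 2, by omega⟩
            · rw [Nat.coprime_comm]
              apply (Nat.Prime.coprime_iff_not_dvd Nat.prime_three).2
              intro h
              have := h.trans hmw
              omega
          · exact Nat.Coprime.coprime_dvd_left hmw w1.2.2.2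
        have hL : 1 ≤ 12 * a * m^2 := Nat.mul_pos (by omega) (by positivity)
        have := ap_card hL (w : ℤ) (x := 0) (y := M) (by positivity) (S'.image (fun D : ℕ => (D : ℤ))) (by
          intro d hd
          obtain ⟨D, hD, rfl⟩ := Finset.mem_image.1 hd
          obtain ⟨d1, d2, d3⟩ := hmem D hD
          refine ⟨?_, by positivity, ?_⟩
          · have k1 : D ≡ w [MOD 12 * a] := d3.trans w3.symm
            have k2 : D ≡ w [MOD m^2] := by
              rw [Nat.ModEq, Nat.mod_eq_zero_of_dvd d2, Nat.mod_eq_zero_of_dvd w2]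
            have k3 := (Nat.modEq_and_modEq_iff_modEq_mul hcop).1 ⟨k1, k2⟩
            exact (Nat.modEq_iff_dvd.1 k3.symm)
          · simp only [Bs, Finset.mem_filter, Finset.mem_range] at d1
            exact_mod_cast d1.1.le)
        rw [Finset.card_image_of_injective _ Nat.cast_injective] at this
        refine this.trans (le_of_eq ?_)
        rw [hm]; push_cast; field_simp; ring
  rwa [Finset.sum_const, nsmul_eq_mul] at h1

lemma sum_odd (J : ℕ) : (∑ j ∈ Finset.range J, (1:ℝ) / (2*(j:ℝ)+5)^2) ≤ (1:ℝ) / 8 - 1 / (4 * (J:ℝ) + 8) := by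
  induction J with
  | zero => simp
  | succ J ih =>
    rw [Finset.sum_range_succ]
    have : (1:ℝ) / (2*J+5)^2 ≤ 1 / (4 * J + 8) - 1 / (4 * (J+1) + 8) := by
      rw [div_sub_div _ _ (by positivity) (by positivity), div_le_div_iff₀ (by positivity) (by positivity)]
      nlinarith [(Nat.cast_nonneg J : (0:ℝ) ≤ J)]
    push_cast
    linarith

def Gs (a M : ℕ) : Finset ℕ := (Bs a M).filter Squarefree

lemma card_Gs {a : ℕ} (ha : 1 ≤ a) (M : ℕ) :
    ((Rs a).card : ℝ) * (7 / 8 * (M / (12 * a)) - 1 - √M) ≤ (Gs a M).card := by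
  classical
  have ha0 : (0:ℝ) < a := by exact_mod_cast ha
  have h1 := card_Bs ha M
  have h2 : Bs a M ⊆ Gs a M ∪ (Finset.range (Nat.sqrt M)).biUnion (fun j => (Bs a M).filter (fun D => (2*j+5)^2 ∣ D)) := by
    intro D hD
    rw [Finset.mem_union]
    by_cases hsf : Squarefree D
    · left; exact Finset.mem_filter.2 ⟨hD, hsf⟩
    · right
      rw [Nat.squarefree_iff_prime_squarefree] at hsf
      push Not at hsf
      obtain ⟨p, hp, hpd⟩ := hsf
      have hD' := hD
      simp only [Bs, Finset.mem_filter, Finset.mem_range] at hD'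
      have hp2 : p ≠ 2 := by rintro rfl; omega
      have hp3 : p ≠ 3 := by rintro rfl; omega
      have hodd := hp.eq_two_or_odd.resolve_left hp2
      have hge := hp.two_le
      have hD0 : 0 < D := by omega
      have hle : p * p ≤ M := (Nat.le_of_dvd hD0 hpd).trans hD'.1.le
      have hps : p ≤ Nat.sqrt M := Nat.le_sqrt.2 hle
      rw [Finset.mem_biUnion]
      have e : 2 * ((p - 5) / 2) + 5 = p := by omega
      refine ⟨(p - 5) / 2, Finset.mem_range.2 (by omega), Finset.mem_filter.2 ⟨hD, ?_⟩⟩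
      rw [e, pow_two]; exact hpd
  have h3 : ((Bs a M).card : ℝ) ≤ (Gs a M).card + ∑ j ∈ Finset.range (Nat.sqrt M), (((Bs a M).filter (fun D => (2*j+5)^2 ∣ D)).card : ℝ) := by
    have := (Finset.card_le_card h2).trans ((Finset.card_union_le _ _).trans (Nat.add_le_add_left Finset.card_biUnion_le _))
    exact_mod_cast this
  have h4 : ∑ j ∈ Finset.range (Nat.sqrt M), (((Bs a M).filter (fun D => (2*j+5)^2 ∣ D)).card : ℝ) ≤
      (Rs a).card * (M / (12 * a) * (1 / 8) + √M) := by
    calc _ ≤ ∑ j ∈ Finset.range (Nat.sqrt M), ((Rs a).card * (M / (12 * a) * (1 / (2*j+5)^2) + 1) : ℝ) :=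
          Finset.sum_le_sum (fun j _ => card_Bm ha M j)
      _ = (Rs a).card * (M / (12 * a) * (∑ j ∈ Finset.range (Nat.sqrt M), (1:ℝ) / (2*j+5)^2) + Nat.sqrt M) := by
          rw [← Finset.mul_sum, Finset.sum_add_distrib, ← Finset.mul_sum]; simp
      _ ≤ _ := by
          have k1 := sum_odd (Nat.sqrt M)
          have k2 : (0:ℝ) ≤ 1 / (4 * (Nat.sqrt M : ℝ) + 8) := by positivity
          have k3 := Real.nat_sqrt_le_real_sqrt (a := M)
          gcongr
          linarith
  linarith

lemma card_T_aux (M : ℕ) : (((Finset.range M).filter (fun D => ¬ 4 ∣ D ∧ ¬ 9 ∣ D)).card : ℝ) ≤ 2 / 3 * M + 24 := by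
  classical
  set S := (Finset.range M).filter (fun D => ¬ 4 ∣ D ∧ ¬ 9 ∣ D) with hS
  have h1 : (S.card : ℝ) ≤ ∑ r ∈ (Finset.range 36).filter (fun D => ¬ 4 ∣ D ∧ ¬ 9 ∣ D), ((M:ℝ) / 36 + 1) := by
    apply card_fib S _ (fun D => D % 36)
    · intro D hD
      simp only [hS, Finset.mem_filter, Finset.mem_range] at hD ⊢
      omega
    · intro r hr
      have := ap_card (L := 36) (by norm_num) (r : ℤ) (x := 0) (y := M) (by positivity)
        ((S.filter (fun D => D % 36 = r)).image (fun D : ℕ => (D : ℤ))) (by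
          intro d hd
          obtain ⟨D, hD, rfl⟩ := Finset.mem_image.1 hd
          simp only [hS, Finset.mem_filter, Finset.mem_range] at hD
          refine ⟨by push_cast; omega, by positivity, by exact_mod_cast hD.1.1.le⟩)
      rw [Finset.card_image_of_injective _ Nat.cast_injective] at this
      simpa using this
  rw [Finset.sum_const, nsmul_eq_mul, show ((Finset.range 36).filter (fun D => ¬ 4 ∣ D ∧ ¬ 9 ∣ D)).card = 24 by decide] at h1
  push_cast at h1
  linarith

end Cnt
end

namespace Cnt

lemma Gs_spec {a M D : ℕ} (h : D ∈ Gs a M) :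
    D < M ∧ D % 3 = 1 ∧ (D % 4 = 1 ∨ D % 4 = 2) ∧ Nat.Coprime D a ∧ Squarefree D := by
  simp only [Gs, Bs, Finset.mem_filter, Finset.mem_range] at h
  tauto

lemma goodN_of {a M D : ℕ} (ha : 1 ≤ a) (hsf : Squarefree a) (hmod : a % 36 = 1 ∨ a % 36 = 25)
    (h : D ∈ Gs a M) (h1 : D ≠ 1) : GoodN ((a:ℤ) * (D:ℤ)) := by
  obtain ⟨_, h3, h4, hc, hs⟩ := Gs_spec h
  have h2 : 2 ≤ D := by omega
  refine ⟨?_, ?_, ?_⟩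
  · have : Squarefree (a * D) := (Nat.squarefree_mul hc.symm).2 ⟨hsf, hs⟩
    have := Int.squarefree_natCast.2 this
    simpa using this
  · have : 1 < a * D := by nlinarith
    exact_mod_cast this
  · have e : (a * D) % 4 = D % 4 := by
      rw [Nat.mul_mod, show a % 4 = 1 by omega]; simp
    have e' : ((a:ℤ) * D) % 4 = (((a * D) % 4 : ℕ) : ℤ) := by push_cast; rfl
    rw [e', e]; omega

noncomputable def Bd (a M k : ℕ) : Finset ℕ := ((Gs a M).erase 1).filter (fun D => 3^(k+1) ≤ cl3 ((a:ℤ) * (D:ℤ)))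

noncomputable def Gd (a M k : ℕ) : Finset ℕ := ((Gs a M).erase 1).filter (fun D => ¬ 3^(k+1) ≤ cl3 ((a:ℤ) * (D:ℤ)))

lemma card_Gd (a M k : ℕ) : ((Gs a M).card : ℝ) ≤ (Gd a M k).card + (Bd a M k).card + 1 := by
  have h1 : (Bd a M k).card + (Gd a M k).card = ((Gs a M).erase 1).card :=
    Finset.card_filter_add_card_filter_not _
  have h2 : (Gs a M).card ≤ ((Gs a M).erase 1).card + 1 := by
    have := Finset.pred_card_le_card_erase (s := Gs a M) (a := 1)
    omega
  have : (Gs a M).card ≤ (Gd a M k).card + (Bd a M k).card + 1 := by omega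
  exact_mod_cast this

lemma tot_prod {a : ℕ} (ha : 1 ≤ a) (hsf : Squarefree a) :
    (∏ p ∈ a.primeFactors, ((p:ℝ) - 1)) = a.totient := by
  have h1 := Nat.totient_mul_prod_primeFactors a
  rw [Nat.prod_primeFactors_of_squarefree hsf, mul_comm] at h1
  have h2 := Nat.eq_of_mul_eq_mul_left (by omega) h1
  rw [h2, Nat.cast_prod]
  apply Finset.prod_congr rfl
  intro p hp
  have := (Nat.prime_of_mem_primeFactors hp).one_le
  push_cast [this]; ring

lemma fac_prod {a : ℕ} (hsf : Squarefree a) :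
    (∏ p ∈ a.primeFactors, (p:ℝ)) = a := by
  rw [← Nat.cast_prod, Nat.prod_primeFactors_of_squarefree hsf]

lemma Ps_ok {a : ℕ} (hmod : a % 36 = 1 ∨ a % 36 = 25) :
    ∀ p ∈ a.primeFactors, p.Prime ∧ p ≠ 2 ∧ p ≠ 3 := by
  intro p hp
  have hd := Nat.dvd_of_mem_primeFactors hp
  refine ⟨Nat.prime_of_mem_primeFactors hp, ?_, ?_⟩ <;> rintro rfl <;> omega

lemma const_lt : 2 * Real.pi / √3 / 18 < 0.2022 := by
  have h1 := Real.pi_lt_d2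
  have h3 : (1.732:ℝ) < √3 := by
    apply Real.lt_sqrt_of_sq_lt; norm_num
  rw [div_div, div_lt_iff₀ (by positivity)]
  nlinarith

lemma card_Bd {a : ℕ} (ha : 1 ≤ a) (hsf : Squarefree a) (hmod : a % 36 = 1 ∨ a % 36 = 25) (M k : ℕ)
    {ν : ℝ} (hν : 1 ≤ ν) (hM : ν^20 = a * M) :
    ((Bd a M k).card : ℝ) * (3^(k+1) - 1) ≤
      0.2022 * (a.totient / a : ℝ) * M + 345600 * (a:ℝ)^6 * a.totient * ν^19 := by
  classical
  have ha0 : (0:ℝ) < a := by exact_mod_cast ha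
  set Ns : Finset ℤ := (Bd a M k).image (fun D : ℕ => (a:ℤ) * (D:ℤ)) with hNs
  have hinj : Function.Injective (fun D : ℕ => (a:ℤ) * (D:ℤ)) := by
    intro x y h
    have := mul_left_cancel₀ (show (a:ℤ) ≠ 0 by omega) h
    exact_mod_cast this
  have hcs := class_sum a.primeFactors (Ps_ok hmod) hν Ns (by
    intro n hn
    obtain ⟨D, hD, rfl⟩ := Finset.mem_image.1 hn
    obtain ⟨hD, -⟩ := Finset.mem_filter.1 hD
    obtain ⟨hD1, hD⟩ := Finset.mem_erase.1 hD
    obtain ⟨s1, s2, _⟩ := Gs_spec hD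
    refine ⟨goodN_of ha hsf hmod hD hD1, ?_, ?_, ?_⟩
    · rw [hM]; push_cast
      have : (D:ℝ) ≤ M := by exact_mod_cast s1.le
      gcongr
    · have e : (a * D) % 3 = 1 := by
        rw [Nat.mul_mod, show a % 3 = 1 by omega, s2]
      exact_mod_cast e
    · intro p hp
      exact Dvd.dvd.mul_right (by exact_mod_cast Nat.dvd_of_mem_primeFactors hp) _)
  have h1 : ((Bd a M k).card : ℝ) * (3^(k+1) - 1) ≤ ∑ n ∈ Ns, ((cl3 n : ℝ) - 1) := by
    rw [hNs, Finset.sum_image (fun x _ y _ h => hinj h), ← nsmul_eq_mul]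
    apply Finset.card_nsmul_le_sum
    intro D hD
    have := (Finset.mem_filter.1 hD).2
    have : ((3^(k+1) : ℕ) : ℝ) ≤ cl3 ((a:ℤ) * (D:ℤ)) := by exact_mod_cast this
    push_cast at this
    linarith
  refine (h1.trans hcs).trans ?_
  have e1 : (∏ p ∈ a.primeFactors, ((p:ℝ)^6 * ((p:ℝ) - 1))) = (a:ℝ)^6 * (a.totient:ℝ) := by
    rw [Finset.prod_mul_distrib, Finset.prod_pow, fac_prod hsf, tot_prod ha hsf]
  have e2 : ((12 * ∏ p ∈ a.primeFactors, p^2 : ℕ) : ℝ) = 12 * (a:ℝ)^2 := by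
    push_cast
    rw [Finset.prod_pow, fac_prod hsf]
  rw [e1, e2, hM]
  have e3 : (48 * (24 * ((a:ℝ)^6 * a.totient))) * ((2*Real.pi/√3) / (12 * (a:ℝ)^2)^4 * (a * M) + 300 * ν^19)
     = (2 * Real.pi / √3 / 18) * ((a.totient / a : ℝ) * M) + 345600 * (a:ℝ)^6 * a.totient * ν^19 := by
    field_simp
    ring
  rw [e3]
  have : (2 * Real.pi / √3 / 18) * ((a.totient / a : ℝ) * M) ≤ 0.2022 * ((a.totient / a : ℝ) * M) :=
    mul_le_mul_of_nonneg_right const_lt.le (by positivity)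
  linarith

lemma P_le {a : ℕ} (ha : 1 ≤ a) (hsf : Squarefree a) (hmod : a % 36 = 1 ∨ a % 36 = 25) :
    ∏ p ∈ a.primeFactors, (p : ℝ) / (((p : ℝ) - 1) * ((p : ℝ) + 1)) ≤ a.totient / a := by
  rw [← tot_prod ha hsf]
  conv_rhs => rw [← fac_prod hsf]
  rw [← Finset.prod_div_distrib]
  apply Finset.prod_le_prod
  · intro p hp
    have : (2:ℝ) ≤ p := by exact_mod_cast (Nat.prime_of_mem_primeFactors hp).two_le
    have : (0:ℝ) ≤ (p:ℝ) - 1 := by linarith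
    positivity
  · intro p hp
    obtain ⟨h1, h2, h3⟩ := Ps_ok hmod p hp
    have : 3 ≤ p := by have := h1.two_le; omega
    have : (3:ℝ) ≤ p := by exact_mod_cast this
    have h4 : (0:ℝ) < (p:ℝ) - 1 := by linarith
    rw [div_le_div_iff₀ (by positivity) (by positivity)]
    nlinarith [mul_nonneg h4.le h4.le, mul_nonneg (mul_nonneg h4.le h4.le) (by linarith : (0:ℝ) ≤ (p:ℝ) - 3)]

lemma main_count {a : ℕ} (ha : 1 ≤ a) (hsf : Squarefree a) (hmod : a % 36 = 1 ∨ a % 36 = 25) (k M : ℕ)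
    {ν : ℝ} (hν : 1 ≤ ν) (hM : ν^20 = a * M)
    (hbig : (24 * (a:ℝ) + 4 + 345600 * (a:ℝ)^6 * a.totient) * a ≤ 0.003 * (a.totient / a : ℝ) * ν) :
    ((3 ^ (k + 1) - 2 : ℝ) / (3 ^ (k + 1) - 1)) / 8 *
        (∏ p ∈ a.primeFactors, (p : ℝ) / (((p : ℝ) - 1) * ((p : ℝ) + 1))) * (2 / 3 * M + 24) ≤ (Gd a M k).card := by
  have ha0 : (0:ℝ) < a := by exact_mod_cast ha
  have hφ : (0:ℝ) < a.totient := by exact_mod_cast Nat.totient_pos.2 ha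
  set W : ℝ := (a.totient / a : ℝ) with hW
  have hW0 : 0 < W := by positivity
  have hW1 : W ≤ 1 := by
    rw [hW, div_le_one ha0]; exact_mod_cast Nat.totient_le a
  have hP := P_le ha hsf hmod
  rw [← hW] at hP
  set P : ℝ := ∏ p ∈ a.primeFactors, (p : ℝ) / (((p : ℝ) - 1) * ((p : ℝ) + 1)) with hPd
  have hb := card_Bd ha hsf hmod M k hν hM
  have hg := card_Gs ha M
  have hR := card_Rs ha (by
    have : Nat.gcd a 12 = Nat.gcd 1 12 := Nat.ModEq.gcd_eq (show a % 12 = 1 % 12 by omega)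
    rw [Nat.Coprime, Nat.gcd_comm, this]; norm_num)
  have hd := card_Gd a M k
  have hRu : ((Rs a).card : ℝ) ≤ 12 * a := by
    have : (Rs a).card ≤ 12 * a := (Finset.card_filter_le _ _).trans (by simp)
    exact_mod_cast this
  have hRl : 2 * (a.totient : ℝ) ≤ (Rs a).card := by exact_mod_cast hR
  have h3k : (3:ℝ) ≤ 3^(k+1) := by
    rw [pow_succ]; nlinarith [one_le_pow₀ (by norm_num : (1:ℝ) ≤ 3) (n := k)]
  set q : ℝ := 1 / (3^(k+1) - 1) with hq
  have hden : (0:ℝ) < 3^(k+1) - 1 := by linarith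
  have hq0 : 0 < q := by positivity
  have hq1 : q ≤ 1/2 := by
    rw [hq]; apply one_div_le_one_div_of_le <;> linarith
  have hδ : (3 ^ (k + 1) - 2 : ℝ) / (3 ^ (k + 1) - 1) = 1 - q := by
    rw [hq]; field_simp; ring
  rw [hδ]
  set E : ℝ := 345600 * (a:ℝ)^6 * a.totient with hE
  have hE0 : 0 ≤ E := by positivity
  have hb' : ((Bd a M k).card : ℝ) ≤ q * (0.2022 * W * M + E * ν^19) := by
    rw [hq, one_div, ← div_eq_inv_mul, le_div_iff₀ hden]; exact hb
  have hν19 : (1:ℝ) ≤ ν^19 := one_le_pow₀ hν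
  have hsq : √M ≤ ν^19 := by
    have : (M:ℝ) ≤ ν^20 := by
      rw [hM]
      have : (1:ℝ) ≤ a := by exact_mod_cast ha
      nlinarith [(Nat.cast_nonneg M : (0:ℝ) ≤ M)]
    calc √M ≤ ν^10 := by
          apply Real.sqrt_le_iff.2 ⟨by positivity, by rw [← pow_mul]; exact this⟩
      _ ≤ ν^19 := pow_le_pow_right₀ hν (by norm_num)
  have hM0 : (0:ℝ) ≤ M := Nat.cast_nonneg M
  have hg' : 7 / 48 * W * M - 24 * a * ν^19 ≤ (Gs a M).card := by
    refine le_trans ?_ hg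
    have k1 : 7 / 48 * W * M = 2 * (a.totient:ℝ) * (7 / 8 * (M / (12 * a))) := by
      rw [hW]; field_simp; ring
    have k2 : 2 * (a.totient:ℝ) * (7 / 8 * (M / (12 * a))) ≤ (Rs a).card * (7 / 8 * (M / (12 * a))) := by gcongr
    have k3 : ((Rs a).card:ℝ) * (1 + √M) ≤ 12 * a * (ν^19 + ν^19) := by gcongr
    rw [k1]
    linarith
  have hMl : (24 * (a:ℝ) + 4 + E) * ν^19 ≤ 0.003 * W * M := by
    have k1 : (24 * (a:ℝ) + 4 + E) * a * ν^19 ≤ 0.003 * W * ν * ν^19 := by gcongr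
    have k2 : 0.003 * W * ν * ν^19 = (0.003 * W * M) * a := by
      rw [show 0.003 * W * ν * ν^19 = 0.003 * W * ν^20 by ring, hM]; ring
    rw [k2] at k1
    refine le_of_mul_le_mul_right ?_ ha0
    linarith
  have hL : (1 - q) / 8 * P * (2 / 3 * M + 24) ≤ (1 - q) / 8 * W * (2 / 3 * M + 24) := by
    have : 0 ≤ 1 - q := by linarith
    gcongr
  have hWM : 0 ≤ W * M := by positivity
  have z1 : (1 - q) / 8 * W * (2 / 3 * M + 24) ≤ (1 - q) / 12 * (W * M) + 3 := by
    have t1 : (1-q) * W ≤ 1 := by nlinarith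
    have t2 : (1 - q) / 8 * W * (2 / 3 * M + 24) = (1 - q) / 12 * (W * M) + 3 * ((1 - q) * W) := by ring
    linarith
  have z2 : q * (E * ν^19) ≤ E * ν^19 := by
    have : 0 ≤ E * ν^19 := by positivity
    nlinarith
  have z3 : q * (W * M) ≤ 1/2 * (W * M) := by gcongr
  clear_value q E W P
  linarith

lemma rank_of_Gd {a : ℕ} (ha : 1 ≤ a) (hsf : Squarefree a) (hmod : a % 36 = 1 ∨ a % 36 = 25) (k M : ℕ) {D : ℕ}
    (h : D ∈ Gd a M k) : D < M ∧ 0 < D ∧ Squarefree D ∧ mordellRank (-((a:ℤ) * (D:ℤ)^3)) ≤ 2 * k := by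
  obtain ⟨h, hc⟩ := Finset.mem_filter.1 h
  obtain ⟨h1, h⟩ := Finset.mem_erase.1 h
  obtain ⟨s1, s2, s3, s4, s5⟩ := Gs_spec h
  have := goodN_of ha hsf hmod h h1
  refine ⟨s1, by omega, s5, ?_⟩
  rw [cl3_eq, not_le] at hc
  exact rank_bound (A := (a:ℤ)) (D := (D:ℤ)) (by omega) (by omega) k hc

lemma T_sub (X : ℝ) : T X ⊆ (((Finset.range ⌈X⌉₊).filter (fun D => ¬ 4 ∣ D ∧ ¬ 9 ∣ D)).image (fun D : ℕ => (D:ℤ)) : Finset ℤ) := by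
  rintro D ⟨h0, h1, h2⟩
  lift D to ℕ using h0.le
  rw [Finset.mem_coe, Finset.mem_image]
  refine ⟨D, ?_, rfl⟩
  rw [Finset.mem_filter, Finset.mem_range, Nat.lt_ceil]
  have h3 := Int.squarefree_natCast.1 h2
  refine ⟨by exact_mod_cast h1, ?_, ?_⟩
  · intro h
    have := h3 2 (by norm_num; exact h)
    norm_num at this
  · intro h
    have := h3 3 (by norm_num; exact h)
    norm_num at this

lemma T_fin (X : ℝ) : (T X).Finite := (Finset.finite_toSet _).subset (T_sub X)

lemma T_card (X : ℝ) : (Nat.card (T X) : ℝ) ≤ 2 / 3 * ⌈X⌉₊ + 24 := by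
  refine le_trans ?_ (card_T_aux ⌈X⌉₊)
  rw [Nat.card_coe_set_eq]
  have h1 := Set.ncard_le_ncard (T_sub X) (Finset.finite_toSet _)
  rw [Set.ncard_coe_finset] at h1
  exact_mod_cast h1.trans Finset.card_image_le

end Cnt

/-- Theorem 1.1(1): for a positive square-free integer `A ≡ 1` or `25 (mod 36)` and a
non-negative integer `k`, the lower density of positive square-free integers `D` with
`rank E_D(ℚ) ≤ 2k` is at least `(δ_k / 8) · ∏_{p ∣ A} p / ((p-1)(p+1))`, where
`E_D : y² = x³ - A·D³` and `δ_k = (3^{k+1} - 2) / (3^{k+1} - 1)`. -/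
theorem main_theorem_1_rank_bound
    (A : ℤ) (hApos : 0 < A) (hAsf : Squarefree A)
    (hAmod : A % 36 = 1 ∨ A % 36 = 25) (k : ℕ) :
    ((3 ^ (k + 1) - 2 : ℝ) / (3 ^ (k + 1) - 1)) / 8 *
        ∏ p ∈ A.natAbs.primeFactors, (p : ℝ) / (((p : ℝ) - 1) * ((p : ℝ) + 1)) ≤
      liminf (fun X : ℝ =>
        (Nat.card {D : ℤ | D ∈ T X ∧ mordellRank (-(A * D ^ 3)) ≤ 2 * k} : ℝ) /
          (Nat.card (T X) : ℝ)) atTop := by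
  obtain ⟨a, rfl⟩ := Int.eq_ofNat_of_zero_le hApos.le
  have ha : 1 ≤ a := by omega
  have hsf : Squarefree a := Int.squarefree_natCast.1 hAsf
  have hmod : a % 36 = 1 ∨ a % 36 = 25 := by omega
  rw [Int.natAbs_natCast]
  have ha0 : (0:ℝ) < a := by exact_mod_cast ha
  have hφ : (0:ℝ) < a.totient := by exact_mod_cast Nat.totient_pos.2 ha
  have hsub : ∀ X : ℝ, {D : ℤ | D ∈ T X ∧ mordellRank (-((a:ℤ) * D ^ 3)) ≤ 2 * k} ⊆ T X := fun X D h => h.1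
  have hle1 : ∀ X : ℝ, (Nat.card {D : ℤ | D ∈ T X ∧ mordellRank (-((a:ℤ) * D ^ 3)) ≤ 2 * k} : ℝ) /
          (Nat.card (T X) : ℝ) ≤ 1 := by
    intro X
    apply div_le_one_of_le₀ _ (by positivity)
    rw [Nat.card_coe_set_eq, Nat.card_coe_set_eq]
    exact_mod_cast Set.ncard_le_ncard (hsub X) (Cnt.T_fin X)
  apply le_liminf_of_le
  · apply IsBoundedUnder.isCoboundedUnder_ge
    exact isBoundedUnder_of ⟨1, hle1⟩
  have htend : Tendsto (fun X : ℝ => ((a:ℝ) * (⌈X⌉₊ : ℝ)) ^ ((1:ℝ) / 20)) atTop atTop := by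
    apply (tendsto_rpow_atTop (by norm_num)).comp
    apply Tendsto.const_mul_atTop ha0
    exact tendsto_natCast_atTop_atTop.comp tendsto_nat_ceil_atTop
  have ev1 := htend.eventually_ge_atTop 1
  have ev2 := htend.eventually_ge_atTop
    ((24 * (a:ℝ) + 4 + 345600 * (a:ℝ)^6 * a.totient) * a / (0.003 * (a.totient / a : ℝ)))
  filter_upwards [ev1, ev2, eventually_gt_atTop 1] with X h1 h2 h3
  set ν := ((a:ℝ) * (⌈X⌉₊ : ℝ)) ^ ((1:ℝ) / 20) with hν
  have hM : ν^20 = a * (⌈X⌉₊ : ℝ) := by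
    rw [hν, ← Real.rpow_natCast, ← Real.rpow_mul (by positivity)]
    norm_num
  rw [div_le_iff₀' (by positivity)] at h2
  have hmain := Cnt.main_count ha hsf hmod k ⌈X⌉₊ h1 hM h2
  have hT0 : (0:ℝ) < Nat.card (T X) := by
    rw [Nat.card_coe_set_eq]
    have : 0 < (T X).ncard := (Set.ncard_pos (Cnt.T_fin X)).2 ⟨1, by
      refine ⟨by norm_num, by exact_mod_cast h3, squarefree_one⟩⟩
    exact_mod_cast this
  rw [le_div_iff₀ hT0]
  have hG : ((Cnt.Gd a ⌈X⌉₊ k).card : ℝ) ≤ Nat.card {D : ℤ | D ∈ T X ∧ mordellRank (-((a:ℤ) * D ^ 3)) ≤ 2 * k} := by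
    rw [Nat.card_coe_set_eq, ← Finset.card_image_of_injective (Cnt.Gd a ⌈X⌉₊ k) (Nat.cast_injective (R := ℤ)),
      ← Set.ncard_coe_finset]
    have := Set.ncard_le_ncard (s := ((Cnt.Gd a ⌈X⌉₊ k).image (Nat.cast : ℕ → ℤ) : Finset ℤ))
      (t := {D : ℤ | D ∈ T X ∧ mordellRank (-((a:ℤ) * D ^ 3)) ≤ 2 * k}) (by
        intro D hD
        rw [Finset.mem_coe, Finset.mem_image] at hD
        obtain ⟨d, hd, rfl⟩ := hD
        obtain ⟨r1, r2, r3, r4⟩ := Cnt.rank_of_Gd ha hsf hmod k _ hd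
        refine ⟨⟨by exact_mod_cast r2, ?_, Int.squarefree_natCast.2 r3⟩, r4⟩
        have := Nat.lt_ceil.1 r1
        exact_mod_cast this) ((Cnt.T_fin X).subset (hsub X))
    exact_mod_cast this
  refine le_trans ?_ (hmain.trans hG)
  apply mul_le_mul_of_nonneg_left (Cnt.T_card X)
  have h3k : (3:ℝ) ≤ 3^(k+1) := by
    rw [pow_succ]; nlinarith [one_le_pow₀ (by norm_num : (1:ℝ) ≤ 3) (n := k)]
  apply mul_nonneg
  · apply div_nonneg (div_nonneg _ _) <;> linarith
  · apply Finset.prod_nonneg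
    intro p hp
    have : (2:ℝ) ≤ p := by exact_mod_cast (Nat.prime_of_mem_primeFactors hp).two_le
    have : (0:ℝ) ≤ (p:ℝ) - 1 := by linarith
    positivity
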